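/- For every fixed ε > 0 there is a constant C(ε) such that for all real B ≥ 2 the number n(B) of triples (u, v, w) of square-full positive integers satisfying u + v = w and w ≤ B obeys n(B) ≤ C(ε) · B^{3/5 − 3/1555 + ε}. -/

import Mathlib

/-- A positive integer `n` is square-full if `p ^ 2 ∣ n` for every prime `p` dividing `n`. -/
def Squarefull (n : ℕ) : Prop := ∀ p : ℕ, p.Prime → p ∣ n → p ^ 2 ∣ n


/-! ### Counting tools -/

/-- fibre bound -/
lemma card_le_fiber {α β : Type*} [DecidableEq β] (S : Finset α) (f : α → β) (T : Finset β)
    (hT : ∀ s ∈ S, f s ∈ T) (n : ℝ)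
    (h : ∀ t ∈ T, ((S.filter (fun s => f s = t)).card : ℝ) ≤ n) :
    (S.card : ℝ) ≤ T.card * n := by
  rw [Finset.card_eq_sum_card_fiberwise (f := f) (t := T) hT]
  push_cast
  calc _ ≤ ∑ _t ∈ T, n := Finset.sum_le_sum h
    _ = _ := by simp

lemma card_le_fiber_sum {α β : Type*} [DecidableEq β] (S : Finset α) (f : α → β) (T : Finset β)
    (hT : ∀ s ∈ S, f s ∈ T) (g : β → ℝ)
    (h : ∀ t ∈ T, ((S.filter (fun s => f s = t)).card : ℝ) ≤ g t) :
    (S.card : ℝ) ≤ ∑ t ∈ T, g t := by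
  rw [Finset.card_eq_sum_card_fiberwise (f := f) (t := T) hT]
  push_cast
  exact Finset.sum_le_sum h

/-- Covering bound: if each element of `S` lies in one of the sets indexed by `T`. -/
lemma card_le_cover_sum {α β : Type*} (S : Finset α) (T : Finset β) (R : β → α → Prop)
    [∀ t, DecidablePred (R t)]
    (hT : ∀ s ∈ S, ∃ t ∈ T, R t s) (g : β → ℝ)
    (h : ∀ t ∈ T, ((S.filter (R t)).card : ℝ) ≤ g t) :
    (S.card : ℝ) ≤ ∑ t ∈ T, g t := by
  classical
  have h1 : S ⊆ T.biUnion (fun t => S.filter (R t)) := by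
    intro s hs
    obtain ⟨t, ht, hr⟩ := hT s hs
    exact Finset.mem_biUnion.mpr ⟨t, ht, Finset.mem_filter.mpr ⟨hs, hr⟩⟩
  have h2 := (Finset.card_le_card h1).trans Finset.card_biUnion_le
  calc (S.card : ℝ) ≤ ((∑ t ∈ T, (S.filter (R t)).card : ℕ) : ℝ) := by exact_mod_cast h2
    _ ≤ _ := by push_cast; exact Finset.sum_le_sum h

/-- if one has at most `K` colors there is a big class -/
lemma exists_big_class {α β : Type*} [DecidableEq β] (S : Finset α) (f : α → β) (T : Finset β)
    (hT : ∀ s ∈ S, f s ∈ T) (K : ℕ) (hK : T.card ≤ K) :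
    ∃ S' ⊆ S, S.card ≤ K * S'.card ∧ ∀ s ∈ S', ∀ s' ∈ S', f s = f s' := by
  classical
  by_cases hS : S = ∅
  · subst hS
    exact ⟨∅, by simp, by simp, by simp⟩
  · obtain ⟨s0, hs0⟩ := Finset.nonempty_iff_ne_empty.mpr hS
    obtain ⟨t, ht, hmax⟩ := Finset.exists_max_image T (fun t => (S.filter (fun s => f s = t)).card)
      ⟨f s0, hT s0 hs0⟩
    refine ⟨S.filter (fun s => f s = t), Finset.filter_subset _ _, ?_, ?_⟩
    · rw [Finset.card_eq_sum_card_fiberwise (f := f) (t := T) hT]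
      calc _ ≤ ∑ _t ∈ T, (S.filter (fun s => f s = t)).card := Finset.sum_le_sum hmax
        _ = T.card * (S.filter (fun s => f s = t)).card := by simp
        _ ≤ _ := Nat.mul_le_mul_right _ hK
    · intro s hs s' hs'
      rw [(Finset.mem_filter.mp hs).2, (Finset.mem_filter.mp hs').2]

/-- Coloring principle: iterate over a finite set of indices. -/
lemma coloring {α ι : Type*} (F : Finset ι) (Q : ι → Finset α → Prop) (K : ℕ)
    (hQ : ∀ i S T, T ⊆ S → Q i S → Q i T) (S0 : Finset α)
    (h : ∀ i ∈ F, ∀ S ⊆ S0, ∃ S' ⊆ S, S.card ≤ K * S'.card ∧ Q i S') :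
    ∃ S' ⊆ S0, S0.card ≤ K ^ F.card * S'.card ∧ ∀ i ∈ F, Q i S' := by
  classical
  induction F using Finset.induction_on with
  | empty => exact ⟨S0, subset_rfl, by simp, by simp⟩
  | insert a F ha ih =>
    obtain ⟨S1, h1, h2, h3⟩ := ih (fun i hi => h i (Finset.mem_insert_of_mem hi))
    obtain ⟨S2, h4, h5, h6⟩ := h a (Finset.mem_insert_self _ _) S1 h1
    refine ⟨S2, h4.trans h1, ?_, ?_⟩
    · rw [Finset.card_insert_of_notMem ha]
      calc S0.card ≤ K ^ F.card * S1.card := h2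
        _ ≤ K ^ F.card * (K * S2.card) := Nat.mul_le_mul_left _ h5
        _ = _ := by ring
    · intro i hi
      rcases Finset.mem_insert.mp hi with rfl | hi
      · exact h6
      · exact hQ i _ _ h4 (h3 i hi)

/-- If among any `k+1` elements two are related by an equivalence, there are at most `k` classes:
packaged for a function with at most `k` values. -/
lemma exists_big_class_of_image {α β : Type*} [DecidableEq β] (S : Finset α) (f : α → β) (K : ℕ)
    (hK : (S.image f).card ≤ K) :
    ∃ S' ⊆ S, S.card ≤ K * S'.card ∧ ∀ s ∈ S', ∀ s' ∈ S', f s = f s' :=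
  exists_big_class S f (S.image f) (fun _ hs => Finset.mem_image_of_mem f hs) K hK

/-- if no three values are distinct then there are at most two values -/
lemma image_card_le_two {α β : Type*} [DecidableEq β] (S : Finset α) (f : α → β)
    (h : ∀ a ∈ S, ∀ b ∈ S, ∀ c ∈ S, f a = f b ∨ f a = f c ∨ f b = f c) :
    (S.image f).card ≤ 2 := by
  by_contra hc
  push Not at hc
  obtain ⟨a, b, c, ha, hb, hc, hab, hac, hbc⟩ := Finset.two_lt_card_iff.mp hc
  obtain ⟨a', ha', rfl⟩ := Finset.mem_image.mp ha
  obtain ⟨b', hb', rfl⟩ := Finset.mem_image.mp hb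
  obtain ⟨c', hc', rfl⟩ := Finset.mem_image.mp hc
  rcases h a' ha' b' hb' c' hc' with h | h | h
  · exact hab h
  · exact hac h
  · exact hbc h

/-! ### The divisor bound -/

lemma pow_omega_le (K : ℕ) (ε : ℝ) (hε : 0 < ε) :
    ∃ C : ℝ, 1 ≤ C ∧ ∀ n : ℕ, 1 ≤ n → (K : ℝ) ^ n.primeFactors.card ≤ C * (n : ℝ) ^ ε := by
  set L : ℕ := K + 1
  obtain ⟨M, hM⟩ := exists_nat_ge ((L : ℝ) ^ (1 / ε))
  have hL1 : (1 : ℝ) ≤ L := by simp [L]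
  have hKL : (K : ℝ) ≤ L := by simp [L]
  refine ⟨(L : ℝ) ^ M, one_le_pow₀ hL1, fun n hn => ?_⟩
  have h1 : (K : ℝ) ^ n.primeFactors.card ≤ (L : ℝ) ^ n.primeFactors.card :=
    pow_le_pow_left₀ (by positivity) hKL _
  refine h1.trans ?_
  have hsplit := Finset.card_filter_add_card_filter_not (s := n.primeFactors) (fun p => p < M)
  rw [← hsplit, pow_add]
  have ha : (L : ℝ) ^ (n.primeFactors.filter (fun p => p < M)).card ≤ (L : ℝ) ^ M := by
    apply pow_le_pow_right₀ hL1
    calc _ ≤ (Finset.range M).card := Finset.card_le_card (by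
          intro p hp; simp at hp ⊢; exact hp.2)
      _ = M := by simp
  have hb : (L : ℝ) ^ (n.primeFactors.filter (fun p => ¬ p < M)).card ≤ (n : ℝ) ^ ε := by
    calc (L : ℝ) ^ (n.primeFactors.filter (fun p => ¬ p < M)).card
        = ∏ _p ∈ n.primeFactors.filter (fun p => ¬ p < M), (L : ℝ) := by simp
      _ ≤ ∏ p ∈ n.primeFactors.filter (fun p => ¬ p < M), (p : ℝ) ^ ε := by
          apply Finset.prod_le_prod
          · intros; positivity
          · intro p hp
            simp only [Finset.mem_filter, not_lt] at hp
            have : (L : ℝ) ^ (1 / ε) ≤ p := hM.trans (by exact_mod_cast hp.2)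
            calc (L : ℝ) = ((L : ℝ) ^ (1 / ε)) ^ ε := by
                  rw [← Real.rpow_mul (by positivity)]; field_simp; simp
              _ ≤ _ := Real.rpow_le_rpow (by positivity) this hε.le
      _ ≤ ∏ p ∈ n.primeFactors, (p : ℝ) ^ ε := by
          rw [← Finset.prod_filter_mul_prod_filter_not n.primeFactors (fun p => p < M)
            (fun p : ℕ => (p : ℝ) ^ ε)]
          apply le_mul_of_one_le_left
          · exact Finset.prod_nonneg (fun _ _ => by positivity)
          · have := Finset.prod_le_prod (s := n.primeFactors.filter (fun p => p < M))
              (f := fun _ => (1 : ℝ)) (g := fun p : ℕ => (p : ℝ) ^ ε) (by simp) (by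
              intro p hp
              have : 1 ≤ p := (Nat.prime_of_mem_primeFactors (Finset.mem_filter.mp hp).1).one_lt.le
              exact Real.one_le_rpow (by exact_mod_cast this) hε.le)
            simpa using this
      _ = ((∏ p ∈ n.primeFactors, p : ℕ) : ℝ) ^ ε := by
          push_cast
          rw [Real.finsetProd_rpow]
          intros; positivity
      _ ≤ _ := by
          apply Real.rpow_le_rpow (by positivity) _ hε.le
          exact_mod_cast Nat.le_of_dvd hn (Nat.prod_primeFactors_dvd n)
  exact mul_le_mul ha hb (by positivity) (by positivity)

lemma add_one_le_mul_pow (ε : ℝ) (hε : 0 < ε) :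
    ∃ C : ℕ, 1 ≤ C ∧ ∀ p e : ℕ, 2 ≤ p → ((e : ℝ) + 1) ≤ C * ((p : ℝ) ^ e) ^ ε := by
  obtain ⟨M, hM⟩ := exists_nat_ge (1 / (ε * Real.log 2))
  have hl : 0 < Real.log 2 := Real.log_pos (by norm_num)
  refine ⟨M + 1, by simp, fun p e hp => ?_⟩
  have hp' : (2 : ℝ) ≤ p := by exact_mod_cast hp
  have h2 : (2 : ℝ) ^ (ε * e) ≤ ((p : ℝ) ^ e) ^ ε := by
    rw [← Real.rpow_natCast, ← Real.rpow_mul (by positivity), mul_comm]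
    exact Real.rpow_le_rpow (by norm_num) hp' (by positivity)
  have h3 : 1 + Real.log 2 * (ε * e) ≤ (2 : ℝ) ^ (ε * e) := by
    rw [Real.rpow_def_of_pos (by norm_num)]
    linarith [Real.add_one_le_exp (Real.log 2 * (ε * e))]
  have hM' : 1 ≤ M * (ε * Real.log 2) := by
    rwa [div_le_iff₀ (by positivity)] at hM
  have h4 : (e : ℝ) ≤ M * (Real.log 2 * (ε * e)) := by
    have : (0 : ℝ) ≤ e := by positivity
    nlinarith
  have h5 : (0 : ℝ) ≤ Real.log 2 * (ε * e) := by positivity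
  push_cast
  calc (e : ℝ) + 1 ≤ (M + 1) * (1 + Real.log 2 * (ε * e)) := by nlinarith [Nat.cast_nonneg (α := ℝ) M]
    _ ≤ _ := mul_le_mul_of_nonneg_left (h3.trans h2) (by positivity)

lemma divisor_bound (ε : ℝ) (hε : 0 < ε) :
    ∃ C : ℝ, 1 ≤ C ∧ ∀ n : ℕ, 1 ≤ n → (n.divisors.card : ℝ) ≤ C * (n : ℝ) ^ ε := by
  obtain ⟨K, hK1, hK⟩ := add_one_le_mul_pow (ε / 2) (by positivity)
  obtain ⟨C, hC1, hC⟩ := pow_omega_le K (ε / 2) (by positivity)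
  refine ⟨C, hC1, fun n hn => ?_⟩
  rw [Nat.card_divisors (by omega)]
  push_cast
  calc ∏ p ∈ n.primeFactors, ((n.factorization p : ℝ) + 1)
      ≤ ∏ p ∈ n.primeFactors, ((K : ℝ) * ((p : ℝ) ^ n.factorization p) ^ (ε / 2)) := by
        apply Finset.prod_le_prod
        · intros; positivity
        · intro p hp
          exact hK p _ (Nat.prime_of_mem_primeFactors hp).two_le
    _ = (K : ℝ) ^ n.primeFactors.card * (n : ℝ) ^ (ε / 2) := by
        rw [Finset.prod_mul_distrib, Finset.prod_const, Real.finsetProd_rpow _ _ (by intros; positivity)]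
        congr 2
        conv_rhs => rw [← Nat.prod_factorization_pow_eq_self (n := n) (by omega)]
        rw [Nat.prod_factorization_eq_prod_primeFactors]
        push_cast
        rfl
    _ ≤ C * (n : ℝ) ^ (ε / 2) * (n : ℝ) ^ (ε / 2) :=
        mul_le_mul_of_nonneg_right (hC n hn) (by positivity)
    _ = _ := by rw [mul_assoc, ← Real.rpow_add (by positivity)]; ring_nf

/-- number of integer divisors in a finset -/
lemma int_divisor_bound (ε : ℝ) (hε : 0 < ε) :
    ∃ C : ℝ, 1 ≤ C ∧ ∀ (n : ℤ) (S : Finset ℤ), n ≠ 0 → (∀ d ∈ S, d ∣ n) →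
      (S.card : ℝ) ≤ C * (|n| : ℝ) ^ ε := by
  obtain ⟨C, hC1, hC⟩ := divisor_bound ε hε
  refine ⟨2 * C, by linarith, fun n S hn hS => ?_⟩
  have h1 : S ⊆ n.natAbs.divisors.image (fun d : ℕ => (d : ℤ)) ∪
      n.natAbs.divisors.image (fun d : ℕ => -(d : ℤ)) := by
    intro d hd
    have := Int.natAbs_dvd_natAbs.mpr (hS d hd)
    have h2 : d.natAbs ∈ n.natAbs.divisors := Nat.mem_divisors.mpr ⟨this, by simpa using hn⟩
    rw [Finset.mem_union, Finset.mem_image, Finset.mem_image]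
    rcases Int.natAbs_eq d with h | h
    · exact Or.inl ⟨_, h2, h.symm⟩
    · exact Or.inr ⟨_, h2, h.symm⟩
  have h2 : S.card ≤ 2 * n.natAbs.divisors.card := by
    refine (Finset.card_le_card h1).trans ((Finset.card_union_le _ _).trans ?_)
    have a := Finset.card_image_le (s := n.natAbs.divisors) (f := fun d : ℕ => (d : ℤ))
    have b := Finset.card_image_le (s := n.natAbs.divisors) (f := fun d : ℕ => -(d : ℤ))
    omega
  have h3 := hC n.natAbs (by have := Int.natAbs_pos.mpr hn; omega)
  have h4 : ((n.natAbs : ℕ) : ℝ) = |(n : ℝ)| := by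
    rw [Nat.cast_natAbs]; push_cast; rfl
  rw [h4] at h3
  calc (S.card : ℝ) ≤ 2 * n.natAbs.divisors.card := by exact_mod_cast h2
    _ ≤ _ := by linarith

/-! ### Auxiliary primes -/

lemma prime_chain (J x : ℕ) (hx : x ≠ 0) :
    ∃ F : Finset ℕ, F.card = J ∧ ∀ p ∈ F, p.Prime ∧ x < p ∧ p ≤ 2 ^ J * x := by
  induction J with
  | zero => exact ⟨∅, by simp, by simp⟩
  | succ J ih =>
    obtain ⟨F, hF, h⟩ := ih
    obtain ⟨p, hp, h1, h2⟩ := Nat.exists_prime_lt_and_le_two_mul (2 ^ J * x) (by positivity)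
    refine ⟨insert p F, ?_, ?_⟩
    · rw [Finset.card_insert_of_notMem, hF]
      intro hpF
      have := (h p hpF).2.2
      omega
    · intro q hq
      rcases Finset.mem_insert.mp hq with rfl | hq
      · refine ⟨hp, lt_of_le_of_lt ?_ h1, by rw [pow_succ]; linarith⟩
        exact Nat.le_mul_of_pos_left _ (by positivity)
      · obtain ⟨a, b, c⟩ := h q hq
        refine ⟨a, b, c.trans ?_⟩
        exact Nat.mul_le_mul_right _ (Nat.pow_le_pow_right (by norm_num) (by omega))

lemma aux_prime (D ε : ℝ) (hε : 0 < ε) :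
    ∃ C : ℝ, 1 ≤ C ∧ ∀ (P R : ℝ) (n : ℤ), 1 ≤ P → 1 ≤ R → n ≠ 0 → (|n| : ℝ) ≤ P ^ D →
      ∃ p : ℕ, p.Prime ∧ R < p ∧ (p : ℝ) ≤ C * (R * P ^ ε) ∧ ¬ (p : ℤ) ∣ n := by
  obtain ⟨J, hJ⟩ := exists_nat_ge (D / ε)
  have hJ' : D ≤ ε * J := by rw [div_le_iff₀ hε] at hJ; linarith
  refine ⟨2 ^ (J + 1) * 2, ?_, fun P R n hP hR hn hnP => ?_⟩
  · have : (1 : ℝ) ≤ 2 ^ (J + 1) := one_le_pow₀ (by norm_num)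
    linarith
  have hPε : 1 ≤ P ^ ε := Real.one_le_rpow hP hε.le
  have hRP : 1 ≤ R * P ^ ε := by nlinarith
  set x := ⌈R * P ^ ε⌉₊ with hx
  have hx0 : x ≠ 0 := by
    have : 0 < x := Nat.ceil_pos.mpr (by linarith)
    omega
  have hx1 : R * P ^ ε ≤ x := Nat.le_ceil _
  have hx2 : (x : ℝ) ≤ 2 * (R * P ^ ε) := by
    have := Nat.ceil_lt_add_one (show 0 ≤ R * P ^ ε by linarith)
    linarith
  obtain ⟨F, hF, hp⟩ := prime_chain (J + 1) x hx0
  have key : ∃ p ∈ F, ¬ (p : ℤ) ∣ n := by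
    by_contra hcon
    push Not at hcon
    have hd : (∏ p ∈ F, p) ∣ n.natAbs := by
      apply Finset.prod_primes_dvd
      · intro p hpF; exact (hp p hpF).1.prime
      · intro p hpF; exact Int.natCast_dvd.mp (hcon p hpF)
    have hle := Nat.le_of_dvd (Int.natAbs_pos.mpr hn) hd
    have hle' : ((∏ p ∈ F, p : ℕ) : ℝ) ≤ P ^ D := by
      refine le_trans ?_ hnP
      calc ((∏ p ∈ F, p : ℕ) : ℝ) ≤ (n.natAbs : ℝ) := by exact_mod_cast hle
        _ = |(n : ℝ)| := by rw [Nat.cast_natAbs]; push_cast; rfl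
    have hge : (P ^ ε) ^ J * 2 ≤ ((∏ p ∈ F, p : ℕ) : ℝ) := by
      push_cast
      have h1 : ∏ _p ∈ F, ((x : ℝ) + 1) ≤ ∏ p ∈ F, (p : ℝ) := by
        apply Finset.prod_le_prod
        · intros; positivity
        · intro p hpF; exact_mod_cast (hp p hpF).2.1
      refine le_trans ?_ h1
      rw [Finset.prod_const, hF, pow_succ]
      have hxx : P ^ ε ≤ x + 1 := by nlinarith
      have hx3 : (1 : ℝ) ≤ x := by linarith
      apply mul_le_mul (pow_le_pow_left₀ (by positivity) hxx _) (by linarith) (by norm_num)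
        (by positivity)
    have h3 : P ^ D ≤ (P ^ ε) ^ J := by
      rw [← Real.rpow_natCast, ← Real.rpow_mul (by linarith)]
      exact Real.rpow_le_rpow_of_exponent_le hP hJ'
    have : 1 ≤ (P ^ ε) ^ J := one_le_pow₀ hPε
    linarith
  obtain ⟨p, hpF, hpn⟩ := key
  obtain ⟨h1, h2, h3⟩ := hp p hpF
  have h2' : (x : ℝ) < p := by exact_mod_cast h2
  have h3' : (p : ℝ) ≤ 2 ^ (J + 1) * x := by exact_mod_cast h3
  refine ⟨p, h1, ?_, ?_, hpn⟩
  · nlinarith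
  · calc (p : ℝ) ≤ 2 ^ (J + 1) * x := h3'
      _ ≤ 2 ^ (J + 1) * (2 * (R * P ^ ε)) := mul_le_mul_of_nonneg_left hx2 (by positivity)
      _ = _ := by ring

/-! ### Close pairs -/

lemma close_pair {α : Type*} (S : Finset α) (c z : α → ℝ) (C Z : ℝ) (hS : 2 ≤ S.card)
    (hc : ∀ s ∈ S, 0 < c s ∧ c s ≤ C) (hz : ∀ s ∈ S, 0 < z s ∧ z s ≤ Z) :
    ∃ s ∈ S, ∃ t ∈ S, s ≠ t ∧ |c s * z t - c t * z s| * ((S.card : ℝ) - 1) ≤ 4 * (C * Z) := by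
  classical
  obtain ⟨s0, hs0⟩ : S.Nonempty := Finset.card_pos.mp (by omega)
  have hC : 0 < C := (hc s0 hs0).1.trans_le (hc s0 hs0).2
  have hZ : 0 < Z := (hz s0 hs0).1.trans_le (hz s0 hs0).2
  set M : ℕ := S.card - 1 with hM
  have hM1 : 1 ≤ M := by omega
  have hMr : ((S.card : ℝ) - 1) = M := by rw [hM, Nat.cast_sub (by omega)]; simp
  have hM0 : (0 : ℝ) < M := by exact_mod_cast hM1
  set φ : α → ℝ := fun s => (c s / C) / (c s / C + z s / Z) with hφ
  have hu : ∀ s ∈ S, 0 < c s / C ∧ c s / C ≤ 1 := fun s hs =>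
    ⟨div_pos (hc s hs).1 hC, (div_le_one hC).mpr (hc s hs).2⟩
  have hw : ∀ s ∈ S, 0 < z s / Z ∧ z s / Z ≤ 1 := fun s hs =>
    ⟨div_pos (hz s hs).1 hZ, (div_le_one hZ).mpr (hz s hs).2⟩
  obtain ⟨s, hs, t, ht, hst, heq⟩ := Finset.exists_ne_map_eq_of_card_lt_of_maps_to
    (s := S) (t := Finset.range M) (f := fun s => ⌊φ s * M⌋₊) (by simp; omega) (by
      intro s hs
      have hs := Finset.mem_coe.mp hs
      simp only [Finset.coe_range, Set.mem_Iio]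
      have h1 := hu s hs
      have h2 := hw s hs
      have : φ s < 1 := by
        simp only [hφ]; rw [div_lt_one (by linarith)]; linarith
      have h0 : 0 ≤ φ s := by simp only [hφ]; apply div_nonneg <;> linarith
      rw [Nat.floor_lt (by positivity)]
      nlinarith)
  refine ⟨s, hs, t, ht, hst, ?_⟩
  have h0 : ∀ s ∈ S, 0 ≤ φ s := fun s hs => by
    have h1 := hu s hs
    have h2 := hw s hs
    simp only [hφ]; apply div_nonneg <;> linarith
  have h1 := Nat.floor_le (show 0 ≤ φ s * M from mul_nonneg (h0 s hs) hM0.le)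
  have h2 := Nat.lt_floor_add_one (φ s * M)
  have h3 := Nat.floor_le (show 0 ≤ φ t * M from mul_nonneg (h0 t ht) hM0.le)
  have h4 := Nat.lt_floor_add_one (φ t * M)
  rw [heq] at h1 h2
  have h5 : |φ s - φ t| * M ≤ 1 := by
    rw [← abs_of_pos hM0, ← abs_mul, abs_le]
    constructor <;> nlinarith
  have hus := hu s hs
  have hut := hu t ht
  have hws := hw s hs
  have hwt := hw t ht
  have h6 : c s * z t - c t * z s = (C * Z) * ((φ s - φ t) *
      ((c s / C + z s / Z) * (c t / C + z t / Z))) := by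
    have e1 : φ s * (c s / C + z s / Z) = c s / C := by
      simp only [hφ]; exact div_mul_cancel₀ _ (by linarith)
    have e2 : φ t * (c t / C + z t / Z) = c t / C := by
      simp only [hφ]; exact div_mul_cancel₀ _ (by linarith)
    have e3 : (φ s - φ t) * ((c s / C + z s / Z) * (c t / C + z t / Z))
        = (φ s * (c s / C + z s / Z)) * (c t / C + z t / Z)
          - (φ t * (c t / C + z t / Z)) * (c s / C + z s / Z) := by ring
    rw [e3, e1, e2]
    field_simp
    ring
  rw [hMr, h6, abs_mul (C * Z), abs_mul (φ s - φ t), abs_of_pos (mul_pos hC hZ),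
    abs_of_pos (mul_pos (show 0 < c s / C + z s / Z by linarith)
      (show 0 < c t / C + z t / Z by linarith))]
  have h7 : (c s / C + z s / Z) * (c t / C + z t / Z) ≤ 4 := by nlinarith
  have h8 : 0 ≤ (c s / C + z s / Z) * (c t / C + z t / Z) := by
    apply mul_nonneg <;> linarith
  calc C * Z * (|φ s - φ t| * ((c s / C + z s / Z) * (c t / C + z t / Z))) * M
      = C * Z * ((|φ s - φ t| * M) * ((c s / C + z s / Z) * (c t / C + z t / Z))) := by ring
    _ ≤ C * Z * (1 * 4) := by
        apply mul_le_mul_of_nonneg_left _ (by positivity)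
        apply mul_le_mul h5 h7 h8 (by norm_num)
    _ = _ := by ring

/-! ### A Siegel type lemma -/

section Siegel
set_option linter.unusedSectionVars false
variable {ι : Type} [Fintype ι] [DecidableEq ι] {G : Type} [AddCommGroup G] [Fintype G] [DecidableEq G]

/-- the elements of the kernel in a box -/
noncomputable def hbox (φ : (ι → ℤ) →+ G) (w : ι → ℝ) (D : ℝ) : Finset (ι → ℤ) :=
  (Fintype.piFinset (fun i => Finset.Icc (-⌊D * w i⌋) ⌊D * w i⌋)).filter (fun h => φ h = 0)

lemma mem_hbox (φ : (ι → ℤ) →+ G) (w : ι → ℝ) (D : ℝ) (h : ι → ℤ) :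
    h ∈ hbox φ w D ↔ φ h = 0 ∧ ∀ i, (|h i| : ℝ) ≤ D * w i := by
  simp only [hbox, Finset.mem_filter, Fintype.mem_piFinset, Finset.mem_Icc]
  rw [and_comm]
  apply and_congr_right
  intro _
  apply forall_congr'
  intro i
  rw [Int.le_floor, abs_le, neg_le, Int.le_floor]
  push_cast
  constructor
  · rintro ⟨a, b⟩; exact ⟨by linarith, b⟩
  · rintro ⟨a, b⟩; exact ⟨by linarith, b⟩

lemma hbox_lower (φ : (ι → ℤ) →+ G) (w : ι → ℝ) (D : ℝ) (hD : 0 ≤ D) (hw : ∀ i, 0 ≤ w i) :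
    ∏ i, (D * w i) ≤ (Fintype.card G : ℝ) * (hbox φ w D).card := by
  set X : Finset (ι → ℤ) := Fintype.piFinset (fun i => Finset.Icc 0 ⌊D * w i⌋) with hX
  have h1 : ∏ i, (D * w i) ≤ (X.card : ℝ) := by
    rw [hX, Fintype.card_piFinset]
    push_cast
    apply Finset.prod_le_prod
    · intro i _; exact mul_nonneg hD (hw i)
    · intro i _
      rw [Int.card_Icc]
      have h2 := Int.lt_floor_add_one (D * w i)
      have h3 : 0 ≤ ⌊D * w i⌋ := Int.floor_nonneg.mpr (mul_nonneg hD (hw i))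
      have h4 : (((⌊D * w i⌋ + 1 - 0).toNat : ℕ) : ℝ) = (⌊D * w i⌋ : ℝ) + 1 := by
        have : (((⌊D * w i⌋ + 1 - 0).toNat : ℕ) : ℤ) = ⌊D * w i⌋ + 1 := by
          rw [Int.toNat_of_nonneg (by omega)]; ring
        exact_mod_cast this
      rw [h4]; exact h2.le
  refine h1.trans ?_
  have := card_le_fiber X (fun h => φ h) Finset.univ (by simp) ((hbox φ w D).card : ℝ) (by
    intro g _
    by_cases hne : (X.filter (fun s => φ s = g)).Nonempty
    · obtain ⟨h0, hh0⟩ := hne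
      have : (X.filter (fun s => φ s = g)).card ≤ (hbox φ w D).card := by
        apply Finset.card_le_card_of_injOn (fun h => h - h0)
        · intro h hh
          have hh := Finset.mem_coe.mp hh
          simp only [hX, Finset.mem_filter, Fintype.mem_piFinset, Finset.mem_Icc] at hh hh0
          simp only [hbox, Finset.coe_filter, Set.mem_ofPred_eq, Fintype.mem_piFinset,
            Finset.mem_Icc, Pi.sub_apply, map_sub, hh.2, hh0.2, sub_self, and_true]
          intro i
          have a := hh.1 i
          have b := hh0.1 i
          constructor <;> linarith
        · intro a _ b _ hab
          simpa using hab
      exact_mod_cast this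
    · rw [Finset.not_nonempty_iff_eq_empty] at hne
      rw [hne]; simp)
  simpa using this

lemma hbox_double (φ : (ι → ℤ) →+ G) (w : ι → ℝ) (D : ℝ) (hD : 0 < D) (hw : ∀ i, 0 < w i) :
    ((hbox φ w (2 * D)).card : ℝ) ≤ 5 ^ Fintype.card ι * (hbox φ w D).card := by
  have := card_le_fiber (hbox φ w (2 * D)) (fun h i => ⌊(h i : ℝ) / (D * w i)⌋)
    (Fintype.piFinset (fun _ : ι => Finset.Icc (-2 : ℤ) 2)) (by
      intro h hh
      rw [mem_hbox] at hh
      rw [Fintype.mem_piFinset]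
      intro i
      have h1 := abs_le.mp (hh.2 i)
      have h2 : 0 < D * w i := mul_pos hD (hw i)
      rw [Finset.mem_Icc, Int.le_floor, Int.floor_le_iff]
      rw [le_div_iff₀ h2, div_lt_iff₀ h2]
      push_cast
      constructor <;> nlinarith) ((hbox φ w D).card : ℝ) (by
    intro g _
    by_cases hne : ((hbox φ w (2 * D)).filter
        (fun h => (fun i => ⌊(h i : ℝ) / (D * w i)⌋) = g)).Nonempty
    · obtain ⟨h0, hh0⟩ := hne
      have : ((hbox φ w (2 * D)).filter
        (fun h => (fun i => ⌊(h i : ℝ) / (D * w i)⌋) = g)).card ≤ (hbox φ w D).card := by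
        apply Finset.card_le_card_of_injOn (fun h => h - h0)
        · intro h hh
          have hh := Finset.mem_coe.mp hh
          rw [Finset.mem_filter, mem_hbox] at hh hh0
          rw [Finset.mem_coe, mem_hbox]
          refine ⟨by rw [map_sub, hh.1.1, hh0.1.1, sub_zero], fun i => ?_⟩
          have e1 := congrFun hh.2 i
          have e2 := congrFun hh0.2 i
          have e3 := e1.trans e2.symm
          have h2 : 0 < D * w i := mul_pos hD (hw i)
          have := Int.abs_sub_lt_one_of_floor_eq_floor e3
          rw [← sub_div, abs_div, abs_of_pos h2, div_lt_one h2] at this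
          simp only [Pi.sub_apply]
          push_cast
          exact this.le
        · intro a _ b _ hab
          simpa using hab
      exact_mod_cast this
    · rw [Finset.not_nonempty_iff_eq_empty] at hne
      rw [hne]; simp)
  refine this.trans (le_of_eq ?_)
  congr 1
  simp [Fintype.card_piFinset]

lemma dot_abs_le (w : ι → ℝ) (D N0 : ℝ) (V : ι → ℝ) (hwV : ∀ i, w i * V i = N0)
    (h v : ι → ℤ) (hh : ∀ i, (|h i| : ℝ) ≤ D * w i) (hv : ∀ i, (|v i| : ℝ) ≤ V i) :
    (|(∑ i, h i * v i : ℤ)| : ℝ) ≤ Fintype.card ι * (D * N0) := by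
  push_cast
  refine (Finset.abs_sum_le_sum_abs _ _).trans ?_
  calc ∑ i, |(h i : ℝ) * v i| ≤ ∑ _i : ι, D * N0 := by
        apply Finset.sum_le_sum
        intro i _
        rw [abs_mul]
        calc |(h i : ℝ)| * |(v i : ℝ)| ≤ (D * w i) * V i :=
              mul_le_mul (hh i) (hv i) (abs_nonneg _) ((abs_nonneg _).trans (hh i))
          _ = D * N0 := by rw [mul_assoc, hwV]
    _ = _ := by simp

/-- single vector version -/
lemma siegel_single (φ : (ι → ℤ) →+ G) (N0 : ℕ) (hN : 0 < N0) (V : ι → ℝ) (hV : ∀ i, 0 < V i)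
    (D : ℝ) (hDn : Fintype.card ι * D < 1)
    (hf : 2 ≤ (hbox φ (fun i => N0 / V i) D).card) :
    ∃ h : ι → ℤ, h ≠ 0 ∧ (∀ i, (|h i| : ℝ) ≤ D * (N0 / V i)) ∧
      ∀ v : ι → ℤ, (∀ i, (|v i| : ℝ) ≤ V i) →
        (∀ h, φ h = 0 → (N0 : ℤ) ∣ ∑ i, h i * v i) → ∑ i, h i * v i = 0 := by
  obtain ⟨h, hh, hne⟩ := Finset.exists_mem_ne (s := hbox φ (fun i => N0 / V i) D) (by omega) 0
  rw [mem_hbox] at hh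
  refine ⟨h, hne, hh.2, fun v hv hdvd => ?_⟩
  have h1 := dot_abs_le (fun i => N0 / V i) D N0 V (fun i => div_mul_cancel₀ _ (hV i).ne')
    h v hh.2 hv
  have hN' : (0 : ℝ) < N0 := by exact_mod_cast hN
  apply Int.eq_zero_of_abs_lt_dvd (hdvd h hh.1)
  have h2 : (|(∑ i, h i * v i : ℤ)| : ℝ) < (N0 : ℝ) := by
    refine h1.trans_lt ?_
    calc (Fintype.card ι : ℝ) * (D * N0) = (Fintype.card ι * D) * N0 := by ring
      _ < 1 * N0 := by nlinarith
      _ = _ := one_mul _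
  exact_mod_cast h2

lemma siegel_kill (φ : (ι → ℤ) →+ G) (N0 : ℕ) (hN : 0 < N0) (V : ι → ℝ) (hV : ∀ i, 0 < V i)
    (D : ℝ) (hf : 2 * Fintype.card ι * D + 1 < ((hbox φ (fun i => N0 / V i) D).card : ℝ))
    (v : ι → ℤ) (hv : ∀ i, (|v i| : ℝ) ≤ V i)
    (hdvd : ∀ h, φ h = 0 → (N0 : ℤ) ∣ ∑ i, h i * v i) (hD : 0 ≤ D) :
    ∃ h ∈ hbox φ (fun i => N0 / V i) (2 * D), h ≠ 0 ∧ ∑ i, h i * v i = 0 := by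
  have hN' : (0 : ℝ) < N0 := by exact_mod_cast hN
  set M : ℤ := ⌊(Fintype.card ι : ℝ) * D⌋ with hM
  have hM0 : 0 ≤ M := Int.floor_nonneg.mpr (by positivity)
  have hMle : (M : ℝ) ≤ (Fintype.card ι : ℝ) * D := Int.floor_le _
  have hcard : (Finset.Icc (-M) M).card < (hbox φ (fun i => N0 / V i) D).card := by
    rw [Int.card_Icc]
    have : (((M + 1 - -M).toNat : ℕ) : ℝ) = 2 * M + 1 := by
      have : (((M + 1 - -M).toNat : ℕ) : ℤ) = 2 * M + 1 := by
        rw [Int.toNat_of_nonneg (by omega)]; ring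
      exact_mod_cast this
    have h2 : (((M + 1 - -M).toNat : ℕ) : ℝ) < (hbox φ (fun i => N0 / V i) D).card := by
      rw [this]; refine lt_of_le_of_lt ?_ hf; nlinarith
    exact_mod_cast h2
  obtain ⟨a, ha, b, hb, hab, heq⟩ := Finset.exists_ne_map_eq_of_card_lt_of_maps_to hcard
    (f := fun h => (∑ i, h i * v i) / (N0 : ℤ)) (by
      intro h hh
      have hh := Finset.mem_coe.mp hh
      rw [mem_hbox] at hh
      have h1 := dot_abs_le (fun i => N0 / V i) D N0 V (fun i => div_mul_cancel₀ _ (hV i).ne')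
        h v hh.2 hv
      obtain ⟨q, hq⟩ := hdvd h hh.1
      rw [hq] at h1
      have hq2 : (∑ i, h i * v i) / (N0 : ℤ) = q := by
        rw [hq]; exact Int.mul_ediv_cancel_left _ (by exact_mod_cast hN.ne')
      simp only [hq2]
      push_cast at h1
      rw [abs_mul, abs_of_pos hN'] at h1
      have h3 : |(q : ℝ)| ≤ (Fintype.card ι : ℝ) * D := by
        have : (N0 : ℝ) * |(q : ℝ)| ≤ N0 * ((Fintype.card ι : ℝ) * D) := by linarith
        exact le_of_mul_le_mul_left this hN'
      have h4 : |q| ≤ M := by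
        rw [hM, Int.le_floor]; push_cast; exact h3
      rw [Finset.coe_Icc, Set.mem_Icc]
      exact abs_le.mp h4)
  rw [mem_hbox] at ha hb
  refine ⟨a - b, ?_, sub_ne_zero.mpr hab, ?_⟩
  · rw [mem_hbox]
    refine ⟨by rw [map_sub, ha.1, hb.1, sub_zero], fun i => ?_⟩
    have h1 := ha.2 i
    have h2 := hb.2 i
    simp only [Pi.sub_apply]
    push_cast
    calc |(a i : ℝ) - b i| ≤ |(a i : ℝ)| + |(b i : ℝ)| := abs_sub _ _
      _ ≤ _ := by linarith
  · obtain ⟨q, hq⟩ := hdvd a ha.1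
    obtain ⟨r, hr⟩ := hdvd b hb.1
    rw [hq, hr, Int.mul_ediv_cancel_left _ (by exact_mod_cast hN.ne'),
      Int.mul_ediv_cancel_left _ (by exact_mod_cast hN.ne')] at heq
    simp only [Pi.sub_apply, sub_mul, Finset.sum_sub_distrib]
    rw [hq, hr, heq, sub_self]

lemma exists_primitive (h : ι → ℤ) (hh : h ≠ 0) :
    ∃ g : ι → ℤ, (∀ p : ℕ, p.Prime → ∃ i, ¬ (p : ℤ) ∣ g i) ∧ (∀ i, |g i| ≤ |h i|) ∧
      ∀ v : ι → ℤ, ∑ i, h i * v i = 0 → ∑ i, g i * v i = 0 := by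
  have hne : (Finset.univ : Finset ι).Nonempty := by
    by_contra hc
    apply hh
    funext i
    exact absurd ⟨i, Finset.mem_univ i⟩ hc
  obtain ⟨g, hg, hg1⟩ := Finset.extract_gcd h hne
  set d := Finset.univ.gcd h with hd
  have hd0 : d ≠ 0 := by
    intro h0
    apply hh
    funext i
    rw [hg i (Finset.mem_univ i), h0]; simp
  refine ⟨g, ?_, ?_, ?_⟩
  · intro p hp
    by_contra hc
    push Not at hc
    have : (p : ℤ) ∣ Finset.univ.gcd g := Finset.dvd_gcd (fun i _ => hc i)
    rw [hg1] at this
    have h2 := Int.eq_one_of_dvd_one (by positivity) this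
    have h3 := hp.one_lt
    omega
  · intro i
    rw [hg i (Finset.mem_univ i), abs_mul]
    have : 1 ≤ |d| := Int.one_le_abs hd0
    nlinarith [abs_nonneg (g i)]
  · intro v hv
    have : d * ∑ i, g i * v i = 0 := by
      rw [Finset.mul_sum, ← hv]
      apply Finset.sum_congr rfl
      intro i _
      rw [hg i (Finset.mem_univ i)]; ring
    rcases mul_eq_zero.mp this with h0 | h0
    · exact absurd h0 hd0
    · exact h0

end Siegel

lemma siegel_list (ι : Type) [Fintype ι] [DecidableEq ι] (hn : 2 ≤ Fintype.card ι) :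
    ∃ K : ℝ, 1 ≤ K ∧ ∀ (G : Type) [AddCommGroup G] [Fintype G] (φ : (ι → ℤ) →+ G)
      (N0 : ℕ) (V : ι → ℝ) (T : ℝ), 0 < N0 → (∀ i, 0 < V i) → 0 ≤ T →
      (Fintype.card G : ℝ) * ∏ i, V i ≤ (N0 : ℝ) ^ Fintype.card ι * T ^ (Fintype.card ι - 1) →
      ∃ L : Finset (ι → ℤ), (L.card : ℝ) ≤ K * (1 + T) ∧
        (∀ g ∈ L, (∀ p : ℕ, p.Prime → ∃ i, ¬ (p : ℤ) ∣ g i) ∧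
          ∀ i, (|g i| : ℝ) * V i ≤ K * (N0 * (1 + T))) ∧
        ∀ v : ι → ℤ, (∀ i, (|v i| : ℝ) ≤ V i) →
          (∀ h, φ h = 0 → (N0 : ℤ) ∣ ∑ i, h i * v i) → ∃ g ∈ L, ∑ i, g i * v i = 0 := by
  classical
  set n := Fintype.card ι with hndef
  have hn' : (2 : ℝ) ≤ n := by exact_mod_cast hn
  refine ⟨25 ^ n * (12 * n ^ 2), ?_, ?_⟩
  · have : (1 : ℝ) ≤ 25 ^ n := one_le_pow₀ (by norm_num)
    nlinarith
  intro G _ _ φ N0 V T hN hV hT0 hT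
  have h25 : (1 : ℝ) ≤ 25 ^ n := one_le_pow₀ (by norm_num)
  have hN' : (0 : ℝ) < N0 := by exact_mod_cast hN
  set w : ι → ℝ := fun i => N0 / V i with hw
  have hw0 : ∀ i, 0 < w i := fun i => div_pos hN' (hV i)
  set D : ℕ → ℝ := fun j => 2 ^ j / (4 * n) with hD
  have hD0 : ∀ j, 0 < D j := fun j => by simp only [hD]; positivity
  have hDge : ∀ j, 1 ≤ 4 * n * D j := fun j => by
    have : (1 : ℝ) ≤ 2 ^ j := one_le_pow₀ (by norm_num)
    have e : 4 * n * D j = 2 ^ j := by simp only [hD]; field_simp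
    rw [e]; exact this
  set f : ℝ → ℝ := fun d => ((hbox φ w d).card : ℝ) with hf
  have hVp : 0 < ∏ i, V i := Finset.prod_pos (fun i _ => hV i)
  -- lower bound
  have hlow : ∀ j, ¬ (2 * n * D j + 1 < f (D j)) → D j ≤ 6 * n * T := by
    intro j hj
    push Not at hj
    have h1 := hbox_lower φ w (D j) (hD0 j).le (fun i => (hw0 i).le)
    have e1 : ∏ i, (D j * w i) = (D j) ^ n * (N0 : ℝ) ^ n / ∏ i, V i := by
      rw [Finset.prod_mul_distrib]
      simp only [hw, Finset.prod_div_distrib, Finset.prod_const, Finset.card_univ, ← hndef]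
      ring
    rw [e1, div_le_iff₀ hVp] at h1
    have h2 : (D j) ^ n * (N0 : ℝ) ^ n ≤ (2 * n * D j + 1) * ((N0 : ℝ) ^ n * T ^ (n - 1)) := by
      calc _ ≤ (Fintype.card G : ℝ) * (hbox φ w (D j)).card * ∏ i, V i := h1
        _ = (hbox φ w (D j)).card * ((Fintype.card G : ℝ) * ∏ i, V i) := by ring
        _ ≤ (hbox φ w (D j)).card * ((N0 : ℝ) ^ n * T ^ (n - 1)) :=
            mul_le_mul_of_nonneg_left hT (by positivity)
        _ ≤ _ := mul_le_mul_of_nonneg_right hj (by positivity)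
    have h3 : (D j) ^ n ≤ (6 * n * D j) * T ^ (n - 1) := by
      have h4 : (D j) ^ n * (N0 : ℝ) ^ n ≤ ((6 * n * D j) * T ^ (n - 1)) * (N0 : ℝ) ^ n := by
        refine h2.trans ?_
        have h5 := hDge j
        have h6 : 2 * n * D j + 1 ≤ 6 * n * D j := by linarith
        calc _ ≤ (6 * n * D j) * ((N0 : ℝ) ^ n * T ^ (n - 1)) :=
              mul_le_mul_of_nonneg_right h6 (by positivity)
          _ = _ := by ring
      exact le_of_mul_le_mul_right h4 (by positivity)
    have h4 : (D j) ^ (n - 1) ≤ (6 * n * T) ^ (n - 1) := by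
      have e2 : (D j) ^ n = D j * (D j) ^ (n - 1) := by
        rw [← pow_succ']; congr 1; omega
      rw [e2] at h3
      have h5 : (D j) ^ (n - 1) ≤ (6 * n) * T ^ (n - 1) := by
        have : D j * (D j) ^ (n - 1) ≤ D j * ((6 * n) * T ^ (n - 1)) := by linarith
        exact le_of_mul_le_mul_left this (hD0 j)
      rw [mul_pow]
      refine h5.trans (mul_le_mul_of_nonneg_right ?_ (by positivity))
      exact le_self_pow₀ (by linarith) (by omega)
    exact le_of_pow_le_pow_left₀ (by omega) (by positivity) h4
  have hex : ∃ j, 2 * n * D j + 1 < f (D j) := by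
    by_contra hc
    push Not at hc
    obtain ⟨j, hj⟩ := pow_unbounded_of_one_lt (6 * n * T * (4 * n)) (show (1 : ℝ) < 2 by norm_num)
    have h1 := hlow j (not_lt.mpr (hc j))
    simp only [hD] at h1
    rw [div_le_iff₀ (by positivity)] at h1
    linarith
  -- reduction to a list of nonzero vectors
  suffices hs : ∃ L : Finset (ι → ℤ), (L.card : ℝ) ≤ 25 ^ n * (12 * n ^ 2) * (1 + T) ∧
        (∀ g ∈ L, g ≠ 0 ∧ ∀ i, (|g i| : ℝ) ≤ (25 ^ n * (12 * n ^ 2)) * (1 + T) * w i) ∧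
        ∀ v : ι → ℤ, (∀ i, (|v i| : ℝ) ≤ V i) →
          (∀ h, φ h = 0 → (N0 : ℤ) ∣ ∑ i, h i * v i) → ∃ g ∈ L, ∑ i, g i * v i = 0 by
    obtain ⟨L, hL1, hL2, hL3⟩ := hs
    have : ∀ h : ι → ℤ, ∃ g : ι → ℤ, h ≠ 0 → (∀ p : ℕ, p.Prime → ∃ i, ¬ (p : ℤ) ∣ g i) ∧
      (∀ i, |g i| ≤ |h i|) ∧ ∀ v : ι → ℤ, ∑ i, h i * v i = 0 → ∑ i, g i * v i = 0 := by
      intro h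
      by_cases hh : h = 0
      · exact ⟨0, fun h0 => absurd hh h0⟩
      · obtain ⟨g, hg⟩ := exists_primitive h hh
        exact ⟨g, fun _ => hg⟩
    choose pr hpr using this
    refine ⟨L.image pr, ?_, ?_, ?_⟩
    · refine le_trans ?_ hL1
      exact_mod_cast Finset.card_image_le
    · intro g hg
      obtain ⟨h, hh, rfl⟩ := Finset.mem_image.mp hg
      obtain ⟨a, b⟩ := hL2 h hh
      obtain ⟨c, d, _⟩ := hpr h a
      refine ⟨c, fun i => ?_⟩
      have h1 : |(pr h i : ℝ)| ≤ |(h i : ℝ)| := by exact_mod_cast d i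
      have h2 := h1.trans (b i)
      calc (|pr h i| : ℝ) * V i ≤ ((25 ^ n * (12 * n ^ 2)) * (1 + T) * w i) * V i :=
            mul_le_mul_of_nonneg_right h2 (hV i).le
        _ = (25 ^ n * (12 * n ^ 2)) * (1 + T) * (w i * V i) := by ring
        _ = _ := by
            have : w i * V i = N0 := div_mul_cancel₀ _ (hV i).ne'
            rw [this]; ring
    · intro v hv hd
      obtain ⟨h, hh, h0⟩ := hL3 v hv hd
      exact ⟨pr h, Finset.mem_image_of_mem _ hh, (hpr h (hL2 h hh).1).2.2 v h0⟩
  have hnn : (2 : ℝ) * n ≤ n ^ 2 := by nlinarith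
  have hK1 : (1 : ℝ) ≤ 25 ^ n * (12 * n ^ 2) := by nlinarith
  have hKle : 12 * (n : ℝ) ^ 2 ≤ 25 ^ n * (12 * n ^ 2) :=
    le_mul_of_one_le_left (by positivity) h25
  set j := Nat.find hex with hj
  have hjs := Nat.find_spec hex
  rw [← hj] at hjs
  by_cases hj0 : j = 0
  · rw [hj0] at hjs
    have h2 : 2 ≤ (hbox φ w (D 0)).card := by
      have h1 := hDge 0
      have : (1 : ℝ) < (hbox φ w (D 0)).card := by
        refine lt_of_le_of_lt ?_ hjs
        have := mul_pos (show (0 : ℝ) < n by linarith) (hD0 0)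
        linarith
      exact_mod_cast this
    have hc1 : (n : ℝ) * D 0 < 1 := by
      simp only [hD]; field_simp; norm_num
    obtain ⟨h, h0, h1, h2⟩ := siegel_single φ N0 hN V hV (D 0) hc1 h2
    refine ⟨{h}, ?_, ?_, ?_⟩
    · simp only [Finset.card_singleton, Nat.cast_one]; nlinarith
    · intro g hg
      rw [Finset.mem_singleton] at hg
      subst hg
      refine ⟨h0, fun i => (h1 i).trans ?_⟩
      apply mul_le_mul_of_nonneg_right _ (hw0 i).le
      have : D 0 ≤ 1 := by nlinarith [hD0 0]
      nlinarith
    · intro v hv hd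
      exact ⟨h, by simp, h2 v hv hd⟩
  · obtain ⟨i, hi⟩ := Nat.exists_eq_succ_of_ne_zero hj0
    have hnot : ¬ (2 * n * D i + 1 < f (D i)) := Nat.find_min hex (by omega)
    have hDi := hlow i hnot
    have hDj : D j = 2 * D i := by
      rw [hi]; simp only [hD, Nat.succ_eq_add_one, pow_succ]; ring
    refine ⟨(hbox φ w (2 * D j)).erase 0, ?_, ?_, ?_⟩
    · have h1 : (((hbox φ w (2 * D j)).erase 0).card : ℝ) ≤ (hbox φ w (2 * D j)).card := by
        exact_mod_cast Finset.card_erase_le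
      have h2 := hbox_double φ w (D j) (hD0 j) hw0
      have h3 := hbox_double φ w (D i) (hD0 i) hw0
      rw [← hDj] at h3
      push Not at hnot
      have h4 : (25 : ℝ) ^ n = 5 ^ n * 5 ^ n := by rw [← mul_pow]; norm_num
      calc _ ≤ _ := h1
        _ ≤ 5 ^ n * ((hbox φ w (D j)).card : ℝ) := h2
        _ ≤ 5 ^ n * (5 ^ n * (hbox φ w (D i)).card) := by gcongr
        _ = 25 ^ n * f (D i) := by rw [h4]; ring
        _ ≤ 25 ^ n * (2 * n * D i + 1) := by gcongr
        _ ≤ 25 ^ n * ((12 * n ^ 2) * (1 + T)) := by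
            apply mul_le_mul_of_nonneg_left _ (by positivity)
            have : 2 * n * D i ≤ 2 * n * (6 * n * T) :=
              mul_le_mul_of_nonneg_left hDi (by positivity)
            nlinarith
        _ = _ := by ring
    · intro g hg
      rw [Finset.mem_erase, mem_hbox] at hg
      refine ⟨hg.1, fun k => (hg.2.2 k).trans ?_⟩
      apply mul_le_mul_of_nonneg_right _ (hw0 k).le
      calc 2 * D j = 4 * D i := by rw [hDj]; ring
        _ ≤ 24 * n * T := by linarith
        _ ≤ (12 * n ^ 2) * T := by nlinarith
        _ ≤ (12 * n ^ 2) * (1 + T) := by nlinarith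
        _ ≤ _ := mul_le_mul_of_nonneg_right hKle (by linarith)
    · intro v hv hd
      obtain ⟨h, h1, h2, h3⟩ := siegel_kill φ N0 hN V hV (D j) hjs v hv hd (hD0 j).le
      exact ⟨h, Finset.mem_erase.mpr ⟨h2, h1⟩, h3⟩

/-! ### Points on diagonal curves -/

lemma nat_dvd_int_of_prime_pow (n : ℕ) (hn : n ≠ 0) (a : ℤ)
    (h : ∀ p ∈ n.primeFactors, ((p ^ n.factorization p : ℕ) : ℤ) ∣ a) : (n : ℤ) ∣ a := by
  rw [Int.natCast_dvd, Nat.dvd_iff_prime_pow_dvd_dvd]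
  intro p k hp hk
  by_cases hk0 : k = 0
  · subst hk0; simp
  · have hpn : p ∣ n := (dvd_pow_self p hk0).trans hk
    have h1 := Int.natCast_dvd.mp (h p (Nat.mem_primeFactors.mpr ⟨hp, hpn, hn⟩))
    refine (pow_dvd_pow p ?_).trans h1
    exact (hp.pow_dvd_iff_le_factorization hn).mp hk

/-- Hensel type uniqueness -/
lemma pow_dvd_sub_of_pow (d : ℕ) (hd : d = 2 ∨ d = 3) (p : ℕ) (hp : p.Prime) (hpd : ¬ p ∣ d) (e : ℕ)
    (A B : ℤ) (hA : ¬ (p : ℤ) ∣ A) (h1 : (p : ℤ) ∣ A - B) (h2 : (p : ℤ) ^ e ∣ A ^ d - B ^ d) :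
    (p : ℤ) ^ e ∣ A - B := by
  have hpp : Prime (p : ℤ) := Nat.prime_iff_prime_int.mp hp
  have hpd' : ¬ (p : ℤ) ∣ (d : ℤ) := fun h => hpd (Int.natCast_dvd_natCast.mp h)
  obtain ⟨k, hk⟩ := h1
  have hB : B = A - p * k := by linarith
  rcases hd with rfl | rfl
  · have hf : A ^ 2 - B ^ 2 = (A + B) * (A - B) := by ring
    rw [hf] at h2
    have hnot : ¬ (p : ℤ) ∣ A + B := by
      intro hc
      have : (p : ℤ) ∣ (2 : ℕ) * A := by
        have : ((2 : ℕ) : ℤ) * A = (A + B) + p * k := by rw [hB]; push_cast; ring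
        rw [this]; exact dvd_add hc (dvd_mul_right _ _)
      rcases hpp.dvd_or_dvd this with h | h
      · exact hpd' h
      · exact hA h
    exact (IsCoprime.pow_left ((Prime.coprime_iff_not_dvd hpp).mpr hnot)).dvd_of_dvd_mul_left h2
  · have hf : A ^ 3 - B ^ 3 = (A ^ 2 + A * B + B ^ 2) * (A - B) := by ring
    rw [hf] at h2
    have hnot : ¬ (p : ℤ) ∣ A ^ 2 + A * B + B ^ 2 := by
      intro hc
      have : (p : ℤ) ∣ (3 : ℕ) * A ^ 2 := by
        have : ((3 : ℕ) : ℤ) * A ^ 2 = (A ^ 2 + A * B + B ^ 2) + p * (k * (3 * A - p * k)) := by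
          rw [hB]; push_cast; ring
        rw [this]; exact dvd_add hc (dvd_mul_right _ _)
      rcases hpp.dvd_or_dvd this with h | h
      · exact hpd' h
      · exact hA (hpp.dvd_of_dvd_pow h)
    exact (IsCoprime.pow_left ((Prime.coprime_iff_not_dvd hpp).mpr hnot)).dvd_of_dvd_mul_left h2

lemma roots_card (F : Type) [Field F] [DecidableEq F] (d : ℕ) (hd : 0 < d) (c : F) (S : Finset F)
    (h : ∀ s ∈ S, s ^ d = c) : S.card ≤ d := by
  calc S.card ≤ (Polynomial.nthRoots d c).toFinset.card := by
        apply Finset.card_le_card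
        intro s hs
        rw [Multiset.mem_toFinset, Polynomial.mem_nthRoots hd]
        exact h s hs
    _ ≤ _ := (Multiset.toFinset_card_le _).trans (Polynomial.card_nthRoots d c)

lemma color_one {α : Type*} (d : ℕ) (hd : d = 2 ∨ d = 3) (S : Finset α) (u w : α → ℤ) (b c : ℤ)
    (n : ℕ) (hn : n ≠ 0) (hnd : n.Coprime d) (hb : IsCoprime (n : ℤ) b)
    (hu : ∀ s ∈ S, IsCoprime (n : ℤ) (u s)) (hw : ∀ s ∈ S, IsCoprime (n : ℤ) (w s))
    (h : ∀ s ∈ S, (n : ℤ) ∣ b * u s ^ d + c * w s ^ d) :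
    ∃ S' ⊆ S, S.card ≤ d ^ n.primeFactors.card * S'.card ∧
      ∀ s ∈ S', ∀ t ∈ S', (n : ℤ) ∣ u s * w t - u t * w s := by
  have key : ∀ p ∈ n.primeFactors, ∀ T ⊆ S, ∃ S' ⊆ T, T.card ≤ d * S'.card ∧
      (∀ s ∈ S', ∀ t ∈ S', ((p ^ n.factorization p : ℕ) : ℤ) ∣ u s * w t - u t * w s) := by
    intro p hp T hT
    have hpp := Nat.prime_of_mem_primeFactors hp
    have hpn := Nat.dvd_of_mem_primeFactors hp
    have hpn' : (p : ℤ) ∣ n := Int.natCast_dvd_natCast.mpr hpn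
    have : Fact p.Prime := ⟨hpp⟩
    have hnz : ∀ x : ℤ, IsCoprime (n : ℤ) x → (x : ZMod p) ≠ 0 := by
      intro x hx h0
      rw [ZMod.intCast_zmod_eq_zero_iff_dvd] at h0
      have := hx.isUnit_of_dvd' hpn' h0
      rw [Int.isUnit_iff] at this
      have := hpp.one_lt
      omega
    obtain ⟨S', h1, h2, h3⟩ := exists_big_class_of_image T
      (fun s => (u s : ZMod p) / (w s : ZMod p)) d (by
        apply roots_card (ZMod p) d (by omega) (-c / b)
        intro r hr
        obtain ⟨s, hs, rfl⟩ := Finset.mem_image.mp hr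
        have hws := hnz _ (hw s (hT hs))
        have hbz := hnz _ hb
        have h0 : (b : ZMod p) * (u s : ZMod p) ^ d + c * (w s : ZMod p) ^ d = 0 := by
          have := (ZMod.intCast_zmod_eq_zero_iff_dvd _ p).mpr (hpn'.trans (h s (hT hs)))
          push_cast at this
          exact this
        rw [div_pow, div_eq_div_iff (pow_ne_zero _ hws) hbz]
        linear_combination h0)
    refine ⟨S', h1, h2, fun s hs t ht => ?_⟩
    have hsS := hT (h1 hs)
    have htS := hT (h1 ht)
    have e := h3 s hs t ht
    rw [div_eq_div_iff (hnz _ (hw s hsS)) (hnz _ (hw t htS))] at e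
    have hd1 : (p : ℤ) ∣ u s * w t - u t * w s := by
      rw [← ZMod.intCast_zmod_eq_zero_iff_dvd]
      push_cast
      rw [e, sub_self]
    push_cast
    have hpd : ¬ p ∣ d := fun hc => by
      have := Nat.dvd_gcd hpn hc
      rw [hnd] at this
      exact hpp.one_lt.ne' (Nat.dvd_one.mp this)
    have hA : ¬ (p : ℤ) ∣ u s * w t := by
      rw [← ZMod.intCast_zmod_eq_zero_iff_dvd]
      push_cast
      exact mul_ne_zero (hnz _ (hu s hsS)) (hnz _ (hw t htS))
    apply pow_dvd_sub_of_pow d hd p hpp hpd _ _ _ hA hd1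
    have hpe : (p : ℤ) ^ n.factorization p ∣ n := by
      exact_mod_cast Nat.ordProj_dvd n p
    refine hpe.trans ?_
    have h5 : (n : ℤ) ∣ b * ((u s * w t) ^ d - (u t * w s) ^ d) := by
      have e5 : b * ((u s * w t) ^ d - (u t * w s) ^ d) =
        (b * u s ^ d + c * w s ^ d) * w t ^ d - (b * u t ^ d + c * w t ^ d) * w s ^ d := by ring
      rw [e5]
      exact dvd_sub ((h s hsS).mul_right _) ((h t htS).mul_right _)
    exact hb.dvd_of_dvd_mul_left h5
  obtain ⟨S', h1, h2, h3⟩ := coloring n.primeFactors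
    (fun p T => ∀ s ∈ T, ∀ t ∈ T, ((p ^ n.factorization p : ℕ) : ℤ) ∣ u s * w t - u t * w s) d
    (fun p A B hAB hA s hs t ht => hA s (hAB hs) t (hAB ht)) S key
  exact ⟨S', h1, h2, fun s hs t ht => nat_dvd_int_of_prime_pow n hn _ (fun p hp => h3 p hp s hs t ht)⟩

/-! collinear points -/

lemma isotropic_false (e : ℕ) (he : e = 1 ∨ e = 2) (α β γ x1 y1 z1 x2 y2 z2 : ℤ)
    (hα : α ≠ 0) (hβ : β ≠ 0) (hx1 : 0 < x1) (hy1 : 0 < y1) (hx2 : 0 < x2) (hy2 : 0 < y2)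
    (hc : x1 * y2 - x2 * y1 ≠ 0)
    (h11 : α * x1 ^ e * x1 + β * y1 ^ e * y1 + γ * z1 ^ e * z1 = 0)
    (h12 : α * x1 ^ e * x2 + β * y1 ^ e * y2 + γ * z1 ^ e * z2 = 0)
    (h21 : α * x2 ^ e * x1 + β * y2 ^ e * y1 + γ * z2 ^ e * z1 = 0)
    (h22 : α * x2 ^ e * x2 + β * y2 ^ e * y2 + γ * z2 ^ e * z2 = 0) : False := by
  set c1 := y1 * z2 - y2 * z1
  set c2 := z1 * x2 - z2 * x1
  set c3 := x1 * y2 - x2 * y1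
  have a1 : α * x1 ^ e * c2 = β * y1 ^ e * c1 := by
    simp only [c1, c2]; linear_combination z1 * h12 - z2 * h11
  have a2 : α * x2 ^ e * c2 = β * y2 ^ e * c1 := by
    simp only [c1, c2]; linear_combination z1 * h22 - z2 * h21
  have a3 : γ * z1 ^ e * c1 = α * x1 ^ e * c3 := by
    simp only [c1, c3]; linear_combination y1 * h12 - y2 * h11
  have a4 : γ * z1 ^ e * c2 = β * y1 ^ e * c3 := by
    simp only [c2, c3]; linear_combination x2 * h11 - x1 * h12
  have hpos : x1 ^ e * y2 ^ e - x2 ^ e * y1 ^ e ≠ 0 := by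
    rcases he with rfl | rfl
    · simpa using hc
    · have : x1 ^ 2 * y2 ^ 2 - x2 ^ 2 * y1 ^ 2 = (x1 * y2 + x2 * y1) * c3 := by
        simp only [c3]; ring
      rw [this]
      have : 0 < x1 * y2 + x2 * y1 := by positivity
      exact mul_ne_zero this.ne' hc
  have a5 : α * c2 * (x1 ^ e * y2 ^ e - x2 ^ e * y1 ^ e) = 0 := by
    linear_combination y2 ^ e * a1 - y1 ^ e * a2
  have hc2 : c2 = 0 := by
    rcases mul_eq_zero.mp a5 with h | h
    · rcases mul_eq_zero.mp h with h | h
      · exact absurd h hα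
      · exact h
    · exact absurd h hpos
  rw [hc2] at a4
  have : β * y1 ^ e * c3 = 0 := by rw [← a4]; ring
  exact mul_ne_zero (mul_ne_zero hβ (pow_ne_zero _ hy1.ne')) hc this

lemma collinear_conic (α β γ x1 y1 z1 x2 y2 z2 x3 y3 z3 : ℤ)
    (hα : α ≠ 0) (hβ : β ≠ 0) (hx1 : 0 < x1) (hy1 : 0 < y1) (hx2 : 0 < x2) (hy2 : 0 < y2)
    (h12 : x1 * y2 - x2 * y1 ≠ 0) (h13 : x1 * y3 - x3 * y1 ≠ 0) (h23 : x2 * y3 - x3 * y2 ≠ 0)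
    (e1 : α * x1 ^ 2 + β * y1 ^ 2 + γ * z1 ^ 2 = 0) (e2 : α * x2 ^ 2 + β * y2 ^ 2 + γ * z2 ^ 2 = 0)
    (e3 : α * x3 ^ 2 + β * y3 ^ 2 + γ * z3 ^ 2 = 0)
    (hdet : x1 * (y2 * z3 - y3 * z2) + x2 * (y3 * z1 - y1 * z3) + x3 * (y1 * z2 - y2 * z1) = 0) :
    False := by
  have hz : (x1 * y2 - x2 * y1) * z3 = - (x2 * y3 - x3 * y2) * z1 + (x1 * y3 - x3 * y1) * z2 := by
    linear_combination hdet
  have hB : (x2 * y3 - x3 * y2) * (x1 * y3 - x3 * y1) *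
      (α * x1 * x2 + β * y1 * y2 + γ * z1 * z2) = 0 := by
    have h2 : 2 * ((x2 * y3 - x3 * y2) * (x1 * y3 - x3 * y1) *
      (α * x1 * x2 + β * y1 * y2 + γ * z1 * z2)) = 0 := by
      linear_combination (x2 * y3 - x3 * y2) ^ 2 * e1 + (x1 * y3 - x3 * y1) ^ 2 * e2
        - (x1 * y2 - x2 * y1) ^ 2 * e3 + γ * ((x1 * y2 - x2 * y1) * z3 +
          (- (x2 * y3 - x3 * y2) * z1 + (x1 * y3 - x3 * y1) * z2)) * hz
    linarith
  have hB' : α * x1 * x2 + β * y1 * y2 + γ * z1 * z2 = 0 := by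
    rcases mul_eq_zero.mp hB with h | h
    · exact absurd h (mul_ne_zero h23 h13)
    · exact h
  exact isotropic_false 1 (Or.inl rfl) α β γ x1 y1 z1 x2 y2 z2 hα hβ hx1 hy1 hx2 hy2 h12
    (by linear_combination e1) (by linear_combination hB') (by linear_combination hB')
    (by linear_combination e2)

lemma cubic_aux (α β γ x1 y1 z1 x2 y2 z2 x3 y3 z3 : ℤ)
    (h13 : x1 * y3 - x3 * y1 ≠ 0) (h23 : x2 * y3 - x3 * y2 ≠ 0)
    (e1 : α * x1 ^ 3 + β * y1 ^ 3 + γ * z1 ^ 3 = 0) (e2 : α * x2 ^ 3 + β * y2 ^ 3 + γ * z2 ^ 3 = 0)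
    (e3 : α * x3 ^ 3 + β * y3 ^ 3 + γ * z3 ^ 3 = 0)
    (hdet : x1 * (y2 * z3 - y3 * z2) + x2 * (y3 * z1 - y1 * z3) + x3 * (y1 * z2 - y2 * z1) = 0) :
    - (x2 * y3 - x3 * y2) * (α * x1 ^ 2 * x2 + β * y1 ^ 2 * y2 + γ * z1 ^ 2 * z2) +
     (x1 * y3 - x3 * y1) * (α * x1 * x2 ^ 2 + β * y1 * y2 ^ 2 + γ * z1 * z2 ^ 2) = 0 := by
  have hz : (x1 * y2 - x2 * y1) * z3 = - (x2 * y3 - x3 * y2) * z1 + (x1 * y3 - x3 * y1) * z2 := by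
    linear_combination hdet
  set s := - (x2 * y3 - x3 * y2) with hs
  set t := (x1 * y3 - x3 * y1) with ht
  set c := (x1 * y2 - x2 * y1) with hc
  have hx : c * x3 = s * x1 + t * x2 := by rw [hc, hs, ht]; ring
  have hy : c * y3 = s * y1 + t * y2 := by rw [hc, hs, ht]; ring
  have h3 : (3 * (s * t)) * (s * (α * x1 ^ 2 * x2 + β * y1 ^ 2 * y2 + γ * z1 ^ 2 * z2) +
     t * (α * x1 * x2 ^ 2 + β * y1 * y2 ^ 2 + γ * z1 * z2 ^ 2)) = 0 := by
    have e3' : α * (c * x3) ^ 3 + β * (c * y3) ^ 3 + γ * (c * z3) ^ 3 = 0 := by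
      linear_combination c ^ 3 * e3
    rw [hx, hy, hz] at e3'
    linear_combination e3' - s ^ 3 * e1 - t ^ 3 * e2
  rcases mul_eq_zero.mp h3 with h | h
  · exfalso
    have : s ≠ 0 := by rw [hs]; exact neg_ne_zero.mpr h23
    exact (mul_ne_zero (by norm_num) (mul_ne_zero this h13)) h
  · exact h

lemma collinear_cubic (α β γ x1 y1 z1 x2 y2 z2 x3 y3 z3 x4 y4 z4 : ℤ)
    (hα : α ≠ 0) (hβ : β ≠ 0) (hx1 : 0 < x1) (hy1 : 0 < y1) (hx2 : 0 < x2) (hy2 : 0 < y2)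
    (h12 : x1 * y2 - x2 * y1 ≠ 0) (h13 : x1 * y3 - x3 * y1 ≠ 0) (h23 : x2 * y3 - x3 * y2 ≠ 0)
    (h14 : x1 * y4 - x4 * y1 ≠ 0) (h24 : x2 * y4 - x4 * y2 ≠ 0) (h34 : x3 * y4 - x4 * y3 ≠ 0)
    (e1 : α * x1 ^ 3 + β * y1 ^ 3 + γ * z1 ^ 3 = 0) (e2 : α * x2 ^ 3 + β * y2 ^ 3 + γ * z2 ^ 3 = 0)
    (e3 : α * x3 ^ 3 + β * y3 ^ 3 + γ * z3 ^ 3 = 0) (e4 : α * x4 ^ 3 + β * y4 ^ 3 + γ * z4 ^ 3 = 0)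
    (hdet : x1 * (y2 * z3 - y3 * z2) + x2 * (y3 * z1 - y1 * z3) + x3 * (y1 * z2 - y2 * z1) = 0)
    (hdet' : x1 * (y2 * z4 - y4 * z2) + x2 * (y4 * z1 - y1 * z4) + x4 * (y1 * z2 - y2 * z1) = 0) :
    False := by
  have f3 := cubic_aux α β γ x1 y1 z1 x2 y2 z2 x3 y3 z3 h13 h23 e1 e2 e3 hdet
  have f4 := cubic_aux α β γ x1 y1 z1 x2 y2 z2 x4 y4 z4 h14 h24 e1 e2 e4 hdet'
  set A := α * x1 ^ 2 * x2 + β * y1 ^ 2 * y2 + γ * z1 ^ 2 * z2 with hA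
  set B := α * x1 * x2 ^ 2 + β * y1 * y2 ^ 2 + γ * z1 * z2 ^ 2 with hB
  have hne : (x1 * y2 - x2 * y1) * (x3 * y4 - x4 * y3) ≠ 0 := mul_ne_zero h12 h34
  have hA0 : A = 0 := by
    have : (x1 * y2 - x2 * y1) * (x3 * y4 - x4 * y3) * A = 0 := by
      linear_combination (x1 * y4 - x4 * y1) * f3 - (x1 * y3 - x3 * y1) * f4
    exact (mul_eq_zero.mp this).resolve_left hne
  have hB0 : B = 0 := by
    have : (x1 * y2 - x2 * y1) * (x3 * y4 - x4 * y3) * B = 0 := by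
      linear_combination (x2 * y4 - x4 * y2) * f3 - (x2 * y3 - x3 * y2) * f4
    exact (mul_eq_zero.mp this).resolve_left hne
  exact isotropic_false 2 (Or.inr rfl) α β γ x1 y1 z1 x2 y2 z2 hα hβ hx1 hy1 hx2 hy2 h12
    (by linear_combination e1) (by linear_combination hA0) (by linear_combination hB0)
    (by linear_combination e2)

lemma det_p3 (d : ℕ) (hd : d = 2 ∨ d = 3) (p : ℤ) (hp : Prime p) (hpd : ¬ p ∣ (d : ℤ))
    (α β γ : ℤ) (hα : ¬ p ∣ α) (hβ : ¬ p ∣ β) (hγ : ¬ p ∣ γ) (x1 y1 z1 x2 y2 z2 x3 y3 z3 l m : ℤ)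
    (h1 : ¬ (p ∣ x1 ∧ p ∣ y1 ∧ p ∣ z1))
    (hl : ¬ p ∣ l) (hm : ¬ p ∣ m)
    (hx2 : p ∣ x2 - l * x1) (hy2 : p ∣ y2 - l * y1) (hz2 : p ∣ z2 - l * z1)
    (hx3 : p ∣ x3 - m * x1) (hy3 : p ∣ y3 - m * y1) (hz3 : p ∣ z3 - m * z1)
    (e1 : α * x1 ^ d + β * y1 ^ d + γ * z1 ^ d = 0) (e2 : α * x2 ^ d + β * y2 ^ d + γ * z2 ^ d = 0)
    (e3 : α * x3 ^ d + β * y3 ^ d + γ * z3 ^ d = 0) :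
    p ^ 3 ∣ x1 * (y2 * z3 - y3 * z2) + x2 * (y3 * z1 - y1 * z3) + x3 * (y1 * z2 - y2 * z1) := by
  have grad : ∀ l a b c : ℤ, ¬ p ∣ l → α * (l * x1 + p * a) ^ d + β * (l * y1 + p * b) ^ d
      + γ * (l * z1 + p * c) ^ d = 0 →
      p ∣ (α * x1 ^ (d - 1)) * a + (β * y1 ^ (d - 1)) * b + (γ * z1 ^ (d - 1)) * c := by
    intro l a b c hl h
    have hp0 : p ≠ 0 := hp.ne_zero
    have : p ∣ ((d : ℤ) * l ^ (d - 1)) * ((α * x1 ^ (d - 1)) * a + (β * y1 ^ (d - 1)) * b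
        + (γ * z1 ^ (d - 1)) * c) := by
      rcases hd with rfl | rfl
      · refine ⟨-(α * a ^ 2 + β * b ^ 2 + γ * c ^ 2), ?_⟩
        apply mul_left_cancel₀ hp0
        push_cast
        simp only [pow_one]
        linear_combination h - l ^ 2 * e1
      · refine ⟨-(α * (3 * l * x1 * a ^ 2 + p * a ^ 3) + β * (3 * l * y1 * b ^ 2 + p * b ^ 3)
          + γ * (3 * l * z1 * c ^ 2 + p * c ^ 3)), ?_⟩
        apply mul_left_cancel₀ hp0
        push_cast
        linear_combination h - l ^ 3 * e1
    rcases hp.dvd_or_dvd this with h | h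
    · rcases hp.dvd_or_dvd h with h | h
      · exact absurd h hpd
      · exact absurd (hp.dvd_of_dvd_pow h) hl
    · exact h
  obtain ⟨a2, ha2⟩ := hx2
  obtain ⟨b2, hb2⟩ := hy2
  obtain ⟨c2, hc2⟩ := hz2
  obtain ⟨a3, ha3⟩ := hx3
  obtain ⟨b3, hb3⟩ := hy3
  obtain ⟨c3, hc3⟩ := hz3
  obtain rfl : x2 = l * x1 + p * a2 := by linarith
  obtain rfl : y2 = l * y1 + p * b2 := by linarith
  obtain rfl : z2 = l * z1 + p * c2 := by linarith
  obtain rfl : x3 = m * x1 + p * a3 := by linarith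
  obtain rfl : y3 = m * y1 + p * b3 := by linarith
  obtain rfl : z3 = m * z1 + p * c3 := by linarith
  have g2 := grad l a2 b2 c2 hl e2
  have g3 := grad m a3 b3 c3 hm e3
  set nx := α * x1 ^ (d - 1)
  set ny := β * y1 ^ (d - 1)
  set nz := γ * z1 ^ (d - 1)
  have g1 : nx * x1 + ny * y1 + nz * z1 = 0 := by
    have : ∀ a b : ℤ, (a * b ^ (d - 1)) * b = a * b ^ d := by
      intro a b; rw [mul_assoc, ← pow_succ]; congr 2; omega
    simp only [nx, ny, nz, this]; exact e1
  set dt := x1 * (b2 * c3 - b3 * c2) + a2 * (b3 * z1 - y1 * c3) + a3 * (y1 * c2 - b2 * z1) with hdt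
  have hfin : p ∣ dt := by
    obtain ⟨q2, hq2⟩ := g2
    obtain ⟨q3, hq3⟩ := g3
    have hx : p ∣ nx * dt := by
      refine ⟨q2 * (b3 * z1 - y1 * c3) + q3 * (y1 * c2 - b2 * z1), ?_⟩
      rw [hdt]
      linear_combination (b2 * c3 - b3 * c2) * g1 + (b3 * z1 - y1 * c3) * hq2
        + (y1 * c2 - b2 * z1) * hq3
    have hy : p ∣ ny * dt := by
      refine ⟨q2 * (x1 * c3 - z1 * a3) + q3 * (z1 * a2 - x1 * c2), ?_⟩
      rw [hdt]
      linear_combination (c2 * a3 - a2 * c3) * g1 + (x1 * c3 - z1 * a3) * hq2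
        + (z1 * a2 - x1 * c2) * hq3
    have hz : p ∣ nz * dt := by
      refine ⟨q2 * (y1 * a3 - x1 * b3) + q3 * (x1 * b2 - y1 * a2), ?_⟩
      rw [hdt]
      linear_combination (a2 * b3 - b2 * a3) * g1 + (y1 * a3 - x1 * b3) * hq2
        + (x1 * b2 - y1 * a2) * hq3
    by_contra hc
    apply h1
    have aux : ∀ a b : ℤ, ¬ p ∣ a → p ∣ (a * b ^ (d - 1)) * dt → p ∣ b := by
      intro a b ha h
      rcases hp.dvd_or_dvd h with h | h
      · rcases hp.dvd_or_dvd h with h | h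
        · exact absurd h ha
        · exact hp.dvd_of_dvd_pow h
      · exact absurd h hc
    exact ⟨aux _ _ hα hx, aux _ _ hβ hy, aux _ _ hγ hz⟩
  obtain ⟨q, hq⟩ := hfin
  refine ⟨q, ?_⟩
  have : p ^ 3 * q = p ^ 2 * dt := by rw [hq]; ring
  rw [this, hdt]; ring

/-- projective coloring modulo `p` -/
lemma color_proj (d : ℕ) (hd : d = 2 ∨ d = 3) (p : ℕ) (hp : p.Prime) (α β γ : ℤ)
    (hα : ¬ (p : ℤ) ∣ α) (hβ : ¬ (p : ℤ) ∣ β) (S : Finset (ℤ × ℤ × ℤ))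
    (hS : ∀ v ∈ S, α * v.1 ^ d + β * v.2.1 ^ d + γ * v.2.2 ^ d = 0 ∧ IsCoprime v.1 v.2.1) :
    ∃ S' ⊆ S, S.card ≤ 6 * p * S'.card ∧ ∀ v ∈ S', ∀ w ∈ S', ∃ l : ℤ, ¬ (p : ℤ) ∣ l ∧
      (p : ℤ) ∣ w.1 - l * v.1 ∧ (p : ℤ) ∣ w.2.1 - l * v.2.1 ∧ (p : ℤ) ∣ w.2.2 - l * v.2.2 := by
  have : Fact p.Prime := ⟨hp⟩
  have hα' : (α : ZMod p) ≠ 0 := by rwa [Ne, ZMod.intCast_zmod_eq_zero_iff_dvd]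
  have hβ' : (β : ZMod p) ≠ 0 := by rwa [Ne, ZMod.intCast_zmod_eq_zero_iff_dvd]
  have hd0 : 0 < d := by omega
  set f : ℤ × ℤ × ℤ → ZMod p × ZMod p × ZMod p := fun v =>
    if (v.2.2 : ZMod p) ≠ 0 then ((v.1 : ZMod p) / v.2.2, (v.2.1 : ZMod p) / v.2.2, 1)
    else ((v.1 : ZMod p) / v.2.1, 1, 0) with hf
  have hE : ∀ v ∈ S, (α : ZMod p) * (v.1 : ZMod p) ^ d + β * (v.2.1 : ZMod p) ^ d
      + γ * (v.2.2 : ZMod p) ^ d = 0 := by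
    intro v hv
    have := congrArg (Int.cast : ℤ → ZMod p) (hS v hv).1
    push_cast at this
    exact this
  -- if z = 0 then x,y are nonzero
  have hy0 : ∀ v ∈ S, (v.2.2 : ZMod p) = 0 → (v.2.1 : ZMod p) ≠ 0 := by
    intro v hv hz hy
    have h1 := hE v hv
    rw [hz, hy, zero_pow (by omega)] at h1
    simp only [mul_zero, add_zero, mul_eq_zero, pow_eq_zero_iff (show d ≠ 0 by omega), hα',
      false_or] at h1
    rw [ZMod.intCast_zmod_eq_zero_iff_dvd] at h1 hy
    have := (hS v hv).2.isUnit_of_dvd' h1 hy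
    rw [Int.isUnit_iff] at this
    have := hp.one_lt
    omega
  have himg : (S.image f).card ≤ 6 * p := by
    have := Finset.card_le_mul_card_image_of_maps_to (s := S.image f)
      (f := fun c => if c.2.2 = 1 then some c.1 else none) (t := (Finset.univ : Finset (Option (ZMod p))))
      (by simp) d (by
        intro o _
        set U := (S.image f).filter (fun c => (if c.2.2 = 1 then some c.1 else none) = o) with hU
        rcases o with _ | X
        · -- z = 0
          have hinj : U.card ≤ (U.image (fun c => c.1)).card := by
            rw [Finset.card_image_of_injOn]
            intro a ha b hb hab
            have ha := Finset.mem_coe.mp ha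
            have hb := Finset.mem_coe.mp hb
            simp only [hU, Finset.mem_filter, Finset.mem_image] at ha hb
            obtain ⟨⟨v, hv, rfl⟩, ha2⟩ := ha
            obtain ⟨⟨w, hw, rfl⟩, hb2⟩ := hb
            by_cases hz : (v.2.2 : ZMod p) = 0 <;> by_cases hz' : (w.2.2 : ZMod p) = 0 <;>
              simp_all
          refine hinj.trans (roots_card (ZMod p) d hd0 (-β / α) _ ?_)
          intro s hs
          simp only [hU, Finset.mem_filter, Finset.mem_image] at hs
          obtain ⟨a, ⟨⟨v, hv, rfl⟩, ha2⟩, rfl⟩ := hs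
          by_cases hz : (v.2.2 : ZMod p) = 0
          · have h1 := hE v hv
            have h2 := hy0 v hv hz
            rw [hz, zero_pow (by omega)] at h1
            simp only [hf, hz, ne_eq, not_true_eq_false, if_false]
            rw [div_pow, div_eq_div_iff (pow_ne_zero _ h2) hα']
            linear_combination h1
          · simp [hf, hz] at ha2
        · have hinj : U.card ≤ (U.image (fun c => c.2.1)).card := by
            rw [Finset.card_image_of_injOn]
            intro a ha b hb hab
            have ha := Finset.mem_coe.mp ha
            have hb := Finset.mem_coe.mp hb
            simp only [hU, Finset.mem_filter, Finset.mem_image] at ha hb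
            obtain ⟨⟨v, hv, rfl⟩, ha2⟩ := ha
            obtain ⟨⟨w, hw, rfl⟩, hb2⟩ := hb
            by_cases hz : (v.2.2 : ZMod p) = 0 <;> by_cases hz' : (w.2.2 : ZMod p) = 0 <;>
              simp_all
          refine hinj.trans (roots_card (ZMod p) d hd0 ((-γ - α * X ^ d) / β) _ ?_)
          intro s hs
          simp only [hU, Finset.mem_filter, Finset.mem_image] at hs
          obtain ⟨a, ⟨⟨v, hv, rfl⟩, ha2⟩, rfl⟩ := hs
          by_cases hz : (v.2.2 : ZMod p) = 0
          · simp [hf, hz] at ha2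
          · have h1 := hE v hv
            simp only [hf, hz, ne_eq, not_false_eq_true, if_true, Option.some.injEq] at ha2 ⊢
            rw [← ha2, eq_div_iff hβ', div_pow, div_pow]
            field_simp
            linear_combination h1)
    refine this.trans ?_
    have hc : (Finset.univ : Finset (Option (ZMod p))).card = p + 1 := by
      rw [Finset.card_univ, Fintype.card_option, ZMod.card]
    rw [hc]
    have := hp.one_lt
    rcases hd with rfl | rfl <;> nlinarith
  obtain ⟨S', h1, h2, h3⟩ := exists_big_class_of_image S f (6 * p) himg
  refine ⟨S', h1, h2, fun v hv w hw => ?_⟩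
  have e := h3 v hv w hw
  have hex : ∃ l : ZMod p, l ≠ 0 ∧ (w.1 : ZMod p) = l * v.1 ∧ (w.2.1 : ZMod p) = l * v.2.1 ∧
      (w.2.2 : ZMod p) = l * v.2.2 := by
    by_cases hz : (v.2.2 : ZMod p) = 0 <;> by_cases hz' : (w.2.2 : ZMod p) = 0
    · have hv0 := hy0 v (h1 hv) hz
      have hw0 := hy0 w (h1 hw) hz'
      simp only [hf, hz, hz', ne_eq, not_true_eq_false, if_false, Prod.mk.injEq, and_true] at e
      rw [div_eq_div_iff hv0 hw0] at e
      refine ⟨(w.2.1 : ZMod p) / v.2.1, div_ne_zero hw0 hv0, ?_, ?_, ?_⟩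
      · field_simp; linear_combination -e
      · field_simp
      · rw [hz, hz']; simp
    · simp [hf, hz, hz'] at e
    · simp [hf, hz, hz'] at e
    · simp only [hf, hz, hz', ne_eq, not_false_eq_true, if_true, Prod.mk.injEq, and_true] at e
      obtain ⟨ea, eb⟩ := e
      rw [div_eq_div_iff hz hz'] at ea eb
      refine ⟨(w.2.2 : ZMod p) / v.2.2, div_ne_zero hz' hz, ?_, ?_, ?_⟩
      · field_simp; linear_combination -ea
      · field_simp; linear_combination -eb
      · field_simp
  obtain ⟨l, hl, a, b, c⟩ := hex
  obtain ⟨l, rfl⟩ := ZMod.intCast_surjective l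
  have conv : ∀ s t : ℤ, (s : ZMod p) = l * t → (p : ℤ) ∣ s - l * t := by
    intro s t h
    rw [← ZMod.intCast_zmod_eq_zero_iff_dvd]
    push_cast
    rw [h, sub_self]
  refine ⟨l, ?_, conv _ _ a, conv _ _ b, conv _ _ c⟩
  rwa [Ne, ZMod.intCast_zmod_eq_zero_iff_dvd] at hl

lemma coprime_pair_eq (x1 y1 x2 y2 : ℤ) (hx1 : 0 < x1) (hx2 : 0 < x2)
    (h1 : IsCoprime x1 y1) (h2 : IsCoprime x2 y2) (h : x1 * y2 - x2 * y1 = 0) :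
    x1 = x2 ∧ y1 = y2 := by
  have ha : x1 ∣ x2 := by
    have : x1 ∣ x2 * y1 := ⟨y2, by linarith⟩
    exact h1.dvd_of_dvd_mul_right this
  have hb : x2 ∣ x1 := by
    have : x2 ∣ x1 * y2 := ⟨y1, by linarith⟩
    exact h2.dvd_of_dvd_mul_right this
  have hx : x1 = x2 := Int.dvd_antisymm hx1.le hx2.le ha hb
  refine ⟨hx, ?_⟩
  subst hx
  have : x1 * (y2 - y1) = 0 := by linarith
  rcases mul_eq_zero.mp this with h | h <;> omega

lemma det_abs_le (M a b c d e f : ℝ) (ha : 0 ≤ a) (hb : 0 ≤ b) (hc : 0 ≤ c) (hd : 0 ≤ d)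
    (he : 0 ≤ e) (hf : 0 ≤ f) (ha' : a ≤ M) (hb' : b ≤ M) (hc' : c ≤ M) (hd' : d ≤ M)
    (he' : e ≤ M) (hf' : f ≤ M) : |a - b + (c - d) + (e - f)| ≤ 6 * M := by
  rw [abs_le]
  constructor <;> linarith

lemma lt_aux (R q n : ℝ) (h : 6 * R ^ 3 < q) (hn : 0 < n) : 6 * (R ^ 3 * n) < q * n := by
  have := mul_lt_mul_of_pos_right h hn
  linarith

set_option maxHeartbeats 1000000 in
/-- The number of points on a diagonal conic or cubic, core version. -/
lemma gl_core (d : ℕ) (hd : d = 2 ∨ d = 3) (D ε : ℝ) (hε : 0 < ε) :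
    ∃ C : ℝ, 1 ≤ C ∧ ∀ (P X Y Z : ℝ) (α β γ : ℤ) (n1 n2 n3 : ℕ) (S : Finset (ℤ × ℤ × ℤ)),
      1 ≤ P → α ≠ 0 → β ≠ 0 → γ ≠ 0 → 0 < n1 → 0 < n2 → 0 < n3 →
      (|α| : ℝ) ≤ P ^ D → (|β| : ℝ) ≤ P ^ D → (|γ| : ℝ) ≤ P ^ D →
      (n1 : ℝ) ≤ P ^ D → (n2 : ℝ) ≤ P ^ D → (n3 : ℝ) ≤ P ^ D →
      n1.Coprime n2 → n1.Coprime n3 → n2.Coprime n3 → 0 ≤ X → 0 ≤ Y → 0 ≤ Z →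
      (∀ v ∈ S, 0 < v.1 ∧ 0 < v.2.1 ∧ 0 < v.2.2 ∧ (v.1 : ℝ) ≤ X ∧ (v.2.1 : ℝ) ≤ Y ∧
        (v.2.2 : ℝ) ≤ Z ∧ α * v.1 ^ d + β * v.2.1 ^ d + γ * v.2.2 ^ d = 0 ∧ IsCoprime v.1 v.2.1) →
      (∀ v ∈ S, ∀ w ∈ S, (n1 : ℤ) ∣ v.2.1 * w.2.2 - w.2.1 * v.2.2 ∧
        (n2 : ℤ) ∣ v.1 * w.2.2 - w.1 * v.2.2 ∧ (n3 : ℤ) ∣ v.1 * w.2.1 - w.1 * v.2.1) →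
      (S.card : ℝ) ≤ C * P ^ ε * (1 + (X * Y * Z / (n1 * n2 * n3)) ^ (1 / 3 : ℝ)) := by
  obtain ⟨C, hC1, hC⟩ := aux_prime (6 * D) ε hε
  refine ⟨72 * C, by linarith, ?_⟩
  intro P X Y Z α β γ n1 n2 n3 S hP hα hβ hγ hn1 hn2 hn3 bα bβ bγ b1 b2 b3 c12 c13 c23 hX hY hZ
    hS hpair
  have hP0 : 0 < P := by linarith
  have hn1' : (0 : ℝ) < n1 := by exact_mod_cast hn1
  have hn2' : (0 : ℝ) < n2 := by exact_mod_cast hn2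
  have hn3' : (0 : ℝ) < n3 := by exact_mod_cast hn3
  set Rr : ℝ := (X * Y * Z / (n1 * n2 * n3)) ^ (1 / 3 : ℝ) with hRr
  have hRr0 : 0 ≤ Rr := by positivity
  have hRr3 : Rr ^ 3 * (n1 * n2 * n3) = X * Y * Z := by
    rw [hRr, ← Real.rpow_natCast, ← Real.rpow_mul (by positivity)]
    norm_num
    field_simp
  obtain ⟨p, hp, hpR, hpC, hpn⟩ := hC P (4 * (1 + Rr)) (α * β * γ * n1 * n2 * n3) hP
    (by linarith) (by positivity) (by
      have e : P ^ (6 * D) = P ^ D * P ^ D * P ^ D * P ^ D * P ^ D * P ^ D := by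
        simp only [← Real.rpow_add hP0]; ring_nf
      rw [e]
      push_cast
      simp only [abs_mul, abs_of_pos hn1', abs_of_pos hn2', abs_of_pos hn3']
      gcongr)
  have hpi : Prime (p : ℤ) := Nat.prime_iff_prime_int.mp hp
  have hpα : ¬ (p : ℤ) ∣ α := fun h => hpn (by
    obtain ⟨k, hk⟩ := h; exact ⟨k * (β * γ * n1 * n2 * n3), by rw [hk]; ring⟩)
  have hpβ : ¬ (p : ℤ) ∣ β := fun h => hpn (by
    obtain ⟨k, hk⟩ := h; exact ⟨k * (α * γ * n1 * n2 * n3), by rw [hk]; ring⟩)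
  have hpγ : ¬ (p : ℤ) ∣ γ := fun h => hpn (by
    obtain ⟨k, hk⟩ := h; exact ⟨k * (β * α * n1 * n2 * n3), by rw [hk]; ring⟩)
  have hpN : ¬ (p : ℤ) ∣ (n1 : ℤ) * n2 * n3 := fun h => hpn (by
    obtain ⟨k, hk⟩ := h
    refine ⟨k * (β * α * γ), ?_⟩
    calc α * β * γ * n1 * n2 * n3 = (α * β * γ) * ((n1 : ℤ) * n2 * n3) := by ring
      _ = _ := by rw [hk]; ring)
  have hp4 : 4 < p := by
    have : (4 : ℝ) < p := by linarith
    exact_mod_cast this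
  have hpd : ¬ (p : ℤ) ∣ (d : ℤ) := by
    intro h
    have := Nat.le_of_dvd (by omega) (Int.natCast_dvd_natCast.mp h)
    omega
  obtain ⟨S', hS'1, hS'2, hS'3⟩ := color_proj d hd p hp α β γ hpα hpβ S
    (fun v hv => ⟨(hS v hv).2.2.2.2.2.2.1, (hS v hv).2.2.2.2.2.2.2⟩)
  -- all determinants vanish
  have hdet : ∀ u ∈ S', ∀ v ∈ S', ∀ w ∈ S', u.1 * (v.2.1 * w.2.2 - w.2.1 * v.2.2)
      + v.1 * (w.2.1 * u.2.2 - u.2.1 * w.2.2) + w.1 * (u.2.1 * v.2.2 - v.2.1 * u.2.2) = 0 := by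
    intro u hu v hv w hw
    obtain ⟨l, hl, a1, a2, a3⟩ := hS'3 u hu v hv
    obtain ⟨m, hm, a4, a5, a6⟩ := hS'3 u hu w hw
    obtain ⟨u1, u2, u3, uX, uY, uZ, ue, uc⟩ := hS u (hS'1 hu)
    obtain ⟨v1, v2, v3, vX, vY, vZ, ve, vc⟩ := hS v (hS'1 hv)
    obtain ⟨w1, w2, w3, wX, wY, wZ, we, wc⟩ := hS w (hS'1 hw)
    have hd1 := det_p3 d hd p hpi hpd α β γ hpα hpβ hpγ u.1 u.2.1 u.2.2 v.1 v.2.1 v.2.2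
      w.1 w.2.1 w.2.2 l m (by
        rintro ⟨h1, h2, -⟩
        have := uc.isUnit_of_dvd' h1 h2
        rw [Int.isUnit_iff] at this
        omega) hl hm a1 a2 a3 a4 a5 a6 ue ve we
    set dt := u.1 * (v.2.1 * w.2.2 - w.2.1 * v.2.2)
      + v.1 * (w.2.1 * u.2.2 - u.2.1 * w.2.2) + w.1 * (u.2.1 * v.2.2 - v.2.1 * u.2.2) with hdt
    have k1 := hpair u (hS'1 hu) v (hS'1 hv)
    have k2 := hpair v (hS'1 hv) w (hS'1 hw)
    have k3 := hpair u (hS'1 hu) w (hS'1 hw)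
    have d1 : (n1 : ℤ) ∣ dt := by
      have : dt = u.1 * (v.2.1 * w.2.2 - w.2.1 * v.2.2) - v.1 * (u.2.1 * w.2.2 - w.2.1 * u.2.2)
        + w.1 * (u.2.1 * v.2.2 - v.2.1 * u.2.2) := by rw [hdt]; ring
      rw [this]
      exact dvd_add (dvd_sub (k2.1.mul_left _) (k3.1.mul_left _)) (k1.1.mul_left _)
    have d2 : (n2 : ℤ) ∣ dt := by
      have : dt = -(u.2.1 * (v.1 * w.2.2 - w.1 * v.2.2)) + v.2.1 * (u.1 * w.2.2 - w.1 * u.2.2)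
        - w.2.1 * (u.1 * v.2.2 - v.1 * u.2.2) := by rw [hdt]; ring
      rw [this]
      exact dvd_sub (dvd_add ((k2.2.1.mul_left _).neg_right) (k3.2.1.mul_left _)) (k1.2.1.mul_left _)
    have d3 : (n3 : ℤ) ∣ dt := by
      have : dt = u.2.2 * (v.1 * w.2.1 - w.1 * v.2.1) - v.2.2 * (u.1 * w.2.1 - w.1 * u.2.1)
        + w.2.2 * (u.1 * v.2.1 - v.1 * u.2.1) := by rw [hdt]; ring
      rw [this]
      exact dvd_add (dvd_sub (k2.2.2.mul_left _) (k3.2.2.mul_left _)) (k1.2.2.mul_left _)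
    have c12' : IsCoprime (n1 : ℤ) n2 := Nat.isCoprime_iff_coprime.mpr c12
    have c13' : IsCoprime (n1 : ℤ) n3 := Nat.isCoprime_iff_coprime.mpr c13
    have c23' : IsCoprime (n2 : ℤ) n3 := Nat.isCoprime_iff_coprime.mpr c23
    have d123 : (n1 : ℤ) * n2 * n3 ∣ dt :=
      (IsCoprime.mul_left c13' c23').mul_dvd (c12'.mul_dvd d1 d2) d3
    have hcop : IsCoprime ((p : ℤ) ^ 3) ((n1 : ℤ) * n2 * n3) :=
      IsCoprime.pow_left ((Prime.coprime_iff_not_dvd hpi).mpr hpN)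
    have hall := hcop.mul_dvd hd1 d123
    apply Int.eq_zero_of_abs_lt_dvd hall
    have hb : (|dt| : ℝ) ≤ 6 * (X * Y * Z) := by
      have key : ∀ a b c : ℤ, 0 < a → 0 < b → 0 < c → (a : ℝ) ≤ X → (b : ℝ) ≤ Y → (c : ℝ) ≤ Z →
          (a * b * c : ℝ) ≤ X * Y * Z ∧ (0 : ℝ) ≤ a * b * c := by
        intro a b c ha hb hc hA hB hC
        have ha' : (0 : ℝ) < a := by exact_mod_cast ha
        have hb' : (0 : ℝ) < b := by exact_mod_cast hb
        have hc' : (0 : ℝ) < c := by exact_mod_cast hc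
        exact ⟨by gcongr, by positivity⟩
      obtain ⟨m1, m1'⟩ := key _ _ _ u1 v2 w3 uX vY wZ
      obtain ⟨m2, m2'⟩ := key _ _ _ u1 w2 v3 uX wY vZ
      obtain ⟨m3, m3'⟩ := key _ _ _ v1 w2 u3 vX wY uZ
      obtain ⟨m4, m4'⟩ := key _ _ _ v1 u2 w3 vX uY wZ
      obtain ⟨m5, m5'⟩ := key _ _ _ w1 u2 v3 wX uY vZ
      obtain ⟨m6, m6'⟩ := key _ _ _ w1 v2 u3 wX vY uZ
      have hh := det_abs_le _ _ _ _ _ _ _ m1' m2' m3' m4' m5' m6' m1 m2 m3 m4 m5 m6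
      have he : (dt : ℝ) = (u.1 : ℝ) * v.2.1 * w.2.2 - u.1 * w.2.1 * v.2.2 +
          (v.1 * w.2.1 * u.2.2 - v.1 * u.2.1 * w.2.2) +
          (w.1 * u.2.1 * v.2.2 - w.1 * v.2.1 * u.2.2) := by
        rw [hdt]
        push_cast
        ring
      rw [he]
      exact hh
    have hlt : 6 * (X * Y * Z) < (p : ℝ) ^ 3 * (n1 * n2 * n3) := by
      rw [← hRr3]
      have h4 : (4 * (1 + Rr)) ^ 3 < (p : ℝ) ^ 3 := pow_lt_pow_left₀ hpR (by positivity) (by norm_num)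
      have h5 : 6 * Rr ^ 3 ≤ (4 * (1 + Rr)) ^ 3 := by
        have : (4 * (1 + Rr)) ^ 3 = 64 * (1 + 3 * Rr + 3 * Rr ^ 2 + Rr ^ 3) := by ring
        rw [this]; have := pow_nonneg hRr0 3; have := pow_nonneg hRr0 2; linarith
      exact lt_aux _ _ _ (h5.trans_lt h4) (by positivity)
    have : (|dt| : ℝ) < ((p : ℝ) ^ 3 * (n1 * n2 * n3)) := hb.trans_lt hlt
    exact_mod_cast this
  have hcr : ∀ u ∈ S', ∀ v ∈ S', u ≠ v → u.1 * v.2.1 - v.1 * u.2.1 ≠ 0 := by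
    intro u hu v hv huv h0
    obtain ⟨u1, u2, u3, uX, uY, uZ, ue, uc⟩ := hS u (hS'1 hu)
    obtain ⟨v1, v2, v3, vX, vY, vZ, ve, vc⟩ := hS v (hS'1 hv)
    obtain ⟨h1, h2⟩ := coprime_pair_eq _ _ _ _ u1 v1 uc vc h0
    apply huv
    have h3 : u.2.2 = v.2.2 := by
      rw [← h1, ← h2] at ve
      have : γ * (u.2.2 ^ d - v.2.2 ^ d) = 0 := by linarith
      have h4 : u.2.2 ^ d = v.2.2 ^ d := by
        rcases mul_eq_zero.mp this with h | h
        · exact absurd h hγ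
        · linarith
      exact (pow_left_inj₀ u3.le v3.le (by omega)).mp h4
    exact Prod.ext h1 (Prod.ext h2 h3)
  have h3 : S'.card ≤ 3 := by
    by_contra hc
    push Not at hc
    obtain ⟨T, hT, hT4⟩ := Finset.exists_subset_card_eq (show 4 ≤ S'.card from hc)
    obtain ⟨q1, q2, q3, q4, n12, n13, n14, n23, n24, n34, rfl⟩ := Finset.card_eq_four.mp hT4
    have m1 : q1 ∈ S' := hT (by simp)
    have m2 : q2 ∈ S' := hT (by simp)
    have m3 : q3 ∈ S' := hT (by simp)
    have m4 : q4 ∈ S' := hT (by simp)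
    obtain ⟨u1, u2, u3, uX, uY, uZ, ue, uc⟩ := hS q1 (hS'1 m1)
    obtain ⟨v1, v2, v3, vX, vY, vZ, ve, vc⟩ := hS q2 (hS'1 m2)
    have we := (hS q3 (hS'1 m3)).2.2.2.2.2.2.1
    have te := (hS q4 (hS'1 m4)).2.2.2.2.2.2.1
    rcases hd with rfl | rfl
    · exact collinear_conic α β γ _ _ _ _ _ _ _ _ _ hα hβ u1 u2 v1 v2 (hcr _ m1 _ m2 n12)
        (hcr _ m1 _ m3 n13) (hcr _ m2 _ m3 n23) ue ve we (hdet _ m1 _ m2 _ m3)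
    · exact collinear_cubic α β γ _ _ _ _ _ _ _ _ _ _ _ _ hα hβ u1 u2 v1 v2 (hcr _ m1 _ m2 n12)
        (hcr _ m1 _ m3 n13) (hcr _ m2 _ m3 n23) (hcr _ m1 _ m4 n14) (hcr _ m2 _ m4 n24)
        (hcr _ m3 _ m4 n34) ue ve we te (hdet _ m1 _ m2 _ m3) (hdet _ m1 _ m2 _ m4)
  have h4 : S.card ≤ 18 * p := by nlinarith
  calc (S.card : ℝ) ≤ 18 * p := by exact_mod_cast h4
    _ ≤ 18 * (C * (4 * (1 + Rr) * P ^ ε)) := by linarith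
    _ = _ := by ring

/-- The number of points on a diagonal conic or cubic. -/
lemma gl_lemma (d : ℕ) (hd : d = 2 ∨ d = 3) (D ε : ℝ) (hε : 0 < ε) :
    ∃ C : ℝ, 1 ≤ C ∧ ∀ (P X Y Z : ℝ) (α β γ : ℤ) (n1 n2 n3 : ℕ) (S : Finset (ℤ × ℤ × ℤ)),
      1 ≤ P → α ≠ 0 → β ≠ 0 → γ ≠ 0 → n1.Coprime d → n2.Coprime d → n3.Coprime d →
      (n1 : ℤ) ∣ α → (n2 : ℤ) ∣ β → (n3 : ℤ) ∣ γ →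
      (|α| : ℝ) ≤ P ^ D → (|β| : ℝ) ≤ P ^ D → (|γ| : ℝ) ≤ P ^ D → 0 ≤ X → 0 ≤ Y → 0 ≤ Z →
      (∀ v ∈ S, 0 < v.1 ∧ 0 < v.2.1 ∧ 0 < v.2.2 ∧ (v.1 : ℝ) ≤ X ∧ (v.2.1 : ℝ) ≤ Y ∧
        (v.2.2 : ℝ) ≤ Z ∧ α * v.1 ^ d + β * v.2.1 ^ d + γ * v.2.2 ^ d = 0 ∧
        IsCoprime (α * v.1) (β * v.2.1) ∧ IsCoprime (α * v.1) (γ * v.2.2) ∧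
        IsCoprime (β * v.2.1) (γ * v.2.2)) →
      (S.card : ℝ) ≤ C * P ^ ε * (1 + (X * Y * Z / (n1 * n2 * n3)) ^ (1 / 3 : ℝ)) := by
  set D' := max D 1
  have hD' : 0 < D' := lt_of_lt_of_le one_pos (le_max_right _ _)
  obtain ⟨C, hC1, hC⟩ := gl_core d hd D' (ε / 2) (by positivity)
  obtain ⟨C', hC'1, hC'⟩ := pow_omega_le d (ε / (6 * D')) (by positivity)
  refine ⟨C * C' ^ 3, one_le_mul_of_one_le_of_one_le hC1 (one_le_pow₀ hC'1), ?_⟩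
  intro P X Y Z α β γ n1 n2 n3 S hP hα hβ hγ o1 o2 o3 d1 d2 d3 bα bβ bγ hX hY hZ hS
  have hP0 : 0 < P := by linarith
  have hn1 : 0 < n1 := Nat.pos_of_ne_zero (by rintro rfl; simp at d1; exact hα d1)
  have hn2 : 0 < n2 := Nat.pos_of_ne_zero (by rintro rfl; simp at d2; exact hβ d2)
  have hn3 : 0 < n3 := Nat.pos_of_ne_zero (by rintro rfl; simp at d3; exact hγ d3)
  have hDD : P ^ D ≤ P ^ D' := Real.rpow_le_rpow_of_exponent_le hP (le_max_left _ _)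
  have bn : ∀ (n : ℕ) (a : ℤ), a ≠ 0 → (n : ℤ) ∣ a → (|a| : ℝ) ≤ P ^ D → (n : ℝ) ≤ P ^ D' := by
    intro n a ha hn hb
    refine le_trans ?_ (hb.trans hDD)
    have h1 := Int.le_of_dvd (abs_pos.mpr ha) ((dvd_abs _ _).mpr hn)
    exact_mod_cast h1
  by_cases hSe : S = ∅
  · subst hSe
    simp only [Finset.card_empty, Nat.cast_zero]
    positivity
  obtain ⟨v0, hv0⟩ := Finset.nonempty_iff_ne_empty.mpr hSe
  have cop : ∀ a b x y : ℤ, ∀ n m : ℕ, (n : ℤ) ∣ a → (m : ℤ) ∣ b → IsCoprime (a * x) (b * y) →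
      n.Coprime m := by
    intro a b x y n m hn hm h
    rw [← Nat.isCoprime_iff_coprime]
    exact (h.of_mul_left_left.of_mul_right_left).of_isCoprime_of_dvd_left hn
      |>.of_isCoprime_of_dvd_right hm
  obtain ⟨-, -, -, -, -, -, -, q1, q2, q3⟩ := hS v0 hv0
  have c12 := cop _ _ _ _ _ _ d1 d2 q1
  have c13 := cop _ _ _ _ _ _ d1 d3 q2
  have c23 := cop _ _ _ _ _ _ d2 d3 q3
  obtain ⟨S1, s1, t1, r1⟩ := color_one d hd S (fun v => v.2.1) (fun v => v.2.2) β γ n1 hn1.ne' o1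
    (q1.of_mul_left_left.of_mul_right_left.of_isCoprime_of_dvd_left d1)
    (fun v hv => ((hS v hv).2.2.2.2.2.2.2.1.of_mul_left_left.of_mul_right_right).of_isCoprime_of_dvd_left d1)
    (fun v hv => ((hS v hv).2.2.2.2.2.2.2.2.1.of_mul_left_left.of_mul_right_right).of_isCoprime_of_dvd_left d1)
    (fun v hv => by
      have e := (hS v hv).2.2.2.2.2.2.1
      have : β * v.2.1 ^ d + γ * v.2.2 ^ d = α * (- v.1 ^ d) := by linarith
      rw [this]; exact d1.mul_right _)
  obtain ⟨S2, s2, t2, r2⟩ := color_one d hd S1 (fun v => v.1) (fun v => v.2.2) α γ n2 hn2.ne' o2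
    (q1.symm.of_mul_left_left.of_mul_right_left.of_isCoprime_of_dvd_left d2)
    (fun v hv => ((hS v (s1 hv)).2.2.2.2.2.2.2.1.symm.of_mul_left_left.of_mul_right_right).of_isCoprime_of_dvd_left d2)
    (fun v hv => ((hS v (s1 hv)).2.2.2.2.2.2.2.2.2.of_mul_left_left.of_mul_right_right).of_isCoprime_of_dvd_left d2)
    (fun v hv => by
      have e := (hS v (s1 hv)).2.2.2.2.2.2.1
      have : α * v.1 ^ d + γ * v.2.2 ^ d = β * (- v.2.1 ^ d) := by linarith
      rw [this]; exact d2.mul_right _)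
  obtain ⟨S3, s3, t3, r3⟩ := color_one d hd S2 (fun v => v.1) (fun v => v.2.1) α β n3 hn3.ne' o3
    (q2.symm.of_mul_left_left.of_mul_right_left.of_isCoprime_of_dvd_left d3)
    (fun v hv => ((hS v (s1 (s2 hv))).2.2.2.2.2.2.2.2.1.symm.of_mul_left_left.of_mul_right_right).of_isCoprime_of_dvd_left d3)
    (fun v hv => ((hS v (s1 (s2 hv))).2.2.2.2.2.2.2.2.2.symm.of_mul_left_left.of_mul_right_right).of_isCoprime_of_dvd_left d3)
    (fun v hv => by
      have e := (hS v (s1 (s2 hv))).2.2.2.2.2.2.1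
      have : α * v.1 ^ d + β * v.2.1 ^ d = γ * (- v.2.2 ^ d) := by linarith
      rw [this]; exact d3.mul_right _)
  have main := hC P X Y Z α β γ n1 n2 n3 S3 hP hα hβ hγ hn1 hn2 hn3 (bα.trans hDD) (bβ.trans hDD)
    (bγ.trans hDD) (bn _ _ hα d1 bα) (bn _ _ hβ d2 bβ) (bn _ _ hγ d3 bγ) c12 c13 c23 hX hY hZ
    (fun v hv => by
      obtain ⟨a1, a2, a3, a4, a5, a6, a7, a8, -, -⟩ := hS v (s1 (s2 (s3 hv)))
      exact ⟨a1, a2, a3, a4, a5, a6, a7, a8.of_mul_left_right.of_mul_right_right⟩)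
    (fun v hv w hw => ⟨r1 v (s2 (s3 hv)) w (s2 (s3 hw)), r2 v (s3 hv) w (s3 hw), r3 v hv w hw⟩)
  have om : ∀ n : ℕ, 0 < n → (n : ℝ) ≤ P ^ D' → (d : ℝ) ^ n.primeFactors.card ≤ C' * P ^ (ε / 6) := by
    intro n hn hnP
    refine (hC' n hn).trans (mul_le_mul_of_nonneg_left ?_ (by linarith))
    calc (n : ℝ) ^ (ε / (6 * D')) ≤ (P ^ D') ^ (ε / (6 * D')) :=
          Real.rpow_le_rpow (by positivity) hnP (by positivity)
      _ = _ := by rw [← Real.rpow_mul hP0.le]; congr 1; field_simp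
  have w1 := om n1 hn1 (bn _ _ hα d1 bα)
  have w2 := om n2 hn2 (bn _ _ hβ d2 bβ)
  have w3 := om n3 hn3 (bn _ _ hγ d3 bγ)
  have t1' : (S.card : ℝ) ≤ (d : ℝ) ^ n1.primeFactors.card * S1.card := by exact_mod_cast t1
  have t2' : (S1.card : ℝ) ≤ (d : ℝ) ^ n2.primeFactors.card * S2.card := by exact_mod_cast t2
  have t3' : (S2.card : ℝ) ≤ (d : ℝ) ^ n3.primeFactors.card * S3.card := by exact_mod_cast t3
  have hPe : P ^ ε = P ^ (ε / 6) * P ^ (ε / 6) * P ^ (ε / 6) * P ^ (ε / 2) := by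
    simp only [← Real.rpow_add hP0]; ring_nf
  calc (S.card : ℝ) ≤ (C' * P ^ (ε / 6)) * ((C' * P ^ (ε / 6)) * ((C' * P ^ (ε / 6)) * S3.card)) := by
        refine t1'.trans (mul_le_mul w1 (t2'.trans (mul_le_mul w2 (t3'.trans
          (mul_le_mul_of_nonneg_right w3 (by positivity))) (by positivity) (by positivity)))
          (by positivity) (by positivity))
    _ ≤ (C' * P ^ (ε / 6)) * ((C' * P ^ (ε / 6)) * ((C' * P ^ (ε / 6)) *
        (C * P ^ (ε / 2) * (1 + (X * Y * Z / (n1 * n2 * n3)) ^ (1 / 3 : ℝ))))) := by gcongr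
    _ = _ := by rw [hPe]; ring

@[ext] structure Pt where
  a : ℤ
  b : ℤ
  c : ℤ
  x : ℤ
  y : ℤ
  z : ℤ

noncomputable instance : DecidableEq Pt := Classical.decEq _

/-- The points counted in a dyadic block. -/
structure Good (P : ℝ) (r1 r2 r3 : ℤ) (A B C : ℝ) (v : Pt) : Prop where
  a0 : 0 < v.a
  b0 : 0 < v.b
  c0 : 0 < v.c
  x0 : 0 < v.x
  y0 : 0 < v.y
  z0 : 0 < v.z
  sa : Squarefree v.a
  sb : Squarefree v.b
  sc : Squarefree v.c
  eq : r1 * v.a ^ 3 * v.x ^ 2 + r2 * v.b ^ 3 * v.y ^ 2 + r3 * v.c ^ 3 * v.z ^ 2 = 0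
  p1 : |(r1 : ℝ)| * v.a ^ 3 * v.x ^ 2 ≤ P
  p2 : |(r2 : ℝ)| * v.b ^ 3 * v.y ^ 2 ≤ P
  p3 : |(r3 : ℝ)| * v.c ^ 3 * v.z ^ 2 ≤ P
  aA : (v.a : ℝ) ≤ A
  bB : (v.b : ℝ) ≤ B
  cC : (v.c : ℝ) ≤ C
  Aa : A ≤ 2 * v.a
  Bb : B ≤ 2 * v.b
  Cc : C ≤ 2 * v.c
  c12 : IsCoprime (r1 * v.a * v.x) (r2 * v.b * v.y)
  c13 : IsCoprime (r1 * v.a * v.x) (r3 * v.c * v.z)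
  c23 : IsCoprime (r2 * v.b * v.y) (r3 * v.c * v.z)

lemma int_one_le_abs {r : ℤ} (hr : r ≠ 0) : (1 : ℝ) ≤ |(r : ℝ)| := by
  have := Int.one_le_abs hr
  exact_mod_cast this

lemma int_one_le {r : ℤ} (hr : 0 < r) : (1 : ℝ) ≤ (r : ℝ) := by
  exact_mod_cast hr

lemma box1_card (T : Finset ℤ) (A : ℝ) (hA : 0 ≤ A) (h : ∀ t ∈ T, 0 < t ∧ (t : ℝ) ≤ A) :
    (T.card : ℝ) ≤ A := by
  have h1 : T ⊆ Finset.Icc 1 ⌊A⌋ := by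
    intro t ht
    rw [Finset.mem_Icc]
    exact ⟨(h t ht).1, Int.le_floor.mpr (h t ht).2⟩
  have h2 := Finset.card_le_card h1
  rw [Int.card_Icc] at h2
  have h3 : ((T.card : ℤ) : ℝ) ≤ (⌊A⌋ : ℝ) := by
    have : 0 ≤ ⌊A⌋ := Int.floor_nonneg.mpr hA
    have : (T.card : ℤ) ≤ ⌊A⌋ := by omega
    exact_mod_cast this
  have h4 := Int.floor_le A
  push_cast at h3
  linarith

lemma box3_card (T : Finset (ℤ × ℤ × ℤ)) (A B C : ℝ) (hA : 0 ≤ A) (hB : 0 ≤ B) (hC : 0 ≤ C)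
    (h : ∀ t ∈ T, 0 < t.1 ∧ (t.1 : ℝ) ≤ A ∧ 0 < t.2.1 ∧ (t.2.1 : ℝ) ≤ B ∧ 0 < t.2.2 ∧
      (t.2.2 : ℝ) ≤ C) :
    (T.card : ℝ) ≤ A * B * C := by
  have h1 : T ⊆ Finset.Icc 1 ⌊A⌋ ×ˢ (Finset.Icc 1 ⌊B⌋ ×ˢ Finset.Icc 1 ⌊C⌋) := by
    intro t ht
    obtain ⟨h1, h2, h3, h4, h5, h6⟩ := h t ht
    simp only [Finset.mem_product, Finset.mem_Icc]
    exact ⟨⟨h1, Int.le_floor.mpr h2⟩, ⟨h3, Int.le_floor.mpr h4⟩, ⟨h5, Int.le_floor.mpr h6⟩⟩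
  have h2 := Finset.card_le_card h1
  rw [Finset.card_product, Finset.card_product] at h2
  have k : ∀ D : ℝ, 0 ≤ D → ((Finset.Icc 1 ⌊D⌋).card : ℝ) ≤ D := fun D hD =>
    box1_card _ D hD (fun t ht => by
      rw [Finset.mem_Icc] at ht
      exact ⟨by omega, Int.le_floor.mp ht.2⟩)
  have h3 : (T.card : ℝ) ≤ ((Finset.Icc 1 ⌊A⌋).card : ℝ) * (((Finset.Icc 1 ⌊B⌋).card : ℝ) *
    ((Finset.Icc 1 ⌊C⌋).card : ℝ)) := by exact_mod_cast h2
  refine h3.trans ?_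
  rw [mul_assoc]
  have := k A hA
  have := k B hB
  have := k C hC
  gcongr

lemma le_of_coef {r a x P : ℝ} (hr : 1 ≤ r) (ha : 0 ≤ a) (hx : 1 ≤ x) (h : r * a * x ^ 2 ≤ P) :
    r * a ≤ P ∧ a * x ^ 2 ≤ P ∧ r * x ^ 2 * a ≤ P := by
  have h1 : 1 ≤ x ^ 2 := one_le_pow₀ hx
  refine ⟨?_, ?_, by linarith⟩
  · refine le_trans ?_ h
    exact le_mul_of_one_le_right (by positivity) h1
  · refine le_trans ?_ h
    rw [mul_assoc]
    exact le_mul_of_one_le_left (by positivity) hr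

lemma odd_part (a : ℤ) (h0 : 0 < a) (ha : Squarefree a) :
    ∃ n : ℕ, 0 < n ∧ n.Coprime 2 ∧ (n : ℤ) ∣ a ∧ a ≤ 2 * n := by
  rcases Int.even_or_odd a with h | h
  · obtain ⟨k, hk⟩ := h
    refine ⟨k.toNat, by omega, ?_, ⟨2, by omega⟩, by omega⟩
    rw [Nat.coprime_two_right]
    by_contra hc
    rw [Nat.not_odd_iff_even] at hc
    obtain ⟨j, hj⟩ := hc
    have := ha 2 ⟨j, by omega⟩
    rw [Int.isUnit_iff] at this
    omega
  · refine ⟨a.toNat, by omega, ?_, ⟨1, by omega⟩, by omega⟩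
    rw [Nat.coprime_two_right]
    obtain ⟨j, hj⟩ := h
    exact ⟨j.toNat, by omega⟩

lemma le_sqrt_aux {a x P : ℝ} (ha : 1 ≤ a) (hx : 0 ≤ x) (h : a ^ 3 * x ^ 2 ≤ P) :
    x ≤ Real.sqrt P := by
  apply Real.le_sqrt_of_sq_le
  refine le_trans ?_ h
  exact le_mul_of_one_le_left (by positivity) (one_le_pow₀ ha)

lemma region1_aux (s A B C n1 n2 n3 : ℝ) (hs : 0 ≤ s) (hA : 0 < A) (hB : 0 < B) (hC : 0 < C)
    (h1 : A ≤ 4 * n1) (h2 : B ≤ 4 * n2) (h3 : C ≤ 4 * n3) :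
    (s * s * s / (n1 ^ 3 * n2 ^ 3 * n3 ^ 3)) ^ (1 / 3 : ℝ) ≤ 64 * s / (A * B * C) := by
  have k1 : 0 < n1 := by linarith
  have k2 : 0 < n2 := by linarith
  have k3 : 0 < n3 := by linarith
  have e : s * s * s / (n1 ^ 3 * n2 ^ 3 * n3 ^ 3) = (s / (n1 * n2 * n3)) ^ (3 : ℕ) := by
    field_simp
  rw [e, ← Real.rpow_natCast, ← Real.rpow_mul (by positivity)]
  norm_num
  rw [div_le_div_iff₀ (by positivity) (by positivity)]
  have : A * B * C ≤ (4 * n1) * (4 * n2) * (4 * n3) := by gcongr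
  calc s * (A * B * C) ≤ s * ((4 * n1) * (4 * n2) * (4 * n3)) := by gcongr
    _ = _ := by ring

lemma region1 (ε : ℝ) (hε : 0 < ε) : ∃ K : ℝ, 1 ≤ K ∧
    ∀ (P : ℝ) (r1 r2 r3 : ℤ) (A B C : ℝ) (S : Finset Pt), 1 ≤ P → r1 ≠ 0 → r2 ≠ 0 → r3 ≠ 0 →
      (∀ v ∈ S, Good P r1 r2 r3 A B C v) → 1 ≤ A → 1 ≤ B → 1 ≤ C →
      (S.card : ℝ) ≤ K * P ^ ε * (A * B * C + Real.sqrt P) := by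
  obtain ⟨K, hK1, hK⟩ := gl_lemma 2 (Or.inl rfl) 1 ε hε
  refine ⟨64 * K, by linarith, ?_⟩
  intro P r1 r2 r3 A B C S hP h1 h2 h3 hS hA hB hC
  have hP0 : 0 < P := by linarith
  set f : Pt → ℤ × ℤ × ℤ := fun v => (v.a, v.b, v.c) with hf
  have hs : 0 ≤ Real.sqrt P := Real.sqrt_nonneg P
  have key := card_le_fiber S f (S.image f) (fun s hs => Finset.mem_image_of_mem f hs)
    (K * P ^ ε * (1 + 64 * Real.sqrt P / (A * B * C))) ?_
  · refine key.trans ?_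
    have hc : (((S.image f).card : ℕ) : ℝ) ≤ A * B * C := by
      apply box3_card _ _ _ _ (by linarith) (by linarith) (by linarith)
      intro t ht
      obtain ⟨v, hv, rfl⟩ := Finset.mem_image.mp ht
      have g := hS v hv
      exact ⟨g.a0, g.aA, g.b0, g.bB, g.c0, g.cC⟩
    calc _ ≤ (A * B * C) * (K * P ^ ε * (1 + 64 * Real.sqrt P / (A * B * C))) := by gcongr
      _ = K * P ^ ε * (A * B * C + 64 * Real.sqrt P) := by field_simp
      _ ≤ K * P ^ ε * (64 * (A * B * C + Real.sqrt P)) := by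
        have : 0 ≤ A * B * C := by positivity
        gcongr
        linarith
      _ = _ := by ring
  · intro t ht
    obtain ⟨v, hv, rfl⟩ := Finset.mem_image.mp ht
    have g := hS v hv
    obtain ⟨n1, p1, o1, d1, l1⟩ := odd_part v.a g.a0 g.sa
    obtain ⟨n2, p2, o2, d2, l2⟩ := odd_part v.b g.b0 g.sb
    obtain ⟨n3, p3, o3, d3, l3⟩ := odd_part v.c g.c0 g.sc
    have a1 := int_one_le g.a0
    have b1 := int_one_le g.b0
    have c1 := int_one_le g.c0
    have main := hK P (Real.sqrt P) (Real.sqrt P) (Real.sqrt P) (r1 * v.a ^ 3) (r2 * v.b ^ 3)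
      (r3 * v.c ^ 3) (n1 ^ 3) (n2 ^ 3) (n3 ^ 3)
      ((S.filter (fun s => f s = f v)).image (fun s => (s.x, s.y, s.z))) hP
      (mul_ne_zero h1 (pow_ne_zero _ g.a0.ne')) (mul_ne_zero h2 (pow_ne_zero _ g.b0.ne'))
      (mul_ne_zero h3 (pow_ne_zero _ g.c0.ne')) (o1.pow_left 3) (o2.pow_left 3) (o3.pow_left 3)
      (by push_cast; exact (pow_dvd_pow_of_dvd d1 3).mul_left _)
      (by push_cast; exact (pow_dvd_pow_of_dvd d2 3).mul_left _)
      (by push_cast; exact (pow_dvd_pow_of_dvd d3 3).mul_left _)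
      (by
        have := (le_of_coef (int_one_le_abs h1) (by positivity) (int_one_le g.x0) g.p1).1
        push_cast
        rwa [abs_mul, abs_of_pos (show (0 : ℝ) < (v.a : ℝ) ^ 3 by positivity), Real.rpow_one])
      (by
        have := (le_of_coef (int_one_le_abs h2) (by positivity) (int_one_le g.y0) g.p2).1
        push_cast
        rwa [abs_mul, abs_of_pos (show (0 : ℝ) < (v.b : ℝ) ^ 3 by positivity), Real.rpow_one])
      (by
        have := (le_of_coef (int_one_le_abs h3) (by positivity) (int_one_le g.z0) g.p3).1
        push_cast
        rwa [abs_mul, abs_of_pos (show (0 : ℝ) < (v.c : ℝ) ^ 3 by positivity), Real.rpow_one])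
      hs hs hs (by
        intro w hw
        obtain ⟨u, hu, rfl⟩ := Finset.mem_image.mp hw
        rw [Finset.mem_filter] at hu
        obtain ⟨hu, huf⟩ := hu
        have gu := hS u hu
        simp only [hf, Prod.mk.injEq] at huf
        obtain ⟨e1, e2, e3⟩ := huf
        have x1 := int_one_le gu.x0
        have y1 := int_one_le gu.y0
        have z1 := int_one_le gu.z0
        have a2 := int_one_le gu.a0
        have b2 := int_one_le gu.b0
        have c2 := int_one_le gu.c0
        refine ⟨gu.x0, gu.y0, gu.z0,
          le_sqrt_aux a2 (by linarith) (le_of_coef (int_one_le_abs h1) (by positivity) x1 gu.p1).2.1,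
          le_sqrt_aux b2 (by linarith) (le_of_coef (int_one_le_abs h2) (by positivity) y1 gu.p2).2.1,
          le_sqrt_aux c2 (by linarith) (le_of_coef (int_one_le_abs h3) (by positivity) z1 gu.p3).2.1,
          ?_, ?_, ?_, ?_⟩
        · rw [← e1, ← e2, ← e3]; exact gu.eq
        · have q : IsCoprime ((r1 * u.a * u.x) ^ 3) ((r2 * u.b * u.y) ^ 3) := gu.c12.pow
          rw [e1, e2] at q
          exact (q.of_isCoprime_of_dvd_left ⟨r1 ^ 2 * u.x ^ 2, by ring⟩).of_isCoprime_of_dvd_right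
            ⟨r2 ^ 2 * u.y ^ 2, by ring⟩
        · have q : IsCoprime ((r1 * u.a * u.x) ^ 3) ((r3 * u.c * u.z) ^ 3) := gu.c13.pow
          rw [e1, e3] at q
          exact (q.of_isCoprime_of_dvd_left ⟨r1 ^ 2 * u.x ^ 2, by ring⟩).of_isCoprime_of_dvd_right
            ⟨r3 ^ 2 * u.z ^ 2, by ring⟩
        · have q : IsCoprime ((r2 * u.b * u.y) ^ 3) ((r3 * u.c * u.z) ^ 3) := gu.c23.pow
          rw [e2, e3] at q
          exact (q.of_isCoprime_of_dvd_left ⟨r2 ^ 2 * u.y ^ 2, by ring⟩).of_isCoprime_of_dvd_right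
            ⟨r3 ^ 2 * u.z ^ 2, by ring⟩)
    rw [Finset.card_image_of_injOn (by
      intro u hu w hw huw
      simp only [Finset.coe_filter, Set.mem_ofPred_eq, hf, Prod.mk.injEq] at hu hw
      simp only [Prod.mk.injEq] at huw
      ext <;> omega)] at main
    refine main.trans ?_
    have l1' : A ≤ 4 * (n1 : ℝ) := by
      have : (v.a : ℝ) ≤ 2 * n1 := by exact_mod_cast l1
      linarith [g.Aa]
    have l2' : B ≤ 4 * (n2 : ℝ) := by
      have : (v.b : ℝ) ≤ 2 * n2 := by exact_mod_cast l2
      linarith [g.Bb]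
    have l3' : C ≤ 4 * (n3 : ℝ) := by
      have : (v.c : ℝ) ≤ 2 * n3 := by exact_mod_cast l3
      linarith [g.Cc]
    have := region1_aux (Real.sqrt P) A B C n1 n2 n3 hs (by linarith) (by linarith) (by linarith)
      l1' l2' l3'
    push_cast
    gcongr

/-- weight `x'^(-2/3)` with `x'` the part of `x` prime to 3 -/
noncomputable def wt3 (x : ℕ) : ℝ := ((((x / 3 ^ x.factorization 3 : ℕ) : ℝ)) ^ 2) ^ (-(1 / 3) : ℝ)

lemma wt3_nonneg (x : ℕ) : 0 ≤ wt3 x := by unfold wt3; positivity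

lemma wt3_mul (y : ℕ) (hy : 0 < y) : wt3 (3 * y) = wt3 y := by
  unfold wt3
  have : 3 * y / 3 ^ (3 * y).factorization 3 = y / 3 ^ y.factorization 3 := by
    rw [Nat.factorization_mul (by norm_num) hy.ne']
    simp only [Finsupp.add_apply, Nat.Prime.factorization_self Nat.prime_three]
    rw [add_comm, pow_succ, mul_comm (3 ^ _) 3]
    exact Nat.mul_div_mul_left _ _ (by norm_num)
  rw [this]

lemma wt3_of_not_dvd (x : ℕ) (h : ¬ 3 ∣ x) : wt3 x = ((x : ℝ) ^ 2) ^ (-(1 / 3) : ℝ) := by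
  unfold wt3
  rw [Nat.factorization_eq_zero_of_not_dvd h]
  simp

lemma rpow_third_step (n : ℕ) :
    3 * (n : ℝ) ^ (1 / 3 : ℝ) + (((n + 1 : ℕ) : ℝ) ^ 2) ^ (-(1 / 3) : ℝ) ≤
      3 * ((n + 1 : ℕ) : ℝ) ^ (1 / 3 : ℝ) := by
  set u : ℝ := (n : ℝ) ^ (1 / 3 : ℝ) with hu
  set w : ℝ := ((n + 1 : ℕ) : ℝ) ^ (1 / 3 : ℝ) with hw
  have hu0 : 0 ≤ u := by positivity
  have hw0 : 0 < w := by positivity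
  have hu3 : u ^ 3 = n := by
    rw [hu, ← Real.rpow_natCast, ← Real.rpow_mul (by positivity)]; norm_num
  have hw3 : w ^ 3 = (n : ℝ) + 1 := by
    rw [hw, ← Real.rpow_natCast, ← Real.rpow_mul (by positivity)]; norm_num
  have e : (((n + 1 : ℕ) : ℝ) ^ 2) ^ (-(1 / 3) : ℝ) = (w ^ 2)⁻¹ := by
    rw [Real.rpow_neg (by positivity), hw, ← Real.rpow_natCast, ← Real.rpow_natCast,
      ← Real.rpow_mul (by positivity), ← Real.rpow_mul (by positivity)]
    norm_num
  rw [e]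
  have h2 : u ≤ w := by
    by_contra hc
    push Not at hc
    have := pow_lt_pow_left₀ hc hw0.le (show 3 ≠ 0 by norm_num)
    linarith
  have h1 : (w - u) * (w ^ 2 + w * u + u ^ 2) = 1 := by ring_nf; linarith
  have h3 : w ^ 2 + w * u + u ^ 2 ≤ 3 * w ^ 2 := by nlinarith
  have h4 : 1 ≤ (w - u) * (3 * w ^ 2) := by
    rw [← h1]
    exact mul_le_mul_of_nonneg_left h3 (by linarith)
  have h5 : (w ^ 2)⁻¹ ≤ 3 * (w - u) := by
    rw [inv_le_iff_one_le_mul₀ (by positivity)]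
    linarith
  linarith

lemma sum_third (N : ℕ) :
    ∑ x ∈ Finset.Icc 1 N, ((x : ℝ) ^ 2) ^ (-(1 / 3) : ℝ) ≤ 3 * (N : ℝ) ^ (1 / 3 : ℝ) := by
  induction N with
  | zero => simp
  | succ n ih =>
    rw [Finset.sum_Icc_succ_top (by omega)]
    have := rpow_third_step n
    linarith

lemma sum_wt3_rec (N : ℕ) : ∑ x ∈ Finset.Icc 1 N, wt3 x ≤
    ∑ x ∈ Finset.Icc 1 N, ((x : ℝ) ^ 2) ^ (-(1 / 3) : ℝ) + ∑ y ∈ Finset.Icc 1 (N / 3), wt3 y := by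
  rw [← Finset.sum_filter_add_sum_filter_not (Finset.Icc 1 N) (fun x => ¬ 3 ∣ x)]
  refine add_le_add ?_ ?_
  · calc _ = ∑ x ∈ (Finset.Icc 1 N).filter (fun x => ¬ 3 ∣ x), ((x : ℝ) ^ 2) ^ (-(1 / 3) : ℝ) := by
          apply Finset.sum_congr rfl
          intro x hx
          exact wt3_of_not_dvd x (Finset.mem_filter.mp hx).2
      _ ≤ _ := Finset.sum_le_sum_of_subset_of_nonneg (Finset.filter_subset _ _)
          (fun _ _ _ => by positivity)
  · have : (Finset.Icc 1 N).filter (fun x => ¬ ¬ 3 ∣ x) = (Finset.Icc 1 (N / 3)).image (fun y => 3 * y) := by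
      ext x
      simp only [not_not, Finset.mem_filter, Finset.mem_Icc, Finset.mem_image]
      constructor
      · rintro ⟨⟨h1, h2⟩, ⟨k, hk⟩⟩
        exact ⟨k, by omega, by omega⟩
      · rintro ⟨y, hy, rfl⟩
        omega
    rw [this, Finset.sum_image (by intro a _ b _ h; simpa using h)]
    apply le_of_eq
    apply Finset.sum_congr rfl
    intro y hy
    exact wt3_mul y (Finset.mem_Icc.mp hy).1

lemma sum_wt3 (N : ℕ) : ∑ x ∈ Finset.Icc 1 N, wt3 x ≤ 12 * (N : ℝ) ^ (1 / 3 : ℝ) := by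
  induction N using Nat.strong_induction_on with
  | _ N ih =>
    rcases Nat.eq_zero_or_pos N with rfl | hN
    · simp
    have h1 := sum_wt3_rec N
    have h2 := sum_third N
    have h3 := ih (N / 3) (Nat.div_lt_self hN (by norm_num))
    have h4 : ((N / 3 : ℕ) : ℝ) ^ (1 / 3 : ℝ) ≤ (3 / 4) * (N : ℝ) ^ (1 / 3 : ℝ) := by
      have e : (3 / 4 : ℝ) = ((27 / 64 : ℝ)) ^ (1 / 3 : ℝ) := by
        rw [show (27 / 64 : ℝ) = (3 / 4) ^ (3 : ℕ) by norm_num, ← Real.rpow_natCast,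
          ← Real.rpow_mul (by positivity)]
        norm_num
      rw [e, ← Real.mul_rpow (by positivity) (by positivity)]
      apply Real.rpow_le_rpow (by positivity) _ (by positivity)
      have : ((N / 3 : ℕ) : ℝ) ≤ N / 3 := Nat.cast_div_le
      have : (0 : ℝ) ≤ N := by positivity
      linarith
    linarith

lemma sum_wt3_prod (X Y Z E : ℝ) (hX : 0 ≤ X) (hY : 0 ≤ Y) (hZ : 0 ≤ Z) (hE : 0 ≤ E) :
    ∑ t ∈ Finset.Icc 1 ⌊X⌋₊ ×ˢ (Finset.Icc 1 ⌊Y⌋₊ ×ˢ Finset.Icc 1 ⌊Z⌋₊),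
      (1 + E * (wt3 t.1 * (wt3 t.2.1 * wt3 t.2.2))) ≤
      X * Y * Z + 1728 * E * (X * Y * Z) ^ (1 / 3 : ℝ) := by
  rw [Finset.sum_add_distrib, ← Finset.mul_sum]
  have k : ∀ D : ℝ, 0 ≤ D → ∑ x ∈ Finset.Icc 1 ⌊D⌋₊, wt3 x ≤ 12 * D ^ (1 / 3 : ℝ) := by
    intro D hD
    refine (sum_wt3 _).trans ?_
    gcongr
    exact Nat.floor_le hD
  have k0 : ∀ D : ℝ, 0 ≤ ∑ x ∈ Finset.Icc 1 ⌊D⌋₊, wt3 x := fun D =>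
    Finset.sum_nonneg (fun x _ => wt3_nonneg x)
  refine add_le_add ?_ ?_
  · simp only [Finset.sum_const, Finset.card_product, Nat.card_Icc, nsmul_eq_mul, mul_one,
      Nat.add_sub_cancel]
    push_cast
    rw [mul_assoc]
    have := Nat.floor_le hX
    have := Nat.floor_le hY
    have := Nat.floor_le hZ
    gcongr
  · have e : ∑ t ∈ Finset.Icc 1 ⌊X⌋₊ ×ˢ (Finset.Icc 1 ⌊Y⌋₊ ×ˢ Finset.Icc 1 ⌊Z⌋₊),
        (wt3 t.1 * (wt3 t.2.1 * wt3 t.2.2)) = (∑ x ∈ Finset.Icc 1 ⌊X⌋₊, wt3 x) *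
        ((∑ x ∈ Finset.Icc 1 ⌊Y⌋₊, wt3 x) * (∑ x ∈ Finset.Icc 1 ⌊Z⌋₊, wt3 x)) := by
      rw [Finset.sum_mul_sum, Finset.sum_mul_sum, ← Finset.sum_product']
      simp only [Finset.mul_sum, Finset.sum_product]
    rw [e, Real.mul_rpow (by positivity) hZ, Real.mul_rpow hX hY]
    have := k X hX
    have := k Y hY
    have := k Z hZ
    have := k0 X
    have := k0 Y
    have := k0 Z
    calc _ ≤ E * ((12 * X ^ (1 / 3 : ℝ)) * ((12 * Y ^ (1 / 3 : ℝ)) * (12 * Z ^ (1 / 3 : ℝ)))) := by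
          gcongr
      _ = _ := by ring

lemma xbound {a x P A : ℝ} (hA : 0 < A) (hAa : A ≤ 2 * a) (hP : 0 ≤ P) (hx : 0 ≤ x)
    (h : a ^ 3 * x ^ 2 ≤ P) : x ≤ 3 * Real.sqrt P / Real.sqrt A ^ 3 := by
  have hs : 0 < Real.sqrt A := Real.sqrt_pos.mpr hA
  rw [le_div_iff₀ (by positivity)]
  apply le_of_sq_le_sq _ (by positivity)
  have h1 : Real.sqrt A ^ 2 = A := Real.sq_sqrt hA.le
  have h2 : Real.sqrt P ^ 2 = P := Real.sq_sqrt hP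
  calc (x * Real.sqrt A ^ 3) ^ 2 = x ^ 2 * (Real.sqrt A ^ 2) ^ 3 := by ring
    _ = x ^ 2 * A ^ 3 := by rw [h1]
    _ ≤ x ^ 2 * (2 * a) ^ 3 := by gcongr
    _ = 8 * (a ^ 3 * x ^ 2) := by ring
    _ ≤ 9 * P := by linarith
    _ = (3 * Real.sqrt P) ^ 2 := by rw [mul_pow, h2]; norm_num

lemma region2 (ε : ℝ) (hε : 0 < ε) : ∃ K : ℝ, 1 ≤ K ∧
    ∀ (P : ℝ) (r1 r2 r3 : ℤ) (A B C : ℝ) (S : Finset Pt), 1 ≤ P → r1 ≠ 0 → r2 ≠ 0 → r3 ≠ 0 →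
      (∀ v ∈ S, Good P r1 r2 r3 A B C v) → 1 ≤ A → 1 ≤ B → 1 ≤ C →
      (S.card : ℝ) ≤ K * P ^ ε * (Real.sqrt P ^ 3 / Real.sqrt (A * B * C) ^ 3 + Real.sqrt P) := by
  obtain ⟨K, hK1, hK⟩ := gl_lemma 3 (Or.inr rfl) 1 ε hε
  refine ⟨6000 * K, by linarith, ?_⟩
  intro P r1 r2 r3 A B C S hP h1 h2 h3 hS hA hB hC
  have hP0 : 0 < P := by linarith
  have hA0 : 0 < A := by linarith
  have hB0 : 0 < B := by linarith
  have hC0 : 0 < C := by linarith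
  set X := 3 * Real.sqrt P / Real.sqrt A ^ 3 with hX
  set Y := 3 * Real.sqrt P / Real.sqrt B ^ 3 with hY
  set Z := 3 * Real.sqrt P / Real.sqrt C ^ 3 with hZ
  have hs : 0 < Real.sqrt P := Real.sqrt_pos.mpr hP0
  have hX0 : 0 ≤ X := by positivity
  have hY0 : 0 ≤ Y := by positivity
  have hZ0 : 0 ≤ Z := by positivity
  set f : Pt → ℕ × ℕ × ℕ := fun v => (v.x.toNat, v.y.toNat, v.z.toNat) with hf
  set E : ℝ := (A * B * C) ^ (1 / 3 : ℝ) with hE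
  have key := card_le_fiber_sum S f (Finset.Icc 1 ⌊X⌋₊ ×ˢ (Finset.Icc 1 ⌊Y⌋₊ ×ˢ Finset.Icc 1 ⌊Z⌋₊))
    ?_ (fun t => K * P ^ ε * (1 + E * (wt3 t.1 * (wt3 t.2.1 * wt3 t.2.2)))) ?_
  · rw [← Finset.mul_sum] at key
    have k2 := sum_wt3_prod X Y Z E hX0 hY0 hZ0 (by positivity)
    have e1 : X * Y * Z = 27 * (Real.sqrt P ^ 3 / Real.sqrt (A * B * C) ^ 3) := by
      rw [hX, hY, hZ, Real.sqrt_mul (by positivity), Real.sqrt_mul (by positivity)]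
      have := Real.sqrt_pos.mpr hA0
      have := Real.sqrt_pos.mpr hB0
      have := Real.sqrt_pos.mpr hC0
      field_simp
      ring
    have e2 : E * (X * Y * Z) ^ (1 / 3 : ℝ) ≤ 3 * Real.sqrt P := by
      rw [hE, ← Real.mul_rpow (by positivity) (by positivity)]
      have : 3 * Real.sqrt P = ((3 * Real.sqrt P) ^ (3 : ℕ)) ^ (1 / 3 : ℝ) := by
        rw [← Real.rpow_natCast, ← Real.rpow_mul (by positivity)]
        norm_num
      rw [this]
      apply Real.rpow_le_rpow (by positivity) _ (by positivity)
      rw [e1]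
      have hQ : 1 ≤ A * B * C := one_le_mul_of_one_le_of_one_le (one_le_mul_of_one_le_of_one_le hA hB) hC
      have hq : 1 ≤ Real.sqrt (A * B * C) := Real.one_le_sqrt.mpr hQ
      set q := Real.sqrt (A * B * C) with hqd
      have hqq : A * B * C = q ^ 2 := (Real.sq_sqrt (by positivity)).symm
      rw [hqq]
      calc q ^ 2 * (27 * (Real.sqrt P ^ 3 / q ^ 3)) = 27 * Real.sqrt P ^ 3 / q := by
            field_simp
        _ ≤ 27 * Real.sqrt P ^ 3 := div_le_self (by positivity) hq
        _ = _ := by ring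
    refine key.trans ?_
    calc _ ≤ K * P ^ ε * (X * Y * Z + 1728 * E * (X * Y * Z) ^ (1 / 3 : ℝ)) := by gcongr
      _ ≤ K * P ^ ε * (6000 * (Real.sqrt P ^ 3 / Real.sqrt (A * B * C) ^ 3 + Real.sqrt P)) := by
        have : 0 ≤ Real.sqrt P ^ 3 / Real.sqrt (A * B * C) ^ 3 := by positivity
        gcongr
        rw [mul_assoc 1728]
        rw [e1] at e2 ⊢
        linarith
      _ = _ := by ring
  · intro v hv
    have g := hS v hv
    have a1 := int_one_le g.a0
    have b1 := int_one_le g.b0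
    have c1 := int_one_le g.c0
    have x1 := int_one_le g.x0
    have y1 := int_one_le g.y0
    have z1 := int_one_le g.z0
    have q1 := xbound hA0 g.Aa hP0.le (by linarith)
      (le_of_coef (int_one_le_abs h1) (by positivity) x1 g.p1).2.1
    have q2 := xbound hB0 g.Bb hP0.le (by linarith)
      (le_of_coef (int_one_le_abs h2) (by positivity) y1 g.p2).2.1
    have q3 := xbound hC0 g.Cc hP0.le (by linarith)
      (le_of_coef (int_one_le_abs h3) (by positivity) z1 g.p3).2.1
    have hc : ∀ (n : ℤ) (D : ℝ), 0 < n → (n : ℝ) ≤ D → 1 ≤ n.toNat ∧ n.toNat ≤ ⌊D⌋₊ := by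
      intro n D hn hD
      refine ⟨by omega, Nat.le_floor ?_⟩
      have : ((n.toNat : ℤ) : ℝ) = n := by rw [Int.toNat_of_nonneg hn.le]
      have h' : ((n.toNat : ℕ) : ℝ) = n := by exact_mod_cast this
      rw [h']; exact hD
    simp only [hf, Finset.mem_product, Finset.mem_Icc]
    exact ⟨hc _ _ g.x0 q1, hc _ _ g.y0 q2, hc _ _ g.z0 q3⟩
  · rintro ⟨x, y, z⟩ ht
    simp only [Finset.mem_product, Finset.mem_Icc] at ht
    obtain ⟨⟨x1, -⟩, ⟨y1, -⟩, ⟨z1, -⟩⟩ := ht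
    rcases (S.filter (fun s => f s = (x, y, z))).eq_empty_or_nonempty with he | ⟨v, hv⟩
    · rw [he]
      have := wt3_nonneg x
      have := wt3_nonneg y
      have := wt3_nonneg z
      simp only [Finset.card_empty, Nat.cast_zero]
      positivity
    rw [Finset.mem_filter] at hv
    obtain ⟨hv, hvf⟩ := hv
    have g := hS v hv
    have gx := g.x0
    have gy := g.y0
    have gz := g.z0
    simp only [hf, Prod.mk.injEq] at hvf
    obtain ⟨vx, vy, vz⟩ := hvf
    have vx' : v.x = x := by omega
    have vy' : v.y = y := by omega
    have vz' : v.z = z := by omega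
    have p3 := Nat.prime_three
    have hdv : ∀ n : ℕ, ((n / 3 ^ n.factorization 3 : ℕ) : ℤ) ∣ (n : ℤ) := fun n =>
      Int.natCast_dvd_natCast.mpr (Nat.ordCompl_dvd n 3)
    have hcop : ∀ n : ℕ, 1 ≤ n → ((n / 3 ^ n.factorization 3) ^ 2).Coprime 3 := fun n hn =>
      (Nat.coprime_ordCompl p3 (by omega)).symm.pow_left 2
    have x1' : (1 : ℝ) ≤ x := by exact_mod_cast x1
    have y1' : (1 : ℝ) ≤ y := by exact_mod_cast y1
    have z1' : (1 : ℝ) ≤ z := by exact_mod_cast z1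
    have bnd : ∀ (r a : ℤ) (x : ℕ), 0 < a → 1 ≤ x → |(r : ℝ)| * (a : ℝ) ^ 3 * (x : ℝ) ^ 2 ≤ P →
        |((r * (x : ℤ) ^ 2 : ℤ) : ℝ)| ≤ P ^ (1 : ℝ) := by
      intro r a x ha hx h
      push_cast
      have hx' : (0 : ℝ) < (x : ℝ) ^ 2 := by positivity
      rw [abs_mul, abs_of_pos hx', Real.rpow_one]
      refine le_trans ?_ h
      have := one_le_pow₀ (n := 3) (int_one_le ha)
      calc |(r : ℝ)| * (x : ℝ) ^ 2 = |(r : ℝ)| * 1 * (x : ℝ) ^ 2 := by ring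
        _ ≤ _ := by gcongr
    have main := hK P A B C (r1 * (x : ℤ) ^ 2) (r2 * (y : ℤ) ^ 2) (r3 * (z : ℤ) ^ 2)
      ((x / 3 ^ x.factorization 3) ^ 2) ((y / 3 ^ y.factorization 3) ^ 2)
      ((z / 3 ^ z.factorization 3) ^ 2)
      ((S.filter (fun s => f s = (x, y, z))).image (fun s => (s.a, s.b, s.c))) hP
      (mul_ne_zero h1 (by positivity)) (mul_ne_zero h2 (by positivity))
      (mul_ne_zero h3 (by positivity)) (hcop x x1) (hcop y y1) (hcop z z1)
      (by rw [Nat.cast_pow]; exact (pow_dvd_pow_of_dvd (hdv x) 2).mul_left _)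
      (by rw [Nat.cast_pow]; exact (pow_dvd_pow_of_dvd (hdv y) 2).mul_left _)
      (by rw [Nat.cast_pow]; exact (pow_dvd_pow_of_dvd (hdv z) 2).mul_left _)
      (bnd r1 v.a x g.a0 x1 (by have := g.p1; rw [vx'] at this; exact_mod_cast this))
      (bnd r2 v.b y g.b0 y1 (by have := g.p2; rw [vy'] at this; exact_mod_cast this))
      (bnd r3 v.c z g.c0 z1 (by have := g.p3; rw [vz'] at this; exact_mod_cast this))
      hA0.le hB0.le hC0.le (by
        intro w hw
        obtain ⟨u, hu, rfl⟩ := Finset.mem_image.mp hw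
        rw [Finset.mem_filter] at hu
        obtain ⟨hu, huf⟩ := hu
        have gu := hS u hu
        have gx := gu.x0
        have gy := gu.y0
        have gz := gu.z0
        simp only [hf, Prod.mk.injEq] at huf
        obtain ⟨e1, e2, e3⟩ := huf
        have e1' : u.x = x := by omega
        have e2' : u.y = y := by omega
        have e3' : u.z = z := by omega
        rw [← e1', ← e2', ← e3']
        refine ⟨gu.a0, gu.b0, gu.c0, gu.aA, gu.bB, gu.cC, ?_, ?_, ?_, ?_⟩
        · have := gu.eq; simp only; linarith
        · exact (gu.c12.pow (m := 2) (n := 2)).of_isCoprime_of_dvd_left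
            ⟨r1 * u.a, by ring⟩ |>.of_isCoprime_of_dvd_right ⟨r2 * u.b, by ring⟩
        · exact (gu.c13.pow (m := 2) (n := 2)).of_isCoprime_of_dvd_left
            ⟨r1 * u.a, by ring⟩ |>.of_isCoprime_of_dvd_right ⟨r3 * u.c, by ring⟩
        · exact (gu.c23.pow (m := 2) (n := 2)).of_isCoprime_of_dvd_left
            ⟨r2 * u.b, by ring⟩ |>.of_isCoprime_of_dvd_right ⟨r3 * u.c, by ring⟩)
    rw [Finset.card_image_of_injOn (by
      intro u hu w hw huw
      simp only [Finset.coe_filter, Set.mem_ofPred_eq, hf, Prod.mk.injEq] at hu hw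
      simp only [Prod.mk.injEq] at huw
      have := (hS u hu.1).x0
      have := (hS u hu.1).y0
      have := (hS u hu.1).z0
      ext <;> omega)] at main
    refine main.trans (le_of_eq ?_)
    have ew : ∀ n : ℕ, wt3 n = ((((n / 3 ^ n.factorization 3) ^ 2 : ℕ) : ℝ) ^ (1 / 3 : ℝ))⁻¹ := by
      intro n
      unfold wt3
      rw [Real.rpow_neg (by positivity), Nat.cast_pow]
    have efin : ∀ n1 n2 n3 : ℝ, 0 ≤ n1 → 0 ≤ n2 → 0 ≤ n3 → (A * B * C / (n1 * n2 * n3)) ^ (1 / 3 : ℝ)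
        = E * ((n1 ^ (1 / 3 : ℝ))⁻¹ * ((n2 ^ (1 / 3 : ℝ))⁻¹ * (n3 ^ (1 / 3 : ℝ))⁻¹)) := by
      intro n1 n2 n3 k1 k2 k3
      rw [Real.div_rpow (by positivity) (by positivity), Real.mul_rpow (mul_nonneg k1 k2) k3,
        Real.mul_rpow k1 k2, div_eq_mul_inv, mul_inv, mul_inv, mul_assoc _ _ _⁻¹]
    rw [ew, ew, ew, efin _ _ _ (by positivity) (by positivity) (by positivity)]

/-- The data of a slice: `t` is the common parameter. -/
structure Slice (m ρ t0 : ℤ) (t : Pt → ℤ) (v : Pt) : Prop where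
  b0 : 0 < v.b
  c0 : 0 < v.c
  y0 : 0 < v.y
  z0 : 0 < v.z
  bc : IsCoprime v.b v.c
  yz : IsCoprime v.y v.z
  h1 : m ^ 3 ∣ v.c - ρ * t v ^ 2 * v.b
  h2 : m ^ 3 ∣ v.y - ρ * t v ^ 3 * v.z
  ht : m ∣ t v - t0
  mb : IsCoprime m v.b
  mz : IsCoprime m v.z
  mt : IsCoprime m (t v)

lemma exists_inv_mod (m k w : ℤ) (h : IsCoprime m w) : ∃ t : ℤ, m ∣ t * w - k := by
  obtain ⟨u, v, huv⟩ := h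
  exact ⟨k * v, ⟨-k * u, by linear_combination k * huv⟩⟩

lemma slice_exists {P : ℝ} {r1 r2 r3 : ℤ} {A B C : ℝ} {v : Pt} (g : Good P r1 r2 r3 A B C v)
    (m ρ : ℤ) (hm : m ∣ v.a) (hρ : m ^ 3 ∣ ρ * r3 + r2) :
    ∃ t : ℤ, m ^ 3 ∣ v.c - ρ * t ^ 2 * v.b ∧ m ^ 3 ∣ v.y - ρ * t ^ 3 * v.z ∧ IsCoprime m t ∧
      IsCoprime m v.b ∧ IsCoprime m v.z ∧ IsCoprime m ρ ∧ IsCoprime m r3 := by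
  have q12 : IsCoprime m (r2 * v.b * v.y) :=
    (g.c12.of_mul_left_left.of_mul_left_right).of_isCoprime_of_dvd_left hm
  have q13 : IsCoprime m (r3 * v.c * v.z) :=
    (g.c13.of_mul_left_left.of_mul_left_right).of_isCoprime_of_dvd_left hm
  have mr2 : IsCoprime m r2 := q12.of_mul_right_left.of_mul_right_left
  have mb : IsCoprime m v.b := q12.of_mul_right_left.of_mul_right_right
  have my : IsCoprime m v.y := q12.of_mul_right_right
  have mr3 : IsCoprime m r3 := q13.of_mul_right_left.of_mul_right_left
  have mc : IsCoprime m v.c := q13.of_mul_right_left.of_mul_right_right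
  have mz : IsCoprime m v.z := q13.of_mul_right_right
  have mzc : IsCoprime (m ^ 3) (v.z * v.c) := (mz.mul_right mc).pow_left
  obtain ⟨t, ht⟩ := exists_inv_mod (m ^ 3) (v.y * v.b) (v.z * v.c) mzc
  have hm3 : m ^ 3 ∣ v.a ^ 3 := pow_dvd_pow_of_dvd hm 3
  obtain ⟨k1, e1⟩ := ht
  obtain ⟨k2, e2⟩ := hm3
  obtain ⟨k3, e3⟩ := hρ
  have E := g.eq
  rw [e2] at E
  refine ⟨t, ?_, ?_, ?_, mb, mz, ?_, mr3⟩
  · have hu : IsCoprime (m ^ 3) (r3 * v.z ^ 2 * v.c ^ 2) :=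
      ((mr3.mul_right mz.pow_right).mul_right mc.pow_right).pow_left
    apply hu.dvd_of_dvd_mul_left
    refine ⟨- r1 * k2 * v.x ^ 2 - k3 * (t * (v.z * v.c)) ^ 2 * v.b
      + r2 * v.b * k1 * (t * (v.z * v.c) + v.y * v.b), ?_⟩
    linear_combination E + r2 * v.b * (t * (v.z * v.c) + v.y * v.b) * e1 -
      (t * (v.z * v.c)) ^ 2 * v.b * e3
  · have hu : IsCoprime (m ^ 3) (r3 * v.z ^ 2 * v.c ^ 3) :=
      ((mr3.mul_right mz.pow_right).mul_right mc.pow_right).pow_left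
    apply hu.dvd_of_dvd_mul_left
    refine ⟨- r1 * k2 * v.x ^ 2 * v.y - k3 * (t * (v.z * v.c)) ^ 3
      + r2 * k1 * ((t * (v.z * v.c)) ^ 2 + (t * (v.z * v.c)) * (v.y * v.b) + (v.y * v.b) ^ 2), ?_⟩
    linear_combination v.y * E + r2 * ((t * (v.z * v.c)) ^ 2 + (t * (v.z * v.c)) * (v.y * v.b)
      + (v.y * v.b) ^ 2) * e1 - (t * (v.z * v.c)) ^ 3 * e3
  · obtain ⟨u, w, huw⟩ := my.mul_right mb
    exact ⟨u - w * m ^ 2 * k1, w * (v.z * v.c), by linear_combination huw + w * e1⟩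
  · obtain ⟨u, w, huw⟩ := mr2
    exact ⟨u + w * m ^ 2 * k3, - w * r3, by linear_combination huw - w * e3⟩

/-- forward Taylor -/
lemma taylor_fwd (m U P V R Q t0 t : ℤ) (ht : m ∣ t - t0)
    (h0 : m ^ 3 ∣ U * t0 ^ 5 + P * t0 ^ 3 + V * t0 ^ 2 + R * t0 + Q)
    (h1 : m ^ 2 ∣ 5 * U * t0 ^ 4 + 3 * P * t0 ^ 2 + 2 * V * t0 + R)
    (h2 : m ∣ 10 * U * t0 ^ 3 + 3 * P * t0 + V) :
    m ^ 3 ∣ U * t ^ 5 + P * t ^ 3 + V * t ^ 2 + R * t + Q := by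
  obtain ⟨s, hs⟩ := ht
  obtain ⟨k0, e0⟩ := h0
  obtain ⟨k1, e1⟩ := h1
  obtain ⟨k2, e2⟩ := h2
  have : t = t0 + m * s := by linarith
  subst this
  refine ⟨k0 + k1 * s + k2 * s ^ 2 + (U * (10 * t0 ^ 2 * s ^ 3 + 5 * t0 * m * s ^ 4 + m ^ 2 * s ^ 5)
    + P * s ^ 3), ?_⟩
  linear_combination e0 + m * s * e1 + m ^ 2 * s ^ 2 * e2

lemma three_roots_aux (p : ℤ) (hp : Prime p) (c0 c1 c2 s1 s2 s3 : ℤ)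
    (d12 : ¬ p ∣ s1 - s2) (d13 : ¬ p ∣ s1 - s3) (d23 : ¬ p ∣ s2 - s3)
    (h1 : p ^ 3 ∣ c0 + c1 * (p * s1) + c2 * (p * s1) ^ 2)
    (h2 : p ^ 3 ∣ c0 + c1 * (p * s2) + c2 * (p * s2) ^ 2)
    (h3 : p ^ 3 ∣ c0 + c1 * (p * s3) + c2 * (p * s3) ^ 2) :
    p ^ 3 ∣ c0 ∧ p ^ 2 ∣ c1 ∧ p ∣ c2 := by
  have hp0 : p ≠ 0 := hp.ne_zero
  have cop : ∀ w : ℤ, ¬ p ∣ w → ∀ n : ℕ, IsCoprime (p ^ n) w := fun w hw n =>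
    ((Prime.coprime_iff_not_dvd hp).mpr hw).pow_left
  have step : ∀ s s' : ℤ, ¬ p ∣ s - s' → p ^ 3 ∣ c0 + c1 * (p * s) + c2 * (p * s) ^ 2 →
      p ^ 3 ∣ c0 + c1 * (p * s') + c2 * (p * s') ^ 2 → p ^ 2 ∣ c1 + c2 * p * (s + s') := by
    intro s s' hd ha hb
    have := dvd_sub ha hb
    have e : c0 + c1 * (p * s) + c2 * (p * s) ^ 2 - (c0 + c1 * (p * s') + c2 * (p * s') ^ 2) =
      p * ((s - s') * (c1 + c2 * p * (s + s'))) := by ring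
    rw [e, show p ^ 3 = p * p ^ 2 by ring, mul_dvd_mul_iff_left hp0] at this
    exact (cop _ hd 2).dvd_of_dvd_mul_left this
  have a1 := step s1 s2 d12 h1 h2
  have a2 := step s1 s3 d13 h1 h3
  have hc2 : p ∣ c2 := by
    have := dvd_sub a1 a2
    have e : c1 + c2 * p * (s1 + s2) - (c1 + c2 * p * (s1 + s3)) = p * ((s2 - s3) * c2) := by ring
    rw [e, show p ^ 2 = p * p by ring, mul_dvd_mul_iff_left hp0] at this
    exact (hp.dvd_or_dvd this).resolve_left d23
  obtain ⟨k, hk⟩ := hc2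
  have hc1 : p ^ 2 ∣ c1 := by
    have : c1 = c1 + c2 * p * (s1 + s2) - p ^ 2 * (k * (s1 + s2)) := by rw [hk]; ring
    rw [this]
    exact dvd_sub a1 (dvd_mul_right _ _)
  refine ⟨?_, hc1, ⟨k, hk⟩⟩
  obtain ⟨j, hj⟩ := hc1
  have : c0 = c0 + c1 * (p * s1) + c2 * (p * s1) ^ 2 - p ^ 3 * (j * s1 + k * s1 ^ 2) := by
    rw [hj, hk]; ring
  rw [this]
  exact dvd_sub h1 (dvd_mul_right _ _)

lemma three_roots (p : ℤ) (hp : Prime p) (U P V R Q t0 t1 t2 t3 : ℤ)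
    (k1 : p ∣ t1 - t0) (k2 : p ∣ t2 - t0) (k3 : p ∣ t3 - t0)
    (d12 : ¬ p ^ 2 ∣ t1 - t2) (d13 : ¬ p ^ 2 ∣ t1 - t3) (d23 : ¬ p ^ 2 ∣ t2 - t3)
    (h1 : p ^ 3 ∣ U * t1 ^ 5 + P * t1 ^ 3 + V * t1 ^ 2 + R * t1 + Q)
    (h2 : p ^ 3 ∣ U * t2 ^ 5 + P * t2 ^ 3 + V * t2 ^ 2 + R * t2 + Q)
    (h3 : p ^ 3 ∣ U * t3 ^ 5 + P * t3 ^ 3 + V * t3 ^ 2 + R * t3 + Q) :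
    p ^ 3 ∣ U * t0 ^ 5 + P * t0 ^ 3 + V * t0 ^ 2 + R * t0 + Q ∧
    p ^ 2 ∣ 5 * U * t0 ^ 4 + 3 * P * t0 ^ 2 + 2 * V * t0 + R ∧
    p ∣ 10 * U * t0 ^ 3 + 3 * P * t0 + V := by
  obtain ⟨s1, e1⟩ := k1
  obtain ⟨s2, e2⟩ := k2
  obtain ⟨s3, e3⟩ := k3
  have f1 : t1 = t0 + p * s1 := by linarith
  have f2 : t2 = t0 + p * s2 := by linarith
  have f3 : t3 = t0 + p * s3 := by linarith
  subst f1 f2 f3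
  have nd : ∀ s s' : ℤ, ¬ p ^ 2 ∣ (t0 + p * s) - (t0 + p * s') → ¬ p ∣ s - s' := by
    rintro s s' h ⟨k, hk⟩
    exact h ⟨k, by linear_combination p * hk⟩
  have tr : ∀ s : ℤ, p ^ 3 ∣ U * (t0 + p * s) ^ 5 + P * (t0 + p * s) ^ 3 + V * (t0 + p * s) ^ 2
      + R * (t0 + p * s) + Q → p ^ 3 ∣ (U * t0 ^ 5 + P * t0 ^ 3 + V * t0 ^ 2 + R * t0 + Q) +
      (5 * U * t0 ^ 4 + 3 * P * t0 ^ 2 + 2 * V * t0 + R) * (p * s) +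
      (10 * U * t0 ^ 3 + 3 * P * t0 + V) * (p * s) ^ 2 := by
    rintro s ⟨k, hk⟩
    exact ⟨k - (U * (10 * t0 ^ 2 * s ^ 3 + 5 * t0 * p * s ^ 4 + p ^ 2 * s ^ 5) + P * s ^ 3),
      by linear_combination hk⟩
  exact three_roots_aux p hp _ _ _ s1 s2 s3 (nd _ _ d12) (nd _ _ d13) (nd _ _ d23)
    (tr _ h1) (tr _ h2) (tr _ h3)

/-- `t` determined by its cube -/
lemma t_of_cube (m t1 t2 t0 : ℤ) (h3 : IsCoprime m 3) (h1 : m ∣ t1 - t0) (h2 : m ∣ t2 - t0)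
    (hc : IsCoprime m t1) (h : m ^ 3 ∣ t1 ^ 3 - t2 ^ 3) : m ^ 3 ∣ t1 - t2 := by
  have hd : m ∣ t2 - t1 := by
    have := dvd_sub h2 h1
    rwa [show t2 - t0 - (t1 - t0) = t2 - t1 by ring] at this
  obtain ⟨k, hk⟩ := hd
  have : IsCoprime (m ^ 3) (t1 ^ 2 + t1 * t2 + t2 ^ 2) := by
    apply IsCoprime.pow_left
    have e : t1 ^ 2 + t1 * t2 + t2 ^ 2 = 3 * t1 ^ 2 + m * (k * (t1 + t1 + (m * k) + t1)) := by
      have : t2 = t1 + m * k := by linarith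
      rw [this]; ring
    rw [e]
    exact (h3.mul_right hc.pow_right).add_mul_left_right _
  apply this.dvd_of_dvd_mul_right
  rwa [show (t1 - t2) * (t1 ^ 2 + t1 * t2 + t2 ^ 2) = t1 ^ 3 - t2 ^ 3 by ring]

lemma t_of_sq (m t1 t2 t0 : ℤ) (h3 : IsCoprime m 2) (h1 : m ∣ t1 - t0) (h2 : m ∣ t2 - t0)
    (hc : IsCoprime m t1) (h : m ^ 3 ∣ t1 ^ 2 - t2 ^ 2) : m ^ 3 ∣ t1 - t2 := by
  have hd : m ∣ t2 - t1 := by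
    have := dvd_sub h2 h1
    rwa [show t2 - t0 - (t1 - t0) = t2 - t1 by ring] at this
  obtain ⟨k, hk⟩ := hd
  have : IsCoprime (m ^ 3) (t1 + t2) := by
    apply IsCoprime.pow_left
    have e : t1 + t2 = 2 * t1 + m * k := by linarith
    rw [e]
    exact (h3.mul_right hc).add_mul_left_right _
  apply this.dvd_of_dvd_mul_right
  rwa [show (t1 - t2) * (t1 + t2) = t1 ^ 2 - t2 ^ 2 by ring]

lemma Slice.cross_y {m ρ t0 : ℤ} {t : Pt → ℤ} {u v : Pt} (hu : Slice m ρ t0 t u)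
    (hv : Slice m ρ t0 t v) :
    m ^ 3 ∣ (u.y * v.z - v.y * u.z) - ρ * u.z * v.z * (t u ^ 3 - t v ^ 3) := by
  have e : (u.y * v.z - v.y * u.z) - ρ * u.z * v.z * (t u ^ 3 - t v ^ 3) =
    (u.y - ρ * t u ^ 3 * u.z) * v.z - (v.y - ρ * t v ^ 3 * v.z) * u.z := by ring
  rw [e]
  exact dvd_sub (hu.h2.mul_right _) (hv.h2.mul_right _)

lemma Slice.cross_b {m ρ t0 : ℤ} {t : Pt → ℤ} {u v : Pt} (hu : Slice m ρ t0 t u)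
    (hv : Slice m ρ t0 t v) :
    m ^ 3 ∣ (u.b * v.c - v.b * u.c) - ρ * u.b * v.b * (t v ^ 2 - t u ^ 2) := by
  have e : (u.b * v.c - v.b * u.c) - ρ * u.b * v.b * (t v ^ 2 - t u ^ 2) =
    (v.c - ρ * t v ^ 2 * v.b) * u.b - (u.c - ρ * t u ^ 2 * u.b) * v.b := by ring
  rw [e]
  exact dvd_sub (hv.h1.mul_right _) (hu.h1.mul_right _)

/-- points with the same `(y, z)` in a slice -/
lemma slice_same_yz (m ρ t0 : ℤ) (t : Pt → ℤ) (S : Finset Pt) (B C : ℝ) (hm : 0 < m)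
    (hρ : IsCoprime m ρ) (h3 : IsCoprime m 3) (hS : ∀ v ∈ S, Slice m ρ t0 t v)
    (hB : ∀ v ∈ S, (v.b : ℝ) ≤ B) (hC : ∀ v ∈ S, (v.c : ℝ) ≤ C)
    (hinj : ∀ u ∈ S, ∀ v ∈ S, u.b = v.b → u.c = v.c → u.y = v.y → u.z = v.z → u = v)
    (hy : ∀ u ∈ S, ∀ v ∈ S, u.y = v.y ∧ u.z = v.z) (hB0 : 0 ≤ B) (hC0 : 0 ≤ C) :
    (S.card : ℝ) ≤ 1 + 4 * (B * C) / (m : ℝ) ^ 3 := by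
  have hm' : (0 : ℝ) < (m : ℝ) ^ 3 := by positivity
  rcases Nat.lt_or_ge S.card 2 with hc | hc
  · have : (S.card : ℝ) ≤ 1 := by exact_mod_cast (by omega : S.card ≤ 1)
    have : 0 ≤ 4 * (B * C) / (m : ℝ) ^ 3 := by positivity
    linarith
  obtain ⟨u, hu, v, hv, huv, hcl⟩ := close_pair S (fun s => (s.b)) (fun s => s.c) B C hc
    (fun s hs => ⟨by exact_mod_cast (hS s hs).b0, hB s hs⟩)
    (fun s hs => ⟨by exact_mod_cast (hS s hs).c0, hC s hs⟩)
  have su := hS u hu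
  have sv := hS v hv
  obtain ⟨ey, ez⟩ := hy u hu v hv
  have ht3 : m ^ 3 ∣ t u ^ 3 - t v ^ 3 := by
    have h := su.cross_y sv
    rw [show u.y * v.z - v.y * u.z = 0 by rw [ey, ez]; ring, zero_sub, dvd_neg] at h
    exact (((hρ.mul_right su.mz).mul_right sv.mz).pow_left).dvd_of_dvd_mul_left h
  have htt := t_of_cube m (t u) (t v) t0 h3 su.ht sv.ht su.mt ht3
  have hd : m ^ 3 ∣ u.b * v.c - v.b * u.c := by
    have h := su.cross_b sv
    have : m ^ 3 ∣ ρ * u.b * v.b * (t v ^ 2 - t u ^ 2) := by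
      apply Dvd.dvd.mul_left
      rw [show t v ^ 2 - t u ^ 2 = (t u - t v) * (-(t u + t v)) by ring]
      exact htt.mul_right _
    have := dvd_add h this
    rwa [sub_add_cancel] at this
  have hne : u.b * v.c - v.b * u.c ≠ 0 := by
    intro h
    obtain ⟨e1, e2⟩ := coprime_pair_eq _ _ _ _ su.b0 sv.b0 su.bc sv.bc h
    exact huv (hinj u hu v hv e1 e2 ey ez)
  have hge : (m : ℝ) ^ 3 ≤ |(u.b : ℝ) * v.c - v.b * u.c| := by
    have := Int.le_of_dvd (abs_pos.mpr hne) ((dvd_abs _ _).mpr hd)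
    exact_mod_cast this
  have h1 : (0 : ℝ) ≤ (S.card : ℝ) - 1 := by
    have : (2 : ℝ) ≤ S.card := by exact_mod_cast hc
    linarith
  have h2 : (m : ℝ) ^ 3 * ((S.card : ℝ) - 1) ≤ 4 * (B * C) :=
    (mul_le_mul_of_nonneg_right hge h1).trans (by push_cast at hcl; exact hcl)
  have h4 : (S.card : ℝ) - 1 ≤ 4 * (B * C) / (m : ℝ) ^ 3 := by
    rw [le_div_iff₀ hm']; linarith
  linarith

/-- points with the same `(b, c)` in a slice -/
lemma slice_same_bc (m ρ t0 : ℤ) (t : Pt → ℤ) (S : Finset Pt) (Y Z : ℝ) (hm : 0 < m)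
    (hρ : IsCoprime m ρ) (h2 : IsCoprime m 2) (hS : ∀ v ∈ S, Slice m ρ t0 t v)
    (hY : ∀ v ∈ S, (v.y : ℝ) ≤ Y) (hZ : ∀ v ∈ S, (v.z : ℝ) ≤ Z)
    (hinj : ∀ u ∈ S, ∀ v ∈ S, u.b = v.b → u.c = v.c → u.y = v.y → u.z = v.z → u = v)
    (hy : ∀ u ∈ S, ∀ v ∈ S, u.b = v.b ∧ u.c = v.c) (hY0 : 0 ≤ Y) (hZ0 : 0 ≤ Z) :
    (S.card : ℝ) ≤ 1 + 4 * (Y * Z) / (m : ℝ) ^ 3 := by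
  have hm' : (0 : ℝ) < (m : ℝ) ^ 3 := by positivity
  rcases Nat.lt_or_ge S.card 2 with hc | hc
  · have : (S.card : ℝ) ≤ 1 := by exact_mod_cast (by omega : S.card ≤ 1)
    have : 0 ≤ 4 * (Y * Z) / (m : ℝ) ^ 3 := by positivity
    linarith
  obtain ⟨u, hu, v, hv, huv, hcl⟩ := close_pair S (fun s => (s.y)) (fun s => s.z) Y Z hc
    (fun s hs => ⟨by exact_mod_cast (hS s hs).y0, hY s hs⟩)
    (fun s hs => ⟨by exact_mod_cast (hS s hs).z0, hZ s hs⟩)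
  have su := hS u hu
  have sv := hS v hv
  obtain ⟨ey, ez⟩ := hy u hu v hv
  have ht3 : m ^ 3 ∣ t u ^ 2 - t v ^ 2 := by
    have h := su.cross_b sv
    rw [show u.b * v.c - v.b * u.c = 0 by rw [ey, ez]; ring, zero_sub, dvd_neg] at h
    have := (((hρ.mul_right su.mb).mul_right sv.mb).pow_left).dvd_of_dvd_mul_left h
    rwa [← dvd_neg, neg_sub] at this
  have htt := t_of_sq m (t u) (t v) t0 h2 su.ht sv.ht su.mt ht3
  have hd : m ^ 3 ∣ u.y * v.z - v.y * u.z := by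
    have h := su.cross_y sv
    have : m ^ 3 ∣ ρ * u.z * v.z * (t u ^ 3 - t v ^ 3) := by
      apply Dvd.dvd.mul_left
      rw [show t u ^ 3 - t v ^ 3 = (t u - t v) * (t u ^ 2 + t u * t v + t v ^ 2) by ring]
      exact htt.mul_right _
    have := dvd_add h this
    rwa [sub_add_cancel] at this
  have hne : u.y * v.z - v.y * u.z ≠ 0 := by
    intro h
    obtain ⟨e1, e2⟩ := coprime_pair_eq _ _ _ _ su.y0 sv.y0 su.yz sv.yz h
    exact huv (hinj u hu v hv ey ez e1 e2)
  have hge : (m : ℝ) ^ 3 ≤ |(u.y : ℝ) * v.z - v.y * u.z| := by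
    have := Int.le_of_dvd (abs_pos.mpr hne) ((dvd_abs _ _).mpr hd)
    exact_mod_cast this
  have h1 : (0 : ℝ) ≤ (S.card : ℝ) - 1 := by
    have : (2 : ℝ) ≤ S.card := by exact_mod_cast hc
    linarith
  have h2 : (m : ℝ) ^ 3 * ((S.card : ℝ) - 1) ≤ 4 * (Y * Z) :=
    (mul_le_mul_of_nonneg_right hge h1).trans (by push_cast at hcl; exact hcl)
  have h4 : (S.card : ℝ) - 1 ≤ 4 * (Y * Z) / (m : ℝ) ^ 3 := by
    rw [le_div_iff₀ hm']; linarith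
  linarith

lemma two_class_int {α : Type*} (S : Finset α) (f : α → ℤ) (M : ℕ)
    (h : ∀ a ∈ S, ∀ b ∈ S, ∀ c ∈ S, (M : ℤ) ∣ f a - f b ∨ (M : ℤ) ∣ f a - f c ∨
      (M : ℤ) ∣ f b - f c) :
    ∃ S' ⊆ S, S.card ≤ 2 * S'.card ∧ ∀ u ∈ S', ∀ v ∈ S', (M : ℤ) ∣ f u - f v := by
  have key : ∀ a b : ℤ, ((a : ZMod M) = (b : ZMod M)) ↔ (M : ℤ) ∣ a - b := by
    intro a b
    rw [← sub_eq_zero, ← Int.cast_sub, ZMod.intCast_zmod_eq_zero_iff_dvd]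
  obtain ⟨S', h1, h2, h3⟩ := exists_big_class_of_image S (fun s => (f s : ZMod M)) 2
    (image_card_le_two S _ (by
      intro a ha b hb c hc
      rw [key, key, key]
      exact h a ha b hb c hc))
  exact ⟨S', h1, h2, fun u hu v hv => (key _ _).mp (h3 u hu v hv)⟩

lemma prod_pow_dvd (s : Finset ℕ) (hs : ∀ p ∈ s, p.Prime) (j : ℕ) (a : ℤ)
    (h : ∀ p ∈ s, (p : ℤ) ^ j ∣ a) : ((∏ p ∈ s, p : ℕ) : ℤ) ^ j ∣ a := by
  push_cast
  rw [← Finset.prod_pow]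
  apply Finset.prod_dvd_of_coprime _ h
  intro p hp q hq hpq
  exact IsCoprime.pow (Nat.isCoprime_iff_coprime.mpr
    ((Nat.coprime_primes (hs p hp) (hs q hq)).mpr hpq))

lemma sqf_pow_dvd (m : ℕ) (hm : Squarefree m) (j : ℕ) (a : ℤ)
    (h : ∀ p ∈ m.primeFactors, (p : ℤ) ^ j ∣ a) : (m : ℤ) ^ j ∣ a := by
  have := prod_pow_dvd m.primeFactors (fun p hp => Nat.prime_of_mem_primeFactors hp) j a h
  rwa [Nat.prod_primeFactors_of_squarefree hm] at this

lemma class_card (T : Finset ℤ) (M : ℤ) (Z : ℝ) (hM : 0 < M) (hZ : 0 ≤ Z)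
    (h : ∀ s ∈ T, 0 < s ∧ (s : ℝ) ≤ Z) (hc : ∀ s ∈ T, ∀ s' ∈ T, M ∣ s - s') :
    (T.card : ℝ) ≤ 1 + Z / M := by
  have hM' : (0 : ℝ) < M := by exact_mod_cast hM
  have h1 : (T.image (fun s => s / M + 1)).card = T.card := by
    apply Finset.card_image_of_injOn
    intro s hs s' hs' he
    simp only [add_left_inj] at he
    obtain ⟨k, hk⟩ := hc s hs s' hs'
    have e : s = s' + M * k := by linarith
    rw [e, Int.add_mul_ediv_left _ _ hM.ne'] at he
    have : k = 0 := by omega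
    rw [e, this]; ring
  rw [← h1, add_comm]
  apply box1_card _ _ (by positivity)
  intro s hs
  obtain ⟨r, hr, rfl⟩ := Finset.mem_image.mp hs
  obtain ⟨r0, rZ⟩ := h r hr
  refine ⟨by have := Int.ediv_nonneg r0.le hM.le; omega, ?_⟩
  push_cast
  have : ((r / M : ℤ) : ℝ) ≤ Z / M := by
    rw [le_div_iff₀ hM']
    refine le_trans ?_ rZ
    exact_mod_cast Int.ediv_mul_le r hM.ne'
  linarith

lemma Slice.mono {m n ρ t0 : ℤ} {t : Pt → ℤ} {v : Pt} (h : Slice m ρ t0 t v) (hn : n ∣ m) :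
    Slice n ρ t0 t v where
  b0 := h.b0
  c0 := h.c0
  y0 := h.y0
  z0 := h.z0
  bc := h.bc
  yz := h.yz
  h1 := (pow_dvd_pow_of_dvd hn 3).trans h.h1
  h2 := (pow_dvd_pow_of_dvd hn 3).trans h.h2
  ht := hn.trans h.ht
  mb := h.mb.of_isCoprime_of_dvd_left hn
  mz := h.mz.of_isCoprime_of_dvd_left hn
  mt := h.mt.of_isCoprime_of_dvd_left hn

/-- `t (g.v) = b Φ(t)` in region 4 -/
lemma r4_phi {m ρ t0 : ℤ} {t : Pt → ℤ} {v : Pt} (h : Slice m ρ t0 t v) (g0 g1 g2 : ℤ) :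
    m ^ 3 ∣ t v * (g0 * v.b + g1 * v.c + g2 * (v.c * v.z)) -
      v.b * (0 * t v ^ 5 + ρ * g1 * t v ^ 3 + 0 * t v ^ 2 + g0 * t v + g2 * v.y) := by
  obtain ⟨k1, e1⟩ := h.h1
  obtain ⟨k2, e2⟩ := h.h2
  refine ⟨g1 * t v * k1 + g2 * (t v * v.z * k1 - v.b * k2), ?_⟩
  linear_combination (g1 * t v + g2 * t v * v.z) * e1 - g2 * v.b * e2

lemma prime_not_dvd_of_coprime {p m w : ℤ} (hp : Prime p) (hpm : p ∣ m) (h : IsCoprime m w) :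
    ¬ p ∣ w := fun hw => hp.not_isUnit (h.isUnit_of_dvd' hpm hw)

lemma r4_color (m : ℕ) (ρ t0 : ℤ) (t : Pt → ℤ) (S : Finset Pt) (hm : Squarefree m) (y0 : ℤ)
    (hρ : IsCoprime (m : ℤ) ρ) (h3 : IsCoprime (m : ℤ) 3) (g0 g1 g2 : ℤ)
    (hS : ∀ v ∈ S, Slice m ρ t0 t v) (hy : ∀ v ∈ S, v.y = y0)
    (hg : ∀ p : ℕ, p.Prime → ¬ ((p : ℤ) ∣ g0 ∧ (p : ℤ) ∣ g1 ∧ (p : ℤ) ∣ g2))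
    (hgv : ∀ v ∈ S, g0 * v.b + g1 * v.c + g2 * (v.c * v.z) = 0) (hmy : IsCoprime (m : ℤ) y0) :
    ∃ S' ⊆ S, S.card ≤ 2 ^ m.primeFactors.card * S'.card ∧
      ∀ u ∈ S', ∀ v ∈ S', (m : ℤ) ^ 2 ∣ t u - t v := by
  obtain ⟨S', s1, s2, s3⟩ := coloring m.primeFactors
    (fun p S => ∀ u ∈ S, ∀ v ∈ S, (p : ℤ) ^ 2 ∣ t u - t v) 2
    (fun i S T hTS hQ u hu v hv => hQ u (hTS hu) v (hTS hv)) S (by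
      intro p hp T hT
      have hpp := Nat.prime_of_mem_primeFactors hp
      have hpi : Prime (p : ℤ) := Nat.prime_iff_prime_int.mp hpp
      have hpm : (p : ℤ) ∣ m := Int.natCast_dvd_natCast.mpr (Nat.dvd_of_mem_primeFactors hp)
      have := two_class_int T t (p ^ 2) (by
        intro a ha b hb c hc
        push_cast
        by_contra hcon
        push Not at hcon
        obtain ⟨n1, n2, n3⟩ := hcon
        have key : ∀ v ∈ T, (p : ℤ) ^ 3 ∣
            0 * t v ^ 5 + ρ * g1 * t v ^ 3 + 0 * t v ^ 2 + g0 * t v + g2 * y0 := by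
          intro v hv
          have sv := (hS v (hT hv)).mono hpm
          have h := r4_phi sv g0 g1 g2
          rw [hgv v (hT hv), mul_zero, zero_sub, dvd_neg, hy v (hT hv)] at h
          exact (sv.mb.pow_left).dvd_of_dvd_mul_left h
        obtain ⟨c0, c1, c2⟩ := three_roots p hpi _ _ _ _ _ t0 _ _ _
          ((hS a (hT ha)).mono hpm).ht ((hS b (hT hb)).mono hpm).ht ((hS c (hT hc)).mono hpm).ht
          n1 n2 n3 (key a ha) (key b hb) (key c hc)
        have p3 := prime_not_dvd_of_coprime hpi hpm h3
        have pρ := prime_not_dvd_of_coprime hpi hpm hρ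
        have py := prime_not_dvd_of_coprime hpi hpm hmy
        have pt0 : ¬ (p : ℤ) ∣ t0 := by
          intro h
          have sa := (hS a (hT ha)).mono hpm
          have h' := dvd_add sa.ht h
          rw [sub_add_cancel] at h'
          exact prime_not_dvd_of_coprime hpi dvd_rfl sa.mt h'
        have d1 : (p : ℤ) ∣ g1 := by
          have e : 10 * 0 * t0 ^ 3 + 3 * (ρ * g1) * t0 + 0 = 3 * ρ * t0 * g1 := by ring
          rw [e] at c2
          rcases hpi.dvd_or_dvd c2 with h | h
          · rcases hpi.dvd_or_dvd h with h | h
            · rcases hpi.dvd_or_dvd h with h | h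
              · exact absurd h p3
              · exact absurd h pρ
            · exact absurd h pt0
          · exact h
        obtain ⟨k, hk⟩ := d1
        have d0 : (p : ℤ) ∣ g0 := by
          have c1' := (dvd_pow_self (p : ℤ) two_ne_zero).trans c1
          have e : g0 = 5 * 0 * t0 ^ 4 + 3 * (ρ * g1) * t0 ^ 2 + 2 * 0 * t0 + g0 -
            p * (3 * ρ * k * t0 ^ 2) := by rw [hk]; ring
          rw [e]
          exact dvd_sub c1' (dvd_mul_right _ _)
        obtain ⟨j, hj⟩ := d0
        have d2 : (p : ℤ) ∣ g2 := by
          have c0' := (dvd_pow_self (p : ℤ) three_ne_zero).trans c0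
          have e : g2 * y0 = 0 * t0 ^ 5 + ρ * g1 * t0 ^ 3 + 0 * t0 ^ 2 + g0 * t0 + g2 * y0 -
            p * (ρ * k * t0 ^ 3 + j * t0) := by rw [hk, hj]; ring
          have : (p : ℤ) ∣ g2 * y0 := by
            rw [e]
            exact dvd_sub c0' (dvd_mul_right _ _)
          exact (hpi.dvd_or_dvd this).resolve_right py
        exact hg p hpp ⟨⟨j, hj⟩, ⟨k, hk⟩, d2⟩)
      simpa using this)
  refine ⟨S', s1, s2, fun u hu v hv => sqf_pow_dvd m hm 2 _ (fun p hp => s3 p hp u hu v hv)⟩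

/-- the number of points of region 4 in a slice killed by a given form -/
lemma r4_slice (D ε : ℝ) (hD : 0 < D) (hε : 0 < ε) : ∃ K : ℝ, 1 ≤ K ∧
    ∀ (P : ℝ) (m : ℕ) (ρ t0 : ℤ) (t : Pt → ℤ) (S : Finset Pt) (y0 g0 g1 g2 : ℤ) (B C Z : ℝ),
      1 ≤ P → Squarefree m → IsCoprime (m : ℤ) ρ → IsCoprime (m : ℤ) 3 →
      (∀ v ∈ S, Slice m ρ t0 t v) → (∀ v ∈ S, v.y = y0) → IsCoprime (m : ℤ) y0 →
      (∀ p : ℕ, p.Prime → ¬ ((p : ℤ) ∣ g0 ∧ (p : ℤ) ∣ g1 ∧ (p : ℤ) ∣ g2)) →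
      (∀ v ∈ S, g0 * v.b + g1 * v.c + g2 * (v.c * v.z) = 0) →
      (∀ v ∈ S, (v.b : ℝ) ≤ B ∧ (v.c : ℝ) ≤ C ∧ (v.z : ℝ) ≤ Z) → 0 ≤ B → 0 ≤ C → 0 ≤ Z →
      (∀ u ∈ S, ∀ v ∈ S, u.b = v.b → u.c = v.c → u.y = v.y → u.z = v.z → u = v) →
      (m : ℝ) ≤ P ^ D → |(g0 : ℝ)| ≤ P ^ D →
      (S.card : ℝ) ≤ K * P ^ ε * (1 + B * C / (m : ℝ) ^ 3 + Z / (m : ℝ) ^ 2) := by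
  obtain ⟨K1, hK1, k1⟩ := int_divisor_bound (ε / (2 * D)) (by positivity)
  obtain ⟨K2, hK2, k2⟩ := pow_omega_le 2 (ε / (2 * D)) (by positivity)
  refine ⟨4 * (K1 * K2), by nlinarith, ?_⟩
  intro P m ρ t0 t S y0 g0 g1 g2 B C Z hP hm hρ h3 hS hy hmy hg hgv hb hB hC hZ hinj hmP hgP
  have hP0 : 0 < P := by linarith
  have hm0 : 0 < m := Nat.pos_of_ne_zero hm.ne_zero
  have hm0' : (0 : ℝ) < m := by exact_mod_cast hm0
  have hPe : 1 ≤ P ^ ε := Real.one_le_rpow hP hε.le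
  have hK12 : 1 ≤ K1 * K2 := one_le_mul_of_one_le_of_one_le hK1 hK2
  have hKP : 1 ≤ K1 * K2 * P ^ ε := one_le_mul_of_one_le_of_one_le hK12 hPe
  by_cases hg0 : g0 = 0
  · have hg2 : g2 ≠ 0 ∨ S = ∅ := by
      by_contra hcon
      push Not at hcon
      obtain ⟨h2, hne⟩ := hcon
      obtain ⟨v, hv⟩ := hne
      have := hgv v hv
      rw [hg0, h2] at this
      have hc := (hS v hv).c0
      have h1 : g1 = 0 := by
        have : g1 * v.c = 0 := by linarith
        rcases mul_eq_zero.mp this with h | h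
        · exact h
        · omega
      exact hg 2 Nat.prime_two ⟨by simp [hg0], by simp [h1], by simp [h2]⟩
    have hn : (S.card : ℝ) ≤ 1 + 4 * (B * C) / (m : ℝ) ^ 3 := by
      rcases hg2 with hg2 | hg2
      · have := slice_same_yz m ρ t0 t S B C (by exact_mod_cast hm0) hρ h3 hS (fun v hv => (hb v hv).1)
          (fun v hv => (hb v hv).2.1) hinj (fun u hu v hv => ⟨by rw [hy u hu, hy v hv], by
            have hu' := hgv u hu
            have hv' := hgv v hv
            rw [hg0] at hu' hv'
            have f : ∀ w ∈ S, g1 + g2 * w.z = 0 := by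
              intro w hw
              have hw' := hgv w hw
              have hc := (hS w hw).c0
              rw [hg0] at hw'
              have : w.c * (g1 + g2 * w.z) = 0 := by linarith
              rcases mul_eq_zero.mp this with h | h
              · omega
              · exact h
            have : g2 * (u.z - v.z) = 0 := by linarith [f u hu, f v hv]
            rcases mul_eq_zero.mp this with h | h
            · exact absurd h hg2
            · omega⟩) hB hC
        exact_mod_cast this
      · rw [hg2]; simp; positivity
    have e1 : 0 ≤ B * C / (m : ℝ) ^ 3 := by positivity
    have e2 : 0 ≤ Z / (m : ℝ) ^ 2 := by positivity
    have e3 : 4 * (B * C) / (m : ℝ) ^ 3 = 4 * (B * C / (m : ℝ) ^ 3) := by ring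
    rw [e3] at hn
    calc (S.card : ℝ) ≤ 4 * (1 + B * C / (m : ℝ) ^ 3 + Z / (m : ℝ) ^ 2) := by linarith
      _ ≤ 4 * (K1 * K2 * P ^ ε) * (1 + B * C / (m : ℝ) ^ 3 + Z / (m : ℝ) ^ 2) := by
        have : 4 ≤ 4 * (K1 * K2 * P ^ ε) := by linarith
        gcongr
      _ = _ := by ring
  · have hpow : ∀ w : ℝ, 0 ≤ w → w ≤ P ^ D → w ^ (ε / (2 * D)) ≤ P ^ (ε / 2) := by
      intro w hw hwP
      calc w ^ (ε / (2 * D)) ≤ (P ^ D) ^ (ε / (2 * D)) := Real.rpow_le_rpow hw hwP (by positivity)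
        _ = _ := by rw [← Real.rpow_mul hP0.le]; congr 1; field_simp
    have key := card_le_fiber S (fun v => v.c) (S.image (fun v => v.c))
      (fun s hs => Finset.mem_image_of_mem _ hs)
      (K2 * P ^ (ε / 2) * (1 + Z / (m : ℝ) ^ 2)) ?_
    · have hc := k1 g0 (S.image (fun v => v.c)) hg0 (by
        intro d hd
        obtain ⟨v, hv, rfl⟩ := Finset.mem_image.mp hd
        have : v.c ∣ g0 * v.b := ⟨-(g1 + g2 * v.z), by linarith [hgv v hv]⟩
        exact (hS v hv).bc.symm.dvd_of_dvd_mul_right this)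
      have hc2 := hpow _ (abs_nonneg _) hgP
      have e : P ^ ε = P ^ (ε / 2) * P ^ (ε / 2) := by rw [← Real.rpow_add hP0]; ring_nf
      have e1 : 0 ≤ B * C / (m : ℝ) ^ 3 := by positivity
      have e2 : 0 ≤ Z / (m : ℝ) ^ 2 := by positivity
      calc (S.card : ℝ) ≤ _ := key
        _ ≤ (K1 * P ^ (ε / 2)) * (K2 * P ^ (ε / 2) * (1 + Z / (m : ℝ) ^ 2)) := by
          gcongr
          refine hc.trans ?_
          gcongr
        _ = (K1 * K2 * P ^ ε) * (1 + Z / (m : ℝ) ^ 2) := by rw [e]; ring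
        _ ≤ (4 * (K1 * K2 * P ^ ε)) * (1 + B * C / (m : ℝ) ^ 3 + Z / (m : ℝ) ^ 2) := by
          exact mul_le_mul (by linarith) (by linarith) (by positivity) (by positivity)
        _ = _ := by ring
    · intro c hc
      set F := S.filter (fun v => v.c = c) with hF
      have hFS : ∀ v ∈ F, v ∈ S ∧ v.c = c := fun v hv => Finset.mem_filter.mp hv
      obtain ⟨S', s1, s2, s3⟩ := r4_color m ρ t0 t F hm y0 hρ h3 g0 g1 g2
        (fun v hv => hS v (hFS v hv).1) (fun v hv => hy v (hFS v hv).1) hg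
        (fun v hv => hgv v (hFS v hv).1) hmy
      have hcard : (S'.card : ℝ) ≤ 1 + Z / (m : ℝ) ^ 2 := by
        have hi : (S'.image (fun v => v.z)).card = S'.card := by
          apply Finset.card_image_of_injOn
          intro u hu v hv he
          have hu' := hFS u (s1 hu)
          have hv' := hFS v (s1 hv)
          refine hinj u hu'.1 v hv'.1 ?_ (by rw [hu'.2, hv'.2]) (by rw [hy u hu'.1, hy v hv'.1]) he
          have a1 := hgv u hu'.1
          have a2 := hgv v hv'.1
          simp only at he
          rw [hu'.2, he] at a1
          rw [hv'.2] at a2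
          have : g0 * (u.b - v.b) = 0 := by linarith
          rcases mul_eq_zero.mp this with h | h
          · exact absurd h hg0
          · omega
        rw [← hi]
        have := class_card (S'.image (fun v => v.z)) ((m : ℤ) ^ 2) Z (by positivity) hZ (by
          intro s hs
          obtain ⟨v, hv, rfl⟩ := Finset.mem_image.mp hs
          have hv' := hFS v (s1 hv)
          exact ⟨(hS v hv'.1).z0, (hb v hv'.1).2.2⟩) (by
          intro s hs s' hs'
          obtain ⟨u, hu, rfl⟩ := Finset.mem_image.mp hs
          obtain ⟨v, hv, rfl⟩ := Finset.mem_image.mp hs'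
          have hu' := hFS u (s1 hu)
          have hv' := hFS v (s1 hv)
          have su := hS u hu'.1
          have sv := hS v hv'.1
          obtain ⟨k, hk⟩ := s3 u hu v hv
          obtain ⟨j1, e1⟩ := su.h2
          obtain ⟨j2, e2⟩ := sv.h2
          rw [hy u hu'.1] at e1
          rw [hy v hv'.1] at e2
          have hcop : IsCoprime ((m : ℤ) ^ 2) (ρ * t u ^ 3) :=
            (hρ.mul_right su.mt.pow_right).pow_left
          apply hcop.dvd_of_dvd_mul_left
          refine ⟨m * j2 - m * j1 - ρ * v.z * k * (t u ^ 2 + t u * t v + t v ^ 2), ?_⟩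
          linear_combination e2 - e1 - ρ * v.z * (t u ^ 2 + t u * t v + t v ^ 2) * hk)
        push_cast at this
        exact this
      have s2' : (F.card : ℝ) ≤ (2 : ℝ) ^ m.primeFactors.card * S'.card := by exact_mod_cast s2
      have hw := (k2 m hm0).trans (mul_le_mul_of_nonneg_left (hpow m hm0'.le hmP) (by linarith))
      push_cast at hw
      calc (F.card : ℝ) ≤ _ := s2'
        _ ≤ _ := by gcongr

lemma siegel_slice (ι : Type) [Fintype ι] [DecidableEq ι] (hn : 2 ≤ Fintype.card ι) :
    ∃ K : ℝ, 1 ≤ K ∧ ∀ (m : ℕ) (w0 w1 w2 : ι → ℤ) (V : ι → ℝ) (T : ℝ), 0 < m → (∀ i, 0 < V i) →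
      0 ≤ T →
      (m : ℝ) ^ 6 * ∏ i, V i ≤ ((m : ℝ) ^ 3) ^ Fintype.card ι * T ^ (Fintype.card ι - 1) →
      ∃ L : Finset (ι → ℤ), (L.card : ℝ) ≤ K * (1 + T) ∧
        (∀ g ∈ L, (∀ p : ℕ, p.Prime → ∃ i, ¬ (p : ℤ) ∣ g i) ∧
          ∀ i, |(g i : ℝ)| * V i ≤ K * ((m : ℝ) ^ 3 * (1 + T))) ∧
        ∀ v : ι → ℤ, (∀ i, |(v i : ℝ)| ≤ V i) →
          (∀ h : ι → ℤ, (m : ℤ) ^ 3 ∣ ∑ i, h i * w0 i → (m : ℤ) ^ 2 ∣ ∑ i, h i * w1 i →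
            (m : ℤ) ∣ ∑ i, h i * w2 i → (m : ℤ) ^ 3 ∣ ∑ i, h i * v i) →
          ∃ g ∈ L, ∑ i, g i * v i = 0 := by
  obtain ⟨K, hK, h⟩ := siegel_list ι hn
  refine ⟨K, hK, ?_⟩
  intro m w0 w1 w2 V T hm hV hT hc
  have : NeZero m := ⟨hm.ne'⟩
  have : NeZero (m ^ 2) := ⟨by positivity⟩
  have : NeZero (m ^ 3) := ⟨by positivity⟩
  let φ : (ι → ℤ) →+ ZMod (m ^ 3) × ZMod (m ^ 2) × ZMod m := AddMonoidHom.mk'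
    (fun h => (((∑ i, h i * w0 i : ℤ) : ZMod (m ^ 3)), ((∑ i, h i * w1 i : ℤ) : ZMod (m ^ 2)),
      ((∑ i, h i * w2 i : ℤ) : ZMod m))) (by
      intro a b
      simp only [Pi.add_apply, add_mul, Finset.sum_add_distrib, Int.cast_add, Prod.mk_add_mk])
  obtain ⟨L, l1, l2, l3⟩ := h _ φ (m ^ 3) V T (by positivity) hV hT (by
    refine le_trans (le_of_eq ?_) (hc.trans (le_of_eq ?_))
    · congr 1
      simp only [Fintype.card_prod, ZMod.card]
      push_cast; ring
    · push_cast; ring)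
  refine ⟨L, l1, fun g hg => ⟨(l2 g hg).1, fun i => ?_⟩, fun v hv hh => ?_⟩
  · have := (l2 g hg).2 i
    push_cast at this
    exact this
  · refine l3 v (fun i => by have := hv i; push_cast; exact this) (fun h hφ => ?_)
    have e : φ h = (((∑ i, h i * w0 i : ℤ) : ZMod (m ^ 3)), ((∑ i, h i * w1 i : ℤ) : ZMod (m ^ 2)),
      ((∑ i, h i * w2 i : ℤ) : ZMod m)) := rfl
    rw [e, Prod.mk_eq_zero, Prod.mk_eq_zero, ZMod.intCast_zmod_eq_zero_iff_dvd,
      ZMod.intCast_zmod_eq_zero_iff_dvd, ZMod.intCast_zmod_eq_zero_iff_dvd] at hφ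
    have := hh h (by exact_mod_cast hφ.1) (by exact_mod_cast hφ.2.1) hφ.2.2
    exact_mod_cast this

lemma part30 (a : ℤ) (h0 : 0 < a) (ha : Squarefree a) :
    ∃ n : ℕ, 0 < n ∧ n.Coprime 30 ∧ (n : ℤ) ∣ a ∧ a ≤ 30 * n ∧ Squarefree n := by
  lift a to ℕ using h0.le
  have h0' : 0 < a := by exact_mod_cast h0
  have ha' : Squarefree a := Int.squarefree_natCast.mp ha
  obtain ⟨n, hn⟩ := Nat.gcd_dvd_left a 30
  have hg0 : 0 < a.gcd 30 := Nat.gcd_pos_of_pos_left _ h0'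
  have hn0 : 0 < n := by
    rcases Nat.eq_zero_or_pos n with h | h
    · rw [h, mul_zero] at hn; omega
    · exact h
  have hcop : (a.gcd 30).Coprime n := by
    rw [hn, Nat.squarefree_mul_iff] at ha'
    exact ha'.1
  refine ⟨n, hn0, ?_, ?_, ?_, ?_⟩
  · apply Nat.Coprime.symm
    apply Nat.coprime_of_dvd
    intro p hp h30 hpn
    have hpa : p ∣ a := by rw [hn]; exact hpn.mul_left _
    have := Nat.dvd_gcd (Nat.dvd_gcd hpa h30) hpn
    rw [hcop] at this
    exact hp.one_lt.ne' (Nat.dvd_one.mp this)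
  · exact Int.natCast_dvd_natCast.mpr ⟨a.gcd 30, by linarith⟩
  · have : a.gcd 30 ≤ 30 := Nat.le_of_dvd (by norm_num) (Nat.gcd_dvd_right a 30)
    have : a ≤ 30 * n := by rw [hn]; exact Nat.mul_le_mul_right _ this
    exact_mod_cast this
  · exact ha'.squarefree_of_dvd ⟨a.gcd 30, by linarith⟩

lemma sqf_cube_unique (a x a' x' : ℤ) (ha : 0 < a) (hx : 0 < x) (ha' : 0 < a') (hx' : 0 < x')
    (sa : Squarefree a) (sa' : Squarefree a') (h : a ^ 3 * x ^ 2 = a' ^ 3 * x' ^ 2) :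
    a = a' ∧ x = x' := by
  have key : ∀ a x a' x' : ℤ, 0 < a → 0 < x → Squarefree a → a ^ 3 * x ^ 2 = a' ^ 3 * x' ^ 2 →
      a ∣ a' := by
    intro a x a' x' ha hx sa h
    have h1 : (a * x) ^ 2 ∣ (a' ^ 2 * x') ^ 2 := ⟨a * a', by linear_combination (-a') * h⟩
    rw [Int.pow_dvd_pow_iff two_ne_zero] at h1
    obtain ⟨s, hs⟩ := h1
    have h2 : a * a' = s ^ 2 := by
      have : (a * x) ^ 2 * (a * a') = (a * x) ^ 2 * s ^ 2 := by
        linear_combination a' * h + (a' ^ 2 * x' + a * x * s) * hs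
      exact mul_left_cancel₀ (by positivity) this
    have h3 : a ∣ s := (sa.dvd_pow_iff_dvd two_ne_zero).mp ⟨a', h2.symm⟩
    obtain ⟨k, hk⟩ := h3
    refine ⟨k ^ 2, ?_⟩
    have : a * a' = a * (a * k ^ 2) := by rw [h2, hk]; ring
    exact mul_left_cancel₀ ha.ne' this
  have e : a = a' := Int.dvd_antisymm ha.le ha'.le (key a x a' x' ha hx sa h)
    (key a' x' a x ha' hx' sa' h.symm)
  refine ⟨e, ?_⟩
  subst e
  have h2 : x ^ 2 = x' ^ 2 := mul_left_cancel₀ (by positivity) h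
  exact (pow_left_inj₀ hx.le hx'.le two_ne_zero).mp h2

lemma good_inj {P : ℝ} {r1 r2 r3 : ℤ} {A B C : ℝ} {u v : Pt} (hr : r1 ≠ 0)
    (gu : Good P r1 r2 r3 A B C u) (gv : Good P r1 r2 r3 A B C v)
    (hb : u.b = v.b) (hc : u.c = v.c) (hy : u.y = v.y) (hz : u.z = v.z) : u = v := by
  have e1 := gu.eq
  have e2 := gv.eq
  rw [hb, hc, hy, hz] at e1
  have h : u.a ^ 3 * u.x ^ 2 = v.a ^ 3 * v.x ^ 2 := by
    apply mul_left_cancel₀ hr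
    linarith
  obtain ⟨h1, h2⟩ := sqf_cube_unique _ _ _ _ gu.a0 gu.x0 gv.a0 gv.x0 gu.sa gv.sa h
  exact Pt.ext h1 hb hc h2 hy hz

/-- everything we need to know on slices -/
lemma slice_setup (P : ℝ) (r1 r2 r3 : ℤ) (A B C : ℝ) :
    ∃ (μ : Pt → ℕ) (ρ : ℕ → ℤ) (t : Pt → ℤ), ∀ v, Good P r1 r2 r3 A B C v →
      Squarefree (μ v) ∧ A ≤ 60 * μ v ∧ (μ v : ℝ) ≤ A ∧ IsCoprime (μ v : ℤ) 30 ∧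
      IsCoprime (μ v : ℤ) (ρ (μ v)) ∧ IsCoprime (μ v : ℤ) v.y ∧
      ∀ t0, (μ v : ℤ) ∣ t v - t0 → Slice (μ v) (ρ (μ v)) t0 t v := by
  classical
  have h1 : ∀ v : Pt, ∃ n : ℕ, Good P r1 r2 r3 A B C v → 0 < n ∧ n.Coprime 30 ∧ (n : ℤ) ∣ v.a ∧
      v.a ≤ 30 * n ∧ Squarefree n := by
    intro v
    by_cases hg : Good P r1 r2 r3 A B C v
    · obtain ⟨n, hn⟩ := part30 v.a hg.a0 hg.sa
      exact ⟨n, fun _ => hn⟩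
    · exact ⟨0, fun h => absurd h hg⟩
  choose μ hμ using h1
  have h2 : ∀ m : ℕ, ∃ ρ : ℤ, IsCoprime (m : ℤ) r3 → (m : ℤ) ^ 3 ∣ ρ * r3 + r2 := by
    intro m
    by_cases h : IsCoprime (m : ℤ) r3
    · obtain ⟨t, ht⟩ := exists_inv_mod ((m : ℤ) ^ 3) (-r2) r3 h.pow_left
      exact ⟨t, fun _ => by simpa using ht⟩
    · exact ⟨0, fun h' => absurd h' h⟩
  choose ρ hρ using h2
  have h3 : ∀ v : Pt, ∃ t : ℤ, Good P r1 r2 r3 A B C v →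
      (μ v : ℤ) ^ 3 ∣ v.c - ρ (μ v) * t ^ 2 * v.b ∧ (μ v : ℤ) ^ 3 ∣ v.y - ρ (μ v) * t ^ 3 * v.z ∧
      IsCoprime (μ v : ℤ) t ∧ IsCoprime (μ v : ℤ) v.b ∧ IsCoprime (μ v : ℤ) v.z ∧
      IsCoprime (μ v : ℤ) (ρ (μ v)) ∧ IsCoprime (μ v : ℤ) r3 := by
    intro v
    by_cases hg : Good P r1 r2 r3 A B C v
    · have hm := (hμ v hg).2.2.1
      have q13 : IsCoprime (μ v : ℤ) (r3 * v.c * v.z) :=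
        (hg.c13.of_mul_left_left.of_mul_left_right).of_isCoprime_of_dvd_left hm
      obtain ⟨t, ht⟩ := slice_exists hg (μ v) (ρ (μ v)) hm
        (hρ _ q13.of_mul_right_left.of_mul_right_left)
      exact ⟨t, fun _ => ht⟩
    · exact ⟨0, fun h => absurd h hg⟩
  choose t ht using h3
  refine ⟨μ, ρ, t, fun v g => ?_⟩
  obtain ⟨m0, m30, ma, am, ms⟩ := hμ v g
  obtain ⟨t1, t2, t3, t4, t5, t6, t7⟩ := ht v g
  have am' : (v.a : ℝ) ≤ 30 * (μ v : ℝ) := by exact_mod_cast am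
  have ma' : ((μ v : ℤ) : ℝ) ≤ v.a := by exact_mod_cast Int.le_of_dvd g.a0 ma
  have q12 : IsCoprime (μ v : ℤ) (r2 * v.b * v.y) :=
    (g.c12.of_mul_left_left.of_mul_left_right).of_isCoprime_of_dvd_left ma
  refine ⟨ms, by linarith [g.Aa], ?_, ?_, t6, q12.of_mul_right_right, fun t0 h0 => ?_⟩
  · have := g.aA
    push_cast at ma'
    linarith
  · exact_mod_cast Nat.isCoprime_iff_coprime.mpr m30
  · exact ⟨g.b0, g.c0, g.y0, g.z0,
      g.c23.of_mul_left_left.of_mul_left_right.of_mul_right_left.of_mul_right_right,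
      g.c23.of_mul_left_right.of_mul_right_right, t1, t2, h0, t4, t5, t3⟩

lemma r4_one (ε : ℝ) (hε : 0 < ε) : ∃ K : ℝ, 1 ≤ K ∧
    ∀ (P : ℝ) (m : ℕ) (ρ t0 : ℤ) (t : Pt → ℤ) (S : Finset Pt) (y0 : ℤ) (B C Z : ℝ),
      1 ≤ P → Squarefree m → IsCoprime (m : ℤ) ρ → IsCoprime (m : ℤ) 3 →
      (∀ v ∈ S, Slice m ρ t0 t v) → (∀ v ∈ S, v.y = y0) → IsCoprime (m : ℤ) y0 →
      (∀ v ∈ S, (v.b : ℝ) ≤ B ∧ (v.c : ℝ) ≤ C ∧ (v.z : ℝ) ≤ Z) → 1 ≤ B → 1 ≤ C → 1 ≤ Z →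
      (∀ u ∈ S, ∀ v ∈ S, u.b = v.b → u.c = v.c → u.y = v.y → u.z = v.z → u = v) →
      (m : ℝ) ≤ 10 * P → B ≤ 10 * P → C ≤ 10 * P → Z ≤ 10 * P →
      (S.card : ℝ) ≤ K * P ^ ε * ((1 + √(B * C * (C * Z) / (m : ℝ) ^ 3)) *
        (1 + B * C / (m : ℝ) ^ 3 + Z / (m : ℝ) ^ 2)) := by
  obtain ⟨K1, hK1, k1⟩ := siegel_slice (Fin 3) (by simp)
  obtain ⟨K2, hK2, k2⟩ := r4_slice 7 ε (by norm_num) hε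
  have hq : (1 : ℝ) ≤ 100 * K1 := by linarith
  refine ⟨K1 * (K2 * (100 * K1) ^ ε), one_le_mul_of_one_le_of_one_le hK1
    (one_le_mul_of_one_le_of_one_le hK2 (Real.one_le_rpow hq hε.le)), ?_⟩
  intro P m ρ t0 t S y0 B C Z hP hm hρ h3 hS hy hmy hb hB hC hZ hinj hmP hBP hCP hZP
  have hm0 : 0 < m := Nat.pos_of_ne_zero hm.ne_zero
  have hm1 : (1 : ℝ) ≤ m := by exact_mod_cast hm0
  have hm0' : (0 : ℝ) < m := by exact_mod_cast hm0
  set w : ℝ := B * C * (C * Z) / (m : ℝ) ^ 3 with hw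
  have hw0 : 0 ≤ w := by positivity
  obtain ⟨L, l1, l2, l3⟩ := k1 m ![t0, ρ * t0 ^ 3, y0] ![1, 3 * ρ * t0 ^ 2, 0] ![0, 3 * ρ * t0, 0]
    ![B, C, C * Z] (√w) hm0 (by
      intro i
      fin_cases i
      · show 0 < B
        linarith
      · show 0 < C
        linarith
      · show 0 < C * Z
        positivity) (Real.sqrt_nonneg _) (by
      simp only [Fintype.card_fin, Fin.prod_univ_three, Matrix.cons_val]
      have e : √w ^ (3 - 1) = w := Real.sq_sqrt hw0
      rw [e, hw]
      apply le_of_eq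
      field_simp)
  have hP1 : 1 ≤ 100 * K1 * P := one_le_mul_of_one_le_of_one_le hq hP
  have cov := card_le_cover_sum S L (fun g v => g 0 * v.b + g 1 * v.c + g 2 * (v.c * v.z) = 0)
    (by
      intro v hv
      obtain ⟨g, hg, e⟩ := l3 ![v.b, v.c, v.c * v.z] (by
        have s := hS v hv
        have := hb v hv
        have b0 : (0 : ℝ) < v.b := by exact_mod_cast s.b0
        have c0 : (0 : ℝ) < v.c := by exact_mod_cast s.c0
        have z0 : (0 : ℝ) < v.z := by exact_mod_cast s.z0
        intro i
        fin_cases i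
        · show |(v.b : ℝ)| ≤ B
          rw [abs_of_pos b0]; exact this.1
        · show |(v.c : ℝ)| ≤ C
          rw [abs_of_pos c0]; exact this.2.1
        · show |((v.c * v.z : ℤ) : ℝ)| ≤ C * Z
          push_cast
          rw [abs_of_pos (by positivity)]
          exact mul_le_mul this.2.1 this.2.2 z0.le (by linarith)) (by
        intro h
        simp only [Fin.sum_univ_three, Matrix.cons_val]
        intro q0 q1 q2
        have s := hS v hv
        have hΦ := taylor_fwd m 0 (ρ * h 1) 0 (h 0) (h 2 * y0) t0 (t v) s.ht
          (by convert q0 using 1; ring) (by convert q1 using 1; ring) (by convert q2 using 1; ring)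
        have hφ := r4_phi s (h 0) (h 1) (h 2)
        rw [hy v hv] at hφ
        have h2 := (dvd_sub_comm.mp hφ)
        have h3 : (m : ℤ) ^ 3 ∣ t v * (h 0 * v.b + h 1 * v.c + h 2 * (v.c * v.z)) := by
          have := dvd_add hφ (hΦ.mul_left v.b)
          rwa [sub_add_cancel] at this
        exact (s.mt.pow_left).dvd_of_dvd_mul_left h3)
      refine ⟨g, hg, ?_⟩
      simpa only [Fin.sum_univ_three, Matrix.cons_val] using e)
    (fun _ => K2 * (100 * K1 * P) ^ ε * (1 + B * C / (m : ℝ) ^ 3 + Z / (m : ℝ) ^ 2)) (by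
      intro g hg
      refine k2 (100 * K1 * P) m ρ t0 t _ y0 (g 0) (g 1) (g 2) B C Z hP1 hm hρ h3
        (fun v hv => hS v (Finset.mem_filter.mp hv).1) (fun v hv => hy v (Finset.mem_filter.mp hv).1)
        hmy ?_ (fun v hv => (Finset.mem_filter.mp hv).2)
        (fun v hv => hb v (Finset.mem_filter.mp hv).1) (by linarith) (by linarith) (by linarith)
        (fun u hu v hv => hinj u (Finset.mem_filter.mp hu).1 v (Finset.mem_filter.mp hv).1) ?_ ?_
      · rintro p hp ⟨p0, p1, p2⟩
        obtain ⟨i, hi⟩ := (l2 g hg).1 p hp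
        fin_cases i
        · exact hi p0
        · exact hi p1
        · exact hi p2
      · have e7 : (100 * K1 * P) ^ (7 : ℝ) = (100 * K1 * P) ^ 7 := by
          rw [← Real.rpow_natCast]; norm_num
        rw [e7]
        calc (m : ℝ) ≤ 10 * P := hmP
          _ ≤ 100 * K1 * P := by nlinarith
          _ ≤ _ := le_self_pow₀ hP1 (by norm_num)
      · have e7 : (100 * K1 * P) ^ (7 : ℝ) = (100 * K1 * P) ^ 7 := by
          rw [← Real.rpow_natCast]; norm_num
        rw [e7]
        have hg0 : |(g 0 : ℝ)| * B ≤ K1 * ((m : ℝ) ^ 3 * (1 + √w)) := (l2 g hg).2 0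
        have hsw : √w ≤ 1 + w := by
          rw [Real.sqrt_le_left (by positivity)]
          nlinarith
        have h10 : 1 ≤ 10 * P := by linarith
        have hwP : w ≤ (10 * P) ^ 4 := by
          calc w ≤ B * C * (C * Z) := div_le_self (by positivity) (one_le_pow₀ hm1)
            _ ≤ (10 * P) * (10 * P) * ((10 * P) * (10 * P)) := by gcongr
            _ = _ := by ring
        have h4 : 1 ≤ (10 * P) ^ 4 := one_le_pow₀ h10
        calc |(g 0 : ℝ)| ≤ |(g 0 : ℝ)| * B := le_mul_of_one_le_right (abs_nonneg _) hB
          _ ≤ K1 * ((m : ℝ) ^ 3 * (1 + √w)) := hg0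
          _ ≤ K1 * ((10 * P) ^ 3 * (3 * (10 * P) ^ 4)) := by
            gcongr
            linarith
          _ = K1 * 3 * (10 * P) ^ 7 := by ring
          _ ≤ (10 * K1) ^ 7 * (10 * P) ^ 7 := by
            gcongr
            calc K1 * 3 ≤ 10 * K1 := by linarith
              _ ≤ _ := le_self_pow₀ (by linarith) (by norm_num)
          _ = _ := by ring)
  rw [Finset.sum_const, nsmul_eq_mul] at cov
  refine cov.trans ?_
  have e : (100 * K1 * P) ^ ε = (100 * K1) ^ ε * P ^ ε := Real.mul_rpow (by linarith) (by linarith)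
  rw [e]
  have hBC : 0 ≤ 1 + B * C / (m : ℝ) ^ 3 + Z / (m : ℝ) ^ 2 := by positivity
  calc _ ≤ (K1 * (1 + √w)) * (K2 * ((100 * K1) ^ ε * P ^ ε) *
        (1 + B * C / (m : ℝ) ^ 3 + Z / (m : ℝ) ^ 2)) := by gcongr
    _ = _ := by ring

lemma sqrt_scale (w A m : ℝ) (hw : 0 ≤ w) (hA : 0 < A) (hm : A ≤ 60 * m) :
    √(w / m ^ 3) ≤ 1000 * √(w / A ^ 3) := by
  have hm0 : 0 < m := by linarith
  have h : A ^ 3 ≤ (60 * m) ^ 3 := by gcongr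
  rw [Real.sqrt_le_left (by positivity), mul_pow, Real.sq_sqrt (by positivity), ← mul_div_assoc,
    div_le_div_iff₀ (by positivity) (by positivity)]
  have : w * A ^ 3 ≤ w * (60 * m) ^ 3 := by gcongr
  have h2 : 0 ≤ w * m ^ 3 := by positivity
  nlinarith

lemma region4 (ε : ℝ) (hε : 0 < ε) : ∃ K : ℝ, 1 ≤ K ∧
    ∀ (P : ℝ) (r1 r2 r3 : ℤ) (A B C Y Z : ℝ) (S : Finset Pt), 1 ≤ P → r1 ≠ 0 →
      (∀ v ∈ S, Good P r1 r2 r3 A B C v) → (∀ v ∈ S, (v.y : ℝ) ≤ Y ∧ (v.z : ℝ) ≤ Z) →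
      0 ≤ Y → 0 ≤ Z → 1 ≤ A → 1 ≤ B → 1 ≤ C →
      A ≤ 10 * P → B ≤ 10 * P → C ≤ 10 * P → Z ≤ 10 * P →
      (S.card : ℝ) ≤ K * P ^ ε * (Y * A * A * ((1 + √(B * C * (C * Z) / A ^ 3)) *
        (1 + B * C / A ^ 3 + Z / A ^ 2))) := by
  obtain ⟨K, hK, k⟩ := r4_one ε hε
  refine ⟨1000 * (60 ^ 3 * K), by linarith, ?_⟩
  intro P r1 r2 r3 A B C Y Z S hP hr hS hb hY hZ hA hB hC hAP hBP hCP hZP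
  have hA0 : 0 < A := by linarith
  have hB0 : 0 < B := by linarith
  have hC0 : 0 < C := by linarith
  obtain ⟨μ, ρ, t, hμ⟩ := slice_setup P r1 r2 r3 A B C
  set f : Pt → ℤ × ℤ × ℤ := fun v => (v.y, (μ v : ℤ), t v % (μ v : ℤ) + 1) with hf
  have hT := card_le_fiber S f (S.image f) (fun s hs => Finset.mem_image_of_mem _ hs)
    (1000 * (60 ^ 3 * K) * P ^ ε * ((1 + √(B * C * (C * Z) / A ^ 3)) *
        (1 + B * C / A ^ 3 + Z / A ^ 2))) (by
    intro τ hτ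
    obtain ⟨v0, hv0, rfl⟩ := Finset.mem_image.mp hτ
    obtain ⟨i1, i2, i3, i4, i5, i6, i7⟩ := hμ v0 (hS v0 hv0)
    have hm0 : 0 < μ v0 := Nat.pos_of_ne_zero i1.ne_zero
    have hm0' : (0 : ℝ) < μ v0 := by exact_mod_cast hm0
    have hZ1 : 1 ≤ Z := (int_one_le (hS v0 hv0).z0).trans (hb v0 hv0).2
    have hm3 : IsCoprime (μ v0 : ℤ) 3 := i4.of_isCoprime_of_dvd_right ⟨10, by norm_num⟩
    have hfib : ∀ v ∈ S.filter (fun s => f s = f v0), v ∈ S ∧ v.y = v0.y ∧ μ v = μ v0 ∧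
        (μ v0 : ℤ) ∣ t v - t v0 := by
      intro v hv
      obtain ⟨h1, h2⟩ := Finset.mem_filter.mp hv
      simp only [hf, Prod.mk.injEq] at h2
      obtain ⟨h3, h4, h5⟩ := h2
      have h4' : μ v = μ v0 := by exact_mod_cast h4
      refine ⟨h1, h3, h4', ?_⟩
      rw [h4'] at h5
      exact Int.ModEq.dvd (Int.ModEq.symm (by rw [Int.ModEq]; omega))
    have := k P (μ v0) (ρ (μ v0)) (t v0) t (S.filter (fun s => f s = f v0)) v0.y B C Z hP i1 i5 hm3
      (by
        intro v hv
        obtain ⟨h1, h2, h3, h4⟩ := hfib v hv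
        have := (hμ v (hS v h1)).2.2.2.2.2.2 (t v0)
        rw [h3] at this
        exact this h4) (fun v hv => (hfib v hv).2.1) i6
      (fun v hv => ⟨(hS v (hfib v hv).1).bB, (hS v (hfib v hv).1).cC, (hb v (hfib v hv).1).2⟩)
      hB hC hZ1 (fun u hu v hv => good_inj hr (hS u (hfib u hu).1) (hS v (hfib v hv).1))
      (by linarith) hBP hCP hZP
    refine this.trans ?_
    have q1 := sqrt_scale (B * C * (C * Z)) A (μ v0) (by positivity) hA0 i2
    have q2 : B * C / (μ v0 : ℝ) ^ 3 ≤ 60 ^ 3 * (B * C / A ^ 3) := by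
      rw [← mul_div_assoc, div_le_div_iff₀ (by positivity) (by positivity)]
      calc B * C * A ^ 3 ≤ B * C * (60 * μ v0) ^ 3 := by gcongr
        _ = _ := by ring
    have q3 : Z / (μ v0 : ℝ) ^ 2 ≤ 60 ^ 3 * (Z / A ^ 2) := by
      rw [← mul_div_assoc, div_le_div_iff₀ (by positivity) (by positivity)]
      calc Z * A ^ 2 ≤ Z * (60 * μ v0) ^ 2 := by gcongr
        _ = (60 ^ 2) * (Z * (μ v0 : ℝ) ^ 2) := by ring
        _ ≤ 60 ^ 3 * (Z * (μ v0 : ℝ) ^ 2) := by gcongr <;> norm_num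
        _ = _ := by ring
    have q4 : 0 ≤ √(B * C * (C * Z) / A ^ 3) := Real.sqrt_nonneg _
    have q5 : 1 + √(B * C * (C * Z) / (μ v0 : ℝ) ^ 3) ≤ 1000 * (1 + √(B * C * (C * Z) / A ^ 3)) := by
      linarith
    have q6 : 1 + B * C / (μ v0 : ℝ) ^ 3 + Z / (μ v0 : ℝ) ^ 2 ≤
      60 ^ 3 * (1 + B * C / A ^ 3 + Z / A ^ 2) := by linarith
    calc _ ≤ K * P ^ ε * ((1000 * (1 + √(B * C * (C * Z) / A ^ 3))) *
          (60 ^ 3 * (1 + B * C / A ^ 3 + Z / A ^ 2))) := by gcongr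
      _ = _ := by ring)
  have hbox := box3_card (S.image f) Y A A hY hA0.le hA0.le (by
    intro τ hτ
    obtain ⟨v, hv, rfl⟩ := Finset.mem_image.mp hτ
    obtain ⟨i1, i2, i3, i4, i5, i6, i7⟩ := hμ v (hS v hv)
    have hm0 : 0 < μ v := Nat.pos_of_ne_zero i1.ne_zero
    have hm0' : (0 : ℤ) < μ v := by exact_mod_cast hm0
    have l1 := Int.emod_nonneg (t v) hm0'.ne'
    have l2 := Int.emod_lt_of_pos (t v) hm0'
    refine ⟨(hS v hv).y0, (hb v hv).1, hm0', by simpa [hf] using i3, ?_, ?_⟩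
    · simp only [hf]; omega
    · simp only [hf]
      have : t v % (μ v : ℤ) + 1 ≤ μ v := by omega
      have : ((t v % (μ v : ℤ) + 1 : ℤ) : ℝ) ≤ ((μ v : ℤ) : ℝ) := by exact_mod_cast this
      refine this.trans ?_
      exact_mod_cast i3)
  refine hT.trans ?_
  calc _ ≤ (Y * A * A) * (1000 * (60 ^ 3 * K) * P ^ ε * ((1 + √(B * C * (C * Z) / A ^ 3)) *
        (1 + B * C / A ^ 3 + Z / A ^ 2))) := by gcongr
    _ = _ := by ring

lemma r3_phi {m ρ t0 : ℤ} {t : Pt → ℤ} {v : Pt} (h : Slice m ρ t0 t v) (g1 g2 g3 g4 : ℤ) :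
    m ^ 3 ∣ (g1 * (v.b * v.y) + g2 * (v.b * v.z) + g3 * (v.c * v.y) + g4 * (v.c * v.z)) -
      (v.b * v.z) * (g3 * ρ ^ 2 * t v ^ 5 + g1 * ρ * t v ^ 3 + g4 * ρ * t v ^ 2 + 0 * t v + g2) := by
  obtain ⟨k1, e1⟩ := h.h1
  obtain ⟨k2, e2⟩ := h.h2
  refine ⟨g1 * v.b * k2 + g3 * (v.c * k2 + ρ * t v ^ 3 * v.z * k1) + g4 * v.z * k1, ?_⟩
  linear_combination (g3 * ρ * t v ^ 3 * v.z + g4 * v.z) * e1 + (g1 * v.b + g3 * v.c) * e2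

/-- consequences of a triple root -/
lemma r3_three (p ρ t0 g1 g2 g3 g4 : ℤ) (hp : Prime p) (h2 : ¬ p ∣ 2) (h3 : ¬ p ∣ 3) (h5 : ¬ p ∣ 5)
    (ht : ¬ p ∣ t0) (hρ : ¬ p ∣ ρ) (hg : ¬ (p ∣ g1 ∧ p ∣ g2 ∧ p ∣ g3 ∧ p ∣ g4))
    (c0 : p ^ 3 ∣ g3 * ρ ^ 2 * t0 ^ 5 + g1 * ρ * t0 ^ 3 + g4 * ρ * t0 ^ 2 + 0 * t0 + g2)
    (c1 : p ^ 2 ∣ 5 * (g3 * ρ ^ 2) * t0 ^ 4 + 3 * (g1 * ρ) * t0 ^ 2 + 2 * (g4 * ρ) * t0 + 0)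
    (c2 : p ∣ 10 * (g3 * ρ ^ 2) * t0 ^ 3 + 3 * (g1 * ρ) * t0 + g4 * ρ) :
    p ^ 2 ∣ g1 * g4 - 25 * g2 * g3 ∧ (¬ p ∣ g1 ∧ ¬ p ∣ g2 ∧ ¬ p ∣ g3 ∧ ¬ p ∣ g4) ∧
      ¬ p ∣ g1 * g4 - g2 * g3 := by
  obtain ⟨k0, e0⟩ := c0
  obtain ⟨k1, e1⟩ := c1
  obtain ⟨k2, e2⟩ := c2
  have hV : p ∣ g4 * ρ - 5 * (g3 * ρ ^ 2) * t0 ^ 3 := by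
    have : p ∣ t0 * (g4 * ρ - 5 * (g3 * ρ ^ 2) * t0 ^ 3) :=
      ⟨p * k1 - t0 * k2, by linear_combination e1 - t0 * e2⟩
    exact (hp.dvd_or_dvd this).resolve_left ht
  have hP : p ∣ g1 * ρ + 5 * (g3 * ρ ^ 2) * t0 ^ 2 := by
    obtain ⟨j, ej⟩ := hV
    have : p ∣ 3 * (t0 * (g1 * ρ + 5 * (g3 * ρ ^ 2) * t0 ^ 2)) :=
      ⟨k2 - j, by linear_combination e2 - ej⟩
    exact (hp.dvd_or_dvd ((hp.dvd_or_dvd this).resolve_left h3)).resolve_left ht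
  have hQ : p ∣ g2 + (g3 * ρ ^ 2) * t0 ^ 5 := by
    obtain ⟨j, ej⟩ := hV
    obtain ⟨i, ei⟩ := hP
    exact ⟨p ^ 2 * k0 - t0 ^ 3 * i - t0 ^ 2 * j, by
      linear_combination e0 - t0 ^ 3 * ei - t0 ^ 2 * ej⟩
  have pw : ∀ n : ℕ, ¬ p ∣ t0 ^ n := fun n h => ht (hp.dvd_of_dvd_pow h)
  have pr : ¬ p ∣ ρ ^ 2 := fun h => hρ (hp.dvd_of_dvd_pow h)
  have hu : ¬ p ∣ g3 := by
    intro h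
    apply hg
    obtain ⟨j, ej⟩ := hV
    obtain ⟨i, ei⟩ := hP
    obtain ⟨l, el⟩ := hQ
    obtain ⟨s, es⟩ := h
    refine ⟨?_, ?_, ⟨s, es⟩, ?_⟩
    · have : p ∣ g1 * ρ := ⟨i - 5 * s * ρ ^ 2 * t0 ^ 2, by rw [es] at ei; linear_combination ei⟩
      exact (hp.dvd_or_dvd this).resolve_right hρ
    · exact ⟨l - s * ρ ^ 2 * t0 ^ 5, by rw [es] at el; linear_combination el⟩
    · have : p ∣ g4 * ρ := ⟨j + 5 * s * ρ ^ 2 * t0 ^ 3, by rw [es] at ej; linear_combination ej⟩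
      exact (hp.dvd_or_dvd this).resolve_right hρ
  obtain ⟨j, ej⟩ := hV
  obtain ⟨i, ei⟩ := hP
  obtain ⟨l, el⟩ := hQ
  refine ⟨?_, ⟨?_, ?_, hu, ?_⟩, ?_⟩
  · have : p ^ 2 ∣ (3 * t0 ^ 2 * ρ ^ 2) * (g1 * g4 - 25 * g2 * g3) := by
      refine ⟨-2 * t0 * k2 ^ 2 - 75 * t0 ^ 2 * (g3 * ρ ^ 2) * (p * k0) +
        k1 * (g4 * ρ + 55 * (g3 * ρ ^ 2) * t0 ^ 3 + 6 * (g1 * ρ) * t0), ?_⟩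
      linear_combination (-2 * t0 * (10 * (g3 * ρ ^ 2) * t0 ^ 3 + 3 * (g1 * ρ) * t0 + g4 * ρ + p * k2)) * e2 -
        75 * t0 ^ 2 * (g3 * ρ ^ 2) * e0 +
        (g4 * ρ + 55 * (g3 * ρ ^ 2) * t0 ^ 3 + 6 * (g1 * ρ) * t0) * e1
    have hc : IsCoprime (p ^ 2) (3 * t0 ^ 2 * ρ ^ 2) := by
      apply IsCoprime.pow_left
      rw [Prime.coprime_iff_not_dvd hp]
      intro h
      rcases hp.dvd_or_dvd h with h | h
      · rcases hp.dvd_or_dvd h with h | h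
        · exact h3 h
        · exact pw 2 h
      · exact pr h
    exact hc.dvd_of_dvd_mul_left this
  · rintro ⟨s, es⟩
    have : p ∣ 5 * (g3 * ρ ^ 2) * t0 ^ 2 := ⟨i - s * ρ, by rw [es] at ei; linear_combination ei⟩
    rcases hp.dvd_or_dvd this with h | h
    · rcases hp.dvd_or_dvd h with h | h
      · exact h5 h
      · rcases hp.dvd_or_dvd h with h | h
        · exact hu h
        · exact pr h
    · exact pw 2 h
  · rintro ⟨s, es⟩
    have : p ∣ (g3 * ρ ^ 2) * t0 ^ 5 := ⟨l - s, by rw [es] at el; linear_combination el⟩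
    rcases hp.dvd_or_dvd this with h | h
    · rcases hp.dvd_or_dvd h with h | h
      · exact hu h
      · exact pr h
    · exact pw 5 h
  · rintro ⟨s, es⟩
    have : p ∣ 5 * (g3 * ρ ^ 2) * t0 ^ 3 := ⟨-j + s * ρ, by rw [es] at ej; linear_combination -ej⟩
    rcases hp.dvd_or_dvd this with h | h
    · rcases hp.dvd_or_dvd h with h | h
      · exact h5 h
      · rcases hp.dvd_or_dvd h with h | h
        · exact hu h
        · exact pr h
    · exact pw 3 h
  · rintro ⟨s, es⟩
    have : p ∣ (2 * (2 * (2 * 3))) * ((g3 * ρ ^ 2) * ((g3 * ρ ^ 2) * t0 ^ 5)) := by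
      refine ⟨i * (g4 * ρ) - 5 * (g3 * ρ ^ 2) * t0 ^ 2 * j - g3 * ρ ^ 2 * l - ρ ^ 2 * s, ?_⟩
      linear_combination (g4 * ρ) * ei - 5 * (g3 * ρ ^ 2) * t0 ^ 2 * ej - g3 * ρ ^ 2 * el -
        ρ ^ 2 * es
    have hb : ¬ p ∣ g3 * ρ ^ 2 := fun h => (hp.dvd_or_dvd h).elim hu pr
    rcases hp.dvd_or_dvd this with h | h
    · rcases hp.dvd_or_dvd h with h | h
      · exact h2 h
      · rcases hp.dvd_or_dvd h with h | h
        · exact h2 h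
        · exact (hp.dvd_or_dvd h).elim h2 h3
    · rcases hp.dvd_or_dvd h with h | h
      · exact hb h
      · exact (hp.dvd_or_dvd h).elim hb (pw 5)

/-- `κ` and `κ*` -/
structure Kap (g1 g2 g3 g4 κ κs : ℤ) (v : Pt) : Prop where
  e1 : g3 * v.y + g4 * v.z = κ * v.b
  e2 : g1 * v.y + g2 * v.z = -(κ * v.c)
  e3 : g2 * v.b + g4 * v.c = κs * v.y
  e4 : g1 * v.b + g3 * v.c = -(κs * v.z)

lemma kap_exists (g1 g2 g3 g4 : ℤ) (v : Pt) (b0 : 0 < v.b) (z0 : 0 < v.z) (y0 : 0 < v.y)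
    (bc : IsCoprime v.b v.c) (yz : IsCoprime v.y v.z)
    (h : g1 * (v.b * v.y) + g2 * (v.b * v.z) + g3 * (v.c * v.y) + g4 * (v.c * v.z) = 0) :
    ∃ κ κs : ℤ, Kap g1 g2 g3 g4 κ κs v ∧ κ * κs = -(g1 * g4 - g2 * g3) := by
  have h1 : v.b ∣ g3 * v.y + g4 * v.z := by
    apply bc.dvd_of_dvd_mul_left
    exact ⟨-(g1 * v.y + g2 * v.z), by linear_combination h⟩
  have h2 : v.y ∣ g2 * v.b + g4 * v.c := by
    apply yz.dvd_of_dvd_mul_left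
    exact ⟨-(g1 * v.b + g3 * v.c), by linear_combination h⟩
  obtain ⟨κ, hκ⟩ := h1
  obtain ⟨κs, hκs⟩ := h2
  have k : Kap g1 g2 g3 g4 κ κs v := by
    refine ⟨by linarith, ?_, by linarith, ?_⟩
    · apply mul_left_cancel₀ b0.ne'
      linear_combination h - v.c * hκ
    · apply mul_left_cancel₀ y0.ne'
      linear_combination h - v.z * hκs
  refine ⟨κ, κs, k, ?_⟩
  apply mul_left_cancel₀ y0.ne'
  linear_combination (-κ) * k.e3 - g2 * k.e1 + g4 * k.e2

/-- the quotient `k` of a pair of points -/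
def kk (a1 a2 a3 a4 : ℤ) (u v : Pt) : ℤ :=
  a3 * (u.b * v.z - v.b * u.z) + a4 * (v.b * u.y - u.b * v.y) - a1 * (u.c * v.z - v.c * u.z) -
    a2 * (v.c * u.y - u.c * v.y)

lemma kap_rel {g1 g2 g3 g4 κ κs a1 a2 a3 a4 : ℤ} {u v : Pt} (hκ : κ ≠ 0)
    (hΔ : κ * κs = -(g1 * g4 - g2 * g3))
    (ha : a1 * g1 + a2 * g2 + a3 * g3 + a4 * g4 = 1) (hu : Kap g1 g2 g3 g4 κ κs u)
    (hv : Kap g1 g2 g3 g4 κ κs v) :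
    u.y * v.z - v.y * u.z = κ * kk a1 a2 a3 a4 u v ∧
    u.b * v.c - v.b * u.c = -(κs * kk a1 a2 a3 a4 u v) ∧
    kk a1 a2 a3 a4 u v * g1 = -(u.c * v.z - v.c * u.z) ∧
    kk a1 a2 a3 a4 u v * g2 = -(v.c * u.y - u.c * v.y) ∧
    kk a1 a2 a3 a4 u v * g3 = u.b * v.z - v.b * u.z ∧
    kk a1 a2 a3 a4 u v * g4 = v.b * u.y - u.b * v.y := by
  have q1 : (u.y * v.z - v.y * u.z) * g1 = -κ * (u.c * v.z - v.c * u.z) := by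
    linear_combination v.z * hu.e2 - u.z * hv.e2
  have q2 : (u.y * v.z - v.y * u.z) * g2 = -κ * (v.c * u.y - u.c * v.y) := by
    linear_combination u.y * hv.e2 - v.y * hu.e2
  have q3 : (u.y * v.z - v.y * u.z) * g3 = κ * (u.b * v.z - v.b * u.z) := by
    linear_combination v.z * hu.e1 - u.z * hv.e1
  have q4 : (u.y * v.z - v.y * u.z) * g4 = κ * (v.b * u.y - u.b * v.y) := by
    linear_combination u.y * hv.e1 - v.y * hu.e1
  have hy : u.y * v.z - v.y * u.z = κ * kk a1 a2 a3 a4 u v := by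
    unfold kk
    linear_combination (-(u.y * v.z - v.y * u.z)) * ha + a1 * q1 + a2 * q2 + a3 * q3 + a4 * q4
  rw [hy] at q1 q2 q3 q4
  refine ⟨hy, ?_, ?_, ?_, ?_, ?_⟩
  · apply mul_left_cancel₀ (pow_ne_zero 2 hκ)
    linear_combination (-κ * v.c) * hu.e1 + (g3 * u.y + g4 * u.z) * hv.e2
      + (κ * u.c) * hv.e1 - (g3 * v.y + g4 * v.z) * hu.e2 + (g1 * g4 - g2 * g3) * hy
      + κ * kk a1 a2 a3 a4 u v * hΔ
  · apply mul_left_cancel₀ hκ; linear_combination q1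
  · apply mul_left_cancel₀ hκ; linear_combination q2
  · apply mul_left_cancel₀ hκ; linear_combination q3
  · apply mul_left_cancel₀ hκ; linear_combination q4

/-- the local alternative at a prime -/
def R3Q (g1 g2 g3 g4 a1 a2 a3 a4 : ℤ) (p : ℤ) (T : Finset Pt) : Prop :=
  (p ^ 2 ∣ g1 * g4 - 25 * g2 * g3 ∧ (¬ p ∣ g1 ∧ ¬ p ∣ g2 ∧ ¬ p ∣ g3 ∧ ¬ p ∣ g4) ∧
    ∀ u ∈ T, ∀ v ∈ T, p ∣ kk a1 a2 a3 a4 u v) ∨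
  (∀ u ∈ T, ∀ v ∈ T, p ^ 2 ∣ kk a1 a2 a3 a4 u v) ∨
  (p ^ 2 ∣ g1 * g4 - g2 * g3 ∧ ∀ u ∈ T, ∀ v ∈ T, p ∣ kk a1 a2 a3 a4 u v) ∨
  p ^ 6 ∣ g1 * g4 - g2 * g3

lemma R3Q.mono {g1 g2 g3 g4 a1 a2 a3 a4 : ℤ} {p : ℤ} {S T : Finset Pt} (hTS : T ⊆ S)
    (h : R3Q g1 g2 g3 g4 a1 a2 a3 a4 p S) : R3Q g1 g2 g3 g4 a1 a2 a3 a4 p T := by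
  rcases h with ⟨h1, h2, h3⟩ | h | ⟨h1, h2⟩ | h
  · exact Or.inl ⟨h1, h2, fun u hu v hv => h3 u (hTS hu) v (hTS hv)⟩
  · exact Or.inr (Or.inl fun u hu v hv => h u (hTS hu) v (hTS hv))
  · exact Or.inr (Or.inr (Or.inl ⟨h1, fun u hu v hv => h2 u (hTS hu) v (hTS hv)⟩))
  · exact Or.inr (Or.inr (Or.inr h))

lemma lam_rel (p ρ κ' κs' k tu tv t0 bu bv zu zv X Y : ℤ) (hp : Prime p)
    (hb : ¬ p ∣ k) (h0 : p ∣ tu - t0) (h2 : p ^ 2 ∣ tu - tv)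
    (hX : p ^ 3 ∣ X - ρ * zu * zv * (tu ^ 3 - tv ^ 3))
    (hY : p ^ 3 ∣ Y - ρ * bu * bv * (tv ^ 2 - tu ^ 2)) (eX : X = p ^ 2 * κ' * k)
    (eY : Y = -(p ^ 2 * κs' * k)) :
    p ∣ 2 * κ' * bu * bv - 3 * t0 * κs' * zu * zv := by
  obtain ⟨s, hs⟩ := h0
  obtain ⟨τ, hτ⟩ := h2
  obtain ⟨i, hi⟩ := hX
  obtain ⟨j, hj⟩ := hY
  have hp2 : p ^ 2 ≠ 0 := pow_ne_zero 2 hp.ne_zero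
  have e1 : tu = t0 + p * s := by linarith
  have e2 : tv = t0 + p * s - p ^ 2 * τ := by linarith
  have f1 : κ' * k = p * i + ρ * zu * zv * τ * (tu ^ 2 + tu * tv + tv ^ 2) := by
    apply mul_left_cancel₀ hp2
    linear_combination hi - eX + ρ * zu * zv * (tu ^ 2 + tu * tv + tv ^ 2) * hτ
  have f2 : κs' * k = -(p * j) + ρ * bu * bv * τ * (tu + tv) := by
    apply mul_left_cancel₀ hp2
    linear_combination eY - hj + ρ * bu * bv * (tu + tv) * hτ
  have : p ∣ k * (2 * κ' * bu * bv - 3 * t0 * κs' * zu * zv) := by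
    have g1 : ∃ w, tu ^ 2 + tu * tv + tv ^ 2 = 3 * t0 ^ 2 + p * w := by
      refine ⟨3 * t0 * (2 * s - p * τ) + p * (s ^ 2 + s * (s - p * τ) + (s - p * τ) ^ 2), ?_⟩
      rw [e1, e2]; ring
    have g2 : ∃ w, tu + tv = 2 * t0 + p * w := ⟨2 * s - p * τ, by rw [e1, e2]; ring⟩
    obtain ⟨w1, hw1⟩ := g1
    obtain ⟨w2, hw2⟩ := g2
    rw [hw1] at f1
    rw [hw2] at f2
    refine ⟨2 * bu * bv * (i + ρ * zu * zv * τ * w1) - 3 * t0 * zu * zv * (-j + ρ * bu * bv * τ * w2), ?_⟩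
    linear_combination 2 * bu * bv * f1 - 3 * t0 * zu * zv * f2
  exact (hp.dvd_or_dvd this).resolve_left hb

lemma r3_local (p : ℕ) (hp : p.Prime) (h2 : ¬ (p : ℤ) ∣ 2) (h3 : ¬ (p : ℤ) ∣ 3) (h5 : ¬ (p : ℤ) ∣ 5)
    (ρ t0 : ℤ) (t : Pt → ℤ) (T : Finset Pt) (g1 g2 g3 g4 κ κs a1 a2 a3 a4 : ℤ)
    (hρ : ¬ (p : ℤ) ∣ ρ) (hS : ∀ v ∈ T, Slice p ρ t0 t v)
    (hK : ∀ v ∈ T, Kap g1 g2 g3 g4 κ κs v) (hκ : κ ≠ 0)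
    (hΔ : κ * κs = -(g1 * g4 - g2 * g3)) (ha : a1 * g1 + a2 * g2 + a3 * g3 + a4 * g4 = 1) :
    ∃ T' ⊆ T, T.card ≤ 4 * T'.card ∧ R3Q g1 g2 g3 g4 a1 a2 a3 a4 p T' := by
  have hpi : Prime (p : ℤ) := Nat.prime_iff_prime_int.mp hp
  have hprim : ¬ ((p : ℤ) ∣ g1 ∧ (p : ℤ) ∣ g2 ∧ (p : ℤ) ∣ g3 ∧ (p : ℤ) ∣ g4) := by
    rintro ⟨d1, d2, d3, d4⟩
    have : (p : ℤ) ∣ 1 := by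
      rw [← ha]
      exact dvd_add (dvd_add (dvd_add (d1.mul_left _) (d2.mul_left _)) (d3.mul_left _)) (d4.mul_left _)
    exact hpi.not_isUnit (isUnit_of_dvd_one this)
  have hΔd : g1 * g4 - g2 * g3 = -(κ * κs) := by linarith
  have tt : ∀ u ∈ T, ∀ v ∈ T, (p : ℤ) ∣ t u - t v := by
    intro u hu v hv
    have := dvd_sub (hS u hu).ht (hS v hv).ht
    rwa [show t u - t0 - (t v - t0) = t u - t v by ring] at this
  have rel := fun u (hu : u ∈ T) v (hv : v ∈ T) => kap_rel hκ hΔ ha (hK u hu) (hK v hv)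
  have crossd : ∀ n : ℕ, n ≤ 3 → ∀ u ∈ T, ∀ v ∈ T, (p : ℤ) ^ n ∣ t u - t v →
      (p : ℤ) ^ n ∣ κ * kk a1 a2 a3 a4 u v ∧ (p : ℤ) ^ n ∣ κs * kk a1 a2 a3 a4 u v := by
    intro n hn u hu v hv hd
    obtain ⟨r1, r2, -⟩ := rel u hu v hv
    have c1 := (pow_dvd_pow (p : ℤ) hn).trans ((hS u hu).cross_y (hS v hv))
    have c2 := (pow_dvd_pow (p : ℤ) hn).trans ((hS u hu).cross_b (hS v hv))
    have d3 := hd.trans (sub_dvd_pow_sub_pow (t u) (t v) 3)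
    have d2 := hd.trans (sub_dvd_pow_sub_pow (t u) (t v) 2)
    rw [dvd_sub_comm] at d2
    constructor
    · rw [← r1]
      have := dvd_add c1 (d3.mul_left (ρ * u.z * v.z))
      rwa [sub_add_cancel] at this
    · rw [← dvd_neg, ← r2]
      have := dvd_add c2 (d2.mul_left (ρ * u.b * v.b))
      rwa [sub_add_cancel] at this
  by_cases htri : ∃ a ∈ T, ∃ b ∈ T, ∃ c ∈ T, ¬ (p : ℤ) ^ 2 ∣ t a - t b ∧ ¬ (p : ℤ) ^ 2 ∣ t a - t c ∧
      ¬ (p : ℤ) ^ 2 ∣ t b - t c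
  · obtain ⟨a, haT, b, hbT, c, hcT, n1, n2, n3⟩ := htri
    have key : ∀ v ∈ T, (p : ℤ) ^ 3 ∣
        g3 * ρ ^ 2 * t v ^ 5 + g1 * ρ * t v ^ 3 + g4 * ρ * t v ^ 2 + 0 * t v + g2 := by
      intro v hv
      have sv := hS v hv
      have h := r3_phi sv g1 g2 g3 g4
      have e : g1 * (v.b * v.y) + g2 * (v.b * v.z) + g3 * (v.c * v.y) + g4 * (v.c * v.z) = 0 := by
        linear_combination v.b * (hK v hv).e2 + v.c * (hK v hv).e1
      rw [e, zero_sub, dvd_neg] at h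
      exact ((sv.mb.mul_right sv.mz).pow_left).dvd_of_dvd_mul_left h
    obtain ⟨c0, c1, c2⟩ := three_roots p hpi _ _ _ _ _ t0 _ _ _ (hS a haT).ht (hS b hbT).ht
      (hS c hcT).ht n1 n2 n3 (key a haT) (key b hbT) (key c hcT)
    have pt0 : ¬ (p : ℤ) ∣ t0 := by
      intro h
      have sa := hS a haT
      have h' := dvd_add sa.ht h
      rw [sub_add_cancel] at h'
      exact prime_not_dvd_of_coprime hpi dvd_rfl sa.mt h'
    obtain ⟨E2, gn, Δn⟩ := r3_three p ρ t0 g1 g2 g3 g4 hpi h2 h3 h5 pt0 hρ hprim c0 c1 c2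
    refine ⟨T, subset_rfl, by omega, Or.inl ⟨E2, gn, fun u hu v hv => ?_⟩⟩
    have := (crossd 1 (by norm_num) u hu v hv (by simpa using tt u hu v hv)).1
    rw [pow_one] at this
    refine (hpi.dvd_or_dvd this).resolve_left (fun h => Δn ?_)
    rw [hΔd, dvd_neg]
    exact h.mul_right _
  · push Not at htri
    obtain ⟨T1, t1, t2, t3⟩ := two_class_int T t (p ^ 2) (by
      intro a haT b hbT c hcT
      push_cast
      by_cases q1 : (p : ℤ) ^ 2 ∣ t a - t b
      · exact Or.inl q1
      by_cases q2 : (p : ℤ) ^ 2 ∣ t a - t c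
      · exact Or.inr (Or.inl q2)
      · exact Or.inr (Or.inr (htri a haT b hbT c hcT q1 q2)))
    push_cast at t3
    have cr : ∀ u ∈ T1, ∀ v ∈ T1, (p : ℤ) ^ 2 ∣ κ * kk a1 a2 a3 a4 u v ∧
        (p : ℤ) ^ 2 ∣ κs * kk a1 a2 a3 a4 u v := fun u hu v hv =>
      crossd 2 (by norm_num) u (t1 hu) v (t1 hv) (t3 u hu v hv)
    have cop : ∀ w : ℤ, ¬ (p : ℤ) ∣ w → ∀ n : ℕ, IsCoprime ((p : ℤ) ^ n) w := fun w hw n =>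
      ((Prime.coprime_iff_not_dvd hpi).mpr hw).pow_left
    by_cases k1 : (p : ℤ) ∣ κ
    swap
    · exact ⟨T1, t1, by omega, Or.inr (Or.inl fun u hu v hv =>
        (cop κ k1 2).dvd_of_dvd_mul_left (cr u hu v hv).1)⟩
    by_cases k2 : (p : ℤ) ∣ κs
    swap
    · exact ⟨T1, t1, by omega, Or.inr (Or.inl fun u hu v hv =>
        (cop κs k2 2).dvd_of_dvd_mul_left (cr u hu v hv).2)⟩
    have hΔ2 : (p : ℤ) ^ 2 ∣ g1 * g4 - g2 * g3 := by
      rw [hΔd, dvd_neg, sq]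
      exact mul_dvd_mul k1 k2
    have once : ∀ w k : ℤ, (p : ℤ) ∣ w → ¬ (p : ℤ) ^ 2 ∣ w → (p : ℤ) ^ 2 ∣ w * k → (p : ℤ) ∣ k := by
      rintro w k ⟨j, rfl⟩ hn hd
      rw [sq, mul_assoc] at hd
      have hd' := (mul_dvd_mul_iff_left hpi.ne_zero).mp hd
      refine (hpi.dvd_or_dvd hd').resolve_left (fun hj => hn ?_)
      rw [sq]
      exact mul_dvd_mul_left _ hj
    by_cases k3 : (p : ℤ) ^ 2 ∣ κ
    swap
    · exact ⟨T1, t1, by omega, Or.inr (Or.inr (Or.inl ⟨hΔ2, fun u hu v hv =>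
        once κ _ k1 k3 (cr u hu v hv).1⟩))⟩
    by_cases k4 : (p : ℤ) ^ 2 ∣ κs
    swap
    · exact ⟨T1, t1, by omega, Or.inr (Or.inr (Or.inl ⟨hΔ2, fun u hu v hv =>
        once κs _ k2 k4 (cr u hu v hv).2⟩))⟩
    obtain ⟨κ', eκ⟩ := k3
    obtain ⟨κs', eκs⟩ := k4
    by_cases k5 : (p : ℤ) ∣ κ' ∧ (p : ℤ) ∣ κs'
    · refine ⟨T1, t1, by omega, Or.inr (Or.inr (Or.inr ?_))⟩
      obtain ⟨⟨i, hi⟩, ⟨j, hj⟩⟩ := k5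
      exact ⟨-(i * j), by rw [hΔd, eκ, eκs, hi, hj]; ring⟩
    have hlam : ∀ v : Pt, ∃ l : ℤ, v ∈ T → (p : ℤ) ∣ l * v.z - v.b := by
      intro v
      by_cases hv : v ∈ T
      · obtain ⟨l, hl⟩ := exists_inv_mod (p : ℤ) v.b v.z (hS v hv).mz
        exact ⟨l, fun _ => hl⟩
      · exact ⟨0, fun h => absurd h hv⟩
    choose l hl using hlam
    have lz : ∀ u ∈ T, ¬ (p : ℤ) ∣ u.z := fun u hu =>
      prime_not_dvd_of_coprime hpi dvd_rfl (hS u hu).mz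
    have lb : ∀ u ∈ T, ¬ (p : ℤ) ∣ u.b := fun u hu =>
      prime_not_dvd_of_coprime hpi dvd_rfl (hS u hu).mb
    have lam1 : ∀ u ∈ T, ∀ v ∈ T, (p : ℤ) ∣ l u - l v → (p : ℤ) ∣ u.b * v.z - v.b * u.z := by
      intro u hu v hv h
      obtain ⟨i, hi⟩ := hl u hu
      obtain ⟨j, hj⟩ := hl v hv
      obtain ⟨k, hk⟩ := h
      exact ⟨k * u.z * v.z - i * v.z + j * u.z, by
        linear_combination (-v.z) * hi + u.z * hj + u.z * v.z * hk⟩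
    have lam2 : ∀ u ∈ T, ∀ v ∈ T, (p : ℤ) ∣ u.b * v.z - v.b * u.z → (p : ℤ) ∣ l u - l v := by
      intro u hu v hv h
      obtain ⟨i, hi⟩ := hl u hu
      obtain ⟨j, hj⟩ := hl v hv
      obtain ⟨k, hk⟩ := h
      have : (p : ℤ) ∣ (u.z * v.z) * (l u - l v) := ⟨k + i * v.z - j * u.z, by
        linear_combination v.z * hi - u.z * hj + hk⟩
      refine (hpi.dvd_or_dvd this).resolve_left (fun h => ?_)
      exact (hpi.dvd_or_dvd h).elim (lz u hu) (lz v hv)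
    have ht0 : ∀ u ∈ T, ¬ (p : ℤ) ∣ t0 := by
      intro u hu h
      have h' := dvd_add (hS u hu).ht h
      rw [sub_add_cancel] at h'
      exact prime_not_dvd_of_coprime hpi dvd_rfl (hS u hu).mt h'
    have pairrel : ∀ u ∈ T1, ∀ v ∈ T1, ¬ (p : ℤ) ∣ l u - l v →
        (p : ℤ) ∣ 2 * κ' * u.b * v.b - 3 * t0 * κs' * u.z * v.z := by
      intro u hu v hv hn
      obtain ⟨r1, r2, -, -, r5, -⟩ := rel u (t1 hu) v (t1 hv)
      refine lam_rel p ρ κ' κs' (kk a1 a2 a3 a4 u v) (t u) (t v) t0 u.b v.b u.z v.z _ _ hpi ?_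
        (hS u (t1 hu)).ht (t3 u hu v hv) ((hS u (t1 hu)).cross_y (hS v (t1 hv)))
        ((hS u (t1 hu)).cross_b (hS v (t1 hv))) (by rw [r1, eκ]) (by rw [r2, eκs])
      intro hk
      apply hn
      apply lam2 u (t1 hu) v (t1 hv)
      rw [← r5]
      exact hk.mul_right _
    obtain ⟨T2, s1, s2, s3⟩ := two_class_int T1 l p (by
      intro a haT b hbT c hcT
      by_contra hcon
      push Not at hcon
      obtain ⟨n1, n2, n3⟩ := hcon
      obtain ⟨i, hi⟩ := pairrel a haT b hbT n1
      obtain ⟨j, hj⟩ := pairrel a haT c hcT n2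
      apply n3
      apply lam2 b (t1 hbT) c (t1 hcT)
      by_cases k6 : (p : ℤ) ∣ κ'
      · have k7 : ¬ (p : ℤ) ∣ κs' := fun h => k5 ⟨k6, h⟩
        have : (p : ℤ) ∣ (3 * t0 * κs' * a.z) * (b.b * c.z - c.b * b.z) := ⟨i * c.b - j * b.b, by
          linear_combination c.b * hi - b.b * hj⟩
        refine (hpi.dvd_or_dvd this).resolve_left (fun h => ?_)
        rcases hpi.dvd_or_dvd h with h | h
        · rcases hpi.dvd_or_dvd h with h | h
          · exact (hpi.dvd_or_dvd h).elim h3 (ht0 a (t1 haT))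
          · exact k7 h
        · exact lz a (t1 haT) h
      · have : (p : ℤ) ∣ (2 * κ' * a.b) * (b.b * c.z - c.b * b.z) := ⟨i * c.z - j * b.z, by
          linear_combination c.z * hi - b.z * hj⟩
        refine (hpi.dvd_or_dvd this).resolve_left (fun h => ?_)
        rcases hpi.dvd_or_dvd h with h | h
        · exact (hpi.dvd_or_dvd h).elim h2 k6
        · exact lb a (t1 haT) h)
    refine ⟨T2, s1.trans t1, by omega, Or.inr (Or.inr (Or.inl ⟨hΔ2, fun u hu v hv => ?_⟩))⟩
    have huT := t1 (s1 hu)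
    have hvT := t1 (s1 hv)
    have d1 := lam1 u huT v hvT (s3 u hu v hv)
    obtain ⟨-, -, r3, r4, r5, r6⟩ := rel u huT v hvT
    obtain ⟨iu, hiu⟩ := (dvd_pow_self (p : ℤ) three_ne_zero).trans (hS u huT).h1
    obtain ⟨iv, hiv⟩ := (dvd_pow_self (p : ℤ) three_ne_zero).trans (hS v hvT).h1
    obtain ⟨ju, hju⟩ := (dvd_pow_self (p : ℤ) three_ne_zero).trans (hS u huT).h2
    obtain ⟨jv, hjv⟩ := (dvd_pow_self (p : ℤ) three_ne_zero).trans (hS v hvT).h2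
    obtain ⟨τ, hτ⟩ := tt u huT v hvT
    obtain ⟨w, hw⟩ := d1
    have etu : t u = t v + p * τ := by linarith
    have d3 : (p : ℤ) ∣ u.c * v.z - v.c * u.z := by
      rw [etu] at hiu
      refine ⟨iu * v.z - iv * u.z + ρ * t v ^ 2 * w + ρ * (2 * t v * τ + p * τ ^ 2) * u.b * v.z, ?_⟩
      linear_combination v.z * hiu - u.z * hiv + ρ * t v ^ 2 * hw
    have d4 : (p : ℤ) ∣ v.b * u.y - u.b * v.y := by
      rw [etu] at hju
      refine ⟨ju * v.b - jv * u.b - ρ * t v ^ 3 * w +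
        ρ * (3 * t v ^ 2 * τ + 3 * t v * p * τ ^ 2 + p ^ 2 * τ ^ 3) * u.z * v.b, ?_⟩
      linear_combination v.b * hju - u.b * hjv - ρ * t v ^ 3 * hw
    have d2 : (p : ℤ) ∣ v.c * u.y - u.c * v.y := by
      obtain ⟨x3, hx3⟩ := d3
      rw [etu] at hju
      refine ⟨ju * v.c - jv * u.c - ρ * t v ^ 3 * x3 +
        ρ * (3 * t v ^ 2 * τ + 3 * t v * p * τ ^ 2 + p ^ 2 * τ ^ 3) * u.z * v.c, ?_⟩
      linear_combination v.c * hju - u.c * hjv - ρ * t v ^ 3 * hx3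
    unfold kk
    exact dvd_sub (dvd_sub (dvd_add (Dvd.dvd.mul_left ⟨w, hw⟩ _) (d4.mul_left _)) (d3.mul_left _))
      (d2.mul_left _)

lemma bezout4 (g1 g2 g3 g4 : ℤ)
    (h : ∀ p : ℕ, p.Prime → ¬ ((p : ℤ) ∣ g1 ∧ (p : ℤ) ∣ g2 ∧ (p : ℤ) ∣ g3 ∧ (p : ℤ) ∣ g4)) :
    ∃ a1 a2 a3 a4 : ℤ, a1 * g1 + a2 * g2 + a3 * g3 + a4 * g4 = 1 := by
  have hc : IsCoprime ((Int.gcd g1 g2 : ℕ) : ℤ) ((Int.gcd g3 g4 : ℕ) : ℤ) := by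
    rw [Nat.isCoprime_iff_coprime]
    by_contra hn
    obtain ⟨p, hp, d1, d2⟩ := Nat.Prime.not_coprime_iff_dvd.mp hn
    have e1 : (p : ℤ) ∣ ((Int.gcd g1 g2 : ℕ) : ℤ) := by exact_mod_cast d1
    have e2 : (p : ℤ) ∣ ((Int.gcd g3 g4 : ℕ) : ℤ) := by exact_mod_cast d2
    exact h p hp ⟨e1.trans (Int.gcd_dvd_left ..), e1.trans (Int.gcd_dvd_right ..),
      e2.trans (Int.gcd_dvd_left ..), e2.trans (Int.gcd_dvd_right ..)⟩
  obtain ⟨x, y, hxy⟩ := hc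
  rw [Int.gcd_eq_gcd_ab, Int.gcd_eq_gcd_ab] at hxy
  exact ⟨x * Int.gcdA g1 g2, x * Int.gcdB g1 g2, y * Int.gcdA g3 g4, y * Int.gcdB g3 g4, by
    linear_combination hxy⟩

/-- degenerate linear relation -/
lemma r3_zero (m : ℕ) (ρ t0 : ℤ) (t : Pt → ℤ) (S : Finset Pt) (g1 g2 g3 g4 : ℤ) (B C Y Z : ℝ)
    (hm : 0 < m) (hρ : IsCoprime (m : ℤ) ρ) (h30 : IsCoprime (m : ℤ) 30)
    (hS : ∀ v ∈ S, Slice m ρ t0 t v)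
    (hg : ∀ p : ℕ, p.Prime → ¬ ((p : ℤ) ∣ g1 ∧ (p : ℤ) ∣ g2 ∧ (p : ℤ) ∣ g3 ∧ (p : ℤ) ∣ g4))
    (hgv : ∀ v ∈ S, g1 * (v.b * v.y) + g2 * (v.b * v.z) + g3 * (v.c * v.y) + g4 * (v.c * v.z) = 0)
    (hb : ∀ v ∈ S, (v.b : ℝ) ≤ B ∧ (v.c : ℝ) ≤ C ∧ (v.y : ℝ) ≤ Y ∧ (v.z : ℝ) ≤ Z)
    (hB : 0 ≤ B) (hC : 0 ≤ C) (hY : 0 ≤ Y) (hZ : 0 ≤ Z)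
    (hinj : ∀ u ∈ S, ∀ v ∈ S, u.b = v.b → u.c = v.c → u.y = v.y → u.z = v.z → u = v)
    (hΔ : g1 * g4 - g2 * g3 = 0) :
    (S.card : ℝ) ≤ 2 + 4 * (B * C) / (m : ℝ) ^ 3 + 4 * (Y * Z) / (m : ℝ) ^ 3 := by
  classical
  obtain ⟨a1, a2, a3, a4, ha⟩ := bezout4 g1 g2 g3 g4 hg
  set S1 := S.filter (fun v => g3 * v.y + g4 * v.z = 0 ∧ g1 * v.y + g2 * v.z = 0) with hS1
  set S2 := S.filter (fun v => ¬ (g3 * v.y + g4 * v.z = 0 ∧ g1 * v.y + g2 * v.z = 0)) with hS2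
  have hadd : S1.card + S2.card = S.card := Finset.card_filter_add_card_filter_not _
  have m1 : ∀ v ∈ S1, v ∈ S ∧ (g3 * v.y + g4 * v.z = 0 ∧ g1 * v.y + g2 * v.z = 0) :=
    fun v hv => Finset.mem_filter.mp hv
  have m2 : ∀ v ∈ S2, v ∈ S ∧ (g2 * v.b + g4 * v.c = 0 ∧ g1 * v.b + g3 * v.c = 0) := by
    intro v hv
    obtain ⟨h1, h2⟩ := Finset.mem_filter.mp hv
    refine ⟨h1, ?_⟩
    have s := hS v h1
    obtain ⟨κ, κs, k, e⟩ := kap_exists g1 g2 g3 g4 v s.b0 s.z0 s.y0 s.bc s.yz (hgv v h1)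
    rw [hΔ, neg_zero] at e
    rcases mul_eq_zero.mp e with e | e
    · exact absurd ⟨by rw [k.e1, e, zero_mul], by rw [k.e2, e, zero_mul, neg_zero]⟩ h2
    · exact ⟨by rw [k.e3, e, zero_mul], by rw [k.e4, e, zero_mul, neg_zero]⟩
  have b1 := slice_same_yz m ρ t0 t S1 B C (by exact_mod_cast hm) hρ
    (h30.of_isCoprime_of_dvd_right ⟨10, by norm_num⟩) (fun v hv => hS v (m1 v hv).1)
    (fun v hv => (hb v (m1 v hv).1).1) (fun v hv => (hb v (m1 v hv).1).2.1)
    (fun u hu v hv => hinj u (m1 u hu).1 v (m1 v hv).1) (by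
      intro u hu v hv
      obtain ⟨hu1, u3, u1⟩ := m1 u hu
      obtain ⟨hv1, v3, v1⟩ := m1 v hv
      have su := hS u hu1
      have sv := hS v hv1
      apply coprime_pair_eq u.y u.z v.y v.z su.y0 sv.y0 su.yz sv.yz
      linear_combination (-(u.y * v.z - v.y * u.z)) * ha + a1 * (v.z * u1 - u.z * v1) +
        a2 * (u.y * v1 - v.y * u1) + a3 * (v.z * u3 - u.z * v3) + a4 * (u.y * v3 - v.y * u3)) hB hC
  have b2 := slice_same_bc m ρ t0 t S2 Y Z (by exact_mod_cast hm) hρ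
    (h30.of_isCoprime_of_dvd_right ⟨15, by norm_num⟩) (fun v hv => hS v (m2 v hv).1)
    (fun v hv => (hb v (m2 v hv).1).2.2.1) (fun v hv => (hb v (m2 v hv).1).2.2.2)
    (fun u hu v hv => hinj u (m2 u hu).1 v (m2 v hv).1) (by
      intro u hu v hv
      obtain ⟨hu1, u2, u1⟩ := m2 u hu
      obtain ⟨hv1, v2, v1⟩ := m2 v hv
      have su := hS u hu1
      have sv := hS v hv1
      apply coprime_pair_eq u.b u.c v.b v.c su.b0 sv.b0 su.bc sv.bc
      linear_combination (-(u.b * v.c - v.b * u.c)) * ha + a1 * (v.c * u1 - u.c * v1) +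
        a3 * (u.b * v1 - v.b * u1) + a2 * (v.c * u2 - u.c * v2) + a4 * (u.b * v2 - v.b * u2)) hY hZ
  have : (S.card : ℝ) = S1.card + S2.card := by rw [← hadd]; push_cast; rfl
  rw [this]
  simp only [Int.cast_natCast] at b1 b2
  linarith

lemma r3_partition (m : ℕ) (hm : Squarefree m) (g1 g2 g3 g4 a1 a2 a3 a4 : ℤ) (T : Finset Pt)
    (h : ∀ p ∈ m.primeFactors, R3Q g1 g2 g3 g4 a1 a2 a3 a4 p T) :
    ∃ m1 m2 m3 m5 : ℕ, m1 * m2 * m3 * m5 = m ∧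
      (m1 = 1 ∨ (g1 ≠ 0 ∧ g2 ≠ 0 ∧ g3 ≠ 0 ∧ g4 ≠ 0)) ∧
      (m3 : ℤ) ^ 2 * (m5 : ℤ) ^ 6 ∣ g1 * g4 - g2 * g3 ∧ (m1 : ℤ) ^ 2 ∣ g1 * g4 - 25 * g2 * g3 ∧
      ∀ u ∈ T, ∀ v ∈ T, (m1 : ℤ) * (m2 : ℤ) ^ 2 * m3 ∣ kk a1 a2 a3 a4 u v := by
  classical
  set q1 : ℕ → Prop := fun p => (p : ℤ) ^ 2 ∣ g1 * g4 - 25 * g2 * g3 ∧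
    (¬ (p : ℤ) ∣ g1 ∧ ¬ (p : ℤ) ∣ g2 ∧ ¬ (p : ℤ) ∣ g3 ∧ ¬ (p : ℤ) ∣ g4) ∧
    ∀ u ∈ T, ∀ v ∈ T, (p : ℤ) ∣ kk a1 a2 a3 a4 u v with hq1
  set q2 : ℕ → Prop := fun p => ∀ u ∈ T, ∀ v ∈ T, (p : ℤ) ^ 2 ∣ kk a1 a2 a3 a4 u v with hq2
  set q3 : ℕ → Prop := fun p => (p : ℤ) ^ 2 ∣ g1 * g4 - g2 * g3 ∧
    ∀ u ∈ T, ∀ v ∈ T, (p : ℤ) ∣ kk a1 a2 a3 a4 u v with hq3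
  set F := m.primeFactors with hF
  set F1 := F.filter q1
  set G1 := F.filter (fun p => ¬ q1 p)
  set F2 := G1.filter q2
  set G2 := G1.filter (fun p => ¬ q2 p)
  set F3 := G2.filter q3
  set F5 := G2.filter (fun p => ¬ q3 p)
  have hprod : (∏ p ∈ F1, p) * (∏ p ∈ F2, p) * (∏ p ∈ F3, p) * (∏ p ∈ F5, p) = m := by
    have e1 : (∏ p ∈ F1, p) * (∏ p ∈ G1, p) = ∏ p ∈ F, p :=
      Finset.prod_filter_mul_prod_filter_not F q1 (fun p => p)
    have e2 : (∏ p ∈ F2, p) * (∏ p ∈ G2, p) = ∏ p ∈ G1, p :=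
      Finset.prod_filter_mul_prod_filter_not G1 q2 (fun p => p)
    have e3 : (∏ p ∈ F3, p) * (∏ p ∈ F5, p) = ∏ p ∈ G2, p :=
      Finset.prod_filter_mul_prod_filter_not G2 q3 (fun p => p)
    rw [mul_assoc, mul_assoc, e3, e2, e1, hF, Nat.prod_primeFactors_of_squarefree hm]
  have s1 : ∀ p ∈ F1, p.Prime ∧ q1 p := fun p hp =>
    ⟨Nat.prime_of_mem_primeFactors (Finset.mem_filter.mp hp).1, (Finset.mem_filter.mp hp).2⟩
  have sG1 : ∀ p ∈ G1, p ∈ F ∧ ¬ q1 p := fun p hp => Finset.mem_filter.mp hp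
  have s2 : ∀ p ∈ F2, p.Prime ∧ q2 p := fun p hp =>
    ⟨Nat.prime_of_mem_primeFactors (sG1 p (Finset.mem_filter.mp hp).1).1, (Finset.mem_filter.mp hp).2⟩
  have sG2 : ∀ p ∈ G2, p ∈ F ∧ ¬ q1 p ∧ ¬ q2 p := fun p hp =>
    ⟨(sG1 p (Finset.mem_filter.mp hp).1).1, (sG1 p (Finset.mem_filter.mp hp).1).2,
      (Finset.mem_filter.mp hp).2⟩
  have s3 : ∀ p ∈ F3, p.Prime ∧ q3 p := fun p hp =>
    ⟨Nat.prime_of_mem_primeFactors (sG2 p (Finset.mem_filter.mp hp).1).1, (Finset.mem_filter.mp hp).2⟩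
  have s5 : ∀ p ∈ F5, p.Prime ∧ (p : ℤ) ^ 6 ∣ g1 * g4 - g2 * g3 := by
    intro p hp
    obtain ⟨hp1, hp2⟩ := Finset.mem_filter.mp hp
    obtain ⟨k0, k1, k2⟩ := sG2 p hp1
    refine ⟨Nat.prime_of_mem_primeFactors k0, ?_⟩
    rcases h p k0 with h | h | h | h
    · exact absurd h k1
    · exact absurd h k2
    · exact absurd h hp2
    · exact h
  have hsq := hm
  rw [← hprod] at hsq
  obtain ⟨c4, hsq, -⟩ := Nat.squarefree_mul_iff.mp hsq
  obtain ⟨c3, hsq, -⟩ := Nat.squarefree_mul_iff.mp hsq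
  obtain ⟨c2, -, -⟩ := Nat.squarefree_mul_iff.mp hsq
  refine ⟨_, _, _, _, hprod, ?_, ?_, ?_, ?_⟩
  · by_cases he : F1 = ∅
    · left; rw [he]; simp
    · right
      obtain ⟨p, hp⟩ := Finset.nonempty_iff_ne_empty.mpr he
      obtain ⟨-, -, ⟨n1, n2, n3, n4⟩, -⟩ := s1 p hp
      refine ⟨?_, ?_, ?_, ?_⟩ <;> rintro rfl
      · exact n1 (dvd_zero _)
      · exact n2 (dvd_zero _)
      · exact n3 (dvd_zero _)
      · exact n4 (dvd_zero _)
  · apply IsCoprime.mul_dvd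
    · apply IsCoprime.pow
      rw [Nat.isCoprime_iff_coprime]
      exact c4.coprime_dvd_left (dvd_mul_left _ _)
    · exact prod_pow_dvd F3 (fun p hp => (s3 p hp).1) 2 _ (fun p hp => (s3 p hp).2.1)
    · exact prod_pow_dvd F5 (fun p hp => (s5 p hp).1) 6 _ (fun p hp => (s5 p hp).2)
  · exact prod_pow_dvd F1 (fun p hp => (s1 p hp).1) 2 _ (fun p hp => (s1 p hp).2.1)
  · intro u hu v hv
    have d1 := prod_pow_dvd F1 (fun p hp => (s1 p hp).1) 1 (kk a1 a2 a3 a4 u v)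
      (fun p hp => by rw [pow_one]; exact (s1 p hp).2.2.2 u hu v hv)
    have d2 := prod_pow_dvd F2 (fun p hp => (s2 p hp).1) 2 (kk a1 a2 a3 a4 u v)
      (fun p hp => (s2 p hp).2 u hu v hv)
    have d3 := prod_pow_dvd F3 (fun p hp => (s3 p hp).1) 1 (kk a1 a2 a3 a4 u v)
      (fun p hp => by rw [pow_one]; exact (s3 p hp).2.2 u hu v hv)
    rw [pow_one] at d1 d3
    have k2 := Nat.isCoprime_iff_coprime.mpr c2
    have k3 := Nat.isCoprime_iff_coprime.mpr c3
    rw [Nat.cast_mul] at k3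
    refine IsCoprime.mul_dvd (IsCoprime.mul_left k3.of_mul_left_left k3.of_mul_left_right.pow_left)
      (IsCoprime.mul_dvd k2.pow_right d1 d2) d3

lemma r3_mulbound (g1 g4 I n C Z B Y : ℝ) (hn : 0 ≤ n) (hI : 0 ≤ I) (hC : 0 ≤ C) (hZ : 0 ≤ Z)
    (h1 : |g1| * I * n ≤ 4 * (C * Z)) (h4 : |g4| * I * n ≤ 4 * (B * Y)) :
    n ^ 2 * I ^ 2 * |g1 * g4| ≤ 16 * (B * C * Y * Z) := by
  have := mul_le_mul h1 h4 (by positivity) (by positivity)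
  rw [abs_mul]
  calc _ = |g1| * I * n * (|g4| * I * n) := by ring
    _ ≤ _ := this
    _ = _ := by ring

lemma r3_close (T : Finset Pt) (g1 g2 g3 g4 κ κs a1 a2 a3 a4 : ℤ) (I : ℤ) (B C Y Z : ℝ)
    (h2 : 2 ≤ T.card) (hI : 0 < I)
    (hb : ∀ v ∈ T, (0 < v.b ∧ 0 < v.c ∧ 0 < v.y ∧ 0 < v.z) ∧
      ((v.b : ℝ) ≤ B ∧ (v.c : ℝ) ≤ C ∧ (v.y : ℝ) ≤ Y ∧ (v.z : ℝ) ≤ Z))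
    (hB : 0 ≤ B) (hC : 0 ≤ C) (hY : 0 ≤ Y) (hZ : 0 ≤ Z)
    (hcop : ∀ v ∈ T, IsCoprime v.b v.c ∧ IsCoprime v.y v.z)
    (hinj : ∀ u ∈ T, ∀ v ∈ T, u.b = v.b → u.c = v.c → u.y = v.y → u.z = v.z → u = v)
    (hK : ∀ v ∈ T, Kap g1 g2 g3 g4 κ κs v) (hκ : κ ≠ 0)
    (hΔ : κ * κs = -(g1 * g4 - g2 * g3)) (ha : a1 * g1 + a2 * g2 + a3 * g3 + a4 * g4 = 1)
    (hk : ∀ u ∈ T, ∀ v ∈ T, I ∣ kk a1 a2 a3 a4 u v) :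
    (T.card : ℝ) ^ 2 * (I : ℝ) ^ 2 * |((g1 * g4 - g2 * g3 : ℤ) : ℝ)| ≤ 1664 * (B * C * Y * Z) ∧
    (T.card : ℝ) ^ 2 * (I : ℝ) ^ 2 * |((g1 * g4 - 25 * g2 * g3 : ℤ) : ℝ)| ≤ 1664 * (B * C * Y * Z) := by
  have rel := fun u (hu : u ∈ T) v (hv : v ∈ T) => kap_rel hκ hΔ ha (hK u hu) (hK v hv)
  have hI0 : (0 : ℝ) < I := by exact_mod_cast hI
  have hn1 : (2 : ℝ) ≤ T.card := by exact_mod_cast h2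
  have kkI : ∀ u ∈ T, ∀ v ∈ T, u ≠ v → (I : ℝ) ≤ |(kk a1 a2 a3 a4 u v : ℝ)| := by
    intro u hu v hv huv
    have h0 : kk a1 a2 a3 a4 u v ≠ 0 := by
      intro h0
      obtain ⟨r1, r2, -⟩ := rel u hu v hv
      rw [h0, mul_zero] at r1 r2
      obtain ⟨e1, e2⟩ := coprime_pair_eq u.y u.z v.y v.z (hb u hu).1.2.2.1 (hb v hv).1.2.2.1
        (hcop u hu).2 (hcop v hv).2 r1
      obtain ⟨e3, e4⟩ := coprime_pair_eq u.b u.c v.b v.c (hb u hu).1.1 (hb v hv).1.1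
        (hcop u hu).1 (hcop v hv).1 (by rw [r2, neg_zero])
      exact huv (hinj u hu v hv e3 e4 e1 e2)
    have := Int.le_of_dvd (abs_pos.mpr h0) ((dvd_abs _ _).mpr (hk u hu v hv))
    exact_mod_cast this
  have gen : ∀ (c z : Pt → ℤ) (C Z : ℝ) (g : ℤ), (∀ v ∈ T, 0 < c v ∧ (c v : ℝ) ≤ C) →
      (∀ v ∈ T, 0 < z v ∧ (z v : ℝ) ≤ Z) →
      (∀ u ∈ T, ∀ v ∈ T, |kk a1 a2 a3 a4 u v * g| = |c u * z v - c v * z u|) →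
      |(g : ℝ)| * I * ((T.card : ℝ) - 1) ≤ 4 * (C * Z) := by
    intro c z C Z g hc hz he
    obtain ⟨u, hu, v, hv, huv, hcl⟩ := close_pair T (fun s => (c s : ℝ)) (fun s => (z s : ℝ)) C Z h2
      (fun s hs => ⟨by exact_mod_cast (hc s hs).1, (hc s hs).2⟩)
      (fun s hs => ⟨by exact_mod_cast (hz s hs).1, (hz s hs).2⟩)
    refine le_trans ?_ hcl
    have e := he u hu v hv
    have e' : |(kk a1 a2 a3 a4 u v : ℝ) * g| = |(c u : ℝ) * z v - c v * z u| := by exact_mod_cast e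
    rw [← e', abs_mul]
    have := kkI u hu v hv huv
    have hh : 0 ≤ (T.card : ℝ) - 1 := by linarith
    calc |(g : ℝ)| * I * ((T.card : ℝ) - 1) ≤ |(g : ℝ)| * |(kk a1 a2 a3 a4 u v : ℝ)| * ((T.card : ℝ) - 1) := by
          gcongr
      _ = _ := by ring
  have b1 := gen (fun v => v.c) (fun v => v.z) C Z g1 (fun v hv => ⟨(hb v hv).1.2.1, (hb v hv).2.2.1⟩)
    (fun v hv => ⟨(hb v hv).1.2.2.2, (hb v hv).2.2.2.2⟩) (fun u hu v hv => by
      rw [(rel u hu v hv).2.2.1, abs_neg])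
  have b2 := gen (fun v => v.c) (fun v => v.y) C Y g2 (fun v hv => ⟨(hb v hv).1.2.1, (hb v hv).2.2.1⟩)
    (fun v hv => ⟨(hb v hv).1.2.2.1, (hb v hv).2.2.2.1⟩) (fun u hu v hv => by
      rw [(rel u hu v hv).2.2.2.1]; congr 1; ring)
  have b3 := gen (fun v => v.b) (fun v => v.z) B Z g3 (fun v hv => ⟨(hb v hv).1.1, (hb v hv).2.1⟩)
    (fun v hv => ⟨(hb v hv).1.2.2.2, (hb v hv).2.2.2.2⟩) (fun u hu v hv => by
      rw [(rel u hu v hv).2.2.2.2.1])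
  have b4 := gen (fun v => v.b) (fun v => v.y) B Y g4 (fun v hv => ⟨(hb v hv).1.1, (hb v hv).2.1⟩)
    (fun v hv => ⟨(hb v hv).1.2.2.1, (hb v hv).2.2.2.1⟩) (fun u hu v hv => by
      rw [(rel u hu v hv).2.2.2.2.2, abs_sub_comm])
  have hh : 0 ≤ (T.card : ℝ) - 1 := by linarith
  have p1 := r3_mulbound g1 g4 I ((T.card : ℝ) - 1) C Z B Y hh hI0.le hC hZ b1 b4
  have p2 := r3_mulbound g2 g3 I ((T.card : ℝ) - 1) C Y B Z hh hI0.le hC hY b2 b3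
  have hq : (T.card : ℝ) ^ 2 ≤ 4 * ((T.card : ℝ) - 1) ^ 2 := by nlinarith
  have fin : ∀ x : ℝ, |x| ≤ |(g1 : ℝ) * g4| + 25 * |(g2 : ℝ) * g3| →
      (T.card : ℝ) ^ 2 * (I : ℝ) ^ 2 * |x| ≤ 1664 * (B * C * Y * Z) := by
    intro x hx
    calc (T.card : ℝ) ^ 2 * (I : ℝ) ^ 2 * |x| ≤ (4 * ((T.card : ℝ) - 1) ^ 2) * (I : ℝ) ^ 2 *
          (|(g1 : ℝ) * g4| + 25 * |(g2 : ℝ) * g3|) := by gcongr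
      _ = 4 * (((T.card : ℝ) - 1) ^ 2 * (I : ℝ) ^ 2 * |(g1 : ℝ) * g4|) +
          100 * (((T.card : ℝ) - 1) ^ 2 * (I : ℝ) ^ 2 * |(g2 : ℝ) * g3|) := by ring
      _ ≤ 4 * (16 * (B * C * Y * Z)) + 100 * (16 * (B * C * Z * Y)) := by linarith
      _ = _ := by ring
  constructor
  · apply fin
    push_cast
    have := abs_sub ((g1 : ℝ) * g4) ((g2 : ℝ) * g3)
    have := abs_nonneg ((g2 : ℝ) * g3)
    linarith
  · apply fin
    push_cast
    have := abs_sub ((g1 : ℝ) * g4) (25 * (g2 : ℝ) * g3)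
    rw [show 25 * (g2 : ℝ) * g3 = 25 * ((g2 : ℝ) * g3) by ring, abs_mul 25, abs_of_pos (by norm_num : (0:ℝ) < 25)] at this
    rwa [show 25 * (g2 : ℝ) * g3 = 25 * ((g2 : ℝ) * g3) by ring]

/-- the exceptional data attached to a linear relation `g` -/
def R3D (g1 g2 g3 g4 : ℤ) (m : ℕ) (N W : ℝ) : Prop :=
  ∃ m1 m2 m3 m5 : ℕ, m1 * m2 * m3 * m5 = m ∧ (g1 ≠ 0 ∧ g2 ≠ 0 ∧ g3 ≠ 0 ∧ g4 ≠ 0) ∧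
    g1 * g4 - g2 * g3 ≠ 0 ∧
    (m3 : ℤ) ^ 2 * (m5 : ℤ) ^ 6 ∣ g1 * g4 - g2 * g3 ∧ (m1 : ℤ) ^ 2 ∣ g1 * g4 - 25 * g2 * g3 ∧
    N ^ 2 * ((m1 : ℝ) * (m2 : ℝ) ^ 2 * m3) ^ 2 * |((g1 * g4 - g2 * g3 : ℤ) : ℝ)| ≤ W ∧
    N ^ 2 * ((m1 : ℝ) * (m2 : ℝ) ^ 2 * m3) ^ 2 * |((g1 * g4 - 25 * g2 * g3 : ℤ) : ℝ)| ≤ W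

lemma r3_e1 (N W m m2 m3 m5 : ℝ) (Δ : ℝ) (h2 : 1 ≤ m2) (h3 : 1 ≤ m3) (h5 : 1 ≤ m5) (hW : 0 ≤ W)
    (hN : 0 ≤ N) (hm : m2 * m3 * m5 = m) (hΔ : m3 ^ 2 * m5 ^ 6 ≤ Δ)
    (h : N ^ 2 * (m2 ^ 2 * m3) ^ 2 * Δ ≤ 1664 * W) : N ≤ 41 * (√W / m ^ 2) := by
  have hm0 : 0 < m := by rw [← hm]; positivity
  have h1 : (N * m ^ 2) ^ 2 ≤ 1664 * W := by
    refine le_trans ?_ h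
    calc (N * m ^ 2) ^ 2 = N ^ 2 * (m2 ^ 4 * m3 ^ 4 * m5 ^ 4) := by rw [← hm]; ring
      _ ≤ N ^ 2 * (m2 ^ 4 * m3 ^ 4 * m5 ^ 6) := by
        gcongr 1
        gcongr 1
        exact pow_le_pow_right₀ h5 (by norm_num)
      _ = N ^ 2 * (m2 ^ 2 * m3) ^ 2 * (m3 ^ 2 * m5 ^ 6) := by ring
      _ ≤ _ := by gcongr
  have h2 : N * m ^ 2 ≤ 41 * √W := by
    apply le_of_sq_le_sq _ (by positivity)
    rw [mul_pow 41, Real.sq_sqrt hW]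
    linarith
  rw [← mul_div_assoc, le_div_iff₀ (by positivity)]
  exact h2

lemma r3_slice (D ε : ℝ) (hD : 0 < D) (hε : 0 < ε) : ∃ K : ℝ, 1 ≤ K ∧
    ∀ (P : ℝ) (m : ℕ) (ρ t0 : ℤ) (t : Pt → ℤ) (S : Finset Pt) (g1 g2 g3 g4 : ℤ) (B C Y Z : ℝ),
      1 ≤ P → Squarefree m → IsCoprime (m : ℤ) ρ → IsCoprime (m : ℤ) 30 →
      (∀ v ∈ S, Slice m ρ t0 t v) →
      (∀ p : ℕ, p.Prime → ¬ ((p : ℤ) ∣ g1 ∧ (p : ℤ) ∣ g2 ∧ (p : ℤ) ∣ g3 ∧ (p : ℤ) ∣ g4)) →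
      (∀ v ∈ S, g1 * (v.b * v.y) + g2 * (v.b * v.z) + g3 * (v.c * v.y) + g4 * (v.c * v.z) = 0) →
      (∀ v ∈ S, (v.b : ℝ) ≤ B ∧ (v.c : ℝ) ≤ C ∧ (v.y : ℝ) ≤ Y ∧ (v.z : ℝ) ≤ Z) →
      0 ≤ B → 0 ≤ C → 0 ≤ Y → 0 ≤ Z →
      (∀ u ∈ S, ∀ v ∈ S, u.b = v.b → u.c = v.c → u.y = v.y → u.z = v.z → u = v) →
      (m : ℝ) ≤ P ^ D → |((g1 * g4 - g2 * g3 : ℤ) : ℝ)| ≤ P ^ D →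
      (S.card : ℝ) ≤ K * P ^ ε * (1 + B * C / (m : ℝ) ^ 3 + Y * Z / (m : ℝ) ^ 3 +
        √(B * C * Y * Z) / (m : ℝ) ^ 2) ∨
      R3D g1 g2 g3 g4 m S.card (K * P ^ ε * (B * C * Y * Z)) := by
  classical
  obtain ⟨K1, hK1, k1⟩ := int_divisor_bound (ε / (4 * D)) (by positivity)
  obtain ⟨K2, hK2, k2⟩ := pow_omega_le 4 (ε / (4 * D)) (by positivity)
  have hK12 : 1 ≤ K1 * K2 := one_le_mul_of_one_le_of_one_le hK1 hK2
  have hKsq : K1 * K2 ≤ (K1 * K2) ^ 2 := le_self_pow₀ hK12 (by norm_num)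
  refine ⟨1664 * (K1 * K2) ^ 2, by linarith, ?_⟩
  intro P m ρ t0 t S g1 g2 g3 g4 B C Y Z hP hm hρ h30 hS hg hgv hb hB hC hY hZ hinj hmP hΔP
  have hP0 : 0 < P := by linarith
  have hm0 : 0 < m := Nat.pos_of_ne_zero hm.ne_zero
  have hm0' : (0 : ℝ) < m := by exact_mod_cast hm0
  have hPe : 1 ≤ P ^ (ε / 2) := Real.one_le_rpow hP (by positivity)
  have ePP : P ^ ε = (P ^ (ε / 2)) ^ 2 := by rw [← Real.rpow_natCast, ← Real.rpow_mul hP0.le]; norm_num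
  have hPe2 : P ^ (ε / 2) ≤ P ^ ε := by rw [ePP]; exact le_self_pow₀ hPe (by norm_num)
  have x1 : 0 ≤ B * C / (m : ℝ) ^ 3 := by positivity
  have x2 : 0 ≤ Y * Z / (m : ℝ) ^ 3 := by positivity
  have x3 : 0 ≤ √(B * C * Y * Z) / (m : ℝ) ^ 2 := by positivity
  by_cases hΔ : g1 * g4 - g2 * g3 = 0
  · left
    have := r3_zero m ρ t0 t S g1 g2 g3 g4 B C Y Z hm0 hρ h30 hS hg hgv hb hB hC hY hZ hinj hΔ
    rw [mul_div_assoc 4 (B * C), mul_div_assoc 4 (Y * Z)] at this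
    have h4 : 4 ≤ 1664 * (K1 * K2) ^ 2 * P ^ ε := by
      have : 1 ≤ (K1 * K2) ^ 2 * P ^ ε := one_le_mul_of_one_le_of_one_le (by linarith) (by linarith)
      linarith
    calc (S.card : ℝ) ≤ 4 * (1 + B * C / (m : ℝ) ^ 3 + Y * Z / (m : ℝ) ^ 3 +
        √(B * C * Y * Z) / (m : ℝ) ^ 2) := by linarith
      _ ≤ _ := by gcongr
  obtain ⟨a1, a2, a3, a4, ha⟩ := bezout4 g1 g2 g3 g4 hg
  have hkap : ∀ v : Pt, ∃ κ κs : ℤ, v ∈ S → (Kap g1 g2 g3 g4 κ κs v ∧ κ * κs = -(g1 * g4 - g2 * g3)) := by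
    intro v
    by_cases hv : v ∈ S
    · have s := hS v hv
      obtain ⟨κ, κs, h⟩ := kap_exists g1 g2 g3 g4 v s.b0 s.z0 s.y0 s.bc s.yz (hgv v hv)
      exact ⟨κ, κs, fun _ => h⟩
    · exact ⟨0, 0, fun h => absurd h hv⟩
  choose κ κs hκ using hkap
  obtain ⟨T, hTS, hTc, hTκ⟩ := exists_big_class_of_image S κ _ le_rfl
  have himg := k1 (g1 * g4 - g2 * g3) (S.image κ) hΔ (by
    intro d hd
    obtain ⟨v, hv, rfl⟩ := Finset.mem_image.mp hd
    exact ⟨-κs v, by linarith [(hκ v hv).2]⟩)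
  have hpow : ∀ w : ℝ, 0 ≤ w → w ≤ P ^ D → w ^ (ε / (4 * D)) ≤ P ^ (ε / 4) := by
    intro w hw hwP
    calc w ^ (ε / (4 * D)) ≤ (P ^ D) ^ (ε / (4 * D)) := Real.rpow_le_rpow hw hwP (by positivity)
      _ = _ := by rw [← Real.rpow_mul hP0.le]; congr 1; field_simp
  have hR : ∃ T' ⊆ T, T.card ≤ 4 ^ m.primeFactors.card * T'.card ∧
      ∀ p ∈ m.primeFactors, R3Q g1 g2 g3 g4 a1 a2 a3 a4 (p : ℤ) T' := by
    apply coloring m.primeFactors (fun p T => R3Q g1 g2 g3 g4 a1 a2 a3 a4 (p : ℤ) T) 4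
      (fun p S T h => R3Q.mono h) T
    intro p hp U hU
    have hpp := Nat.prime_of_mem_primeFactors hp
    have hpi : Prime (p : ℤ) := Nat.prime_iff_prime_int.mp hpp
    have hpm : (p : ℤ) ∣ m := by exact_mod_cast Nat.dvd_of_mem_primeFactors hp
    have h30' := prime_not_dvd_of_coprime hpi hpm h30
    rcases U.eq_empty_or_nonempty with rfl | ⟨u0, hu0⟩
    · exact ⟨∅, subset_rfl, by simp, Or.inr (Or.inl (by simp))⟩
    have hκ0 : κ u0 ≠ 0 := by
      intro h
      have := (hκ u0 (hTS (hU hu0))).2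
      rw [h, zero_mul] at this
      apply hΔ; linarith
    apply r3_local p hpp (fun h => h30' (h.trans ⟨15, by norm_num⟩))
      (fun h => h30' (h.trans ⟨10, by norm_num⟩)) (fun h => h30' (h.trans ⟨6, by norm_num⟩)) ρ t0 t U
      g1 g2 g3 g4 (κ u0) (κs u0) a1 a2 a3 a4 (prime_not_dvd_of_coprime hpi hpm hρ)
      (fun v hv => (hS v (hTS (hU hv))).mono hpm) _ hκ0 (hκ u0 (hTS (hU hu0))).2 ha
    intro v hv
    have e1 : κ v = κ u0 := hTκ v (hU hv) u0 (hU hu0)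
    have e2 : κs v = κs u0 := by
      apply mul_left_cancel₀ hκ0
      rw [(hκ u0 (hTS (hU hu0))).2, ← (hκ v (hTS (hU hv))).2, e1]
    rw [← e1, ← e2]
    exact (hκ v (hTS (hU hv))).1
  obtain ⟨T', hT', hcT', hQ⟩ := hR
  obtain ⟨m1, m2, m3, m5, em, hm1, hd1, hd2, hd3⟩ := r3_partition m hm g1 g2 g3 g4 a1 a2 a3 a4 T' hQ
  set L : ℝ := K1 * K2 * P ^ (ε / 2) with hL
  have hL0 : 1 ≤ L := one_le_mul_of_one_le_of_one_le hK12 hPe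
  have hn : (S.card : ℝ) ≤ L * T'.card := by
    have c1 : (S.card : ℝ) ≤ (S.image κ).card * ((4 : ℝ) ^ m.primeFactors.card * T'.card) := by
      have : S.card ≤ (S.image κ).card * (4 ^ m.primeFactors.card * T'.card) :=
        hTc.trans (Nat.mul_le_mul_left _ hcT')
      exact_mod_cast this
    have c2 := k2 m hm0
    have c3 := hpow _ hm0'.le hmP
    have c4 := hpow _ (abs_nonneg _) hΔP
    have e : P ^ (ε / 2) = P ^ (ε / 4) * P ^ (ε / 4) := by rw [← Real.rpow_add hP0]; ring_nf
    push_cast at c2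
    calc (S.card : ℝ) ≤ _ := c1
      _ ≤ (K1 * P ^ (ε / 4)) * ((K2 * P ^ (ε / 4)) * T'.card) := by
        gcongr
        · refine himg.trans ?_
          gcongr
        · refine c2.trans ?_
          gcongr
      _ = _ := by rw [hL, e]; ring
  have hLK : L ≤ (K1 * K2) ^ 2 * P ^ ε := by
    rw [hL]; gcongr
  have hLL : L ^ 2 = (K1 * K2) ^ 2 * P ^ ε := by rw [hL, ePP]; ring
  rcases Nat.lt_or_ge T'.card 2 with hlt | hge
  · left
    have : (T'.card : ℝ) ≤ 1 := by exact_mod_cast (by omega : T'.card ≤ 1)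
    calc (S.card : ℝ) ≤ L * T'.card := hn
      _ ≤ L * 1 := by gcongr
      _ ≤ 1664 * ((K1 * K2) ^ 2 * P ^ ε) * 1 := by linarith
      _ ≤ 1664 * ((K1 * K2) ^ 2 * P ^ ε) * (1 + B * C / (m : ℝ) ^ 3 + Y * Z / (m : ℝ) ^ 3 +
        √(B * C * Y * Z) / (m : ℝ) ^ 2) := by
          gcongr; linarith
      _ = _ := by ring
  have hpos : 0 < m1 ∧ 0 < m2 ∧ 0 < m3 ∧ 0 < m5 := by
    refine ⟨?_, ?_, ?_, ?_⟩ <;> rw [Nat.pos_iff_ne_zero] <;> rintro rfl <;> simp at em <;> omega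
  obtain ⟨q1, q2, q3, q5⟩ := hpos
  obtain ⟨u0, hu0⟩ : T'.Nonempty := Finset.card_pos.mp (by omega)
  have hsub : ∀ v ∈ T', v ∈ S := fun v hv => hTS (hT' hv)
  have hκ0 : κ u0 ≠ 0 := by
    intro h
    have := (hκ u0 (hsub u0 hu0)).2
    rw [h, zero_mul] at this
    apply hΔ; linarith
  obtain ⟨f1, f2⟩ := r3_close T' g1 g2 g3 g4 (κ u0) (κs u0) a1 a2 a3 a4 ((m1 : ℤ) * (m2 : ℤ) ^ 2 * m3)
    B C Y Z hge (by positivity)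
    (fun v hv => ⟨⟨(hS v (hsub v hv)).b0, (hS v (hsub v hv)).c0, (hS v (hsub v hv)).y0,
      (hS v (hsub v hv)).z0⟩, hb v (hsub v hv)⟩) hB hC hY hZ
    (fun v hv => ⟨(hS v (hsub v hv)).bc, (hS v (hsub v hv)).yz⟩)
    (fun u hu v hv => hinj u (hsub u hu) v (hsub v hv))
    (by
      intro v hv
      have e1 : κ v = κ u0 := hTκ v (hT' hv) u0 (hT' hu0)
      have e2 : κs v = κs u0 := by
        apply mul_left_cancel₀ hκ0
        rw [(hκ u0 (hsub u0 hu0)).2, ← (hκ v (hsub v hv)).2, e1]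
      rw [← e1, ← e2]
      exact (hκ v (hsub v hv)).1) hκ0 (hκ u0 (hsub u0 hu0)).2 ha hd3
  have ecast : (((m1 : ℤ) * (m2 : ℤ) ^ 2 * m3 : ℤ) : ℝ) = (m1 : ℝ) * (m2 : ℝ) ^ 2 * m3 := by push_cast; rfl
  rw [ecast] at f1 f2
  have hW : 0 ≤ B * C * Y * Z := by positivity
  rcases hm1 with hm1 | hm1
  · left
    have hΔr : (m3 : ℝ) ^ 2 * (m5 : ℝ) ^ 6 ≤ |((g1 * g4 - g2 * g3 : ℤ) : ℝ)| := by
      have := Int.le_of_dvd (abs_pos.mpr hΔ) ((dvd_abs _ _).mpr hd1)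
      exact_mod_cast this
    have := r3_e1 T'.card (B * C * Y * Z) m m2 m3 m5 _ (by exact_mod_cast q2) (by exact_mod_cast q3)
      (by exact_mod_cast q5) hW (by positivity) (by rw [← em, hm1]; push_cast; ring) hΔr
      (by rw [hm1] at f1; simpa using f1)
    calc (S.card : ℝ) ≤ L * T'.card := hn
      _ ≤ L * (41 * (√(B * C * Y * Z) / (m : ℝ) ^ 2)) := by gcongr
      _ = 41 * L * (√(B * C * Y * Z) / (m : ℝ) ^ 2) := by ring
      _ ≤ 1664 * ((K1 * K2) ^ 2 * P ^ ε) * (1 + B * C / (m : ℝ) ^ 3 + Y * Z / (m : ℝ) ^ 3 +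
        √(B * C * Y * Z) / (m : ℝ) ^ 2) := by
          apply mul_le_mul <;> first | positivity | linarith
      _ = _ := by ring
  · right
    have sc : ∀ x : ℝ, (T'.card : ℝ) ^ 2 * ((m1 : ℝ) * (m2 : ℝ) ^ 2 * m3) ^ 2 * |x| ≤ 1664 * (B * C * Y * Z) →
        (S.card : ℝ) ^ 2 * ((m1 : ℝ) * (m2 : ℝ) ^ 2 * m3) ^ 2 * |x| ≤
          1664 * (K1 * K2) ^ 2 * P ^ ε * (B * C * Y * Z) := by
      intro x hx
      calc (S.card : ℝ) ^ 2 * ((m1 : ℝ) * (m2 : ℝ) ^ 2 * m3) ^ 2 * |x| ≤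
          (L * T'.card) ^ 2 * ((m1 : ℝ) * (m2 : ℝ) ^ 2 * m3) ^ 2 * |x| := by gcongr
        _ = L ^ 2 * ((T'.card : ℝ) ^ 2 * ((m1 : ℝ) * (m2 : ℝ) ^ 2 * m3) ^ 2 * |x|) := by ring
        _ ≤ L ^ 2 * (1664 * (B * C * Y * Z)) := by gcongr
        _ = _ := by rw [hLL]; ring
    exact ⟨m1, m2, m3, m5, em, hm1, hΔ, hd1, hd2, sc _ f1, sc _ f2⟩

lemma mult_card (T : Finset ℤ) (d : ℤ) (R : ℝ) (hd : 0 < d) (hR : 0 ≤ R)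
    (h : ∀ x ∈ T, d ∣ x ∧ x ≠ 0 ∧ |(x : ℝ)| ≤ R) : (T.card : ℝ) ≤ 2 * (R / d) := by
  classical
  have hd' : (0 : ℝ) < d := by exact_mod_cast hd
  have key : ∀ U : Finset ℤ, (∀ x ∈ U, d ∣ x ∧ 0 < x ∧ (x : ℝ) ≤ R) → (U.card : ℝ) ≤ R / d := by
    intro U hU
    have hi : (U.image (fun x => x / d)).card = U.card := by
      apply Finset.card_image_of_injOn
      intro x hx y hy hxy
      obtain ⟨i, rfl⟩ := (hU x hx).1
      obtain ⟨j, rfl⟩ := (hU y hy).1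
      simp only [Int.mul_ediv_cancel_left _ hd.ne'] at hxy
      rw [hxy]
    rw [← hi]
    apply box1_card _ _ (by positivity)
    intro k hk
    obtain ⟨x, hx, rfl⟩ := Finset.mem_image.mp hk
    obtain ⟨⟨i, hi⟩, h2, h3⟩ := hU x hx
    rw [hi, Int.mul_ediv_cancel_left _ hd.ne']
    constructor
    · rw [hi] at h2
      exact pos_of_mul_pos_right h2 hd.le
    · rw [le_div_iff₀ hd']
      rw [hi] at h3
      push_cast at h3
      linarith
  have h1 := key (T.filter (fun x => 0 < x)) (by
    intro x hx
    obtain ⟨a, b⟩ := Finset.mem_filter.mp hx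
    obtain ⟨c1, c2, c3⟩ := h x a
    exact ⟨c1, b, (le_abs_self _).trans c3⟩)
  have h2 := key ((T.filter (fun x => ¬ 0 < x)).image (fun x => -x)) (by
    intro x hx
    obtain ⟨y, hy, rfl⟩ := Finset.mem_image.mp hx
    obtain ⟨a, b⟩ := Finset.mem_filter.mp hy
    obtain ⟨c1, c2, c3⟩ := h y a
    refine ⟨(dvd_neg).mpr c1, by omega, ?_⟩
    push_cast
    exact (neg_le_abs _).trans c3)
  rw [Finset.card_image_of_injective _ neg_injective] at h2
  have h3 : (T.filter (fun x => 0 < x)).card + (T.filter (fun x => ¬ 0 < x)).card = T.card :=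
    Finset.card_filter_add_card_filter_not _
  have : (T.card : ℝ) = (T.filter (fun x => 0 < x)).card + (T.filter (fun x => ¬ 0 < x)).card := by
    rw [← h3]; push_cast; rfl
  linarith

lemma mult_card0 (T : Finset ℤ) (d : ℤ) (R : ℝ) (hd : 0 < d) (hR : 0 ≤ R)
    (h : ∀ x ∈ T, d ∣ x ∧ |(x : ℝ)| ≤ R) : (T.card : ℝ) ≤ 1 + 2 * (R / d) := by
  have h1 := mult_card (T.erase 0) d R hd hR (by
    intro x hx
    obtain ⟨a, b⟩ := Finset.mem_erase.mp hx
    exact ⟨(h x b).1, a, (h x b).2⟩)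
  have h2 : T.card ≤ (T.erase 0).card + 1 := by
    have := Finset.pred_card_le_card_erase (s := T) (a := (0 : ℤ))
    omega
  have : (T.card : ℝ) ≤ (T.erase 0).card + 1 := by exact_mod_cast h2
  linarith

open Polynomial in
lemma phi_roots (p : ℕ) (hp : p.Prime) (ρ g1 g2 g3 g4 : ℤ) (hρ : ¬ (p : ℤ) ∣ ρ)
    (hg : ¬ ((p : ℤ) ∣ g1 ∧ (p : ℤ) ∣ g2 ∧ (p : ℤ) ∣ g3 ∧ (p : ℤ) ∣ g4)) (T : Finset ℤ)
    (hT : ∀ t ∈ T, (p : ℤ) ∣ g3 * ρ ^ 2 * t ^ 5 + g1 * ρ * t ^ 3 + g4 * ρ * t ^ 2 + g2) :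
    (T.image (fun t : ℤ => (t : ZMod p))).card ≤ 5 := by
  haveI : Fact p.Prime := ⟨hp⟩
  have hz : ∀ a : ℤ, (a : ZMod p) = 0 ↔ (p : ℤ) ∣ a := fun a => ZMod.intCast_zmod_eq_zero_iff_dvd a p
  set F : (ZMod p)[X] := C ((g3 : ZMod p) * ρ ^ 2) * X ^ 5 + C ((g1 : ZMod p) * ρ) * X ^ 3 +
    C ((g4 : ZMod p) * ρ) * X ^ 2 + C (g2 : ZMod p) with hF
  have hr : (ρ : ZMod p) ≠ 0 := fun h => hρ ((hz ρ).mp h)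
  have hF0 : F ≠ 0 := by
    intro h
    have c5 : F.coeff 5 = 0 := by rw [h]; simp
    have c3 : F.coeff 3 = 0 := by rw [h]; simp
    have c2 : F.coeff 2 = 0 := by rw [h]; simp
    have c0 : F.coeff 0 = 0 := by rw [h]; simp
    simp only [hF, coeff_add, coeff_C_mul, coeff_X_pow, coeff_C] at c5 c3 c2 c0
    norm_num at c5 c3 c2 c0
    simp only [hr, or_false] at c5 c3 c2
    exact hg ⟨(hz _).mp c3, (hz _).mp c0, (hz _).mp c5, (hz _).mp c2⟩
  have hdeg : F.natDegree ≤ 5 := by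
    rw [hF]; compute_degree
  calc (T.image (fun t : ℤ => (t : ZMod p))).card ≤ F.roots.toFinset.card := by
        apply Finset.card_le_card
        intro x hx
        obtain ⟨t, ht, rfl⟩ := Finset.mem_image.mp hx
        rw [Multiset.mem_toFinset, mem_roots hF0, IsRoot.def, hF]
        have := (hz _).mpr (hT t ht)
        push_cast at this
        simp only [eval_add, eval_mul, eval_C, eval_pow, eval_X]
        linear_combination this
    _ ≤ Multiset.card F.roots := Multiset.toFinset_card_le _
    _ ≤ F.natDegree := card_roots' F
    _ ≤ 5 := hdeg

lemma t0_count (m : ℕ) (hm : Squarefree m) (ρ g1 g2 g3 g4 : ℤ) (hρ : IsCoprime (m : ℤ) ρ)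
    (hg : ∀ p : ℕ, p.Prime → ¬ ((p : ℤ) ∣ g1 ∧ (p : ℤ) ∣ g2 ∧ (p : ℤ) ∣ g3 ∧ (p : ℤ) ∣ g4))
    (T : Finset ℤ) (hb : ∀ t ∈ T, 0 ≤ t ∧ t < m)
    (hT : ∀ t ∈ T, (m : ℤ) ∣ g3 * ρ ^ 2 * t ^ 5 + g1 * ρ * t ^ 3 + g4 * ρ * t ^ 2 + g2) :
    T.card ≤ 5 ^ m.primeFactors.card := by
  classical
  obtain ⟨T', h1, h2, h3⟩ := coloring m.primeFactors
    (fun p T => ∀ s ∈ T, ∀ s' ∈ T, (p : ℤ) ∣ s - s') 5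
    (fun p S T hTS h s hs s' hs' => h s (hTS hs) s' (hTS hs')) T (by
      intro p hp S hS
      have hpp := Nat.prime_of_mem_primeFactors hp
      have hpi : Prime (p : ℤ) := Nat.prime_iff_prime_int.mp hpp
      have hpm : (p : ℤ) ∣ m := by exact_mod_cast Nat.dvd_of_mem_primeFactors hp
      obtain ⟨S', s1, s2, s3⟩ := exists_big_class_of_image S (fun t : ℤ => (t : ZMod p)) 5
        (phi_roots p hpp ρ g1 g2 g3 g4 (prime_not_dvd_of_coprime hpi hpm hρ) (hg p hpp) S
          (fun t ht => hpm.trans (hT t (hS ht))))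
      refine ⟨S', s1, s2, fun s hs s' hs' => ?_⟩
      have := s3 s hs s' hs'
      rw [← ZMod.intCast_zmod_eq_zero_iff_dvd]
      push_cast
      exact sub_eq_zero.mpr this)
  have : T'.card ≤ 1 := by
    rw [Finset.card_le_one]
    intro a ha b hb'
    have hd : (m : ℤ) ^ 1 ∣ a - b := sqf_pow_dvd m hm 1 _ (fun p hp => by
      rw [pow_one]; exact h3 p hp a ha b hb')
    rw [pow_one] at hd
    have b1 := hb a (h1 ha)
    have b2 := hb b (h1 hb')
    have := Int.eq_zero_of_abs_lt_dvd hd (by rw [abs_lt]; constructor <;> linarith)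
    linarith
  calc T.card ≤ _ := h2
    _ ≤ 5 ^ m.primeFactors.card * 1 := Nat.mul_le_mul_left _ this
    _ = _ := by ring

/-- number of `g` with given `Δ` and `E` -/
lemma g_count (ε : ℝ) (hε : 0 < ε) : ∃ K : ℝ, 1 ≤ K ∧
    ∀ (Q : ℝ) (Δ E : ℤ) (X : Finset (Fin 4 → ℤ)), 1 ≤ Q → |(Δ : ℝ)| ≤ Q → |(E : ℝ)| ≤ Q →
      (∀ g ∈ X, (g 0 ≠ 0 ∧ g 1 ≠ 0 ∧ g 2 ≠ 0 ∧ g 3 ≠ 0) ∧ g 0 * g 3 - g 1 * g 2 = Δ ∧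
        g 0 * g 3 - 25 * g 1 * g 2 = E) → (X.card : ℝ) ≤ K * Q ^ ε := by
  classical
  obtain ⟨K1, hK1, k1⟩ := int_divisor_bound (ε / 2) (by positivity)
  refine ⟨(K1 * (26 : ℝ) ^ (ε / 2)) ^ 2, one_le_pow₀ (one_le_mul_of_one_le_of_one_le hK1
    (Real.one_le_rpow (by norm_num) (by positivity))), ?_⟩
  intro Q Δ E X hQ hΔ hE hX
  rcases X.eq_empty_or_nonempty with rfl | ⟨g0, hg0⟩
  · simp; positivity
  have hQ0 : 0 < Q := by linarith
  have e1 : ∀ g ∈ X, 24 * (g 0 * g 3) = 25 * Δ - E := by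
    intro g hg; linarith [(hX g hg).2.1, (hX g hg).2.2]
  have e2 : ∀ g ∈ X, 24 * (g 1 * g 2) = Δ - E := by
    intro g hg; linarith [(hX g hg).2.1, (hX g hg).2.2]
  have n1 : 25 * Δ - E ≠ 0 := by
    rw [← e1 g0 hg0]
    exact mul_ne_zero (by norm_num) (mul_ne_zero (hX g0 hg0).1.1 (hX g0 hg0).1.2.2.2)
  have n2 : Δ - E ≠ 0 := by
    rw [← e2 g0 hg0]
    exact mul_ne_zero (by norm_num) (mul_ne_zero (hX g0 hg0).1.2.1 (hX g0 hg0).1.2.2.1)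
  have hi : (X.image (fun g => (g 0, g 1))).card = X.card := by
    apply Finset.card_image_of_injOn
    intro g hg h hh he
    simp only [Prod.mk.injEq] at he
    have a1 := e1 g hg
    have a2 := e1 h hh
    have a3 := e2 g hg
    have a4 := e2 h hh
    obtain ⟨⟨z0, z1, -, -⟩, -⟩ := hX g hg
    have f3 : g 3 = h 3 := by
      apply mul_left_cancel₀ z0
      rw [← he.1] at a2
      linarith
    have f2 : g 2 = h 2 := by
      apply mul_left_cancel₀ z1
      rw [← he.2] at a4
      linarith
    funext i
    fin_cases i
    · exact he.1
    · exact he.2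
    · exact f2
    · exact f3
  have hsub : X.image (fun g => (g 0, g 1)) ⊆ (X.image (fun g => g 0)) ×ˢ (X.image (fun g => g 1)) := by
    intro x hx
    obtain ⟨g, hg, rfl⟩ := Finset.mem_image.mp hx
    exact Finset.mem_product.mpr ⟨Finset.mem_image_of_mem _ hg, Finset.mem_image_of_mem _ hg⟩
  have hc : (X.card : ℝ) ≤ (X.image (fun g => g 0)).card * (X.image (fun g => g 1)).card := by
    have := Finset.card_le_card hsub
    rw [hi, Finset.card_product] at this
    exact_mod_cast this
  have d1 := k1 _ (X.image (fun g => g 0)) n1 (by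
    intro d hd
    obtain ⟨g, hg, rfl⟩ := Finset.mem_image.mp hd
    exact ⟨24 * g 3, by rw [← e1 g hg]; ring⟩)
  have d2 := k1 _ (X.image (fun g => g 1)) n2 (by
    intro d hd
    obtain ⟨g, hg, rfl⟩ := Finset.mem_image.mp hd
    exact ⟨24 * g 2, by rw [← e2 g hg]; ring⟩)
  have c1 : |((25 * Δ - E : ℤ) : ℝ)| ≤ 26 * Q := by
    push_cast
    have := abs_le.mp hΔ
    have := abs_le.mp hE
    rw [abs_le]; constructor <;> linarith
  have c2 : |((Δ - E : ℤ) : ℝ)| ≤ 26 * Q := by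
    push_cast
    have := abs_le.mp hΔ
    have := abs_le.mp hE
    rw [abs_le]; constructor <;> linarith
  have eQ : (26 * Q) ^ (ε / 2) = 26 ^ (ε / 2) * Q ^ (ε / 2) := Real.mul_rpow (by norm_num) hQ0.le
  have ePP : Q ^ ε = (Q ^ (ε / 2)) ^ 2 := by rw [← Real.rpow_natCast, ← Real.rpow_mul hQ0.le]; norm_num
  calc (X.card : ℝ) ≤ _ := hc
    _ ≤ (K1 * (26 * Q) ^ (ε / 2)) * (K1 * (26 * Q) ^ (ε / 2)) := by
      gcongr
      · exact d1.trans (by gcongr)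
      · exact d2.trans (by gcongr)
    _ = _ := by rw [eQ, ePP]; ring

/-- the body of `R3D` -/
def R3E (g1 g2 g3 g4 : ℤ) (m : ℕ) (N W : ℝ) (m1 m2 m3 m5 : ℕ) : Prop :=
  m1 * m2 * m3 * m5 = m ∧ (g1 ≠ 0 ∧ g2 ≠ 0 ∧ g3 ≠ 0 ∧ g4 ≠ 0) ∧
    g1 * g4 - g2 * g3 ≠ 0 ∧
    (m3 : ℤ) ^ 2 * (m5 : ℤ) ^ 6 ∣ g1 * g4 - g2 * g3 ∧ (m1 : ℤ) ^ 2 ∣ g1 * g4 - 25 * g2 * g3 ∧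
    N ^ 2 * ((m1 : ℝ) * (m2 : ℝ) ^ 2 * m3) ^ 2 * |((g1 * g4 - g2 * g3 : ℤ) : ℝ)| ≤ W ∧
    N ^ 2 * ((m1 : ℝ) * (m2 : ℝ) ^ 2 * m3) ^ 2 * |((g1 * g4 - 25 * g2 * g3 : ℤ) : ℝ)| ≤ W

lemma r3_arith (w m1 m2 m3 m5 m : ℝ) (h1 : 1 ≤ m1) (h2 : 1 ≤ m2) (h3 : 1 ≤ m3) (h5 : 1 ≤ m5)
    (hw : 0 ≤ w) (hm : m1 * m2 * m3 * m5 = m) :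
    (2 * (w / (m1 * m2 ^ 2 * m3) ^ 2 / (m3 ^ 2 * m5 ^ 6))) *
      (1 + 2 * (w / (m1 * m2 ^ 2 * m3) ^ 2 / m1 ^ 2)) ≤ 4 * (w / m ^ 2 + w ^ 2 / m ^ 6) := by
  have e1 : w / (m1 * m2 ^ 2 * m3) ^ 2 / (m3 ^ 2 * m5 ^ 6) ≤ w / m ^ 2 := by
    rw [div_div]
    apply div_le_div_of_nonneg_left hw (by rw [← hm]; positivity)
    rw [← hm]
    calc (m1 * m2 * m3 * m5) ^ 2 = m1 ^ 2 * m2 ^ 2 * m3 ^ 2 * m5 ^ 2 := by ring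
      _ ≤ m1 ^ 2 * m2 ^ 4 * m3 ^ 4 * m5 ^ 6 := by
        gcongr <;> first | assumption | norm_num
      _ = _ := by ring
  have e2 : (w / (m1 * m2 ^ 2 * m3) ^ 2 / (m3 ^ 2 * m5 ^ 6)) * (w / (m1 * m2 ^ 2 * m3) ^ 2 / m1 ^ 2) ≤
      w ^ 2 / m ^ 6 := by
    rw [div_div, div_div, div_mul_div_comm, ← sq]
    apply div_le_div_of_nonneg_left (by positivity) (by rw [← hm]; positivity)
    rw [← hm]
    calc (m1 * m2 * m3 * m5) ^ 6 = m1 ^ 6 * m2 ^ 6 * m3 ^ 6 * m5 ^ 6 := by ring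
      _ ≤ m1 ^ 6 * m2 ^ 8 * m3 ^ 6 * m5 ^ 6 := by
        gcongr <;> first | assumption | norm_num
      _ = _ := by ring
  have : 0 ≤ w / m ^ 2 := by positivity
  linarith

lemma r3_level (ε : ℝ) (hε : 0 < ε) : ∃ K : ℝ, 1 ≤ K ∧
    ∀ (Q N W : ℝ) (m : ℕ) (ρ : ℤ) (X : Finset (ℤ × (Fin 4 → ℤ))), 1 ≤ Q → 1 ≤ N → 0 ≤ W → W ≤ Q →
      (m : ℝ) ≤ Q → Squarefree m → IsCoprime (m : ℤ) ρ →
      (∀ x ∈ X, 0 ≤ x.1 ∧ x.1 < m) →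
      (∀ x ∈ X, ∀ p : ℕ, p.Prime → ¬ ((p : ℤ) ∣ x.2 0 ∧ (p : ℤ) ∣ x.2 1 ∧ (p : ℤ) ∣ x.2 2 ∧ (p : ℤ) ∣ x.2 3)) →
      (∀ x ∈ X, (m : ℤ) ∣ x.2 2 * ρ ^ 2 * x.1 ^ 5 + x.2 0 * ρ * x.1 ^ 3 + x.2 3 * ρ * x.1 ^ 2 + x.2 1) →
      (∀ x ∈ X, R3D (x.2 0) (x.2 1) (x.2 2) (x.2 3) m N W) →
      (X.card : ℝ) ≤ K * Q ^ ε * (W / (N ^ 2 * (m : ℝ) ^ 2) + W ^ 2 / (N ^ 4 * (m : ℝ) ^ 6)) := by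
  classical
  obtain ⟨K1, hK1, k1⟩ := divisor_bound (ε / 6) (by positivity)
  obtain ⟨K2, hK2, k2⟩ := pow_omega_le 5 (ε / 6) (by positivity)
  obtain ⟨K3, hK3, k3⟩ := g_count (ε / 6) (by positivity)
  refine ⟨4 * (K1 ^ 4 * K2 * K3), ?_, ?_⟩
  · have : 1 ≤ K1 ^ 4 * K2 * K3 := one_le_mul_of_one_le_of_one_le (one_le_mul_of_one_le_of_one_le (one_le_pow₀ hK1) hK2) hK3
    linarith
  intro Q N W m ρ X hQ hN hW hWQ hmQ hm hρ hX0 hXg hXm hXD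
  have hQ0 : 0 < Q := by linarith
  have hm0 : 0 < m := Nat.pos_of_ne_zero hm.ne_zero
  have hm1 : (1 : ℝ) ≤ m := by exact_mod_cast hm0
  have hN0 : 0 < N := by linarith
  set q := Q ^ (ε / 6) with hq
  have hq1 : 1 ≤ q := Real.one_le_rpow hQ (by positivity)
  have eq6 : Q ^ ε = q ^ 6 := by rw [hq, ← Real.rpow_natCast, ← Real.rpow_mul hQ0.le]; norm_num
  have hmq : (m : ℝ) ^ (ε / 6) ≤ q := Real.rpow_le_rpow (by positivity) hmQ (by positivity)
  have hom : (5 : ℝ) ^ m.primeFactors.card ≤ K2 * q := by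
    have := k2 m hm0
    push_cast at this
    exact this.trans (by gcongr)
  have hdv : (m.divisors.card : ℝ) ≤ K1 * q := (k1 m hm0).trans (by gcongr)
  set bd : ℝ := 4 * (W / (N ^ 2 * (m : ℝ) ^ 2) + W ^ 2 / (N ^ 4 * (m : ℝ) ^ 6)) with hbd
  have hbd0 : 0 ≤ bd := by positivity
  set DD := m.divisors ×ˢ (m.divisors ×ˢ (m.divisors ×ˢ m.divisors)) with hDD
  have cov := card_le_cover_sum X DD
    (fun τ x => R3E (x.2 0) (x.2 1) (x.2 2) (x.2 3) m N W τ.1 τ.2.1 τ.2.2.1 τ.2.2.2) (by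
      intro x hx
      obtain ⟨m1, m2, m3, m5, h⟩ := hXD x hx
      refine ⟨(m1, m2, m3, m5), ?_, h⟩
      have e := h.1
      simp only [hDD, Finset.mem_product, Nat.mem_divisors]
      refine ⟨⟨⟨m2 * m3 * m5, by rw [← e]; ring⟩, hm0.ne'⟩, ⟨⟨m1 * m3 * m5, by rw [← e]; ring⟩, hm0.ne'⟩,
        ⟨⟨m1 * m2 * m5, by rw [← e]; ring⟩, hm0.ne'⟩, ⟨⟨m1 * m2 * m3, by rw [← e]; ring⟩, hm0.ne'⟩⟩)
    (fun _ => bd * (K3 * q * (K2 * q))) (by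
      rintro ⟨m1, m2, m3, m5⟩ -
      set Y := X.filter (fun x => R3E (x.2 0) (x.2 1) (x.2 2) (x.2 3) m N W m1 m2 m3 m5) with hY
      rcases Y.eq_empty_or_nonempty with hYe | ⟨y0, hy0⟩
      · rw [hYe]; simp; positivity
      have hYX : ∀ y ∈ Y, y ∈ X := fun y hy => (Finset.mem_filter.mp hy).1
      have hYE : ∀ y ∈ Y, R3E (y.2 0) (y.2 1) (y.2 2) (y.2 3) m N W m1 m2 m3 m5 :=
        fun y hy => (Finset.mem_filter.mp hy).2
      have em := (hYE y0 hy0).1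
      have hpos : 0 < m1 ∧ 0 < m2 ∧ 0 < m3 ∧ 0 < m5 := by
        refine ⟨?_, ?_, ?_, ?_⟩ <;> rw [Nat.pos_iff_ne_zero] <;> rintro rfl <;> simp at em <;> omega
      obtain ⟨q1, q2, q3, q5⟩ := hpos
      have q1' : (1 : ℝ) ≤ m1 := by exact_mod_cast q1
      have q2' : (1 : ℝ) ≤ m2 := by exact_mod_cast q2
      have q3' : (1 : ℝ) ≤ m3 := by exact_mod_cast q3
      have q5' : (1 : ℝ) ≤ m5 := by exact_mod_cast q5
      set I : ℝ := (m1 : ℝ) * (m2 : ℝ) ^ 2 * m3 with hI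
      have hI1 : 1 ≤ I := one_le_mul_of_one_le_of_one_le (one_le_mul_of_one_le_of_one_le q1' (one_le_pow₀ q2')) q3'
      set R : ℝ := W / N ^ 2 / I ^ 2 with hR
      have hRW : R ≤ W := by
        rw [hR, div_div]
        exact div_le_self hW (one_le_mul_of_one_le_of_one_le (one_le_pow₀ hN) (one_le_pow₀ hI1))
      have toR : ∀ x : ℝ, N ^ 2 * I ^ 2 * |x| ≤ W → |x| ≤ R := by
        intro x hx
        rw [hR, div_div, le_div_iff₀ (by positivity)]
        linarith
      set f1 : ℤ × (Fin 4 → ℤ) → ℤ := fun x => x.2 0 * x.2 3 - x.2 1 * x.2 2 with hf1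
      set f2 : ℤ × (Fin 4 → ℤ) → ℤ := fun x => x.2 0 * x.2 3 - 25 * x.2 1 * x.2 2 with hf2
      have c1 := mult_card (Y.image f1) ((m3 : ℤ) ^ 2 * (m5 : ℤ) ^ 6) R (by positivity) (by positivity) (by
        intro d hd
        obtain ⟨y, hy, rfl⟩ := Finset.mem_image.mp hd
        obtain ⟨-, -, a3, a4, a5, a6, a7⟩ := hYE y hy
        exact ⟨a4, a3, toR _ a6⟩)
      have c2 := mult_card0 (Y.image f2) ((m1 : ℤ) ^ 2) R (by positivity) (by positivity) (by
        intro d hd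
        obtain ⟨y, hy, rfl⟩ := Finset.mem_image.mp hd
        obtain ⟨-, -, a3, a4, a5, a6, a7⟩ := hYE y hy
        exact ⟨a5, toR _ a7⟩)
      have hc := card_le_fiber Y (fun y => (f1 y, f2 y)) ((Y.image f1) ×ˢ (Y.image f2))
        (fun s hs => Finset.mem_product.mpr ⟨Finset.mem_image_of_mem _ hs, Finset.mem_image_of_mem _ hs⟩)
        (K3 * q * (K2 * q)) (by
          rintro ⟨Δ, E⟩ hτ
          obtain ⟨ht1, ht2⟩ := Finset.mem_product.mp hτ
          obtain ⟨u, hu, hu'⟩ := Finset.mem_image.mp ht1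
          obtain ⟨v, hv, hv'⟩ := Finset.mem_image.mp ht2
          set V := Y.filter (fun y => (f1 y, f2 y) = (Δ, E)) with hV
          have hVY : ∀ y ∈ V, y ∈ Y ∧ f1 y = Δ ∧ f2 y = E := by
            intro y hy
            obtain ⟨h1, h2⟩ := Finset.mem_filter.mp hy
            exact ⟨h1, by simpa using h2⟩
          have hg := k3 Q Δ E (V.image (fun y => y.2)) hQ
            (by have e1 : f1 u = Δ := hu'; rw [← e1]; exact ((toR _ (hYE u hu).2.2.2.2.2.1).trans hRW).trans hWQ)
            (by have e2 : f2 v = E := hv'; rw [← e2]; exact ((toR _ (hYE v hv).2.2.2.2.2.2).trans hRW).trans hWQ) (by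
              intro g hg
              obtain ⟨y, hy, rfl⟩ := Finset.mem_image.mp hg
              obtain ⟨h1, h2, h3⟩ := hVY y hy
              exact ⟨(hYE y h1).2.1, h2, h3⟩)
          have hf := card_le_fiber V (fun y => y.2) (V.image (fun y => y.2))
            (fun s hs => Finset.mem_image_of_mem _ hs) (K2 * q) (by
              intro g hg
              obtain ⟨w, hw, rfl⟩ := Finset.mem_image.mp hg
              refine le_trans ?_ hom
              have hU : ∀ y ∈ V.filter (fun y => y.2 = w.2), y ∈ X ∧ y.2 = w.2 := fun y hy =>
                ⟨hYX y (hVY y (Finset.mem_filter.mp hy).1).1, (Finset.mem_filter.mp hy).2⟩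
              have := t0_count m hm ρ (w.2 0) (w.2 1) (w.2 2) (w.2 3) hρ
                (hXg w (hYX w (hVY w hw).1)) ((V.filter (fun y => y.2 = w.2)).image (fun y => y.1)) (by
                  intro t ht
                  obtain ⟨y, hy, rfl⟩ := Finset.mem_image.mp ht
                  exact hX0 y (hU y hy).1) (by
                  intro t ht
                  obtain ⟨y, hy, rfl⟩ := Finset.mem_image.mp ht
                  have := hXm y (hU y hy).1
                  rwa [(hU y hy).2] at this)
              rw [Finset.card_image_of_injOn (by
                intro a ha b hb hab
                exact Prod.ext hab ((hU a ha).2.trans (hU b hb).2.symm))] at this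
              exact_mod_cast this)
          calc (V.card : ℝ) ≤ _ := hf
            _ ≤ (K3 * q) * (K2 * q) := by gcongr)
      have ha := r3_arith (W / N ^ 2) m1 m2 m3 m5 m q1' q2' q3' q5' (by positivity) (by rw [← em]; push_cast; ring)
      have ebd : 4 * (W / N ^ 2 / (m : ℝ) ^ 2 + (W / N ^ 2) ^ 2 / (m : ℝ) ^ 6) = bd := by
        rw [hbd, div_div, div_pow, div_div]; ring_nf
      rw [ebd] at ha
      calc (Y.card : ℝ) ≤ _ := hc
        _ ≤ bd * (K3 * q * (K2 * q)) := by
          gcongr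
          rw [Finset.card_product]
          push_cast at c1 c2 ⊢
          refine le_trans (mul_le_mul c1 c2 (by positivity) (by positivity)) ha)
  rw [Finset.sum_const, nsmul_eq_mul, hDD] at cov
  simp only [Finset.card_product] at cov
  push_cast at cov
  calc (X.card : ℝ) ≤ _ := cov
    _ ≤ ((K1 * q) * ((K1 * q) * ((K1 * q) * (K1 * q)))) * (bd * (K3 * q * (K2 * q))) := by gcongr
    _ = _ := by rw [eq6, hbd]; ring

lemma log_levels (ε : ℝ) (hε : 0 < ε) : ∃ K : ℝ, 1 ≤ K ∧ ∀ n : ℕ, 1 ≤ n →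
    ((Nat.log 2 n + 1 : ℕ) : ℝ) ≤ K * (n : ℝ) ^ ε := by
  obtain ⟨K, hK, k⟩ := divisor_bound ε hε
  refine ⟨K, hK, fun n hn => ?_⟩
  have h := k (2 ^ Nat.log 2 n) Nat.one_le_two_pow
  rw [Nat.divisors_prime_pow Nat.prime_two, Finset.card_map, Finset.card_range] at h
  refine h.trans ?_
  have : ((2 ^ Nat.log 2 n : ℕ) : ℝ) ≤ n := by exact_mod_cast Nat.pow_log_le_self 2 (by omega)
  have h0 : (0 : ℝ) ≤ ((2 ^ Nat.log 2 n : ℕ) : ℝ) := Nat.cast_nonneg _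
  gcongr

lemma level_sum {β : Type*} [DecidableEq β] (X : Finset β) (n : β → ℕ) (M : ℕ) (n0 a b : ℝ) (hn0 : 1 ≤ n0)
    (ha : 0 ≤ a) (hb : 0 ≤ b) (hM : ∀ x ∈ X, n x ≤ M) (h0 : ∀ x ∈ X, n0 < n x)
    (hl : ∀ j : ℕ, ((X.filter (fun x => 2 ^ j ≤ n x)).card : ℝ) ≤
      a / ((2 : ℝ) ^ j) ^ 2 + b / ((2 : ℝ) ^ j) ^ 4) :
    ∑ x ∈ X, (n x : ℝ) ≤ ((Nat.log 2 M + 1 : ℕ) : ℝ) * (4 * a / n0 + 16 * b / n0 ^ 3) := by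
  have hn0' : 0 < n0 := by linarith
  rw [← Finset.sum_fiberwise_of_maps_to (s := X) (t := Finset.range (Nat.log 2 M + 1))
    (g := fun x => Nat.log 2 (n x)) (fun x hx => Finset.mem_range.mpr
      (Nat.lt_succ_of_le (Nat.log_mono_right (hM x hx))))]
  have : ∀ j ∈ Finset.range (Nat.log 2 M + 1), ∑ x ∈ X.filter (fun x => Nat.log 2 (n x) = j), (n x : ℝ) ≤
      4 * a / n0 + 16 * b / n0 ^ 3 := by
    intro j _
    have hpos : 0 ≤ 4 * a / n0 + 16 * b / n0 ^ 3 := by positivity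
    rcases (X.filter (fun x => Nat.log 2 (n x) = j)).eq_empty_or_nonempty with he | ⟨x0, hx0⟩
    · rw [he, Finset.sum_empty]; exact hpos
    have up : ∀ x ∈ X.filter (fun x => Nat.log 2 (n x) = j), (n x : ℝ) ≤ 2 * 2 ^ j := by
      intro x hx
      obtain ⟨h1, h2⟩ := Finset.mem_filter.mp hx
      have := Nat.lt_pow_succ_log_self (b := 2) (by norm_num) (n x)
      rw [h2] at this
      have h3 : ((n x : ℕ) : ℝ) ≤ ((2 ^ (j + 1) : ℕ) : ℝ) := by exact_mod_cast this.le
      refine h3.trans (le_of_eq ?_)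
      push_cast; ring
    have hj : n0 ≤ 2 * 2 ^ j := (h0 x0 (Finset.mem_filter.mp hx0).1).le.trans (up x0 hx0)
    have hc : ((X.filter (fun x => Nat.log 2 (n x) = j)).card : ℝ) ≤
        a / ((2 : ℝ) ^ j) ^ 2 + b / ((2 : ℝ) ^ j) ^ 4 := by
      refine le_trans ?_ (hl j)
      norm_cast
      apply Finset.card_le_card
      intro x hx
      obtain ⟨h1, h2⟩ := Finset.mem_filter.mp hx
      refine Finset.mem_filter.mpr ⟨h1, ?_⟩
      rw [← h2]
      apply Nat.pow_log_le_self
      have := h0 x h1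
      have h3 : (0 : ℝ) < n x := by linarith
      exact_mod_cast h3.ne'
    have hN : (0 : ℝ) < 2 ^ j := by positivity
    set N : ℝ := 2 ^ j
    calc _ ≤ ∑ x ∈ X.filter (fun x => Nat.log 2 (n x) = j), 2 * N := Finset.sum_le_sum up
      _ = ((X.filter (fun x => Nat.log 2 (n x) = j)).card : ℝ) * (2 * N) := by
        rw [Finset.sum_const, nsmul_eq_mul]
      _ ≤ (a / N ^ 2 + b / N ^ 4) * (2 * N) := by gcongr
      _ = 4 * a / (2 * N) + 16 * b / (2 * N) ^ 3 := by field_simp; ring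
      _ ≤ _ := by gcongr
  calc _ ≤ ∑ j ∈ Finset.range (Nat.log 2 M + 1), (4 * a / n0 + 16 * b / n0 ^ 3) := Finset.sum_le_sum this
    _ = _ := by rw [Finset.sum_const, nsmul_eq_mul, Finset.card_range]

lemma R3D.mono {g1 g2 g3 g4 : ℤ} {m : ℕ} {N N' W : ℝ} (h : R3D g1 g2 g3 g4 m N W) (h0 : 0 ≤ N') (hN : N' ≤ N) :
    R3D g1 g2 g3 g4 m N' W := by
  obtain ⟨m1, m2, m3, m5, h1, h2, h3, h4, h5, h6, h7⟩ := h
  refine ⟨m1, m2, m3, m5, h1, h2, h3, h4, h5, le_trans ?_ h6, le_trans ?_ h7⟩ <;> gcongr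

lemma R3D.le_W {g1 g2 g3 g4 : ℤ} {m : ℕ} {N W : ℝ} (h : R3D g1 g2 g3 g4 m N W) (hm : 0 < m) (h0 : 1 ≤ N) :
    N ≤ W := by
  obtain ⟨m1, m2, m3, m5, h1, h2, h3, h4, h5, h6, h7⟩ := h
  refine le_trans ?_ h6
  have hm' : m1 * m2 * m3 * m5 ≠ 0 := by omega
  have p1 : (1 : ℝ) ≤ m1 := by
    have : m1 ≠ 0 := by rintro rfl; simp at hm'
    exact_mod_cast Nat.one_le_iff_ne_zero.mpr this
  have p2 : (1 : ℝ) ≤ m2 := by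
    have : m2 ≠ 0 := by rintro rfl; simp at hm'
    exact_mod_cast Nat.one_le_iff_ne_zero.mpr this
  have p3 : (1 : ℝ) ≤ m3 := by
    have : m3 ≠ 0 := by rintro rfl; simp at hm'
    exact_mod_cast Nat.one_le_iff_ne_zero.mpr this
  have d := int_one_le_abs h3
  calc N ≤ N ^ 2 := le_self_pow₀ h0 (by norm_num)
    _ ≤ N ^ 2 * (((m1 : ℝ) * (m2 : ℝ) ^ 2 * m3) ^ 2 * |((g1 * g4 - g2 * g3 : ℤ) : ℝ)|) := by
      apply le_mul_of_one_le_right (by positivity)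
      apply one_le_mul_of_one_le_of_one_le _ d
      apply one_le_pow₀
      exact one_le_mul_of_one_le_of_one_le (one_le_mul_of_one_le_of_one_le p1 (one_le_pow₀ p2)) p3
    _ = _ := by ring

lemma abs_div_bound (g V X : ℝ) (hV : 0 < V) (h : |g| * V ≤ X) : |g| ≤ X / V := by
  rwa [le_div_iff₀ hV]

lemma det_bound (g1 g2 g3 g4 B C Y Z X : ℝ) (hB : 1 ≤ B) (hC : 1 ≤ C) (hY : 1 ≤ Y) (hZ : 1 ≤ Z)
    (h1 : |g1| * (B * Y) ≤ X) (h2 : |g2| * (B * Z) ≤ X) (h3 : |g3| * (C * Y) ≤ X)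
    (h4 : |g4| * (C * Z) ≤ X) : |g1 * g4 - g2 * g3| ≤ 2 * X ^ 2 := by
  have q1 : |g1| ≤ X := (le_mul_of_one_le_right (abs_nonneg _) (one_le_mul_of_one_le_of_one_le hB hY)).trans h1
  have q2 : |g2| ≤ X := (le_mul_of_one_le_right (abs_nonneg _) (one_le_mul_of_one_le_of_one_le hB hZ)).trans h2
  have q3 : |g3| ≤ X := (le_mul_of_one_le_right (abs_nonneg _) (one_le_mul_of_one_le_of_one_le hC hY)).trans h3
  have q4 : |g4| ≤ X := (le_mul_of_one_le_right (abs_nonneg _) (one_le_mul_of_one_le_of_one_le hC hZ)).trans h4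
  have hX : 0 ≤ X := (abs_nonneg _).trans q1
  calc |g1 * g4 - g2 * g3| ≤ |g1 * g4| + |g2 * g3| := abs_sub _ _
    _ = |g1| * |g4| + |g2| * |g3| := by rw [abs_mul, abs_mul]
    _ ≤ X * X + X * X := by gcongr
    _ = _ := by ring

lemma r3_list : ∃ K : ℝ, 1 ≤ K ∧
    ∀ (m : ℕ) (ρ t0 : ℤ) (t : Pt → ℤ) (B C Y Z w : ℝ), 0 < m →
      1 ≤ B → 1 ≤ C → 1 ≤ Y → 1 ≤ Z → 0 ≤ w → w ^ 3 = (B * C * Y * Z) ^ 2 →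
      ∃ L : Finset (Fin 4 → ℤ), (L.card : ℝ) ≤ K * (1 + w / (m : ℝ) ^ 2) ∧
        (∀ g ∈ L, (∀ p : ℕ, p.Prime → ¬ ((p : ℤ) ∣ g 0 ∧ (p : ℤ) ∣ g 1 ∧ (p : ℤ) ∣ g 2 ∧ (p : ℤ) ∣ g 3)) ∧
          |((g 0 * g 3 - g 1 * g 2 : ℤ) : ℝ)| ≤ 2 * (K * ((m : ℝ) ^ 3 * (1 + w / (m : ℝ) ^ 2))) ^ 2) ∧
        ∀ v, Slice m ρ t0 t v → ((v.b : ℝ) ≤ B ∧ (v.c : ℝ) ≤ C ∧ (v.y : ℝ) ≤ Y ∧ (v.z : ℝ) ≤ Z) →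
          ∃ g ∈ L, g 0 * (v.b * v.y) + g 1 * (v.b * v.z) + g 2 * (v.c * v.y) + g 3 * (v.c * v.z) = 0 := by
  obtain ⟨K, hK, k⟩ := siegel_slice (Fin 4) (by simp)
  refine ⟨K, hK, ?_⟩
  intro m ρ t0 t B C Y Z w hm hB hC hY hZ hw hw3
  have hm0' : (0 : ℝ) < m := by exact_mod_cast hm
  have hBp : 0 < B := by linarith
  have hCp : 0 < C := by linarith
  have hYp : 0 < Y := by linarith
  have hZp : 0 < Z := by linarith
  obtain ⟨L, l1, l2, l3⟩ := k m ![ρ * t0 ^ 3, 1, ρ ^ 2 * t0 ^ 5, ρ * t0 ^ 2]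
    ![3 * ρ * t0 ^ 2, 0, 5 * ρ ^ 2 * t0 ^ 4, 2 * ρ * t0] ![3 * ρ * t0, 0, 10 * ρ ^ 2 * t0 ^ 3, ρ]
    ![B * Y, B * Z, C * Y, C * Z] (w / (m : ℝ) ^ 2) hm (by
      intro i
      fin_cases i
      · show 0 < B * Y
        positivity
      · show 0 < B * Z
        positivity
      · show 0 < C * Y
        positivity
      · show 0 < C * Z
        positivity) (by positivity) (by
      simp only [Fintype.card_fin, Fin.prod_univ_four, Matrix.cons_val]
      apply le_of_eq
      rw [show (4 - 1 : ℕ) = 3 from rfl, div_pow, hw3]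
      field_simp)
  refine ⟨L, l1, ?_, ?_⟩
  · intro g hg
    refine ⟨?_, ?_⟩
    · rintro p hp ⟨p0, p1, p2, p3⟩
      obtain ⟨i, hi⟩ := (l2 g hg).1 p hp
      fin_cases i
      · exact hi p0
      · exact hi p1
      · exact hi p2
      · exact hi p3
    · have := (l2 g hg).2
      push_cast
      exact det_bound _ _ _ _ B C Y Z _ hB hC hY hZ (this 0) (this 1) (this 2) (this 3)
  · intro v s hb
    obtain ⟨g, hg, e⟩ := l3 ![v.b * v.y, v.b * v.z, v.c * v.y, v.c * v.z] (by
      have b0 : (0 : ℝ) < v.b := by exact_mod_cast s.b0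
      have c0 : (0 : ℝ) < v.c := by exact_mod_cast s.c0
      have y0 : (0 : ℝ) < v.y := by exact_mod_cast s.y0
      have z0 : (0 : ℝ) < v.z := by exact_mod_cast s.z0
      obtain ⟨h1, h2, h3, h4⟩ := hb
      intro i
      fin_cases i
      · show |((v.b * v.y : ℤ) : ℝ)| ≤ B * Y
        push_cast
        rw [abs_of_pos (by positivity)]
        gcongr
      · show |((v.b * v.z : ℤ) : ℝ)| ≤ B * Z
        push_cast
        rw [abs_of_pos (by positivity)]
        gcongr
      · show |((v.c * v.y : ℤ) : ℝ)| ≤ C * Y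
        push_cast
        rw [abs_of_pos (by positivity)]
        gcongr
      · show |((v.c * v.z : ℤ) : ℝ)| ≤ C * Z
        push_cast
        rw [abs_of_pos (by positivity)]
        gcongr) (by
      intro h
      simp only [Fin.sum_univ_four, Matrix.cons_val]
      intro q0 q1 q2
      have hΦ := taylor_fwd m (h 2 * ρ ^ 2) (h 0 * ρ) (h 3 * ρ) 0 (h 1) t0 (t v) s.ht
        (by convert q0 using 1; ring) (by convert q1 using 1; ring) (by convert q2 using 1; ring)
      have hφ := r3_phi s (h 0) (h 1) (h 2) (h 3)
      have := dvd_add hφ (hΦ.mul_left (v.b * v.z))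
      rwa [sub_add_cancel] at this)
    refine ⟨g, hg, ?_⟩
    simpa only [Fin.sum_univ_four, Matrix.cons_val] using e

lemma r3_size (K P m w W : ℝ) (hK : 1 ≤ K) (hP : 1 ≤ P) (hm1 : 1 ≤ m) (hm : m ≤ 10 * P) (hw : 0 ≤ w)
    (hW : W ≤ (10 * P) ^ 4) (hwW : w ^ 3 = W ^ 2) (hW1 : 1 ≤ W) :
    2 * (K * (m ^ 3 * (1 + w / m ^ 2))) ^ 2 ≤ (100 * K * P) ^ 10 := by
  have hwle : w ≤ W := by
    by_contra h
    push Not at h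
    have h1 : W ^ 3 < w ^ 3 := by gcongr
    have h2 : W ^ 2 ≤ W ^ 3 := pow_le_pow_right₀ hW1 (by norm_num)
    linarith
  have e : m ^ 3 * (1 + w / m ^ 2) = m ^ 3 + m * w := by field_simp
  have h10 : 1 ≤ 10 * P := by linarith
  have h1 : m ^ 3 + m * w ≤ 2 * (10 * P) ^ 5 := by
    calc m ^ 3 + m * w ≤ (10 * P) ^ 3 + (10 * P) * (10 * P) ^ 4 := by
          gcongr
          exact hwle.trans hW
      _ ≤ (10 * P) ^ 5 + (10 * P) * (10 * P) ^ 4 := by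
          gcongr
          norm_num
      _ = _ := by ring
  rw [e]
  calc 2 * (K * (m ^ 3 + m * w)) ^ 2 ≤ 2 * (K * (2 * (10 * P) ^ 5)) ^ 2 := by gcongr
    _ = 8 * K ^ 2 * (10 * P) ^ 10 := by ring
    _ ≤ 10 ^ 10 * K ^ 10 * (10 * P) ^ 10 := by
      gcongr
      · norm_num
      · norm_num
    _ = _ := by ring

lemma r3_m (ε : ℝ) (hε : 0 < ε) : ∃ K : ℝ, 1 ≤ K ∧
    ∀ (P : ℝ) (m : ℕ) (ρ : ℤ) (t : Pt → ℤ) (S : Finset Pt) (B C Y Z w n0 : ℝ),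
      1 ≤ P → Squarefree m → IsCoprime (m : ℤ) ρ → IsCoprime (m : ℤ) 30 →
      (∀ v ∈ S, ∀ t0, (m : ℤ) ∣ t v - t0 → Slice m ρ t0 t v) →
      (∀ v ∈ S, (v.b : ℝ) ≤ B ∧ (v.c : ℝ) ≤ C ∧ (v.y : ℝ) ≤ Y ∧ (v.z : ℝ) ≤ Z) →
      1 ≤ B → 1 ≤ C → 1 ≤ Y → 1 ≤ Z →
      (∀ u ∈ S, ∀ v ∈ S, u.b = v.b → u.c = v.c → u.y = v.y → u.z = v.z → u = v) →
      (m : ℝ) ≤ 10 * P → B ≤ 10 * P → C ≤ 10 * P → Y ≤ 10 * P → Z ≤ 10 * P →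
      0 ≤ w → w ^ 3 = (B * C * Y * Z) ^ 2 → 1 ≤ n0 →
      (S.card : ℝ) ≤ K * P ^ ε * ((m + w / m) * (n0 + B * C / (m : ℝ) ^ 3 + Y * Z / (m : ℝ) ^ 3 +
          √(B * C * Y * Z) / (m : ℝ) ^ 2) + B * C * Y * Z / (n0 * (m : ℝ) ^ 2) +
          (B * C * Y * Z) ^ 2 / (n0 ^ 3 * (m : ℝ) ^ 6)) := by
  classical
  obtain ⟨K1, hK1, k1⟩ := r3_list
  set ε1 := ε / 4 with hε1
  have hε1p : 0 < ε1 := by positivity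
  obtain ⟨K2, hK2, k2⟩ := r3_slice 10 ε1 (by norm_num) hε1p
  set δ := ε / (4 * (ε1 + 4)) with hδ
  have hδp : 0 < δ := by positivity
  obtain ⟨K3, hK3, k3⟩ := r3_level δ hδp
  obtain ⟨K4, hK4, k4⟩ := log_levels δ hδp
  have hq : (1 : ℝ) ≤ 100 * K1 := by linarith
  have c1 : 1 ≤ K2 ^ δ := Real.one_le_rpow hK2 hδp.le
  have c2 : 1 ≤ (100 * K1) ^ ε := Real.one_le_rpow hq hε.le
  refine ⟨16 * (K1 * K2 ^ 2 * K3 * K4 * (K2 ^ δ) ^ 2 * (100 * K1) ^ ε), ?_, ?_⟩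
  · have : 1 ≤ K1 * K2 ^ 2 * K3 * K4 * (K2 ^ δ) ^ 2 * (100 * K1) ^ ε := by
      refine one_le_mul_of_one_le_of_one_le (one_le_mul_of_one_le_of_one_le
        (one_le_mul_of_one_le_of_one_le (one_le_mul_of_one_le_of_one_le
        (one_le_mul_of_one_le_of_one_le hK1 (one_le_pow₀ hK2)) hK3) hK4) (one_le_pow₀ c1)) c2
    linarith
  intro P m ρ t S B C Y Z w n0 hP hm hρ h30 hS hb hB hC hY hZ hinj hmP hBP hCP hYP hZP hw hw3 hn0
  have hm0 : 0 < m := Nat.pos_of_ne_zero hm.ne_zero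
  have hm1 : (1 : ℝ) ≤ m := by exact_mod_cast hm0
  have hm0' : (0 : ℝ) < m := by exact_mod_cast hm0
  have hmz : (0 : ℤ) < m := by exact_mod_cast hm0
  have hn0' : 0 < n0 := by linarith
  set W := B * C * Y * Z with hWdef
  have hW1 : 1 ≤ W := one_le_mul_of_one_le_of_one_le (one_le_mul_of_one_le_of_one_le
    (one_le_mul_of_one_le_of_one_le hB hC) hY) hZ
  have hWP : W ≤ (10 * P) ^ 4 := by
    calc W ≤ (10 * P) * (10 * P) * (10 * P) * (10 * P) := by rw [hWdef]; gcongr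
      _ = _ := by ring
  set P' := 100 * K1 * P with hP'
  have hP1 : 1 ≤ P' := one_le_mul_of_one_le_of_one_le hq hP
  have hP10 : 10 * P ≤ P' := by rw [hP']; nlinarith
  have hP0 : 0 < P' := by linarith
  set Q := K2 * P' ^ (ε1 + 4) with hQ
  have hQ1 : 1 ≤ Q := one_le_mul_of_one_le_of_one_le hK2 (Real.one_le_rpow hP1 (by positivity))
  set W' := K2 * P' ^ ε1 * W with hW'
  have hPe1 : 1 ≤ P' ^ ε1 := Real.one_le_rpow hP1 hε1p.le
  have hW'0 : 0 ≤ W' := by positivity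
  have hW'Q : W' ≤ Q := by
    have hq0 : 0 ≤ K2 * P' ^ ε1 := by positivity
    have hq1 : Q = K2 * P' ^ ε1 * P' ^ (4 : ℝ) := by rw [hQ, Real.rpow_add hP0, ← mul_assoc]
    rw [hq1]
    refine mul_le_mul_of_nonneg_left ?_ hq0
    calc W ≤ (10 * P) ^ 4 := hWP
      _ ≤ P' ^ 4 := by gcongr
      _ = P' ^ (4 : ℝ) := by rw [← Real.rpow_natCast]; norm_num
  have hmQ : (m : ℝ) ≤ Q := by
    calc (m : ℝ) ≤ P' := hmP.trans hP10
      _ = P' ^ (1 : ℝ) := (Real.rpow_one _).symm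
      _ ≤ P' ^ (ε1 + 4) := Real.rpow_le_rpow_of_exponent_le hP1 (by linarith)
      _ ≤ _ := le_mul_of_one_le_left (by positivity) hK2
  have hQδ : Q ^ δ = K2 ^ δ * P' ^ ε1 := by
    rw [hQ, Real.mul_rpow (by linarith) (by positivity), ← Real.rpow_mul hP0.le]
    congr 2
    rw [hδ, hε1]; field_simp
  -- the list of (t0, g)
  choose L L1 L2 L3 using fun t0 : ℤ => k1 m ρ t0 t B C Y Z w hm0 hB hC hY hZ hw hw3
  set X : Finset (ℤ × (Fin 4 → ℤ)) := (Finset.Ico (0 : ℤ) m).biUnion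
    (fun t0 => (L t0).image (fun g => (t0, g))) with hX
  have memX : ∀ x, x ∈ X ↔ (0 ≤ x.1 ∧ x.1 < m) ∧ x.2 ∈ L x.1 := by
    rintro ⟨x1, x2⟩
    simp only [hX, Finset.mem_biUnion, Finset.mem_Ico, Finset.mem_image, Prod.mk.injEq]
    constructor
    · rintro ⟨a, ha, g, hg, rfl, rfl⟩
      exact ⟨ha, hg⟩
    · rintro ⟨ha, hg⟩
      exact ⟨x1, ha, x2, hg, rfl, rfl⟩
  have cardX : (X.card : ℝ) ≤ K1 * (m + w / m) := by
    have h1 : (X.card : ℝ) ≤ ∑ t0 ∈ Finset.Ico (0 : ℤ) m, (((L t0).image (fun g => (t0, g))).card : ℝ) := by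
      exact_mod_cast Finset.card_biUnion_le
    have h2 : ∑ t0 ∈ Finset.Ico (0 : ℤ) m, (((L t0).image (fun g => (t0, g))).card : ℝ) ≤
        ∑ t0 ∈ Finset.Ico (0 : ℤ) m, K1 * (1 + w / (m : ℝ) ^ 2) := by
      apply Finset.sum_le_sum
      intro t0 _
      refine le_trans ?_ (L1 t0)
      exact_mod_cast Finset.card_image_le
    refine (h1.trans h2).trans (le_of_eq ?_)
    rw [Finset.sum_const, nsmul_eq_mul, Int.card_Ico]
    simp only [sub_zero, Int.toNat_natCast]
    field_simp
  set R : ℤ × (Fin 4 → ℤ) → Pt → Prop := fun x v => (m : ℤ) ∣ t v - x.1 ∧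
    x.2 0 * (v.b * v.y) + x.2 1 * (v.b * v.z) + x.2 2 * (v.c * v.y) + x.2 3 * (v.c * v.z) = 0 with hR
  set n : ℤ × (Fin 4 → ℤ) → ℕ := fun x => (S.filter (R x)).card with hn
  have cov := card_le_cover_sum S X R (by
    intro v hv
    have hd : (m : ℤ) ∣ t v - t v % m := Int.dvd_self_sub_emod
    obtain ⟨g, hg, e⟩ := L3 (t v % m) v (hS v hv _ hd) (hb v hv)
    exact ⟨(t v % m, g), (memX _).mpr ⟨⟨Int.emod_nonneg _ hmz.ne', Int.emod_lt_of_pos _ hmz⟩, hg⟩, hd, e⟩)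
    (fun x => (n x : ℝ)) (fun x _ => le_refl _)
  set E := 1 + B * C / (m : ℝ) ^ 3 + Y * Z / (m : ℝ) ^ 3 + √W / (m : ℝ) ^ 2 with hE
  have alt : ∀ x ∈ X, (n x : ℝ) ≤ K2 * P' ^ ε1 * E ∨
      R3D (x.2 0) (x.2 1) (x.2 2) (x.2 3) m (n x) W' := by
    intro x hx
    obtain ⟨x1, x2⟩ := (memX x).mp hx
    obtain ⟨g1, g2⟩ := L2 x.1 x.2 x2
    refine k2 P' m ρ x.1 t (S.filter (R x)) (x.2 0) (x.2 1) (x.2 2) (x.2 3) B C Y Z hP1 hm hρ h30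
      (fun v hv => hS v (Finset.mem_filter.mp hv).1 _ (Finset.mem_filter.mp hv).2.1) g1
      (fun v hv => (Finset.mem_filter.mp hv).2.2) (fun v hv => hb v (Finset.mem_filter.mp hv).1)
      (by linarith) (by linarith) (by linarith) (by linarith)
      (fun u hu v hv => hinj u (Finset.mem_filter.mp hu).1 v (Finset.mem_filter.mp hv).1) ?_ ?_
    · have e10 : P' ^ (10 : ℝ) = P' ^ 10 := by rw [← Real.rpow_natCast]; norm_num
      rw [e10]
      exact (hmP.trans hP10).trans (le_self_pow₀ hP1 (by norm_num))
    · have e10 : P' ^ (10 : ℝ) = P' ^ 10 := by rw [← Real.rpow_natCast]; norm_num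
      rw [e10]
      exact g2.trans (r3_size K1 P m w W hK1 hP hm1 hmP hw hWP hw3 hW1)
  set X1 := X.filter (fun x => (n x : ℝ) ≤ K2 * P' ^ ε1 * E ∨ (n x : ℝ) ≤ n0) with hX1
  set X2 := X.filter (fun x => ¬ ((n x : ℝ) ≤ K2 * P' ^ ε1 * E ∨ (n x : ℝ) ≤ n0)) with hX2
  have hE0 : 0 ≤ E := by positivity
  have sum1 : ∑ x ∈ X1, (n x : ℝ) ≤ K1 * (m + w / m) * (K2 * P' ^ ε1 * E + n0) := by
    calc ∑ x ∈ X1, (n x : ℝ) ≤ ∑ x ∈ X1, (K2 * P' ^ ε1 * E + n0) := by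
          apply Finset.sum_le_sum
          intro x hx
          have : 0 ≤ K2 * P' ^ ε1 * E := by positivity
          rcases (Finset.mem_filter.mp hx).2 with h | h <;> linarith
      _ = (X1.card : ℝ) * (K2 * P' ^ ε1 * E + n0) := by rw [Finset.sum_const, nsmul_eq_mul]
      _ ≤ (X.card : ℝ) * (K2 * P' ^ ε1 * E + n0) := by
          gcongr
          exact Finset.filter_subset _ _
      _ ≤ _ := by gcongr
  have prop2 : ∀ x ∈ X2, x ∈ X ∧ n0 < n x ∧ R3D (x.2 0) (x.2 1) (x.2 2) (x.2 3) m (n x) W' := by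
    intro x hx
    obtain ⟨h1, h2⟩ := Finset.mem_filter.mp hx
    push Not at h2
    refine ⟨h1, h2.2, ?_⟩
    rcases alt x h1 with h | h
    · linarith [h2.1]
    · exact h
  set M := ⌊Q⌋₊ with hM
  have hM1 : 1 ≤ M := Nat.le_floor (by simpa using hQ1)
  have hMQ : (M : ℝ) ≤ Q := Nat.floor_le (by linarith)
  have sum2 := level_sum X2 n M n0 (K3 * Q ^ δ * (W' / (m : ℝ) ^ 2)) (K3 * Q ^ δ * (W' ^ 2 / (m : ℝ) ^ 6))
    hn0 (by positivity) (by positivity) (by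
      intro x hx
      obtain ⟨h1, h2, h3⟩ := prop2 x hx
      exact Nat.le_floor ((h3.le_W hm0 (by linarith)).trans hW'Q))
    (fun x hx => (prop2 x hx).2.1) (by
      intro j
      have := k3 Q (2 ^ j) W' m ρ (X2.filter (fun x => 2 ^ j ≤ n x)) hQ1 (one_le_pow₀ (by norm_num)) hW'0
        hW'Q hmQ hm hρ
        (fun x hx => ((memX x).mp (prop2 x (Finset.mem_filter.mp hx).1).1).1)
        (fun x hx => (L2 x.1 x.2 ((memX x).mp (prop2 x (Finset.mem_filter.mp hx).1).1).2).1)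
        (by
          intro x hx
          obtain ⟨h1, h2, h3⟩ := prop2 x (Finset.mem_filter.mp hx).1
          have hne : (S.filter (R x)).Nonempty := by
            rw [← Finset.card_pos]
            have : (0 : ℝ) < n x := by linarith
            exact_mod_cast this
          obtain ⟨v, hv⟩ := hne
          obtain ⟨v1, v2, v3⟩ := Finset.mem_filter.mp hv
          have s := hS v v1 _ v2
          have q := r3_phi s (x.2 0) (x.2 1) (x.2 2) (x.2 3)
          rw [v3, zero_sub, dvd_neg] at q
          have q1 : (m : ℤ) ∣ v.b * v.z * (x.2 2 * ρ ^ 2 * t v ^ 5 + x.2 0 * ρ * t v ^ 3 +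
              x.2 3 * ρ * t v ^ 2 + 0 * t v + x.2 1) := (dvd_pow_self _ (by norm_num)).trans q
          have q2 := (s.mb.mul_right s.mz).dvd_of_dvd_mul_left q1
          obtain ⟨k, hk⟩ := v2
          have et : x.1 = t v - m * k := by linarith
          have hmod : x.1 ≡ t v [ZMOD m] := by
            apply Int.ModEq.symm
            rw [Int.modEq_iff_dvd]
            exact ⟨-k, by rw [et]; ring⟩
          have hmod2 : x.2 2 * ρ ^ 2 * x.1 ^ 5 + x.2 0 * ρ * x.1 ^ 3 + x.2 3 * ρ * x.1 ^ 2 + x.2 1 ≡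
            x.2 2 * ρ ^ 2 * t v ^ 5 + x.2 0 * ρ * t v ^ 3 +
              x.2 3 * ρ * t v ^ 2 + 0 * t v + x.2 1 [ZMOD m] := by
            rw [zero_mul, add_zero]
            gcongr
          exact hmod2.dvd_iff.mpr q2)
        (by
          intro x hx
          obtain ⟨h1, h2⟩ := Finset.mem_filter.mp hx
          refine (prop2 x h1).2.2.mono (by positivity) ?_
          exact_mod_cast h2)
      refine this.trans (le_of_eq ?_)
      field_simp)
  have hlev := k4 M hM1
  have hlev2 : ((Nat.log 2 M + 1 : ℕ) : ℝ) ≤ K4 * Q ^ δ := by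
    refine hlev.trans ?_
    gcongr
  have tot : (S.card : ℝ) ≤ K1 * (m + w / m) * (K2 * P' ^ ε1 * E + n0) +
      (K4 * Q ^ δ) * (4 * (K3 * Q ^ δ * (W' / (m : ℝ) ^ 2)) / n0 + 16 * (K3 * Q ^ δ * (W' ^ 2 / (m : ℝ) ^ 6)) / n0 ^ 3) := by
    refine cov.trans ?_
    rw [← Finset.sum_filter_add_sum_filter_not X (fun x => (n x : ℝ) ≤ K2 * P' ^ ε1 * E ∨ (n x : ℝ) ≤ n0)]
    refine add_le_add sum1 (sum2.trans ?_)
    gcongr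
  refine tot.trans ?_
  set p := P' ^ ε1 with hp
  have hPε : (100 * K1) ^ ε * P ^ ε = p ^ 4 := by
    rw [← Real.mul_rpow (by linarith) (by linarith), hp, ← Real.rpow_natCast, ← Real.rpow_mul hP0.le]
    congr 1
    rw [hε1]; push_cast; ring
  rw [hQδ, hW']
  set F := n0 + B * C / (m : ℝ) ^ 3 + Y * Z / (m : ℝ) ^ 3 + √W / (m : ℝ) ^ 2 with hF
  have hEF : E ≤ F := by rw [hE, hF]; linarith
  have hn0F : n0 ≤ F := by
    rw [hF]
    have : 0 ≤ B * C / (m : ℝ) ^ 3 + Y * Z / (m : ℝ) ^ 3 + √W / (m : ℝ) ^ 2 := by positivity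
    linarith
  have hF0 : 0 ≤ F := by linarith
  set k := K2 ^ δ with hk
  clear_value p k F E
  have a1 : K2 * p * E + n0 ≤ 2 * (K2 * p * F) := by
    have h1 : K2 * p * E ≤ K2 * p * F := by gcongr
    have h2 : F ≤ K2 * p * F := le_mul_of_one_le_left hF0 (one_le_mul_of_one_le_of_one_le hK2 hPe1)
    linarith
  have eK : 16 * (K1 * K2 ^ 2 * K3 * K4 * k ^ 2 * (100 * K1) ^ ε) * P ^ ε =
      16 * (K1 * K2 ^ 2 * K3 * K4 * k ^ 2) * p ^ 4 := by rw [← hPε]; ring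
  rw [eK, add_assoc ((m + w / m : ℝ) * F), mul_add (16 * (K1 * K2 ^ 2 * K3 * K4 * k ^ 2) * p ^ 4)]
  have hmw : 0 ≤ (m : ℝ) + w / m := by positivity
  apply add_le_add
  · calc K1 * (m + w / m) * (K2 * p * E + n0) ≤ K1 * (m + w / m) * (2 * (K2 * p * F)) := by gcongr
      _ = 2 * (K1 * K2 ^ 1 * 1 * 1 * 1) * p ^ 1 * ((m + w / m) * F) := by ring
      _ ≤ 16 * (K1 * K2 ^ 2 * K3 * K4 * k ^ 2) * p ^ 4 * ((m + w / m) * F) := by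
        have : 1 ≤ k ^ 2 := one_le_pow₀ c1
        gcongr
        · norm_num
        · norm_num
        · norm_num
  · have e1 : K4 * (k * p) * (4 * (K3 * (k * p) * (K2 * p * W / (m : ℝ) ^ 2)) / n0 +
        16 * (K3 * (k * p) * ((K2 * p * W) ^ 2 / (m : ℝ) ^ 6)) / n0 ^ 3) =
        4 * (1 * K2 ^ 1 * K3 * K4 * k ^ 2) * p ^ 3 * (W / (n0 * (m : ℝ) ^ 2)) +
        16 * (1 * K2 ^ 2 * K3 * K4 * k ^ 2) * p ^ 4 * (W ^ 2 / (n0 ^ 3 * (m : ℝ) ^ 6)) := by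
      field_simp
    rw [e1, mul_add]
    gcongr
    · norm_num
    · norm_num
    · norm_num

lemma r3_scale (A m w n0 U V R W : ℝ) (hA : 1 ≤ A) (hm : A ≤ 60 * m) (hm2 : m ≤ A) (hw : 0 ≤ w) (hn0 : 1 ≤ n0)
    (hU : 0 ≤ U) (hV : 0 ≤ V) (hR : 0 ≤ R) (hW : 0 ≤ W) :
    (m + w / m) * (n0 + U / m ^ 3 + V / m ^ 3 + R / m ^ 2) + W / (n0 * m ^ 2) + W ^ 2 / (n0 ^ 3 * m ^ 6) ≤
    60 ^ 6 * ((A + w / A) * (n0 + U / A ^ 3 + V / A ^ 3 + R / A ^ 2) + W / (n0 * A ^ 2) +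
      W ^ 2 / (n0 ^ 3 * A ^ 6)) := by
  have hm0 : 0 < m := by linarith
  have hA0 : 0 < A := by linarith
  have hn : 0 < n0 := by linarith
  have key : ∀ (x : ℝ) (k : ℕ), 0 ≤ x → x / m ^ k ≤ 60 ^ k * (x / A ^ k) := by
    intro x k hx
    rw [← mul_div_assoc, div_le_div_iff₀ (by positivity) (by positivity)]
    calc x * A ^ k ≤ x * (60 * m) ^ k := by gcongr
      _ = _ := by rw [mul_pow]; ring
  have a1 := key w 1 hw
  have a2 := key U 3 hU
  have a3 := key V 3 hV
  have a4 := key R 2 hR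
  have a5 := key (W / n0) 2 (by positivity)
  have a6 := key (W ^ 2 / n0 ^ 3) 6 (by positivity)
  have b1 : 0 ≤ w / A := by positivity
  have b2 : 0 ≤ U / A ^ 3 := by positivity
  have b3 : 0 ≤ V / A ^ 3 := by positivity
  have b4 : 0 ≤ R / A ^ 2 := by positivity
  have b5 : 0 ≤ W / n0 / A ^ 2 := by positivity
  have b6 : 0 ≤ W ^ 2 / n0 ^ 3 / A ^ 6 := by positivity
  rw [pow_one, pow_one, pow_one] at a1
  have c1 : m + w / m ≤ 60 * (A + w / A) := by linarith
  have c2 : n0 + U / m ^ 3 + V / m ^ 3 + R / m ^ 2 ≤ 60 ^ 3 * (n0 + U / A ^ 3 + V / A ^ 3 + R / A ^ 2) := by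
    linarith
  have c3 : (m + w / m) * (n0 + U / m ^ 3 + V / m ^ 3 + R / m ^ 2) ≤
      60 * (A + w / A) * (60 ^ 3 * (n0 + U / A ^ 3 + V / A ^ 3 + R / A ^ 2)) := by gcongr
  have c4 : 0 ≤ (A + w / A) * (n0 + U / A ^ 3 + V / A ^ 3 + R / A ^ 2) := by positivity
  rw [← div_div W, ← div_div W, ← div_div (W ^ 2), ← div_div (W ^ 2)]
  linarith

lemma region3 (ε : ℝ) (hε : 0 < ε) : ∃ K : ℝ, 1 ≤ K ∧
    ∀ (P : ℝ) (r1 r2 r3 : ℤ) (A B C Y Z w n0 : ℝ) (S : Finset Pt), 1 ≤ P → r1 ≠ 0 →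
      (∀ v ∈ S, Good P r1 r2 r3 A B C v) → (∀ v ∈ S, (v.y : ℝ) ≤ Y ∧ (v.z : ℝ) ≤ Z) →
      1 ≤ Y → 1 ≤ Z → 1 ≤ A → 1 ≤ B → 1 ≤ C →
      A ≤ 10 * P → B ≤ 10 * P → C ≤ 10 * P → Y ≤ 10 * P → Z ≤ 10 * P →
      0 ≤ w → w ^ 3 = (B * C * Y * Z) ^ 2 → 1 ≤ n0 →
      (S.card : ℝ) ≤ K * P ^ ε * ((A ^ 2 + w) * (n0 + B * C / A ^ 3 + Y * Z / A ^ 3 +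
          √(B * C * Y * Z) / A ^ 2) + B * C * Y * Z / (n0 * A) +
          (B * C * Y * Z) ^ 2 / (n0 ^ 3 * A ^ 5)) := by
  obtain ⟨K, hK, k⟩ := r3_m ε hε
  refine ⟨60 ^ 6 * K, by linarith, ?_⟩
  intro P r1 r2 r3 A B C Y Z w n0 S hP hr hS hb hY hZ hA hB hC hAP hBP hCP hYP hZP hw hw3 hn0
  have hA0 : 0 < A := by linarith
  have hn0' : 0 < n0 := by linarith
  obtain ⟨μ, ρ, t, hμ⟩ := slice_setup P r1 r2 r3 A B C
  set f : Pt → ℤ := fun v => (μ v : ℤ) with hf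
  set E := (A + w / A) * (n0 + B * C / A ^ 3 + Y * Z / A ^ 3 +
          √(B * C * Y * Z) / A ^ 2) + B * C * Y * Z / (n0 * A ^ 2) +
          (B * C * Y * Z) ^ 2 / (n0 ^ 3 * A ^ 6) with hE
  have hE0 : 0 ≤ E := by positivity
  have hT := card_le_fiber S f (S.image f) (fun s hs => Finset.mem_image_of_mem _ hs)
    (60 ^ 6 * K * P ^ ε * E) (by
    intro τ hτ
    obtain ⟨v0, hv0, rfl⟩ := Finset.mem_image.mp hτ
    obtain ⟨i1, i2, i3, i4, i5, i6, i7⟩ := hμ v0 (hS v0 hv0)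
    have hfib : ∀ v ∈ S.filter (fun s => f s = f v0), v ∈ S ∧ μ v = μ v0 := by
      intro v hv
      obtain ⟨h1, h2⟩ := Finset.mem_filter.mp hv
      exact ⟨h1, by have h3 : (μ v : ℤ) = (μ v0 : ℤ) := h2; exact_mod_cast h3⟩
    have := k P (μ v0) (ρ (μ v0)) t (S.filter (fun s => f s = f v0)) B C Y Z w n0 hP i1 i5 i4
      (by
        intro v hv t0
        obtain ⟨h1, h3⟩ := hfib v hv
        have := (hμ v (hS v h1)).2.2.2.2.2.2 t0
        rwa [h3] at this)
      (fun v hv => ⟨(hS v (hfib v hv).1).bB, (hS v (hfib v hv).1).cC, hb v (hfib v hv).1⟩)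
      hB hC hY hZ (fun u hu v hv => good_inj hr (hS u (hfib u hu).1) (hS v (hfib v hv).1))
      (by linarith) hBP hCP hYP hZP hw hw3 hn0
    refine this.trans ?_
    have q := r3_scale A (μ v0) w n0 (B * C) (Y * Z) (√(B * C * Y * Z)) (B * C * Y * Z) hA i2 i3 hw hn0
      (by positivity) (by positivity) (by positivity) (by positivity)
    have hKP : 0 ≤ K * P ^ ε := by positivity
    calc _ ≤ K * P ^ ε * (60 ^ 6 * E) := mul_le_mul_of_nonneg_left q hKP
      _ = _ := by ring)
  have hbox := box1_card (S.image f) A hA0.le (by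
    intro τ hτ
    obtain ⟨v, hv, rfl⟩ := Finset.mem_image.mp hτ
    obtain ⟨i1, i2, i3, i4, i5, i6, i7⟩ := hμ v (hS v hv)
    have hm0 : 0 < μ v := Nat.pos_of_ne_zero i1.ne_zero
    have hm0' : (0 : ℤ) < μ v := by exact_mod_cast hm0
    exact ⟨hm0', by simpa [hf] using i3⟩)
  refine hT.trans ?_
  calc _ ≤ A * (60 ^ 6 * K * P ^ ε * E) := by gcongr
    _ = 60 ^ 6 * K * P ^ ε * (A * E) := by ring
    _ = _ := by
      congr 1
      rw [hE]
      field_simp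

open Polynomial in
/-- Newton approximations of the local parametrisation of `κ z^2 = β b^3 + δ`. -/
noncomputable def zpoly (κ β δ b0 z0 l : ℤ) : ℕ → Polynomial ℤ
  | 0 => C z0
  | n + 1 => zpoly κ β δ b0 z0 l n +
      C l * (C β * (X + C b0) ^ 3 + C δ - C κ * (zpoly κ β δ b0 z0 l n) ^ 2)

lemma zpoly_spec (κ β δ b0 z0 l p b z : ℤ) (hl : p ∣ 2 * κ * z0 * l - 1) 
    (hz : p ∣ z - z0) (e : κ * z ^ 2 = β * b ^ 3 + δ) (n : ℕ) :
    p ^ (n + 1) ∣ (zpoly κ β δ b0 z0 l n).eval (b - b0) - z := by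
  induction n with
  | zero =>
    simp only [zpoly, Polynomial.eval_C, zero_add, pow_one]
    exact dvd_sub_comm.mp hz
  | succ n ih =>
    simp only [zpoly, Polynomial.eval_add, Polynomial.eval_mul, Polynomial.eval_C, Polynomial.eval_sub,
      Polynomial.eval_pow, Polynomial.eval_X, sub_add_cancel]
    set y := (zpoly κ β δ b0 z0 l n).eval (b - b0)
    have e2 : y + l * (β * b ^ 3 + δ - κ * y ^ 2) - z = (y - z) * (1 - l * κ * (y + z)) := by
      rw [← e]; ring
    rw [e2, pow_succ]
    apply mul_dvd_mul ih
    have hp : p ∣ y - z := (dvd_pow_self p (by omega)).trans ih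
    obtain ⟨c1, h1⟩ := hl
    obtain ⟨c2, h2⟩ := hz
    obtain ⟨c3, h3⟩ := hp
    refine ⟨-c1 - l * κ * c3 - 2 * l * κ * c2, ?_⟩
    linear_combination -h1 - l * κ * h3 - 2 * l * κ * h2

lemma dvd_eval_of_coeff (p u : ℤ) (N : ℕ) (q : Polynomial ℤ) (hu : p ∣ u)
    (h : ∀ j < N, p ^ (N - j) ∣ q.coeff j) : p ^ N ∣ q.eval u := by
  rw [Polynomial.eval_eq_sum_range]
  apply Finset.dvd_sum
  intro j _
  rcases lt_or_ge j N with hj | hj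
  · have := mul_dvd_mul (h j hj) (pow_dvd_pow_of_dvd hu j)
    rwa [← pow_add, Nat.sub_add_cancel hj.le] at this
  · exact ((pow_dvd_pow p hj).trans (pow_dvd_pow_of_dvd hu j)).mul_left _

open Polynomial in
noncomputable def fpol (g : Fin 10 → ℤ) : Polynomial ℤ := ∑ i : Fin 10, C (g i) * X ^ (i : ℕ)

lemma fpol_eval (g : Fin 10 → ℤ) (b : ℤ) : (fpol g).eval b = ∑ i : Fin 10, g i * b ^ (i : ℕ) := by
  simp [fpol, Polynomial.eval_finsetSum]

lemma fpol_coeff (g : Fin 10 → ℤ) (i : Fin 10) : (fpol g).coeff i = g i := by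
  simp only [fpol, Polynomial.finsetSum_coeff, Polynomial.coeff_C_mul, Polynomial.coeff_X_pow]
  rw [Finset.sum_eq_single i]
  · simp
  · intro j _ hj
    rw [if_neg (fun h => hj (Fin.ext h.symm)), mul_zero]
  · simp

lemma fpol_deg (g : Fin 10 → ℤ) : (fpol g).natDegree ≤ 9 := by
  apply Polynomial.natDegree_sum_le_of_forall_le
  intro i _
  refine (Polynomial.natDegree_C_mul_X_pow_le _ _).trans (by omega)

open Polynomial in
lemma hpol_ne (κ β δ : ℤ) (hκ : κ ≠ 0) (hβ : β ≠ 0) (f g : Polynomial ℤ) (h : f ≠ 0 ∨ g ≠ 0) :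
    C κ * f ^ 2 - g ^ 2 * (C β * X ^ 3 + C δ) ≠ 0 := by
  intro h0
  have e : C κ * f ^ 2 = g ^ 2 * (C β * X ^ 3 + C δ) := sub_eq_zero.mp h0
  have hF : (C β * X ^ 3 + C δ).natDegree = 3 := by compute_degree!
  have hF0 : C β * X ^ 3 + C δ ≠ 0 := by
    intro h; rw [h] at hF; simp at hF
  by_cases hg : g = 0
  · rw [hg] at e
    have hf : f = 0 := by simpa [hκ] using e
    rcases h with h | h
    · exact h hf
    · exact h hg
  · have hd := congrArg natDegree e
    rw [natDegree_C_mul hκ, natDegree_pow, natDegree_mul (pow_ne_zero 2 hg) hF0, natDegree_pow, hF] at hd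
    omega

open Polynomial in
lemma hpol_deg (κ β δ : ℤ) (f g : Polynomial ℤ) (hf : f.natDegree ≤ 9) (hg : g.natDegree ≤ 9) :
    (C κ * f ^ 2 - g ^ 2 * (C β * X ^ 3 + C δ)).natDegree ≤ 21 := by
  apply (natDegree_sub_le _ _).trans
  apply max_le
  · refine (natDegree_C_mul_le _ _).trans (natDegree_pow_le.trans (by omega))
  · refine natDegree_mul_le.trans ?_
    have h1 : (g ^ 2).natDegree ≤ 2 * 9 := natDegree_pow_le.trans (by omega)
    have h2 : (C β * X ^ 3 + C δ).natDegree ≤ 3 := by compute_degree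
    omega

lemma ell_kill (κ β δ : ℤ) (hκ : κ ≠ 0) (hβ : β ≠ 0) (f g : Polynomial ℤ) (h : f ≠ 0 ∨ g ≠ 0)
    (hf : f.natDegree ≤ 9) (hg : g.natDegree ≤ 9) (S : Finset (ℤ × ℤ))
    (hS : ∀ s ∈ S, 0 < s.2 ∧ κ * s.2 ^ 2 = β * s.1 ^ 3 + δ ∧ f.eval s.1 + s.2 * g.eval s.1 = 0) :
    S.card ≤ 21 := by
  classical
  have hinj : Set.InjOn Prod.fst (S : Set (ℤ × ℤ)) := by
    rintro ⟨b, z⟩ hs ⟨b', z'⟩ hs' hb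
    simp only at hb
    subst hb
    obtain ⟨h1, h2, -⟩ := hS _ hs
    obtain ⟨h3, h4, -⟩ := hS _ hs'
    have : z ^ 2 = z' ^ 2 := mul_left_cancel₀ hκ (h2.trans h4.symm)
    have : z = z' := by
      simp only at h1 h3
      nlinarith [sq_nonneg (z - z')]
    rw [this]
  rw [← Finset.card_image_of_injOn hinj]
  set H := Polynomial.C κ * f ^ 2 - g ^ 2 * (Polynomial.C β * Polynomial.X ^ 3 + Polynomial.C δ) with hH
  have hH0 : H ≠ 0 := hpol_ne κ β δ hκ hβ f g h
  calc (S.image Prod.fst).card ≤ H.roots.toFinset.card := by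
        apply Finset.card_le_card
        intro b hb
        obtain ⟨s, hs, rfl⟩ := Finset.mem_image.mp hb
        rw [Multiset.mem_toFinset, Polynomial.mem_roots hH0, Polynomial.IsRoot.def]
        obtain ⟨h1, h2, h3⟩ := hS s hs
        simp only [hH, Polynomial.eval_sub, Polynomial.eval_mul, Polynomial.eval_C, Polynomial.eval_pow,
          Polynomial.eval_add, Polynomial.eval_X]
        linear_combination κ * (f.eval s.1 - s.2 * g.eval s.1) * h3 + (g.eval s.1) ^ 2 * h2
    _ ≤ H.roots.card := Multiset.toFinset_card_le _
    _ ≤ H.natDegree := Polynomial.card_roots' _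
    _ ≤ 21 := hpol_deg κ β δ f g hf hg

open Polynomial in
set_option maxHeartbeats 400000 in
lemma ell_class : ∃ K : ℝ, 1 ≤ K ∧ ∀ (p : ℕ) (κ β δ b0 z0 : ℤ) (B Z : ℝ) (S : Finset (ℤ × ℤ)),
    p.Prime → ¬ (p : ℤ) ∣ 2 * κ * z0 → β ≠ 0 → 1 ≤ B → 1 ≤ Z →
    (∀ s ∈ S, (0 < s.1 ∧ (s.1 : ℝ) ≤ B) ∧ (0 < s.2 ∧ (s.2 : ℝ) ≤ Z) ∧ κ * s.2 ^ 2 = β * s.1 ^ 3 + δ ∧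
      (p : ℤ) ∣ s.1 - b0 ∧ (p : ℤ) ∣ s.2 - z0) →
    B ^ 9 * Z ≤ (p : ℝ) ^ 19 → (S.card : ℝ) ≤ K := by
  classical
  obtain ⟨K, hK, k⟩ := siegel_list (Fin 10 ⊕ Fin 10) (by simp)
  refine ⟨K * 2 * 21, by linarith, ?_⟩
  intro p κ β δ b0 z0 B Z S hp hnd hβ hB hZ hS hBZ
  have hB0 : 0 < B := by linarith
  have hZ0 : 0 < Z := by linarith
  have hp0 : 0 < p := hp.pos
  have hκ : κ ≠ 0 := by rintro rfl; simp at hnd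
  have hpZ : Prime (p : ℤ) := Nat.prime_iff_prime_int.mp hp
  have hcop : IsCoprime (p : ℤ) (2 * κ * z0) := by
    rw [← Prime.coprime_iff_not_dvd hpZ] at hnd
    exact hnd
  obtain ⟨x, l, hl⟩ := hcop
  have hl' : (p : ℤ) ∣ 2 * κ * z0 * l - 1 := ⟨-x, by linear_combination hl⟩
  obtain ⟨zp, hzp⟩ : ∃ zp : Polynomial ℤ, ∀ b z : ℤ, (p : ℤ) ∣ z - z0 → κ * z ^ 2 = β * b ^ 3 + δ →
      (p : ℤ) ^ 20 ∣ zp.eval (b - b0) - z :=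
    ⟨zpoly κ β δ b0 z0 l 19, fun b z hz e => zpoly_spec κ β δ b0 z0 l p b z hl' hz e 19⟩
  set q : Fin 10 ⊕ Fin 10 → Polynomial ℤ := Sum.elim (fun i => (X + C b0) ^ (i : ℕ))
    (fun i => zp * (X + C b0) ^ (i : ℕ)) with hq
  have : ∀ j : Fin 20, NeZero (p ^ (20 - (j : ℕ))) := fun j => ⟨by positivity⟩
  let φ : (Fin 10 ⊕ Fin 10 → ℤ) →+ ((j : Fin 20) → ZMod (p ^ (20 - (j : ℕ)))) := AddMonoidHom.mk'
    (fun h j => ((∑ i, h i * (q i).coeff j : ℤ) : ZMod (p ^ (20 - (j : ℕ))))) (by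
      intro a b
      funext j
      simp only [Pi.add_apply, add_mul, Finset.sum_add_distrib, Int.cast_add])
  obtain ⟨L, l1, l2, l3⟩ := k _ φ (p ^ 20) (Sum.elim (fun i => B ^ (i : ℕ)) (fun i => Z * B ^ (i : ℕ))) 1
    (by positivity) (by
      rintro (i | i)
      · simp only [Sum.elim_inl]; positivity
      · simp only [Sum.elim_inr]; positivity) zero_le_one (by
      rw [Fintype.card_pi, Fintype.prod_sum_type]
      simp only [ZMod.card, Sum.elim_inl, Sum.elim_inr, one_pow, mul_one, Fintype.card_sum, Fintype.card_fin]
      rw [Fin.prod_univ_eq_prod_range (fun j => p ^ (20 - j)) 20,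
        Fin.prod_univ_eq_prod_range (fun i => B ^ i) 10, Fin.prod_univ_eq_prod_range (fun i => Z * B ^ i) 10]
      simp only [Finset.prod_range_succ, Finset.prod_range_zero]
      push_cast
      have := pow_le_pow_left₀ (by positivity) hBZ 10
      calc _ = (p : ℝ) ^ 210 * (B ^ 9 * Z) ^ 10 := by ring
        _ ≤ (p : ℝ) ^ 210 * ((p : ℝ) ^ 19) ^ 10 := by gcongr
        _ = _ := by ring)
  have cov := card_le_cover_sum S L (fun g s => (fpol (fun i => g (Sum.inl i))).eval s.1 +
      s.2 * (fpol (fun i => g (Sum.inr i))).eval s.1 = 0) (by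
    intro s hs
    obtain ⟨⟨h1, h2⟩, ⟨h3, h4⟩, h5, h6, h7⟩ := hS s hs
    have r1 : (0 : ℝ) < s.1 := by exact_mod_cast h1
    have r3 : (0 : ℝ) < s.2 := by exact_mod_cast h3
    obtain ⟨g, hg, e⟩ := l3 (Sum.elim (fun i => s.1 ^ (i : ℕ)) (fun i => s.2 * s.1 ^ (i : ℕ))) (by
      rintro (i | i)
      · simp only [Sum.elim_inl]
        push_cast
        rw [abs_of_pos (by positivity)]
        gcongr
      · simp only [Sum.elim_inr]
        push_cast
        rw [abs_of_pos (by positivity)]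
        gcongr) (by
      intro h hφ
      have hc : ∀ j < 20, (p : ℤ) ^ (20 - j) ∣ (∑ i, C (h i) * q i).coeff j := by
        intro j hj
        have := congrFun hφ ⟨j, hj⟩
        have e2 : φ h ⟨j, hj⟩ = ((∑ i, h i * (q i).coeff j : ℤ) : ZMod (p ^ (20 - j))) := rfl
        rw [e2, Pi.zero_apply, ZMod.intCast_zmod_eq_zero_iff_dvd] at this
        rw [finsetSum_coeff]
        simp only [coeff_C_mul]
        exact_mod_cast this
      have hd := dvd_eval_of_coeff p (s.1 - b0) 20 _ h6 hc
      have hz := hzp s.1 s.2 h7 h5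
      push_cast
      have e3 : (∑ i, C (h i) * q i).eval (s.1 - b0) -
          (∑ i, h i * (Sum.elim (fun i : Fin 10 => s.1 ^ (i : ℕ)) (fun i : Fin 10 => s.2 * s.1 ^ (i : ℕ)) i)) =
          (zp.eval (s.1 - b0) - s.2) * ∑ i : Fin 10, h (Sum.inr i) * s.1 ^ (i : ℕ) := by
        rw [eval_finsetSum, Fintype.sum_sum_type, Fintype.sum_sum_type]
        simp only [hq, Sum.elim_inl, Sum.elim_inr, eval_mul, eval_C, eval_pow, eval_add, eval_X, sub_add_cancel]
        rw [add_sub_add_left_eq_sub, ← Finset.sum_sub_distrib, Finset.mul_sum]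
        apply Finset.sum_congr rfl
        intro i _
        ring
      have hz2 := hz.mul_right (∑ i : Fin 10, h (Sum.inr i) * s.1 ^ (i : ℕ))
      rw [← e3] at hz2
      have := dvd_sub hd hz2
      rwa [sub_sub_cancel] at this)
    refine ⟨g, hg, ?_⟩
    rw [Fintype.sum_sum_type] at e
    simp only [Sum.elim_inl, Sum.elim_inr] at e
    rw [fpol_eval, fpol_eval, Finset.mul_sum, ← e]
    congr 1
    apply Finset.sum_congr rfl
    intro i _
    ring) (fun _ => 21) (by
    intro g hg
    have : (S.filter (fun s => (fpol (fun i => g (Sum.inl i))).eval s.1 +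
      s.2 * (fpol (fun i => g (Sum.inr i))).eval s.1 = 0)).card ≤ 21 := by
      refine ell_kill κ β δ hκ hβ (fpol (fun i => g (Sum.inl i))) (fpol (fun i => g (Sum.inr i))) ?_
        (fpol_deg _) (fpol_deg _) _ (fun s hs => ?_)
      · by_contra hcon
        push Not at hcon
        obtain ⟨i, hi⟩ := (l2 g hg).1 2 Nat.prime_two
        rcases i with i | i
        · have := fpol_coeff (fun i => g (Sum.inl i)) i
          rw [hcon.1, coeff_zero] at this
          rw [← this] at hi
          simp at hi
        · have := fpol_coeff (fun i => g (Sum.inr i)) i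
          rw [hcon.2, coeff_zero] at this
          rw [← this] at hi
          simp at hi
      · obtain ⟨h1, h2⟩ := Finset.mem_filter.mp hs
        exact ⟨(hS s h1).2.1.1, (hS s h1).2.2.1, h2⟩
    exact_mod_cast this)
  rw [Finset.sum_const, nsmul_eq_mul] at cov
  refine cov.trans ?_
  have : (L.card : ℝ) ≤ K * 2 := by linarith
  gcongr

lemma ell_inj (κ β δ : ℤ) (hκ : κ ≠ 0) (S : Finset (ℤ × ℤ))
    (hS : ∀ s ∈ S, 0 < s.2 ∧ κ * s.2 ^ 2 = β * s.1 ^ 3 + δ) : Set.InjOn Prod.fst (S : Set (ℤ × ℤ)) := by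
  rintro ⟨b, z⟩ hs ⟨b', z'⟩ hs' hb
  simp only at hb
  subst hb
  obtain ⟨h1, h2⟩ := hS _ hs
  obtain ⟨h3, h4⟩ := hS _ hs'
  have : z ^ 2 = z' ^ 2 := mul_left_cancel₀ hκ (h2.trans h4.symm)
  have : z = z' := by
    simp only at h1 h3
    nlinarith [sq_nonneg (z - z')]
  rw [this]

/-- number of integers in `(0,B]` in a fixed class mod `p` -/
lemma residue_card (p : ℕ) (hp : 0 < p) (B : ℝ) (hB : 0 ≤ B) (T : Finset ℤ) (b0 : ℤ)
    (h : ∀ b ∈ T, 0 < b ∧ (b : ℝ) ≤ B ∧ (p : ℤ) ∣ b - b0) : (T.card : ℝ) ≤ B / p + 1 := by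
  classical
  have hpz : (0 : ℤ) < p := by exact_mod_cast hp
  have hpr : (0 : ℝ) < p := by exact_mod_cast hp
  have hinj : Set.InjOn (fun b : ℤ => b / (p : ℤ) + 1) (T : Set ℤ) := by
    intro b hb b' hb' e
    obtain ⟨-, -, k1, e1⟩ := h b hb
    obtain ⟨-, -, k2, e2⟩ := h b' hb'
    have e3 : b / (p : ℤ) = b' / (p : ℤ) := by simpa using e
    have e4 : b % p = b' % p := by
      have : b ≡ b' [ZMOD p] := by
        apply Int.ModEq.symm
        rw [Int.modEq_iff_dvd]
        exact ⟨k1 - k2, by linear_combination e1 - e2⟩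
      exact this
    have e5 := Int.mul_ediv_add_emod b p
    have e6 := Int.mul_ediv_add_emod b' p
    rw [e3, e4] at e5
    omega
  have := box1_card (T.image (fun b : ℤ => b / (p : ℤ) + 1)) (B / p + 1) (by positivity) (by
    intro t ht
    obtain ⟨b, hb, rfl⟩ := Finset.mem_image.mp ht
    obtain ⟨h1, h2, -⟩ := h b hb
    have h3 : 0 ≤ b / (p : ℤ) := Int.ediv_nonneg h1.le hpz.le
    refine ⟨by omega, ?_⟩
    push_cast
    have h4 : (b / (p : ℤ)) * p ≤ b := Int.ediv_mul_le b hpz.ne'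
    have h5 : ((b / (p : ℤ) : ℤ) : ℝ) * p ≤ b := by exact_mod_cast h4
    have h6 : ((b / (p : ℤ) : ℤ) : ℝ) ≤ B / p := by
      rw [le_div_iff₀ hpr]; linarith
    linarith)
  rwa [Finset.card_image_of_injOn hinj] at this

lemma ell_count : ∃ K : ℝ, 1 ≤ K ∧ ∀ (p : ℕ) (κ β δ : ℤ) (B Z : ℝ) (S : Finset (ℤ × ℤ)),
    p.Prime → ¬ (p : ℤ) ∣ 2 * κ * β → 1 ≤ B → 1 ≤ Z →
    (∀ s ∈ S, (0 < s.1 ∧ (s.1 : ℝ) ≤ B) ∧ (0 < s.2 ∧ (s.2 : ℝ) ≤ Z) ∧ κ * s.2 ^ 2 = β * s.1 ^ 3 + δ) →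
    B ^ 9 * Z ≤ (p : ℝ) ^ 19 → B ≤ (p : ℝ) ^ 2 → (S.card : ℝ) ≤ K * p := by
  classical
  obtain ⟨K, hK, k⟩ := ell_class
  refine ⟨6 + 2 * K, by linarith, ?_⟩
  intro p κ β δ B Z S hp hnd hB hZ hS hBZ hBp
  have hpZ : Prime (p : ℤ) := Nat.prime_iff_prime_int.mp hp
  have : Fact p.Prime := ⟨hp⟩
  have hp1 : (1 : ℝ) ≤ p := by exact_mod_cast hp.one_lt.le
  have hp0 : (0 : ℝ) < p := by linarith
  have n2 : ¬ (p : ℤ) ∣ 2 := fun h => hnd ((h.mul_right κ).mul_right β)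
  have nκ : ¬ (p : ℤ) ∣ κ := fun h => hnd ((h.mul_left 2).mul_right β)
  have nβ : ¬ (p : ℤ) ∣ β := fun h => hnd (h.mul_left _)
  have hκ : κ ≠ 0 := by rintro rfl; simp at nκ
  have hβ : β ≠ 0 := by rintro rfl; simp at nβ
  have zκ : (κ : ZMod p) ≠ 0 := by rwa [Ne, ZMod.intCast_zmod_eq_zero_iff_dvd]
  have zβ : (β : ZMod p) ≠ 0 := by rwa [Ne, ZMod.intCast_zmod_eq_zero_iff_dvd]
  have heq : ∀ s ∈ S, (κ : ZMod p) * (s.2 : ZMod p) ^ 2 = β * (s.1 : ZMod p) ^ 3 + δ := by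
    intro s hs
    have := congrArg (fun x : ℤ => (x : ZMod p)) (hS s hs).2.2
    push_cast at this
    exact this
  have dvd_of : ∀ a b : ℤ, (a : ZMod p) = (b : ZMod p) → (p : ℤ) ∣ a - b := by
    intro a b h
    rw [← ZMod.intCast_zmod_eq_zero_iff_dvd]
    push_cast
    rw [h, sub_self]
  set S1 := S.filter (fun s => (p : ℤ) ∣ s.2) with hS1
  set S2 := S.filter (fun s => ¬ (p : ℤ) ∣ s.2) with hS2
  have c1 : (S1.card : ℝ) ≤ 3 * (2 * p) := by
    have h := card_le_fiber S1 (fun s => (s.1 : ZMod p)) (S1.image (fun s => (s.1 : ZMod p)))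
      (fun s hs => Finset.mem_image_of_mem _ hs) (2 * p) (by
        intro τ hτ
        obtain ⟨s0, hs0, rfl⟩ := Finset.mem_image.mp hτ
        have hinj := ell_inj κ β δ hκ (S1.filter (fun s => (s.1 : ZMod p) = (s0.1 : ZMod p))) (by
          intro s hs
          have := hS s (Finset.mem_filter.mp (Finset.mem_filter.mp hs).1).1
          exact ⟨this.2.1.1, this.2.2⟩)
        have := residue_card p hp.pos B (by linarith)
          ((S1.filter (fun s => (s.1 : ZMod p) = (s0.1 : ZMod p))).image Prod.fst) s0.1 (by
            intro b hb
            obtain ⟨s, hs, rfl⟩ := Finset.mem_image.mp hb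
            obtain ⟨h1, h2⟩ := Finset.mem_filter.mp hs
            have := hS s (Finset.mem_filter.mp h1).1
            exact ⟨this.1.1, this.1.2, dvd_of _ _ h2⟩)
        rw [Finset.card_image_of_injOn hinj] at this
        refine this.trans ?_
        have : B / p ≤ p := by
          rw [div_le_iff₀ hp0]; linarith [sq (p : ℝ)]
        linarith)
    have hr := roots_card (ZMod p) 3 (by norm_num) (-(δ : ZMod p) / β) (S1.image (fun s => (s.1 : ZMod p))) (by
      intro x hx
      obtain ⟨s, hs, rfl⟩ := Finset.mem_image.mp hx
      obtain ⟨h1, h2⟩ := Finset.mem_filter.mp hs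
      have e := heq s h1
      rw [(ZMod.intCast_zmod_eq_zero_iff_dvd _ _).mpr h2] at e
      rw [eq_div_iff zβ]
      linear_combination -e)
    have hr' : ((S1.image (fun s => (s.1 : ZMod p))).card : ℝ) ≤ 3 := by exact_mod_cast hr
    refine h.trans ?_
    gcongr
  have c2 : (S2.card : ℝ) ≤ (2 * p) * K := by
    set f : ℤ × ℤ → ZMod p × ZMod p := fun s => ((s.1 : ZMod p), (s.2 : ZMod p)) with hf
    have h := card_le_fiber S2 f (S2.image f) (fun s hs => Finset.mem_image_of_mem _ hs) K (by
        intro τ hτ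
        obtain ⟨s0, hs0, rfl⟩ := Finset.mem_image.mp hτ
        have ns0 := (Finset.mem_filter.mp hs0).2
        refine k p κ β δ s0.1 s0.2 B Z _ hp ?_ hβ hB hZ ?_ hBZ
        · intro hd
          rcases hpZ.dvd_or_dvd hd with hd | hd
          · rcases hpZ.dvd_or_dvd hd with hd | hd
            · exact n2 hd
            · exact nκ hd
          · exact ns0 hd
        · intro s hs
          obtain ⟨h1, h2⟩ := Finset.mem_filter.mp hs
          obtain ⟨q1, q2, q3⟩ := hS s (Finset.mem_filter.mp h1).1
          simp only [hf, Prod.mk.injEq] at h2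
          exact ⟨q1, q2, q3, dvd_of _ _ h2.1, dvd_of _ _ h2.2⟩)
    have hT := card_le_fiber (S2.image f) Prod.fst (Finset.univ : Finset (ZMod p))
      (fun s _ => Finset.mem_univ _) 2 (by
        intro x _
        set U := (S2.image f).filter (fun s => s.1 = x) with hU
        have hinj : Set.InjOn Prod.snd (U : Set (ZMod p × ZMod p)) := by
          rintro ⟨a, b⟩ ha ⟨a', b'⟩ ha' e
          have e1 := (Finset.mem_filter.mp ha).2
          have e2 := (Finset.mem_filter.mp ha').2
          simp only at e e1 e2
          rw [e, e1, e2]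
        have hr := roots_card (ZMod p) 2 (by norm_num) ((β * x ^ 3 + δ) / κ) (U.image Prod.snd) (by
          intro y hy
          obtain ⟨u, hu, rfl⟩ := Finset.mem_image.mp hy
          obtain ⟨h1, h2⟩ := Finset.mem_filter.mp hu
          obtain ⟨s, hs, rfl⟩ := Finset.mem_image.mp h1
          have e := heq s (Finset.mem_filter.mp hs).1
          rw [eq_div_iff zκ, ← h2]
          simp only [hf]
          linear_combination e)
        rw [Finset.card_image_of_injOn hinj] at hr
        exact_mod_cast hr)
    rw [Finset.card_univ, ZMod.card] at hT
    refine h.trans ?_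
    gcongr
    linarith
  have hsplit : (S.card : ℝ) = S1.card + S2.card := by
    rw [← Finset.card_filter_add_card_filter_not (s := S) (fun s => (p : ℤ) ∣ s.2)]
    push_cast
    rfl
  rw [hsplit]
  linarith

lemma region5 (ε : ℝ) (hε : 0 < ε) : ∃ K : ℝ, 1 ≤ K ∧
    ∀ (P : ℝ) (r1 r2 r3 : ℤ) (A B C X Y Z R : ℝ) (S : Finset Pt), 1 ≤ P → r2 ≠ 0 → r3 ≠ 0 →
      (∀ v ∈ S, Good P r1 r2 r3 A B C v) →
      (∀ v ∈ S, (v.x : ℝ) ≤ X ∧ (v.y : ℝ) ≤ Y ∧ (v.z : ℝ) ≤ Z) →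
      0 ≤ X → 0 ≤ Y → 0 ≤ A → 1 ≤ B → 0 ≤ C → 1 ≤ R → B ^ 9 * Z ≤ R ^ 19 → B ≤ R ^ 2 →
      (S.card : ℝ) ≤ K * P ^ ε * (X * Y * C * A * R) := by
  classical
  obtain ⟨K, hK, k⟩ := ell_count
  obtain ⟨L, hL, l⟩ := aux_prime (2 : ℝ) ε hε
  obtain ⟨L2, hL2, l2⟩ : ∃ L2 : ℝ, 1 ≤ L2 ∧ ∀ (P R : ℝ) (n : ℤ), 1 ≤ P → 1 ≤ R → n ≠ 0 →
      |(n : ℝ)| ≤ P ^ (2 : ℝ) → ∃ p : ℕ, p.Prime ∧ R < p ∧ (p : ℝ) ≤ L2 * (R * P ^ ε) ∧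
        ¬ (p : ℤ) ∣ 2 * n := by
    refine ⟨2 * L, by linarith, fun P R n hP hR hn hnP => ?_⟩
    obtain ⟨p, h1, h2, h3, h4⟩ := l P (2 * R) n hP (by linarith) hn hnP
    refine ⟨p, h1, by linarith, by linarith, ?_⟩
    intro h
    rcases (Nat.prime_iff_prime_int.mp h1).dvd_or_dvd h with h5 | h5
    · have h6 : p ∣ 2 := by exact_mod_cast h5
      have h7 : (p : ℝ) ≤ 2 := by exact_mod_cast Nat.le_of_dvd (by norm_num) h6
      linarith
    · exact h4 h5
  refine ⟨K * L2, one_le_mul_of_one_le_of_one_le hK hL2, ?_⟩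
  intro P r1 r2 r3 A B C X Y Z R S hP hr2 hr3 hS hb hX hY hA hB hC hR hR1 hR2
  set f : Pt → (ℤ × ℤ × ℤ) × ℤ := fun v => ((v.x, v.y, v.c), v.a) with hf
  have hPε : 0 < P ^ ε := Real.rpow_pos_of_pos (by linarith) _
  have hT := card_le_fiber S f (S.image f) (fun s hs => Finset.mem_image_of_mem _ hs)
    (K * (L2 * (R * P ^ ε))) (by
    intro τ hτ
    obtain ⟨v0, hv0, rfl⟩ := Finset.mem_image.mp hτ
    have g0 := hS v0 hv0
    have b1 := int_one_le g0.b0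
    have z1 := int_one_le g0.z0
    have c1 := int_one_le g0.c0
    have y1 := int_one_le g0.y0
    have e2 : |(r2 : ℝ)| * (v0.y : ℝ) ^ 2 ≤ P := by
      refine le_trans ?_ g0.p2
      have : (1 : ℝ) ≤ (v0.b : ℝ) ^ 3 := one_le_pow₀ b1
      calc |(r2 : ℝ)| * (v0.y : ℝ) ^ 2 = |(r2 : ℝ)| * 1 * (v0.y : ℝ) ^ 2 := by ring
        _ ≤ _ := by gcongr
    have e3 : |(r3 : ℝ)| * (v0.c : ℝ) ^ 3 ≤ P := by
      refine le_trans ?_ g0.p3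
      have : (1 : ℝ) ≤ (v0.z : ℝ) ^ 2 := one_le_pow₀ z1
      exact le_mul_of_one_le_right (by positivity) this
    have hn : (r3 * v0.c ^ 3) * (-(r2 * v0.y ^ 2)) ≠ 0 :=
      mul_ne_zero (mul_ne_zero hr3 (pow_ne_zero _ g0.c0.ne'))
        (neg_ne_zero.mpr (mul_ne_zero hr2 (pow_ne_zero _ g0.y0.ne')))
    obtain ⟨p, hp, hp1, hp2, hp3⟩ := l2 P R _ hP hR hn (by
      have : (((r3 * v0.c ^ 3) * (-(r2 * v0.y ^ 2)) : ℤ) : ℝ) =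
        (r3 * v0.c ^ 3 : ℝ) * (-(r2 * v0.y ^ 2)) := by push_cast; ring
      rw [this, abs_mul, abs_neg, abs_mul, abs_mul, abs_pow, abs_pow,
        abs_of_pos (show (0 : ℝ) < v0.c by linarith), abs_of_pos (show (0 : ℝ) < v0.y by linarith)]
      have : P ^ (2 : ℝ) = P * P := by rw [← sq]; norm_cast
      rw [this]
      gcongr)
    set F := S.filter (fun s => f s = f v0) with hF
    have hfib : ∀ v ∈ F, v ∈ S ∧ v.x = v0.x ∧ v.y = v0.y ∧ v.c = v0.c ∧ v.a = v0.a := by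
      intro v hv
      obtain ⟨h1, h2⟩ := Finset.mem_filter.mp hv
      simp only [hf, Prod.mk.injEq] at h2
      exact ⟨h1, h2.1.1, h2.1.2.1, h2.1.2.2, h2.2⟩
    have hinj : Set.InjOn (fun v : Pt => (v.b, v.z)) F := by
      intro u hu v hv huv
      obtain ⟨_, q1, q2, q3, q4⟩ := hfib u hu
      obtain ⟨_, s1, s2, s3, s4⟩ := hfib v hv
      simp only [Prod.mk.injEq] at huv
      exact Pt.ext (q4.trans s4.symm) huv.1 (q3.trans s3.symm) (q1.trans s1.symm)
        (q2.trans s2.symm) huv.2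
    have hRp : R ≤ p := hp1.le
    have := k p (r3 * v0.c ^ 3) (-(r2 * v0.y ^ 2)) (-(r1 * v0.a ^ 3 * v0.x ^ 2)) B Z
      (F.image (fun v : Pt => (v.b, v.z))) hp (by rw [mul_assoc]; exact hp3) hB
      (z1.trans (hb v0 hv0).2.2) (by
        intro s hs
        obtain ⟨v, hv, rfl⟩ := Finset.mem_image.mp hs
        obtain ⟨h1, q1, q2, q3, q4⟩ := hfib v hv
        have g := hS v h1
        refine ⟨⟨g.b0, g.bB⟩, ⟨g.z0, (hb v h1).2.2⟩, ?_⟩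
        have := g.eq
        rw [q1, q2, q3, q4] at this
        simp only
        linarith) (hR1.trans (by gcongr)) (hR2.trans (by gcongr))
    rw [Finset.card_image_of_injOn hinj] at this
    refine this.trans ?_
    gcongr)
  have hbox : ((S.image f).card : ℝ) ≤ X * Y * C * A := by
    have h1 : S.image f ⊆ (S.image (fun v => (v.x, v.y, v.c))) ×ˢ (S.image (fun v => v.a)) := by
      intro τ hτ
      obtain ⟨v, hv, rfl⟩ := Finset.mem_image.mp hτ
      exact Finset.mem_product.mpr ⟨Finset.mem_image_of_mem (fun v : Pt => (v.x, v.y, v.c)) hv,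
        Finset.mem_image_of_mem (fun v : Pt => v.a) hv⟩
    have h2 := Finset.card_le_card h1
    rw [Finset.card_product] at h2
    have h3 := box3_card (S.image (fun v => (v.x, v.y, v.c))) X Y C hX hY hC (by
      intro τ hτ
      obtain ⟨v, hv, rfl⟩ := Finset.mem_image.mp hτ
      have g := hS v hv
      exact ⟨g.x0, (hb v hv).1, g.y0, (hb v hv).2.1, g.c0, g.cC⟩)
    have h4 := box1_card (S.image (fun v => v.a)) A hA (by
      intro τ hτ
      obtain ⟨v, hv, rfl⟩ := Finset.mem_image.mp hτ
      have g := hS v hv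
      exact ⟨g.a0, g.aA⟩)
    calc ((S.image f).card : ℝ) ≤ ((S.image (fun v => (v.x, v.y, v.c))).card : ℝ) *
          ((S.image (fun v => v.a)).card : ℝ) := by exact_mod_cast h2
      _ ≤ _ := by gcongr
  refine hT.trans ?_
  calc _ ≤ (X * Y * C * A) * (K * (L2 * (R * P ^ ε))) := by gcongr
    _ = _ := by ring

/-- the block bound with box sizes `P^α, P^β, P^γ` -/
def Blk (K ε P α β γ : ℝ) : Prop := ∀ (r1 r2 r3 : ℤ) (S : Finset Pt), r1 ≠ 0 → r2 ≠ 0 → r3 ≠ 0 →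
  (∀ v ∈ S, Good P r1 r2 r3 (P ^ α) (P ^ β) (P ^ γ) v) →
  (S.card : ℝ) ≤ K * P ^ ε * P ^ (0.598 : ℝ)

lemma Blk.mono {K K' ε P α β γ : ℝ} (hP : 1 ≤ P) (hK : K ≤ K') (h : Blk K ε P α β γ) :
    Blk K' ε P α β γ := by
  intro r1 r2 r3 S h1 h2 h3 hS
  refine (h r1 r2 r3 S h1 h2 h3 hS).trans ?_
  have : 0 < P := by linarith
  gcongr

def Pt.swap12 (v : Pt) : Pt := ⟨v.b, v.a, v.c, v.y, v.x, v.z⟩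
def Pt.swap23 (v : Pt) : Pt := ⟨v.a, v.c, v.b, v.x, v.z, v.y⟩

lemma Pt.swap12_inj : Function.Injective Pt.swap12 := by
  intro u v h
  simp only [Pt.swap12, Pt.mk.injEq] at h
  exact Pt.ext h.2.1 h.1 h.2.2.1 h.2.2.2.2.1 h.2.2.2.1 h.2.2.2.2.2

lemma Pt.swap23_inj : Function.Injective Pt.swap23 := by
  intro u v h
  simp only [Pt.swap23, Pt.mk.injEq] at h
  exact Pt.ext h.1 h.2.2.1 h.2.1 h.2.2.2.1 h.2.2.2.2.2 h.2.2.2.2.1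

lemma Good.swap12 {P : ℝ} {r1 r2 r3 : ℤ} {A B C : ℝ} {v : Pt} (h : Good P r1 r2 r3 A B C v) :
    Good P r2 r1 r3 B A C v.swap12 :=
  ⟨h.b0, h.a0, h.c0, h.y0, h.x0, h.z0, h.sb, h.sa, h.sc,
    by have := h.eq; simp only [Pt.swap12]; linarith,
    h.p2, h.p1, h.p3, h.bB, h.aA, h.cC, h.Bb, h.Aa, h.Cc, h.c12.symm, h.c23, h.c13⟩

lemma Good.swap23 {P : ℝ} {r1 r2 r3 : ℤ} {A B C : ℝ} {v : Pt} (h : Good P r1 r2 r3 A B C v) :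
    Good P r1 r3 r2 A C B v.swap23 :=
  ⟨h.a0, h.c0, h.b0, h.x0, h.z0, h.y0, h.sa, h.sc, h.sb,
    by have := h.eq; simp only [Pt.swap23]; linarith,
    h.p1, h.p3, h.p2, h.aA, h.cC, h.bB, h.Aa, h.Cc, h.Bb, h.c13, h.c12, h.c23.symm⟩

lemma Blk.swap12 {K ε P α β γ : ℝ} (h : Blk K ε P α β γ) : Blk K ε P β α γ := by
  intro r1 r2 r3 S h1 h2 h3 hS
  have := h r2 r1 r3 (S.image Pt.swap12) h2 h1 h3 (by
    intro w hw
    obtain ⟨v, hv, rfl⟩ := Finset.mem_image.mp hw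
    exact (hS v hv).swap12)
  rwa [Finset.card_image_of_injective _ Pt.swap12_inj] at this

lemma Blk.swap23 {K ε P α β γ : ℝ} (h : Blk K ε P α β γ) : Blk K ε P α γ β := by
  intro r1 r2 r3 S h1 h2 h3 hS
  have := h r1 r3 r2 (S.image Pt.swap23) h1 h3 h2 (by
    intro w hw
    obtain ⟨v, hv, rfl⟩ := Finset.mem_image.mp hw
    exact (hS v hv).swap23)
  rwa [Finset.card_image_of_injective _ Pt.swap23_inj] at this

lemma blk1 (ε : ℝ) (hε : 0 < ε) : ∃ K : ℝ, 1 ≤ K ∧ ∀ (P α β γ : ℝ), 1 ≤ P → 0 ≤ α → 0 ≤ β →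
    0 ≤ γ → α + β + γ ≤ 0.598 → Blk K ε P α β γ := by
  obtain ⟨K, hK, k⟩ := region1 ε hε
  refine ⟨2 * K, by linarith, ?_⟩
  intro P α β γ hP hα hβ hγ hq r1 r2 r3 S h1 h2 h3 hS
  have hP0 : 0 < P := by linarith
  refine (k P r1 r2 r3 _ _ _ S hP h1 h2 h3 hS (Real.one_le_rpow hP hα) (Real.one_le_rpow hP hβ)
    (Real.one_le_rpow hP hγ)).trans ?_
  have e1 : P ^ α * P ^ β * P ^ γ ≤ P ^ (0.598 : ℝ) := by
    rw [← Real.rpow_add hP0, ← Real.rpow_add hP0]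
    exact Real.rpow_le_rpow_of_exponent_le hP hq
  have e2 : √P ≤ P ^ (0.598 : ℝ) := by
    rw [Real.sqrt_eq_rpow]
    exact Real.rpow_le_rpow_of_exponent_le hP (by norm_num)
  calc _ ≤ K * P ^ ε * (P ^ (0.598 : ℝ) + P ^ (0.598 : ℝ)) := by gcongr
    _ = _ := by ring

lemma blk2 (ε : ℝ) (hε : 0 < ε) : ∃ K : ℝ, 1 ≤ K ∧ ∀ (P α β γ : ℝ), 1 ≤ P → 0 ≤ α → 0 ≤ β →
    0 ≤ γ → 0.602 ≤ α + β + γ → Blk K ε P α β γ := by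
  obtain ⟨K, hK, k⟩ := region2 ε hε
  refine ⟨2 * K, by linarith, ?_⟩
  intro P α β γ hP hα hβ hγ hq r1 r2 r3 S h1 h2 h3 hS
  have hP0 : 0 < P := by linarith
  refine (k P r1 r2 r3 _ _ _ S hP h1 h2 h3 hS (Real.one_le_rpow hP hα) (Real.one_le_rpow hP hβ)
    (Real.one_le_rpow hP hγ)).trans ?_
  have e1 : √P ^ 3 / √(P ^ α * P ^ β * P ^ γ) ^ 3 ≤ P ^ (0.598 : ℝ) := by
    simp only [Real.sqrt_eq_rpow, ← Real.rpow_natCast, ← Real.rpow_mul hP0.le, ← Real.rpow_add hP0,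
      ← Real.rpow_sub hP0]
    refine Real.rpow_le_rpow_of_exponent_le hP ?_
    push_cast
    linarith
  have e2 : √P ≤ P ^ (0.598 : ℝ) := by
    rw [Real.sqrt_eq_rpow]
    exact Real.rpow_le_rpow_of_exponent_le hP (by norm_num)
  calc _ ≤ K * P ^ ε * (P ^ (0.598 : ℝ) + P ^ (0.598 : ℝ)) := by gcongr
    _ = _ := by ring

/-- blocks with one variable too large: `P` is bounded -/
lemma blkS (ε : ℝ) (hε : 0 < ε) : ∃ K : ℝ, 1 ≤ K ∧ ∀ (P α β γ : ℝ), 1 ≤ P → 0 ≤ α → 0 ≤ β →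
    0 ≤ γ → α + β + γ ≤ 0.602 → P ≤ 8 ^ 50 → Blk K ε P α β γ := by
  obtain ⟨K, hK, k⟩ := region1 ε hε
  refine ⟨2 * K * 8 ^ 50, by nlinarith, ?_⟩
  intro P α β γ hP hα hβ hγ hq hP8 r1 r2 r3 S h1 h2 h3 hS
  have hP0 : 0 < P := by linarith
  refine (k P r1 r2 r3 _ _ _ S hP h1 h2 h3 hS (Real.one_le_rpow hP hα) (Real.one_le_rpow hP hβ)
    (Real.one_le_rpow hP hγ)).trans ?_
  have e1 : P ^ α * P ^ β * P ^ γ ≤ 8 ^ 50 := by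
    rw [← Real.rpow_add hP0, ← Real.rpow_add hP0]
    refine le_trans ?_ hP8
    calc _ ≤ P ^ (1 : ℝ) := Real.rpow_le_rpow_of_exponent_le hP (by linarith)
      _ = P := Real.rpow_one P
  have e2 : √P ≤ 8 ^ 50 := by
    rw [Real.sqrt_eq_rpow]
    refine le_trans ?_ hP8
    calc _ ≤ P ^ (1 : ℝ) := Real.rpow_le_rpow_of_exponent_le hP (by norm_num)
      _ = P := Real.rpow_one P
  have e3 : 1 ≤ P ^ (0.598 : ℝ) := Real.one_le_rpow hP (by norm_num)
  calc _ ≤ K * P ^ ε * (8 ^ 50 + 8 ^ 50) := by gcongr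
    _ = 2 * K * 8 ^ 50 * P ^ ε * 1 := by ring
    _ ≤ _ := by gcongr

lemma xbound' {P α : ℝ} {a x : ℝ} (hP : 1 ≤ P) (hx : 0 ≤ x) (hA : P ^ α ≤ 2 * a)
    {r : ℤ} (hr : r ≠ 0) (h : |(r : ℝ)| * a ^ 3 * x ^ 2 ≤ P) :
    x ≤ 3 * P ^ (1 / 2 - 3 / 2 * α) := by
  have hP0 : 0 < P := by linarith
  have h0 : 0 < P ^ α := Real.rpow_pos_of_pos hP0 _
  have ha : 0 < a := by linarith
  refine (xbound h0 hA hP0.le hx (le_trans ?_ h)).trans (le_of_eq ?_)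
  · have := int_one_le_abs hr
    rw [mul_assoc]
    exact le_mul_of_one_le_left (by positivity) this
  · simp only [Real.sqrt_eq_rpow, ← Real.rpow_natCast, ← Real.rpow_mul hP0.le, ← Real.rpow_add hP0,
      ← Real.rpow_sub hP0, mul_div_assoc]
    congr 2
    push_cast
    ring

lemma size_bound {P α a x : ℝ} (hP : 1 ≤ P) (ha : 1 ≤ a) (hx : 1 ≤ x)
    (hA : P ^ α ≤ 2 * a) {r : ℤ} (hr : r ≠ 0) (h : |(r : ℝ)| * a ^ 3 * x ^ 2 ≤ P) :
    (P ^ α) ^ 3 ≤ 8 * P := by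
  have hP0 : 0 < P := by linarith
  have h0 : 0 < P ^ α := Real.rpow_pos_of_pos hP0 _
  have h1 := int_one_le_abs hr
  have h2 : 1 * a ^ 3 * 1 ≤ P := by
    refine le_trans ?_ h
    have : 1 ≤ x ^ 2 := one_le_pow₀ hx
    gcongr
  calc (P ^ α) ^ 3 ≤ (2 * a) ^ 3 := by gcongr
    _ = 8 * (1 * a ^ 3 * 1) := by ring
    _ ≤ _ := by linarith

lemma size_bound2 {P α : ℝ} (hP : 1 ≤ P) (h0 : 0 ≤ α) (h : (P ^ α) ^ 3 ≤ 8 * P) : P ^ α ≤ 10 * P := by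
  have h1 := Real.one_le_rpow hP h0
  have h2 : P ^ α ≤ (P ^ α) ^ 3 := le_self_pow₀ h1 (by norm_num)
  linarith

lemma size_bound3 {P α : ℝ} (hP : 1 ≤ P) (hα : 0.34 ≤ α) (h : (P ^ α) ^ 3 ≤ 8 * P) : P ≤ 8 ^ 50 := by
  have hP0 : 0 < P := by linarith
  have h1 : P ^ (0.02 : ℝ) * P ≤ 8 * P := by
    refine le_trans ?_ h
    rw [← Real.rpow_natCast, ← Real.rpow_mul hP0.le]
    calc P ^ (0.02 : ℝ) * P = P ^ (0.02 : ℝ) * P ^ (1 : ℝ) := by rw [Real.rpow_one]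
      _ = P ^ (0.02 + 1 : ℝ) := by rw [Real.rpow_add hP0]
      _ ≤ _ := Real.rpow_le_rpow_of_exponent_le hP (by push_cast; linarith)
  have h2 : P ^ (0.02 : ℝ) ≤ 8 := le_of_mul_le_mul_right h1 hP0
  have h3 : P = (P ^ (0.02 : ℝ)) ^ 50 := by
    rw [← Real.rpow_natCast, ← Real.rpow_mul hP0.le]
    norm_num
  rw [h3]
  gcongr

lemma y_upper {P β : ℝ} (hP : 1 ≤ P) (hβ : 0 ≤ β) : 3 * P ^ (1 / 2 - 3 / 2 * β) ≤ 10 * P := by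
  have : P ^ (1 / 2 - 3 / 2 * β) ≤ P ^ (1 : ℝ) :=
    Real.rpow_le_rpow_of_exponent_le hP (by linarith)
  rw [Real.rpow_one] at this
  linarith

lemma blk3 (ε : ℝ) (hε : 0 < ε) : ∃ K : ℝ, 1 ≤ K ∧ ∀ (P α β γ : ℝ), 1 ≤ P → 0 ≤ β →
    0 ≤ γ → 0.598 ≤ α + β + γ → α + β + γ ≤ 0.602 → 0.199 ≤ α → α ≤ 0.296 →
    Blk K ε P α β γ := by
  obtain ⟨K, hK, k⟩ := region3 ε hε
  refine ⟨230 * K, by linarith, ?_⟩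
  intro P α β γ hP hβ hγ hq1 hq2 hα1 hα2 r1 r2 r3 S h1 h2 h3 hS
  have hα : 0 ≤ α := by linarith
  have hP0 : 0 < P := by linarith
  rcases S.eq_empty_or_nonempty with rfl | ⟨v0, hv0⟩
  · simp only [Finset.card_empty, Nat.cast_zero]; positivity
  have mono : ∀ {e f : ℝ}, e ≤ f → P ^ e ≤ P ^ f :=
    fun h => Real.rpow_le_rpow_of_exponent_le hP h
  have g0 := hS v0 hv0
  have sA := size_bound hP (int_one_le g0.a0) (int_one_le g0.x0) g0.Aa h1 g0.p1
  have sB := size_bound hP (int_one_le g0.b0) (int_one_le g0.y0) g0.Bb h2 g0.p2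
  have sC := size_bound hP (int_one_le g0.c0) (int_one_le g0.z0) g0.Cc h3 g0.p3
  have hy : ∀ v ∈ S, (v.y : ℝ) ≤ 3 * P ^ (1 / 2 - 3 / 2 * β) ∧
      (v.z : ℝ) ≤ 3 * P ^ (1 / 2 - 3 / 2 * γ) := fun v hv =>
    ⟨xbound' hP (by have := int_one_le (hS v hv).y0; linarith) (hS v hv).Bb h2 (hS v hv).p2,
     xbound' hP (by have := int_one_le (hS v hv).z0; linarith) (hS v hv).Cc h3 (hS v hv).p3⟩
  have hW : P ^ β * P ^ γ * (3 * P ^ (1 / 2 - 3 / 2 * β)) * (3 * P ^ (1 / 2 - 3 / 2 * γ)) =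
      9 * P ^ (1 - 1 / 2 * (β + γ)) := by
    have : P ^ (1 - 1 / 2 * (β + γ)) = P ^ β * P ^ γ * P ^ (1 / 2 - 3 / 2 * β) *
      P ^ (1 / 2 - 3 / 2 * γ) := by
      simp only [← Real.rpow_add hP0]; congr 1; ring
    rw [this]; ring
  obtain ⟨c, hc0, hc9, hc3⟩ : ∃ c : ℝ, 0 ≤ c ∧ c ≤ 9 ∧ c ^ 3 = 81 := by
    have e : ((81 : ℝ) ^ (1 / 3 : ℝ)) ^ 3 = 81 := by
      rw [← Real.rpow_natCast, ← Real.rpow_mul (by norm_num)]; norm_num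
    refine ⟨(81 : ℝ) ^ (1 / 3 : ℝ), by positivity, ?_, e⟩
    by_contra hh
    push Not at hh
    have := pow_lt_pow_left₀ hh (by norm_num) (show 3 ≠ 0 by norm_num)
    rw [e] at this
    norm_num at this
  have hw : (c * P ^ (2 / 3 * (1 - 1 / 2 * (β + γ)))) ^ 3 =
      (P ^ β * P ^ γ * (3 * P ^ (1 / 2 - 3 / 2 * β)) * (3 * P ^ (1 / 2 - 3 / 2 * γ))) ^ 2 := by
    rw [hW, mul_pow, mul_pow, hc3]
    simp only [← Real.rpow_natCast, ← Real.rpow_mul hP0.le]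
    have : 2 / 3 * (1 - 1 / 2 * (β + γ)) * ((3 : ℕ) : ℝ) = (1 - 1 / 2 * (β + γ)) * ((2 : ℕ) : ℝ) := by
      push_cast; ring
    rw [this]; norm_num
  have := k P r1 r2 r3 (P ^ α) (P ^ β) (P ^ γ) _ _ _ (P ^ (0.005 : ℝ)) S hP h1 hS hy
    ((int_one_le g0.y0).trans (hy v0 hv0).1) ((int_one_le g0.z0).trans (hy v0 hv0).2)
    (Real.one_le_rpow hP hα) (Real.one_le_rpow hP hβ) (Real.one_le_rpow hP hγ)
    (size_bound2 hP hα sA) (size_bound2 hP hβ sB) (size_bound2 hP hγ sC)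
    (y_upper hP hβ) (y_upper hP hγ) (by positivity) hw (Real.one_le_rpow hP (by norm_num))
  refine this.trans ?_
  rw [hW]
  have i1 : (P ^ α) ^ 2 ≤ P ^ (0.592 : ℝ) := by
    simp only [← Real.rpow_natCast, ← Real.rpow_mul hP0.le]
    exact mono (by push_cast; linarith)
  have i2 : c * P ^ (2 / 3 * (1 - 1 / 2 * (β + γ))) ≤ 9 * P ^ (0.592 : ℝ) :=
    mul_le_mul hc9 (mono (by linarith)) (by positivity) (by norm_num)
  have i3 : P ^ β * P ^ γ / (P ^ α) ^ 3 ≤ P ^ (0.005 : ℝ) := by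
    simp only [← Real.rpow_natCast, ← Real.rpow_mul hP0.le, ← Real.rpow_add hP0,
      ← Real.rpow_sub hP0]
    exact mono (by push_cast; linarith)
  have i4 : (3 * P ^ (1 / 2 - 3 / 2 * β)) * (3 * P ^ (1 / 2 - 3 / 2 * γ)) / (P ^ α) ^ 3 ≤
      9 * P ^ (0.005 : ℝ) := by
    have : (3 * P ^ (1 / 2 - 3 / 2 * β)) * (3 * P ^ (1 / 2 - 3 / 2 * γ)) / (P ^ α) ^ 3 =
      9 * (P ^ (1 / 2 - 3 / 2 * β) * P ^ (1 / 2 - 3 / 2 * γ) / (P ^ α) ^ 3) := by ring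
    rw [this]
    simp only [← Real.rpow_natCast, ← Real.rpow_mul hP0.le, ← Real.rpow_add hP0,
      ← Real.rpow_sub hP0]
    exact mul_le_mul_of_nonneg_left (mono (by push_cast; linarith)) (by norm_num)
  have i5 : √(9 * P ^ (1 - 1 / 2 * (β + γ))) / (P ^ α) ^ 2 ≤ 3 * P ^ (0.005 : ℝ) := by
    have h9 : √(9 : ℝ) = 3 := by
      rw [show (9 : ℝ) = 3 ^ 2 by norm_num]; exact Real.sqrt_sq (by norm_num)
    rw [Real.sqrt_mul (by norm_num), h9, mul_div_assoc]
    simp only [Real.sqrt_eq_rpow, ← Real.rpow_natCast, ← Real.rpow_mul hP0.le, ← Real.rpow_sub hP0]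
    exact mul_le_mul_of_nonneg_left (mono (by push_cast; linarith)) (by norm_num)
  have i6 : 9 * P ^ (1 - 1 / 2 * (β + γ)) / (P ^ (0.005 : ℝ) * P ^ α) ≤ 9 * P ^ (0.598 : ℝ) := by
    rw [mul_div_assoc]
    simp only [← Real.rpow_add hP0, ← Real.rpow_sub hP0]
    exact mul_le_mul_of_nonneg_left (mono (by linarith)) (by norm_num)
  have i7 : (9 * P ^ (1 - 1 / 2 * (β + γ))) ^ 2 / ((P ^ (0.005 : ℝ)) ^ 3 * (P ^ α) ^ 5) ≤
      81 * P ^ (0.598 : ℝ) := by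
    rw [mul_pow, mul_div_assoc]
    have : (9 : ℝ) ^ 2 = 81 := by norm_num
    rw [this]
    refine mul_le_mul_of_nonneg_left ?_ (by norm_num)
    simp only [← Real.rpow_natCast, ← Real.rpow_mul hP0.le, ← Real.rpow_add hP0,
      ← Real.rpow_sub hP0]
    exact mono (by push_cast; linarith)
  have i8 : P ^ (0.592 : ℝ) * P ^ (0.005 : ℝ) ≤ P ^ (0.598 : ℝ) := by
    rw [← Real.rpow_add hP0]; exact mono (by norm_num)
  calc _ ≤ K * P ^ ε * ((P ^ (0.592 : ℝ) + 9 * P ^ (0.592 : ℝ)) * (P ^ (0.005 : ℝ) +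
        P ^ (0.005 : ℝ) + 9 * P ^ (0.005 : ℝ) + 3 * P ^ (0.005 : ℝ)) + 9 * P ^ (0.598 : ℝ) +
        81 * P ^ (0.598 : ℝ)) := by gcongr
    _ = K * P ^ ε * (140 * (P ^ (0.592 : ℝ) * P ^ (0.005 : ℝ)) + 90 * P ^ (0.598 : ℝ)) := by ring
    _ ≤ K * P ^ ε * (140 * P ^ (0.598 : ℝ) + 90 * P ^ (0.598 : ℝ)) := by gcongr
    _ = _ := by ring

lemma blk5 (ε : ℝ) (hε : 0 < ε) : ∃ K : ℝ, 1 ≤ K ∧ ∀ (P α β γ : ℝ), 1 ≤ P →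
    0 ≤ γ → α + β + γ ≤ 0.602 → 0.296 ≤ α → 0.296 ≤ β →
    Blk K ε P α β γ := by
  obtain ⟨K, hK, k⟩ := region5 ε hε
  refine ⟨27 * K, by linarith, ?_⟩
  intro P α β γ hP hγ hq hα1 hβ1 r1 r2 r3 S h1 h2 h3 hS
  have hα : 0 ≤ α := by linarith
  have hβ : 0 ≤ β := by linarith
  have hP0 : 0 < P := by linarith
  have mono : ∀ {e f : ℝ}, e ≤ f → P ^ e ≤ P ^ f :=
    fun h => Real.rpow_le_rpow_of_exponent_le hP h
  have hy : ∀ v ∈ S, (v.x : ℝ) ≤ 3 * P ^ (1 / 2 - 3 / 2 * α) ∧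
      (v.y : ℝ) ≤ 3 * P ^ (1 / 2 - 3 / 2 * β) ∧
      (v.z : ℝ) ≤ 3 * P ^ (1 / 2 - 3 / 2 * γ) := fun v hv =>
    ⟨xbound' hP (by have := int_one_le (hS v hv).x0; linarith) (hS v hv).Aa h1 (hS v hv).p1,
     xbound' hP (by have := int_one_le (hS v hv).y0; linarith) (hS v hv).Bb h2 (hS v hv).p2,
     xbound' hP (by have := int_one_le (hS v hv).z0; linarith) (hS v hv).Cc h3 (hS v hv).p3⟩
  have hR1 : 1 ≤ P ^ ((9 * β + 1 / 2) / 19) := Real.one_le_rpow hP (by linarith)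
  have := k P r1 r2 r3 (P ^ α) (P ^ β) (P ^ γ) _ _ _ (3 * P ^ ((9 * β + 1 / 2) / 19)) S hP h2 h3 hS hy
    (by positivity) (by positivity) (by positivity) (Real.one_le_rpow hP hβ) (by positivity)
    (by linarith) (by
      have e : (P ^ β) ^ 9 * (3 * P ^ (1 / 2 - 3 / 2 * γ)) =
        3 * ((P ^ β) ^ 9 * P ^ (1 / 2 - 3 / 2 * γ)) := by ring
      rw [e, mul_pow]
      refine mul_le_mul (by norm_num) ?_ (by positivity) (by norm_num)
      simp only [← Real.rpow_natCast, ← Real.rpow_mul hP0.le, ← Real.rpow_add hP0]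
      exact mono (by push_cast; linarith)) (by
      have e : P ^ β ≤ (P ^ ((9 * β + 1 / 2) / 19)) ^ 2 := by
        simp only [← Real.rpow_natCast, ← Real.rpow_mul hP0.le]
        exact mono (by push_cast; linarith)
      rw [mul_pow]
      refine e.trans (le_mul_of_one_le_left (by positivity) (by norm_num)))
  refine this.trans ?_
  have e : (3 * P ^ (1 / 2 - 3 / 2 * α)) * (3 * P ^ (1 / 2 - 3 / 2 * β)) * P ^ γ * P ^ α *
      (3 * P ^ ((9 * β + 1 / 2) / 19)) ≤ 27 * P ^ (0.598 : ℝ) := by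
    have : (3 * P ^ (1 / 2 - 3 / 2 * α)) * (3 * P ^ (1 / 2 - 3 / 2 * β)) * P ^ γ * P ^ α *
      (3 * P ^ ((9 * β + 1 / 2) / 19)) = 27 * (P ^ (1 / 2 - 3 / 2 * α) * P ^ (1 / 2 - 3 / 2 * β) *
        P ^ γ * P ^ α * P ^ ((9 * β + 1 / 2) / 19)) := by ring
    rw [this]
    simp only [← Real.rpow_add hP0]
    exact mul_le_mul_of_nonneg_left (mono (by linarith)) (by norm_num)
  calc _ ≤ K * P ^ ε * (27 * P ^ (0.598 : ℝ)) := by gcongr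
    _ = _ := by ring

lemma blk4 (ε : ℝ) (hε : 0 < ε) : ∃ K : ℝ, 1 ≤ K ∧ ∀ (P α β γ : ℝ), 1 ≤ P →
    0 ≤ γ → 0.598 ≤ α + β + γ → α + β + γ ≤ 0.602 → 0.296 ≤ β → γ ≤ α → α ≤ 0.199 →
    Blk K ε P α β γ := by
  obtain ⟨K, hK, k⟩ := region4 ε hε
  obtain ⟨K2, hK2, k2⟩ := blkS ε hε
  refine ⟨96 * K + K2, by linarith, ?_⟩
  intro P α β γ hP hγ hq1 hq2 hβ1 hγα hα1 r1 r2 r3 S h1 h2 h3 hS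
  have hα : 0 ≤ α := by linarith
  have hβ : 0 ≤ β := by linarith
  have hP0 : 0 < P := by linarith
  rcases S.eq_empty_or_nonempty with rfl | ⟨v0, hv0⟩
  · simp only [Finset.card_empty, Nat.cast_zero]; positivity
  have mono : ∀ {e f : ℝ}, e ≤ f → P ^ e ≤ P ^ f :=
    fun h => Real.rpow_le_rpow_of_exponent_le hP h
  have g0 := hS v0 hv0
  have sA := size_bound hP (int_one_le g0.a0) (int_one_le g0.x0) g0.Aa h1 g0.p1
  have sB := size_bound hP (int_one_le g0.b0) (int_one_le g0.y0) g0.Bb h2 g0.p2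
  have sC := size_bound hP (int_one_le g0.c0) (int_one_le g0.z0) g0.Cc h3 g0.p3
  rcases le_total (0.34 : ℝ) β with hβ2 | hβ2
  · exact (k2 P α β γ hP hα hβ hγ hq2 (size_bound3 hP hβ2 sB)).mono hP (by linarith) r1 r2 r3 S
      h1 h2 h3 hS
  have hy : ∀ v ∈ S, (v.y : ℝ) ≤ 3 * P ^ (1 / 2 - 3 / 2 * β) ∧
      (v.z : ℝ) ≤ 3 * P ^ (1 / 2 - 3 / 2 * γ) := fun v hv =>
    ⟨xbound' hP (by have := int_one_le (hS v hv).y0; linarith) (hS v hv).Bb h2 (hS v hv).p2,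
     xbound' hP (by have := int_one_le (hS v hv).z0; linarith) (hS v hv).Cc h3 (hS v hv).p3⟩
  have := k P r1 r2 r3 (P ^ α) (P ^ β) (P ^ γ) _ _ S hP h1 hS hy (by positivity) (by positivity)
    (Real.one_le_rpow hP hα) (Real.one_le_rpow hP hβ) (Real.one_le_rpow hP hγ)
    (size_bound2 hP hα sA) (size_bound2 hP hβ sB) (size_bound2 hP hγ sC) (y_upper hP hγ)
  refine this.trans ?_
  have j1 : √(P ^ β * P ^ γ * (P ^ γ * (3 * P ^ (1 / 2 - 3 / 2 * γ))) / (P ^ α) ^ 3) ≤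
      3 * P ^ ((β + 1 / 2 * γ + 1 / 2 - 3 * α) / 2) := by
    rw [Real.sqrt_le_left (by positivity), mul_pow]
    have : P ^ β * P ^ γ * (P ^ γ * (3 * P ^ (1 / 2 - 3 / 2 * γ))) / (P ^ α) ^ 3 =
      3 * (P ^ β * P ^ γ * (P ^ γ * P ^ (1 / 2 - 3 / 2 * γ)) / (P ^ α) ^ 3) := by ring
    rw [this]
    refine mul_le_mul (by norm_num) ?_ (by positivity) (by norm_num)
    simp only [← Real.rpow_natCast, ← Real.rpow_mul hP0.le, ← Real.rpow_add hP0,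
      ← Real.rpow_sub hP0]
    exact mono (by push_cast; linarith)
  have j2 : P ^ β * P ^ γ / (P ^ α) ^ 3 = P ^ (β + γ - 3 * α) := by
    simp only [← Real.rpow_natCast, ← Real.rpow_mul hP0.le, ← Real.rpow_add hP0,
      ← Real.rpow_sub hP0]
    congr 1; push_cast; ring
  have j3 : 3 * P ^ (1 / 2 - 3 / 2 * γ) / (P ^ α) ^ 2 = 3 * P ^ (1 / 2 - 3 / 2 * γ - 2 * α) := by
    rw [mul_div_assoc]
    simp only [← Real.rpow_natCast, ← Real.rpow_mul hP0.le, ← Real.rpow_sub hP0]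
    congr 2; push_cast; ring
  have j4 : 3 * P ^ (1 / 2 - 3 / 2 * β) * P ^ α * P ^ α = 3 * P ^ (1 / 2 - 3 / 2 * β + 2 * α) := by
    rw [mul_assoc, mul_assoc]
    simp only [← Real.rpow_add hP0]
    congr 2; ring
  rw [j2, j3, j4]
  set U := (1 / 2 - 3 / 2 * β + 2 * α)
  set V := (β + 1 / 2 * γ + 1 / 2 - 3 * α) / 2
  set M1 := β + γ - 3 * α
  set M2 := 1 / 2 - 3 / 2 * γ - 2 * α
  have f0 : P ^ U ≤ P ^ (0.598 : ℝ) := mono (by simp only [U]; linarith)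
  have f1 : P ^ (U + M1) ≤ P ^ (0.598 : ℝ) := mono (by simp only [U, M1]; linarith)
  have f2 : P ^ (U + M2) ≤ P ^ (0.598 : ℝ) := mono (by simp only [U, M2]; linarith)
  have f3 : P ^ (U + V) ≤ P ^ (0.598 : ℝ) := mono (by simp only [U, V]; linarith)
  have f4 : P ^ (U + V + M1) ≤ P ^ (0.598 : ℝ) := mono (by simp only [U, V, M1]; linarith)
  have f5 : P ^ (U + V + M2) ≤ P ^ (0.598 : ℝ) := mono (by simp only [U, V, M2]; linarith)
  calc _ ≤ K * P ^ ε * (3 * P ^ U * ((1 + 3 * P ^ V) * (1 + P ^ M1 + 3 * P ^ M2))) := by gcongr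
    _ = K * P ^ ε * (3 * P ^ U + 3 * (P ^ U * P ^ M1) + 9 * (P ^ U * P ^ M2) +
        9 * (P ^ U * P ^ V) + 9 * (P ^ U * P ^ V * P ^ M1) + 27 * (P ^ U * P ^ V * P ^ M2)) := by ring
    _ = K * P ^ ε * (3 * P ^ U + 3 * P ^ (U + M1) + 9 * P ^ (U + M2) +
        9 * P ^ (U + V) + 9 * P ^ (U + V + M1) + 27 * P ^ (U + V + M2)) := by
      simp only [← Real.rpow_add hP0]
    _ ≤ K * P ^ ε * (3 * P ^ (0.598 : ℝ) + 3 * P ^ (0.598 : ℝ) + 9 * P ^ (0.598 : ℝ) +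
        9 * P ^ (0.598 : ℝ) + 9 * P ^ (0.598 : ℝ) + 27 * P ^ (0.598 : ℝ)) := by gcongr
    _ = 60 * K * P ^ ε * P ^ (0.598 : ℝ) := by ring
    _ ≤ _ := by gcongr; linarith

lemma blk_sorted (ε : ℝ) (hε : 0 < ε) : ∃ K : ℝ, 1 ≤ K ∧ ∀ (P α β γ : ℝ), 1 ≤ P → 0 ≤ γ →
    γ ≤ α → α ≤ β → Blk K ε P α β γ := by
  obtain ⟨K1, hK1, k1⟩ := blk1 ε hε
  obtain ⟨K2, hK2, k2⟩ := blk2 ε hε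
  obtain ⟨K3, hK3, k3⟩ := blk3 ε hε
  obtain ⟨K4, hK4, k4⟩ := blk4 ε hε
  obtain ⟨K5, hK5, k5⟩ := blk5 ε hε
  refine ⟨K1 + K2 + K3 + K4 + K5, by linarith, ?_⟩
  intro P α β γ hP hγ h1 h2
  have hα : 0 ≤ α := by linarith
  have hβ : 0 ≤ β := by linarith
  rcases le_total (α + β + γ) 0.598 with q1 | q1
  · exact (k1 P α β γ hP hα hβ hγ q1).mono hP (by linarith)
  rcases le_total 0.602 (α + β + γ) with q2 | q2
  · exact (k2 P α β γ hP hα hβ hγ q2).mono hP (by linarith)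
  rcases le_total β 0.296 with b1 | b1
  · exact ((k3 P β α γ hP hα hγ (by linarith) (by linarith) (by linarith) b1).mono hP
      (by linarith)).swap12
  rcases le_total 0.296 α with a1 | a1
  · exact (k5 P α β γ hP hγ q2 a1 b1).mono hP (by linarith)
  rcases le_total α 0.199 with a2 | a2
  · exact (k4 P α β γ hP hγ q1 q2 b1 h1 a2).mono hP (by linarith)
  · exact (k3 P α β γ hP hβ hγ q1 q2 a2 a1).mono hP (by linarith)

lemma blk (ε : ℝ) (hε : 0 < ε) : ∃ K : ℝ, 1 ≤ K ∧ ∀ (P α β γ : ℝ), 1 ≤ P → 0 ≤ α → 0 ≤ β → 0 ≤ γ →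
    Blk K ε P α β γ := by
  obtain ⟨K, hK, k⟩ := blk_sorted ε hε
  refine ⟨K, hK, ?_⟩
  intro P α β γ hP hα hβ hγ
  rcases le_total α β with h1 | h1 <;> rcases le_total β γ with h2 | h2 <;>
    rcases le_total α γ with h3 | h3
  · exact (k P β γ α hP hα h1 h2).swap23.swap12
  · have : α = γ := by linarith
    have : β = γ := by linarith
    subst_vars
    exact k P _ _ _ hP hγ le_rfl le_rfl
  · exact (k P γ β α hP hα h3 h2).swap23.swap12.swap23
  · exact k P α β γ hP hγ h3 h1
  · exact (k P α γ β hP hβ h1 h3).swap23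
  · exact (k P γ α β hP hβ h2 h3).swap12.swap23
  · have : α = γ := by linarith
    have : β = γ := by linarith
    subst_vars
    exact k P _ _ _ hP hγ le_rfl le_rfl
  · exact (k P β α γ hP hγ h2 h1).swap12

noncomputable def cl (a : ℤ) : ℕ := Nat.clog 2 a.toNat

lemma cl_ge {a : ℤ} : (a : ℝ) ≤ 2 ^ (cl a) := by
  have h1 : a.toNat ≤ 2 ^ cl a := Nat.le_pow_clog (by norm_num) _
  have h2 : a ≤ (a.toNat : ℤ) := Int.self_le_toNat a
  have h3 : (a : ℝ) ≤ (a.toNat : ℝ) := by exact_mod_cast h2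
  refine h3.trans (by exact_mod_cast h1)

lemma cl_le {a : ℤ} (ha : 0 < a) : (2 : ℝ) ^ (cl a) ≤ 2 * a := by
  have h2 : (a.toNat : ℤ) = a := Int.toNat_of_nonneg ha.le
  have h3 : (a : ℝ) = (a.toNat : ℝ) := by exact_mod_cast h2.symm
  rw [h3]
  by_cases h1 : 1 < a.toNat
  · have h5 : 2 ^ (Nat.clog 2 a.toNat).pred < a.toNat :=
      Nat.pow_pred_clog_lt_self (by norm_num) h1
    have h6 : 0 < Nat.clog 2 a.toNat := Nat.clog_pos (by norm_num) h1
    have h7 : 2 ^ (cl a) = 2 ^ (Nat.clog 2 a.toNat).pred * 2 := by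
      rw [← pow_succ, Nat.pred_eq_sub_one, Nat.sub_add_cancel h6]; rfl
    have : 2 ^ (cl a) ≤ 2 * a.toNat := by omega
    exact_mod_cast this
  · have h4 : a.toNat = 1 := by omega
    unfold cl
    rw [h4]
    norm_num

lemma all_blocks (ε : ℝ) (hε : 0 < ε) : ∃ K : ℝ, 1 ≤ K ∧ ∀ (P : ℝ) (r1 r2 r3 : ℤ) (S : Finset Pt),
    2 ≤ P → r1 ≠ 0 → r2 ≠ 0 → r3 ≠ 0 →
    (∀ v ∈ S, Good P r1 r2 r3 (2 ^ cl v.a) (2 ^ cl v.b) (2 ^ cl v.c) v) →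
    (S.card : ℝ) ≤ K * P ^ (0.598 + ε) := by
  classical
  obtain ⟨K, hK, k⟩ := blk (ε / 4) (by linarith)
  have hε4 : 0 < ε / 4 := by linarith
  obtain ⟨M, hM, m⟩ : ∃ M : ℝ, 1 ≤ M ∧ ∀ P : ℝ, 2 ≤ P → ((Nat.log 2 ⌊10 * P⌋₊ + 1 : ℕ) : ℝ) ≤
      M * P ^ (ε / 4) := by
    refine ⟨1 + 20 ^ (ε / 4) / (ε / 4 * Real.log 2), ?_, ?_⟩
    · have : 0 < Real.log 2 := Real.log_pos (by norm_num)
      have : (0 : ℝ) ≤ 20 ^ (ε / 4) / (ε / 4 * Real.log 2) := by positivity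
      linarith
    · intro P hP
      have hl : 0 < Real.log 2 := Real.log_pos (by norm_num)
      have h1 : (2 : ℝ) ^ Nat.log 2 ⌊10 * P⌋₊ ≤ 10 * P := by
        have h2 : 2 ^ Nat.log 2 ⌊10 * P⌋₊ ≤ ⌊10 * P⌋₊ := Nat.pow_log_le_self 2 (by
          have : 0 < ⌊10 * P⌋₊ := Nat.floor_pos.mpr (by linarith)
          omega)
        have h3 : ((2 ^ Nat.log 2 ⌊10 * P⌋₊ : ℕ) : ℝ) ≤ (⌊10 * P⌋₊ : ℝ) := by exact_mod_cast h2
        push_cast at h3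
        exact h3.trans (Nat.floor_le (by linarith))
      have h4 : (Nat.log 2 ⌊10 * P⌋₊ : ℝ) * Real.log 2 ≤ Real.log (10 * P) := by
        rw [← Real.log_pow]
        exact Real.log_le_log (by positivity) h1
      have h5 : Real.log (10 * P) ≤ (10 * P) ^ (ε / 4) / (ε / 4) :=
        Real.log_le_rpow_div (by linarith) hε4
      have h6 : (10 * P) ^ (ε / 4) ≤ 20 ^ (ε / 4) * P ^ (ε / 4) := by
        rw [← Real.mul_rpow (by norm_num) (by linarith)]
        exact Real.rpow_le_rpow (by linarith) (by linarith) hε4.le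
      have h7 : 1 ≤ P ^ (ε / 4) := Real.one_le_rpow (by linarith) hε4.le
      have h8 : (Nat.log 2 ⌊10 * P⌋₊ : ℝ) ≤ 20 ^ (ε / 4) / (ε / 4 * Real.log 2) * P ^ (ε / 4) := by
        rw [div_mul_eq_mul_div, le_div_iff₀ (by positivity)]
        have h9 : (Nat.log 2 ⌊10 * P⌋₊ : ℝ) * Real.log 2 ≤ (10 * P) ^ (ε / 4) / (ε / 4) := h4.trans h5
        rw [le_div_iff₀ hε4] at h9
        linarith
      push_cast
      linarith
  refine ⟨M * M * M * K, ?_, ?_⟩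
  · have := one_le_mul_of_one_le_of_one_le (one_le_mul_of_one_le_of_one_le
      (one_le_mul_of_one_le_of_one_le hM hM) hM) hK
    exact this
  intro P r1 r2 r3 S hP h1 h2 h3 hS
  have hP0 : 0 < P := by linarith
  have hP1 : 1 ≤ P := by linarith
  have key : ∀ {a x A : ℝ} {i : ℕ} {r : ℤ}, r ≠ 0 → 1 ≤ a → 1 ≤ x → A = 2 ^ i → A ≤ 2 * a →
      |(r : ℝ)| * a ^ 3 * x ^ 2 ≤ P → i ∈ Finset.range (Nat.log 2 ⌊10 * P⌋₊ + 1) := by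
    intro a x A i r hr ha hx hA hAa hp
    have e1 := int_one_le_abs hr
    have e2 : 1 * a * 1 ≤ P := by
      refine le_trans ?_ hp
      have : 1 ≤ x ^ 2 := one_le_pow₀ hx
      have : a ≤ a ^ 3 := le_self_pow₀ ha (by norm_num)
      gcongr
    have e3 : (2 : ℝ) ^ i ≤ 10 * P := by rw [← hA]; linarith
    have e4 : 2 ^ i ≤ ⌊10 * P⌋₊ := Nat.le_floor (by push_cast; exact e3)
    have : i ≤ Nat.log 2 ⌊10 * P⌋₊ := Nat.le_log_of_pow_le (by norm_num) e4
    exact Finset.mem_range.mpr (by omega)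
  set f : Pt → ℕ × ℕ × ℕ := fun v => (cl v.a, cl v.b, cl v.c)
  set T := Finset.range (Nat.log 2 ⌊10 * P⌋₊ + 1)
  have hT := card_le_fiber S f (T ×ˢ T ×ˢ T) (by
    intro v hv
    have g := hS v hv
    refine Finset.mem_product.mpr ⟨?_, Finset.mem_product.mpr ⟨?_, ?_⟩⟩
    · exact key h1 (int_one_le g.a0) (int_one_le g.x0) rfl g.Aa g.p1
    · exact key h2 (int_one_le g.b0) (int_one_le g.y0) rfl g.Bb g.p2
    · exact key h3 (int_one_le g.c0) (int_one_le g.z0) rfl g.Cc g.p3)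
    (K * P ^ (ε / 4) * P ^ (0.598 : ℝ)) (by
    rintro ⟨i, j, l⟩ -
    have e : ∀ i : ℕ, P ^ (Real.logb P (2 ^ i)) = 2 ^ i := fun i =>
      Real.rpow_logb hP0 (by linarith) (by positivity)
    have n : ∀ i : ℕ, 0 ≤ Real.logb P (2 ^ i) := fun i =>
      Real.logb_nonneg (by linarith) (one_le_pow₀ (by norm_num))
    refine k P _ _ _ hP1 (n i) (n j) (n l) r1 r2 r3 _ h1 h2 h3 ?_
    intro v hv
    obtain ⟨g1, g2⟩ := Finset.mem_filter.mp hv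
    simp only [f, Prod.mk.injEq] at g2
    have := hS v g1
    rw [e, e, e, ← g2.1, ← g2.2.1, ← g2.2.2]
    exact this)
  refine hT.trans ?_
  rw [Finset.card_product, Finset.card_product, Finset.card_range]
  have hm := m P hP
  rw [Nat.cast_mul, Nat.cast_mul]
  set N := ((Nat.log 2 ⌊10 * P⌋₊ + 1 : ℕ) : ℝ)
  have hN : 0 ≤ N := by positivity
  have hE : P ^ (0.598 + ε) = P ^ (ε / 4) * P ^ (ε / 4) * P ^ (ε / 4) * P ^ (ε / 4) * P ^ (0.598 : ℝ) := by
    simp only [← Real.rpow_add hP0]; congr 1; ring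
  rw [hE]
  calc N * (N * N) * (K * P ^ (ε / 4) * P ^ (0.598 : ℝ)) ≤
      (M * P ^ (ε / 4)) * ((M * P ^ (ε / 4)) * (M * P ^ (ε / 4))) *
        (K * P ^ (ε / 4) * P ^ (0.598 : ℝ)) := by gcongr
    _ = _ := by ring

/-- decomposition of a number that becomes squarefull after multiplication by `d` -/
lemma decomp (n : ℕ) : 0 < n → ∀ d : ℕ, (∀ p : ℕ, p.Prime → p ∣ n → p ^ 2 ∣ d * n) →
    ∃ r a x : ℕ, n = r * a ^ 3 * x ^ 2 ∧ Squarefree a ∧ r ∣ d := by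
  induction n using Nat.recOnPosPrimePosCoprime with
  | prime_pow p k hp hk =>
    intro _ d h
    have h1 := h p hp (dvd_pow_self p (by omega))
    rcases Nat.even_or_odd' k with ⟨l, rfl | rfl⟩
    · exact ⟨1, 1, p ^ l, by ring, squarefree_one, one_dvd _⟩
    · rcases Nat.eq_zero_or_pos l with rfl | hl
      · refine ⟨p, 1, 1, by ring, squarefree_one, ?_⟩
        simp only [mul_zero, zero_add, pow_one, sq] at h1
        exact Nat.dvd_of_mul_dvd_mul_right hp.pos h1
      · obtain ⟨j, rfl⟩ : ∃ j, l = j + 1 := ⟨l - 1, by omega⟩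
        exact ⟨1, p, p ^ j, by ring, hp.squarefree, one_dvd _⟩
  | zero => intro h; omega
  | one => intro _ d _; exact ⟨1, 1, 1, by norm_num, squarefree_one, one_dvd _⟩
  | coprime m n hm hn hmn ihm ihn =>
    intro _ d h
    obtain ⟨r, a, x, e1, e2, e3⟩ := ihm (by omega) d (by
      intro p hp hpm
      have h1 := h p hp (hpm.mul_right n)
      have h2 : Nat.Coprime (p ^ 2) n :=
        Nat.Coprime.pow_left 2 (Nat.Coprime.coprime_dvd_left hpm hmn)
      rw [← mul_assoc] at h1
      exact h2.dvd_of_dvd_mul_right h1)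
    obtain ⟨s, b, y, f1, f2, f3⟩ := ihn (by omega) d (by
      intro p hp hpn
      have h1 := h p hp (hpn.mul_left m)
      have h2 : Nat.Coprime (p ^ 2) m :=
        Nat.Coprime.pow_left 2 (Nat.Coprime.coprime_dvd_left hpn hmn.symm)
      rw [show d * (m * n) = d * n * m by ring] at h1
      exact h2.dvd_of_dvd_mul_right h1)
    have ra : r * a ∣ m := ⟨a ^ 2 * x ^ 2, by rw [e1]; ring⟩
    have sb : s * b ∣ n := ⟨b ^ 2 * y ^ 2, by rw [f1]; ring⟩
    have co := Nat.Coprime.of_dvd ra sb hmn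
    refine ⟨r * s, a * b, x * y, by rw [e1, f1]; ring, ?_, ?_⟩
    · rw [Nat.squarefree_mul (Nat.Coprime.coprime_mul_left (Nat.Coprime.coprime_mul_left_right co))]
      exact ⟨e2, f2⟩
    · exact Nat.Coprime.mul_dvd_of_dvd_of_dvd
        (Nat.Coprime.coprime_mul_right (Nat.Coprime.coprime_mul_right_right co)) e3 f3

/-- the triple `t` with gcd `d` is represented by a good point -/
def TripleRep (B : ℝ) (d : ℕ) (ρ : ℕ × ℕ × ℕ) (t : ℕ × ℕ × ℕ) (v : Pt) : Prop :=
  Good (2 * B / d) ρ.1 ρ.2.1 (-(ρ.2.2 : ℤ)) (2 ^ cl v.a) (2 ^ cl v.b) (2 ^ cl v.c) v ∧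
  (t.1 : ℤ) = d * (ρ.1 * v.a ^ 3 * v.x ^ 2) ∧ (t.2.1 : ℤ) = d * (ρ.2.1 * v.b ^ 3 * v.y ^ 2) ∧
  (t.2.2 : ℤ) = d * (ρ.2.2 * v.c ^ 3 * v.z ^ 2)

lemma rep_aux {n r a x : ℕ} (hn : 0 < n) (h : n = r * a ^ 3 * x ^ 2) :
    0 < r ∧ 0 < a ∧ 0 < x ∧ r * a * x ∣ n := by
  refine ⟨?_, ?_, ?_, ?_⟩
  · rcases Nat.eq_zero_or_pos r with rfl | h1
    · simp at h; omega
    · exact h1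
  · rcases Nat.eq_zero_or_pos a with rfl | h1
    · simp at h; omega
    · exact h1
  · rcases Nat.eq_zero_or_pos x with rfl | h1
    · simp at h; omega
    · exact h1
  · exact ⟨a ^ 2 * x, by rw [h]; ring⟩

lemma rep_coprime {m n s t : ℕ} (h : Nat.Coprime m n) (hs : s ∣ m) (ht : t ∣ n) :
    IsCoprime (s : ℤ) (t : ℤ) :=
  Nat.isCoprime_iff_coprime.mpr (Nat.Coprime.of_dvd hs ht h)

lemma exists_rep (B : ℝ) (u v w : ℕ) (hu : 0 < u) (hv : 0 < v) (su : Squarefull u)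
    (sv : Squarefull v) (sw : Squarefull w) (huv : u + v = w) (hB : (w : ℝ) ≤ B) :
    ∃ r1 r2 r3 : ℕ, r1 ∣ Nat.gcd u v ∧ r2 ∣ Nat.gcd u v ∧ r3 ∣ Nat.gcd u v ∧
      ∃ q : Pt, TripleRep B (Nat.gcd u v) (r1, r2, r3) (u, v, w) q := by
  have hd : 0 < Nat.gcd u v := Nat.gcd_pos_of_pos_left _ hu
  obtain ⟨m, n, hmn, hum, hvn⟩ := Nat.exists_coprime u v
  set d := Nat.gcd u v
  have hw : w = (m + n) * d := by rw [← huv, hum, hvn]; ring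
  have hm : 0 < m := Nat.pos_of_ne_zero (by rintro rfl; omega)
  have hn : 0 < n := Nat.pos_of_ne_zero (by rintro rfl; omega)
  obtain ⟨r1, a, x, e1, e2, e3⟩ := decomp m hm d (by
    intro p hp hpm
    rw [mul_comm, ← hum]
    exact su p hp (hum ▸ hpm.mul_right d))
  obtain ⟨r2, b, y, f1, f2, f3⟩ := decomp n hn d (by
    intro p hp hpm
    rw [mul_comm, ← hvn]
    exact sv p hp (hvn ▸ hpm.mul_right d))
  obtain ⟨r3, c, z, g1, g2, g3⟩ := decomp (m + n) (by omega) d (by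
    intro p hp hpm
    rw [mul_comm, ← hw]
    exact sw p hp (hw ▸ hpm.mul_right d))
  obtain ⟨e4, e5, e6, e7⟩ := rep_aux hm e1
  obtain ⟨f4, f5, f6, f7⟩ := rep_aux hn f1
  obtain ⟨g4, g5, g6, g7⟩ := rep_aux (by omega) g1
  have hd' : (0 : ℝ) < d := by exact_mod_cast hd
  have hwB : ((m + n : ℕ) : ℝ) ≤ B / d := by
    rw [le_div_iff₀ hd']
    have : (w : ℝ) = ((m + n : ℕ) : ℝ) * d := by exact_mod_cast hw
    rw [← this]; exact hB
  have hwB2 : ((m + n : ℕ) : ℝ) ≤ 2 * B / d := by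
    have h0 : (0 : ℝ) ≤ ((m + n : ℕ) : ℝ) := by positivity
    have : 2 * B / d = 2 * (B / d) := by ring
    rw [this]; linarith
  have hm2 : (m : ℝ) ≤ 2 * B / d := by
    refine le_trans ?_ hwB2; push_cast; linarith [(Nat.cast_nonneg n : (0 : ℝ) ≤ n)]
  have hn2 : (n : ℝ) ≤ 2 * B / d := by
    refine le_trans ?_ hwB2; push_cast; linarith [(Nat.cast_nonneg m : (0 : ℝ) ≤ m)]
  have co13 : Nat.Coprime m (m + n) := by simpa using hmn
  have co23 : Nat.Coprime n (m + n) := by simpa using hmn.symm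
  refine ⟨r1, r2, r3, e3, f3, g3, ⟨a, b, c, x, y, z⟩, ?_, ?_, ?_, ?_⟩
  · refine ⟨?_, ?_, ?_, ?_, ?_, ?_, ?_, ?_, ?_, ?_, ?_, ?_, ?_, cl_ge, cl_ge, cl_ge, ?_, ?_, ?_, ?_,
      ?_, ?_⟩
    · exact Int.natCast_pos.mpr e5
    · exact Int.natCast_pos.mpr f5
    · exact Int.natCast_pos.mpr g5
    · exact Int.natCast_pos.mpr e6
    · exact Int.natCast_pos.mpr f6
    · exact Int.natCast_pos.mpr g6
    · exact Int.squarefree_natCast.mpr e2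
    · exact Int.squarefree_natCast.mpr f2
    · exact Int.squarefree_natCast.mpr g2
    · have h1 : (m : ℤ) = r1 * a ^ 3 * x ^ 2 := by exact_mod_cast e1
      have h2 : (n : ℤ) = r2 * b ^ 3 * y ^ 2 := by exact_mod_cast f1
      have h3 : (m : ℤ) + n = r3 * c ^ 3 * z ^ 2 := by exact_mod_cast g1
      simp only
      linarith
    · simp only [Int.cast_natCast, abs_of_nonneg (Nat.cast_nonneg r1 : (0 : ℝ) ≤ r1)]
      refine le_trans (le_of_eq ?_) hm2
      exact_mod_cast e1.symm
    · simp only [Int.cast_natCast, abs_of_nonneg (Nat.cast_nonneg r2 : (0 : ℝ) ≤ r2)]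
      refine le_trans (le_of_eq ?_) hn2
      exact_mod_cast f1.symm
    · simp only [Int.cast_neg, abs_neg, Int.cast_natCast,
        abs_of_nonneg (Nat.cast_nonneg r3 : (0 : ℝ) ≤ r3)]
      refine le_trans (le_of_eq ?_) hwB2
      exact_mod_cast g1.symm
    · exact cl_le (Int.natCast_pos.mpr e5)
    · exact cl_le (Int.natCast_pos.mpr f5)
    · exact cl_le (Int.natCast_pos.mpr g5)
    · have := rep_coprime hmn e7 f7
      push_cast at this
      exact this
    · have := rep_coprime co13 e7 g7
      push_cast at this
      simp only [neg_mul]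
      exact this.neg_right
    · have := rep_coprime co23 f7 g7
      push_cast at this
      simp only [neg_mul]
      exact this.neg_right
  · have : u = d * (r1 * a ^ 3 * x ^ 2) := by rw [← e1, hum]; ring
    simp only
    exact_mod_cast this
  · have : v = d * (r2 * b ^ 3 * y ^ 2) := by rw [← f1, hvn]; ring
    simp only
    exact_mod_cast this
  · have : w = d * (r3 * c ^ 3 * z ^ 2) := by rw [← g1, hw]; ring
    simp only
    exact_mod_cast this

lemma gcd_fiber (ε : ℝ) (hε : 0 < ε) : ∃ K : ℝ, 1 ≤ K ∧ ∀ (B : ℝ) (d : ℕ)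
    (S : Finset (ℕ × ℕ × ℕ)), 0 < d → (d : ℝ) ≤ B →
    (∀ t ∈ S, 0 < t.1 ∧ 0 < t.2.1 ∧ Squarefull t.1 ∧ Squarefull t.2.1 ∧ Squarefull t.2.2 ∧
      t.1 + t.2.1 = t.2.2 ∧ (t.2.2 : ℝ) ≤ B ∧ Nat.gcd t.1 t.2.1 = d) →
    (S.card : ℝ) ≤ K * (B ^ (0.598 + ε) * (d : ℝ) ^ (-0.598 : ℝ)) := by
  classical
  obtain ⟨K, hK, k⟩ := all_blocks ε hε
  obtain ⟨L, hL, l⟩ := divisor_bound (ε / 3) (by linarith)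
  have h2 : (1 : ℝ) ≤ 2 ^ (0.598 + ε) := Real.one_le_rpow (by norm_num) (by linarith)
  refine ⟨L * (L * L) * (K * 2 ^ (0.598 + ε)), ?_, ?_⟩
  · exact one_le_mul_of_one_le_of_one_le (one_le_mul_of_one_le_of_one_le hL
      (one_le_mul_of_one_le_of_one_le hL hL)) (one_le_mul_of_one_le_of_one_le hK h2)
  intro B d S hd hdB hS
  have hd' : (0 : ℝ) < d := by exact_mod_cast hd
  have hB0 : 0 < B := by linarith
  have hc := card_le_cover_sum S (d.divisors ×ˢ d.divisors ×ˢ d.divisors)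
    (fun ρ t => ∃ q : Pt, TripleRep B d ρ t q) (by
    rintro ⟨u, v, w⟩ ht
    obtain ⟨t1, t2, t3, t4, t5, t6, t7, t8⟩ := hS _ ht
    obtain ⟨r1, r2, r3, q1, q2, q3, q4⟩ := exists_rep B u v w t1 t2 t3 t4 t5 t6 t7
    simp only at t8
    rw [t8] at q1 q2 q3 q4
    refine ⟨(r1, r2, r3), ?_, q4⟩
    simp only [Finset.mem_product, Nat.mem_divisors]
    exact ⟨⟨q1, hd.ne'⟩, ⟨q2, hd.ne'⟩, ⟨q3, hd.ne'⟩⟩)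
    (fun _ => K * (2 * B / d) ^ (0.598 + ε)) (by
    rintro ⟨r1, r2, r3⟩ hρ
    simp only [Finset.mem_product, Nat.mem_divisors] at hρ
    obtain ⟨⟨q1, -⟩, ⟨q2, -⟩, ⟨q3, -⟩⟩ := hρ
    set F := S.filter (fun t => ∃ q : Pt, TripleRep B d (r1, r2, r3) t q)
    have hF : ∀ t ∈ F, ∃ q : Pt, TripleRep B d (r1, r2, r3) t q := fun t ht => (Finset.mem_filter.mp ht).2
    have : Nonempty Pt := ⟨⟨0, 0, 0, 0, 0, 0⟩⟩
    choose! q hq using hF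
    have inj : Set.InjOn q F := by
      intro s hs t ht hst
      obtain ⟨-, a1, a2, a3⟩ := hq s hs
      obtain ⟨-, b1, b2, b3⟩ := hq t ht
      rw [hst] at a1 a2 a3
      have c1 : (s.1 : ℤ) = t.1 := a1.trans b1.symm
      have c2 : (s.2.1 : ℤ) = t.2.1 := a2.trans b2.symm
      have c3 : (s.2.2 : ℤ) = t.2.2 := a3.trans b3.symm
      exact Prod.ext (by exact_mod_cast c1) (Prod.ext (by exact_mod_cast c2) (by exact_mod_cast c3))
    rw [← Finset.card_image_of_injOn inj]
    have pos : ∀ {r : ℕ}, r ∣ d → (r : ℤ) ≠ 0 := fun h => by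
      have := Nat.pos_of_dvd_of_pos h hd
      omega
    refine k (2 * B / d) r1 r2 (-(r3 : ℤ)) _ ?_ (pos q1) (pos q2) (neg_ne_zero.mpr (pos q3)) ?_
    · rw [le_div_iff₀ hd']; linarith
    · intro v hv
      obtain ⟨t, ht, rfl⟩ := Finset.mem_image.mp hv
      exact (hq t ht).1)
  rw [Finset.sum_const, Finset.card_product, Finset.card_product, nsmul_eq_mul] at hc
  refine hc.trans ?_
  have hl := l d hd
  push_cast
  have e1 : (2 * B / d) ^ (0.598 + ε) = 2 ^ (0.598 + ε) * B ^ (0.598 + ε) * (d : ℝ) ^ (-(0.598 + ε)) := by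
    rw [Real.div_rpow (by linarith) hd'.le, Real.mul_rpow (by norm_num) hB0.le,
      Real.rpow_neg hd'.le, div_eq_mul_inv]
  have e2 : (d : ℝ) ^ (ε / 3) * ((d : ℝ) ^ (ε / 3) * (d : ℝ) ^ (ε / 3)) * (d : ℝ) ^ (-(0.598 + ε)) =
      (d : ℝ) ^ (-0.598 : ℝ) := by
    simp only [← Real.rpow_add hd']; congr 1; ring
  rw [e1, ← e2]
  calc (d.divisors.card : ℝ) * (d.divisors.card * d.divisors.card) *
      (K * (2 ^ (0.598 + ε) * B ^ (0.598 + ε) * (d : ℝ) ^ (-(0.598 + ε)))) ≤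
      (L * (d : ℝ) ^ (ε / 3)) * ((L * (d : ℝ) ^ (ε / 3)) * (L * (d : ℝ) ^ (ε / 3))) *
      (K * (2 ^ (0.598 + ε) * B ^ (0.598 + ε) * (d : ℝ) ^ (-(0.598 + ε)))) := by gcongr
    _ = _ := by ring

lemma sum_rpow_bound (s : ℝ) (hs : 1 < s) : ∃ M : ℝ, 1 ≤ M ∧ ∀ T : Finset ℕ,
    ∑ n ∈ T, (n : ℝ) ^ (-s) ≤ M := by
  have h : Summable (fun n : ℕ => (n : ℝ) ^ (-s)) := Real.summable_nat_rpow.mpr (by linarith)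
  refine ⟨max 1 (∑' n : ℕ, (n : ℝ) ^ (-s)), le_max_left _ _, fun T => ?_⟩
  exact (h.sum_le_tsum T (fun n _ => by positivity)).trans (le_max_right _ _)

lemma triples_finset (ε : ℝ) (hε : 0 < ε) : ∃ K : ℝ, 1 ≤ K ∧ ∀ (B : ℝ)
    (S : Finset (ℕ × ℕ × ℕ)), 2 ≤ B →
    (∀ t ∈ S, 0 < t.1 ∧ 0 < t.2.1 ∧ Squarefull t.1 ∧ Squarefull t.2.1 ∧ Squarefull t.2.2 ∧
      t.1 + t.2.1 = t.2.2 ∧ (t.2.2 : ℝ) ≤ B) →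
    (S.card : ℝ) ≤ K * B ^ (0.598 + ε) := by
  classical
  obtain ⟨K, hK, k⟩ := gcd_fiber ε hε
  obtain ⟨M1, hM1, m1⟩ := sum_rpow_bound 1.794 (by norm_num)
  obtain ⟨M2, hM2, m2⟩ := sum_rpow_bound 1.196 (by norm_num)
  refine ⟨K * (M1 * M2), one_le_mul_of_one_le_of_one_le hK (one_le_mul_of_one_le_of_one_le hM1 hM2),
    ?_⟩
  intro B S hB hS
  have hB0 : 0 < B := by linarith
  have hc := card_le_cover_sum S (Finset.Icc 1 ⌊B⌋₊ ×ˢ Finset.Icc 1 ⌊B⌋₊)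
    (fun e t => Nat.gcd t.1 t.2.1 = e.1 ^ 3 * e.2 ^ 2) (by
    rintro ⟨u, v, w⟩ ht
    obtain ⟨t1, t2, t3, t4, t5, t6, t7⟩ := hS _ ht
    simp only at t1 t2 t3 t4 t5 t6 t7 ⊢
    have hd : 0 < Nat.gcd u v := Nat.gcd_pos_of_pos_left _ t1
    obtain ⟨r, a, x, e1, -, e3⟩ := decomp (Nat.gcd u v) hd 1 (by
      intro p hp hpd
      rw [one_mul]
      exact Nat.dvd_gcd (t3 p hp (hpd.trans (Nat.gcd_dvd_left u v)))
        (t4 p hp (hpd.trans (Nat.gcd_dvd_right u v))))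
    have hr : r = 1 := Nat.dvd_one.mp e3
    obtain ⟨-, e5, e6, e7⟩ := rep_aux hd e1
    have hle : Nat.gcd u v ≤ ⌊B⌋₊ := by
      refine (Nat.le_of_dvd t1 (Nat.gcd_dvd_left u v)).trans (Nat.le_floor ?_)
      refine le_trans ?_ t7
      exact_mod_cast (by omega : u ≤ w)
    have ha : a ∣ Nat.gcd u v := (Dvd.intro_left r rfl).trans ((Dvd.intro x rfl).trans e7)
    have hx : x ∣ Nat.gcd u v := (Dvd.intro_left (r * a) rfl).trans e7
    refine ⟨(a, x), ?_, by rw [e1, hr, one_mul]⟩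
    simp only [Finset.mem_product, Finset.mem_Icc]
    exact ⟨⟨e5, (Nat.le_of_dvd hd ha).trans hle⟩, ⟨e6, (Nat.le_of_dvd hd hx).trans hle⟩⟩)
    (fun e => K * B ^ (0.598 + ε) * ((e.1 : ℝ) ^ (-1.794 : ℝ) * (e.2 : ℝ) ^ (-1.196 : ℝ))) (by
    rintro ⟨e, f⟩ hef
    simp only [Finset.mem_product, Finset.mem_Icc] at hef
    set F := S.filter (fun t => Nat.gcd t.1 t.2.1 = e ^ 3 * f ^ 2) with hF
    rcases F.eq_empty_or_nonempty with h0 | ⟨t0, ht0⟩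
    · rw [h0, Finset.card_empty, Nat.cast_zero]; positivity
    have h1 : (S.filter (fun t => Nat.gcd t.1 t.2.1 = e ^ 3 * f ^ 2)).card = F.card := rfl
    have hd : 0 < e ^ 3 * f ^ 2 := Nat.mul_pos (pow_pos hef.1.1 3) (pow_pos hef.2.1 2)
    obtain ⟨s1, s2⟩ := Finset.mem_filter.mp ht0
    obtain ⟨t1, t2, t3, t4, t5, t6, t7⟩ := hS _ s1
    have hdB : ((e ^ 3 * f ^ 2 : ℕ) : ℝ) ≤ B := by
      refine le_trans ?_ t7
      have := Nat.le_of_dvd t1 (Nat.gcd_dvd_left t0.1 t0.2.1)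
      exact_mod_cast (by omega : e ^ 3 * f ^ 2 ≤ t0.2.2)
    refine (k B (e ^ 3 * f ^ 2) F hd hdB (by
      intro t ht
      obtain ⟨s1, s2⟩ := Finset.mem_filter.mp ht
      obtain ⟨t1, t2, t3, t4, t5, t6, t7⟩ := hS _ s1
      exact ⟨t1, t2, t3, t4, t5, t6, t7, s2⟩)).trans (le_of_eq ?_)
    have e1 : ((e ^ 3 * f ^ 2 : ℕ) : ℝ) ^ (-0.598 : ℝ) = (e : ℝ) ^ (-1.794 : ℝ) *
        (f : ℝ) ^ (-1.196 : ℝ) := by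
      push_cast
      rw [Real.mul_rpow (by positivity) (by positivity), ← Real.rpow_natCast, ← Real.rpow_natCast,
        ← Real.rpow_mul (by positivity), ← Real.rpow_mul (by positivity)]
      norm_num
    rw [e1]; ring)
  refine hc.trans ?_
  rw [← Finset.mul_sum, Finset.sum_product]
  simp only
  rw [← Finset.sum_mul_sum]
  calc _ ≤ K * B ^ (0.598 + ε) * (M1 * M2) := by
        refine mul_le_mul_of_nonneg_left ?_ (by positivity)
        exact mul_le_mul (m1 _) (m2 _) (Finset.sum_nonneg (fun _ _ => by positivity)) (by linarith)
    _ = _ := by ring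

theorem squarefull_triples_count (ε : ℝ) (hε : 0 < ε) :
    ∃ C : ℝ, 0 < C ∧ ∀ B : ℝ, 2 ≤ B →
      (({t : ℕ × ℕ × ℕ |
          0 < t.1 ∧ 0 < t.2.1 ∧ 0 < t.2.2 ∧
          Squarefull t.1 ∧ Squarefull t.2.1 ∧ Squarefull t.2.2 ∧
          t.1 + t.2.1 = t.2.2 ∧ (t.2.2 : ℝ) ≤ B}).ncard : ℝ) ≤
        C * B ^ (3 / 5 - 3 / 1555 + ε : ℝ) := by
  obtain ⟨K, hK, k⟩ := triples_finset ε hε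
  refine ⟨K, by linarith, fun B hB => ?_⟩
  have hexp : B ^ (0.598 + ε) ≤ B ^ (3 / 5 - 3 / 1555 + ε : ℝ) := by
    apply Real.rpow_le_rpow_of_exponent_le (by linarith)
    norm_num
  have hpos : 0 ≤ K * B ^ (3 / 5 - 3 / 1555 + ε : ℝ) := by
    have : 0 < B := by linarith
    positivity
  generalize hA : {t : ℕ × ℕ × ℕ |
          0 < t.1 ∧ 0 < t.2.1 ∧ 0 < t.2.2 ∧
          Squarefull t.1 ∧ Squarefull t.2.1 ∧ Squarefull t.2.2 ∧
          t.1 + t.2.1 = t.2.2 ∧ (t.2.2 : ℝ) ≤ B} = A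
  by_cases hfin : A.Finite
  · rw [Set.ncard_eq_toFinset_card A hfin]
    refine (k B hfin.toFinset hB ?_).trans (by gcongr)
    intro t ht
    have h1 : t ∈ A := hfin.mem_toFinset.mp ht
    rw [← hA] at h1
    obtain ⟨h1, h2, -, h4, h5, h6, h7, h8⟩ := h1
    exact ⟨h1, h2, h4, h5, h6, h7, h8⟩
  · rw [Set.Infinite.ncard hfin, Nat.cast_zero]
    exact hpos
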